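/- For every (P̲, f, c; Q) ∈ R̃_{M,N}, the Weyl module satisfies deg Q < dim_ℂ W(P̲, f, c; Q) < ∞; in particular every Weyl module is nonzero and finite-dimensional. -/

import Mathlib

noncomputable section

namespace QAS

open Polynomial
open scoped TensorProduct

/-! ### Basic combinatorial data -/

/-- `l_i = 1` for `i ≤ M`, `-1` otherwise. -/
def lof (M : ℕ) (i : ℕ) : ℤ := if i ≤ M then 1 else -1

/-- the bilinear form `(ε_i, ε_j) = l_i δ_{ij}`. -/
def innerE (M : ℕ) (i j : ℕ) : ℤ := if i = j then lof M i else 0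

/-- `(ε_a − ε_b, ε_c − ε_d)`. -/
def form4 (M : ℕ) (a b c d : ℕ) : ℤ :=
  innerE M a c - innerE M a d - innerE M b c + innerE M b d

/-- the Cartan pairing `c_{ij} = (ε_i − ε_{i+1}, ε_j − ε_{j+1})`. -/
def cc (M : ℕ) (i j : ℕ) : ℤ := form4 M i (i + 1) j (j + 1)

/-- `q_i = q^{l_i}`. -/
def qpar (q : ℂ) (M : ℕ) (i : ℕ) : ℂ := q ^ lof M i

/-- the quantum integer `[m]_v`. -/
def qint (v : ℂ) (m : ℤ) : ℂ := (v ^ m - v ^ (-m)) / (v - v⁻¹)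

/-- the sign `(−1)^{|X_i||X_j|}` for the generators `X_i`, `X_j`. -/
def sgn (M : ℕ) (i j : ℕ) : ℂ := if i = M ∧ j = M then -1 else 1

/-- index set `1 ≤ i ≤ M+N−1`. -/
abbrev Idx (M N : ℕ) := {i : ℕ // 1 ≤ i ∧ i ≤ M + N - 1}

/-! ### Generators and the free superalgebra -/

/-- Drinfel'd generators; when `ext = true` we also have `K₀^{±1}`. -/
inductive Gen (M N : ℕ) (ext : Bool) : Type
  | Xp : Idx M N → ℤ → Gen M N ext
  | Xm : Idx M N → ℤ → Gen M N ext
  | K : Idx M N → Gen M N ext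
  | Ki : Idx M N → Gen M N ext
  | H : Idx M N → {s : ℤ // s ≠ 0} → Gen M N ext
  | K0 : ext = true → Gen M N ext
  | K0i : ext = true → Gen M N ext

abbrev FA (M N : ℕ) (ext : Bool) := FreeAlgebra ℂ (Gen M N ext)

def gi {M N : ℕ} {ext : Bool} (g : Gen M N ext) : FA M N ext := FreeAlgebra.ι ℂ g

def XpF (M N : ℕ) (ext : Bool) (i : ℕ) (n : ℤ) : FA M N ext :=
  if h : 1 ≤ i ∧ i ≤ M + N - 1 then gi (Gen.Xp ⟨i, h⟩ n) else 0

def XmF (M N : ℕ) (ext : Bool) (i : ℕ) (n : ℤ) : FA M N ext :=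
  if h : 1 ≤ i ∧ i ≤ M + N - 1 then gi (Gen.Xm ⟨i, h⟩ n) else 0

def KF (M N : ℕ) (ext : Bool) (i : ℕ) : FA M N ext :=
  if h : 1 ≤ i ∧ i ≤ M + N - 1 then gi (Gen.K ⟨i, h⟩) else 0

def KiF (M N : ℕ) (ext : Bool) (i : ℕ) : FA M N ext :=
  if h : 1 ≤ i ∧ i ≤ M + N - 1 then gi (Gen.Ki ⟨i, h⟩) else 0

def HF (M N : ℕ) (ext : Bool) (i : ℕ) (s : ℤ) : FA M N ext :=
  if h : (1 ≤ i ∧ i ≤ M + N - 1) ∧ s ≠ 0 then gi (Gen.H ⟨i, h.1⟩ ⟨s, h.2⟩) else 0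

def K0F (M N : ℕ) (ext : Bool) : FA M N ext :=
  if h : ext = true then gi (Gen.K0 h) else 0

def K0iF (M N : ℕ) (ext : Bool) : FA M N ext :=
  if h : ext = true then gi (Gen.K0i h) else 0

/-- coefficients of `exp (t · Σ_{s ≥ 1} a_s z^s)`. -/
def expC {A : Type} [Ring A] [Algebra ℂ A] (t : ℂ) (a : ℕ → A) : ℕ → A
  | 0 => 1
  | n + 1 =>
      ((n : ℂ) + 1)⁻¹ •
        (t • ∑ s ∈ Finset.range (n + 1), ((s : ℂ) + 1) • (a (s + 1) * expC t a (n - s)))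
termination_by n => n
decreasing_by omega

/-- `φ⁺_{i,n}`, the coefficient of `z^n` in
`K_i exp((q_i − q_i⁻¹) Σ_{s>0} h_{i,s} z^s)`. -/
def phiPF (q : ℂ) (M N : ℕ) (ext : Bool) (i : ℕ) (n : ℤ) : FA M N ext :=
  if 0 ≤ n then
    KF M N ext i *
      expC (qpar q M i - (qpar q M i)⁻¹) (fun s => HF M N ext i (s : ℤ)) n.toNat
  else 0

/-- `φ⁻_{i,n}`, the coefficient of `z^n` (`n ≤ 0`) in
`K_i⁻¹ exp(−(q_i − q_i⁻¹) Σ_{s>0} h_{i,−s} z^{−s})`. -/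
def phiMF (q : ℂ) (M N : ℕ) (ext : Bool) (i : ℕ) (n : ℤ) : FA M N ext :=
  if n ≤ 0 then
    KiF M N ext i *
      expC (-(qpar q M i - (qpar q M i)⁻¹)) (fun s => HF M N ext i (-(s : ℤ))) (-n).toNat
  else 0

/-- the `u`-bracket `[x,y]_u = xy − u·yx` (for `x` or `y` of even parity). -/
def brF {A : Type} [Ring A] [Module ℂ A] (u : ℂ) (x y : A) : A := x * y - u • (y * x)

/-- the quartic oscillation expression
`[[[X_{M−1,m}, X_{M,n}]_{q⁻¹}, X_{M+1,k}]_q, X_{M,u}]` (a graded anticommutator in the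
outermost bracket, both entries being odd). -/
def oscOf {A : Type} [Ring A] [Module ℂ A] (q : ℂ) (M : ℕ) (X : ℕ → ℤ → A) (m n k u : ℤ) : A :=
  brF q (brF q⁻¹ (X (M - 1) m) (X M n)) (X (M + 1) k) * X M u +
    X M u * brF q (brF q⁻¹ (X (M - 1) m) (X M n)) (X (M + 1) k)

/-! ### The defining relations.
`lvl = 1`: only (R1)–(R3);  `lvl = 2`: (R1)–(R5);  `lvl = 3`: all of (R1)–(R7).
`ext = true` adds `K₀^{±1}` together with its relations. -/

inductive rel (q : ℂ) (M N : ℕ) (ext : Bool) (lvl : ℕ) : FA M N ext → FA M N ext → Prop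
  | KKi (i : Idx M N) : rel q M N ext lvl (gi (Gen.K i) * gi (Gen.Ki i)) 1
  | KiK (i : Idx M N) : rel q M N ext lvl (gi (Gen.Ki i) * gi (Gen.K i)) 1
  | KK (i j : Idx M N) :
      rel q M N ext lvl (gi (Gen.K i) * gi (Gen.K j)) (gi (Gen.K j) * gi (Gen.K i))
  | KKi2 (i j : Idx M N) :
      rel q M N ext lvl (gi (Gen.K i) * gi (Gen.Ki j)) (gi (Gen.Ki j) * gi (Gen.K i))
  | KiKi (i j : Idx M N) :
      rel q M N ext lvl (gi (Gen.Ki i) * gi (Gen.Ki j)) (gi (Gen.Ki j) * gi (Gen.Ki i))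
  | KH (i j : Idx M N) (s : {s : ℤ // s ≠ 0}) :
      rel q M N ext lvl (gi (Gen.K i) * gi (Gen.H j s)) (gi (Gen.H j s) * gi (Gen.K i))
  | KiH (i j : Idx M N) (s : {s : ℤ // s ≠ 0}) :
      rel q M N ext lvl (gi (Gen.Ki i) * gi (Gen.H j s)) (gi (Gen.H j s) * gi (Gen.Ki i))
  | HH (i j : Idx M N) (s t : {s : ℤ // s ≠ 0}) :
      rel q M N ext lvl (gi (Gen.H i s) * gi (Gen.H j t)) (gi (Gen.H j t) * gi (Gen.H i s))
  | KXp (i j : Idx M N) (n : ℤ) :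
      rel q M N ext lvl (gi (Gen.K i) * gi (Gen.Xp j n))
        ((q ^ cc M i.1 j.1) • (gi (Gen.Xp j n) * gi (Gen.K i)))
  | KXm (i j : Idx M N) (n : ℤ) :
      rel q M N ext lvl (gi (Gen.K i) * gi (Gen.Xm j n))
        ((q ^ (-cc M i.1 j.1)) • (gi (Gen.Xm j n) * gi (Gen.K i)))
  | HXp (i j : Idx M N) (s : {s : ℤ // s ≠ 0}) (n : ℤ) :
      rel q M N ext lvl
        (gi (Gen.H i s) * gi (Gen.Xp j n) - gi (Gen.Xp j n) * gi (Gen.H i s))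
        ((qint (qpar q M i.1) (s.1 * lof M i.1 * cc M i.1 j.1) / (s.1 : ℂ)) •
          gi (Gen.Xp j (n + s.1)))
  | HXm (i j : Idx M N) (s : {s : ℤ // s ≠ 0}) (n : ℤ) :
      rel q M N ext lvl
        (gi (Gen.H i s) * gi (Gen.Xm j n) - gi (Gen.Xm j n) * gi (Gen.H i s))
        (-((qint (qpar q M i.1) (s.1 * lof M i.1 * cc M i.1 j.1) / (s.1 : ℂ)) •
          gi (Gen.Xm j (n + s.1))))
  | XpXm (i j : Idx M N) (m n : ℤ) :
      rel q M N ext lvl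
        (gi (Gen.Xp i m) * gi (Gen.Xm j n) -
          sgn M i.1 j.1 • (gi (Gen.Xm j n) * gi (Gen.Xp i m)))
        (if i = j then
            (qpar q M i.1 - (qpar q M i.1)⁻¹)⁻¹ •
              (phiPF q M N ext i.1 (m + n) - phiMF q M N ext i.1 (m + n))
          else 0)
  | XX0p (i j : Idx M N) (m n : ℤ) (h2 : 2 ≤ lvl) (h : cc M i.1 j.1 = 0) :
      rel q M N ext lvl
        (gi (Gen.Xp i m) * gi (Gen.Xp j n) -
          sgn M i.1 j.1 • (gi (Gen.Xp j n) * gi (Gen.Xp i m))) 0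
  | XX0m (i j : Idx M N) (m n : ℤ) (h2 : 2 ≤ lvl) (h : cc M i.1 j.1 = 0) :
      rel q M N ext lvl
        (gi (Gen.Xm i m) * gi (Gen.Xm j n) -
          sgn M i.1 j.1 • (gi (Gen.Xm j n) * gi (Gen.Xm i m))) 0
  | XXp (i j : Idx M N) (m n : ℤ) (h2 : 2 ≤ lvl) (h : cc M i.1 j.1 ≠ 0) :
      rel q M N ext lvl
        (gi (Gen.Xp i (m + 1)) * gi (Gen.Xp j n) -
          (q ^ cc M i.1 j.1) • (gi (Gen.Xp j n) * gi (Gen.Xp i (m + 1))))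
        ((q ^ cc M i.1 j.1) • (gi (Gen.Xp i m) * gi (Gen.Xp j (n + 1))) -
          gi (Gen.Xp j (n + 1)) * gi (Gen.Xp i m))
  | XXm (i j : Idx M N) (m n : ℤ) (h2 : 2 ≤ lvl) (h : cc M i.1 j.1 ≠ 0) :
      rel q M N ext lvl
        (gi (Gen.Xm i (m + 1)) * gi (Gen.Xm j n) -
          (q ^ (-cc M i.1 j.1)) • (gi (Gen.Xm j n) * gi (Gen.Xm i (m + 1))))
        ((q ^ (-cc M i.1 j.1)) • (gi (Gen.Xm i m) * gi (Gen.Xm j (n + 1))) -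
          gi (Gen.Xm j (n + 1)) * gi (Gen.Xm i m))
  | serreP (i j : Idx M N) (m n k : ℤ) (h3 : 3 ≤ lvl)
      (h : cc M i.1 j.1 = 1 ∨ cc M i.1 j.1 = -1) (hi : i.1 ≠ M) :
      rel q M N ext lvl
        (brF q (gi (Gen.Xp i m)) (brF q⁻¹ (gi (Gen.Xp i n)) (gi (Gen.Xp j k))) +
          brF q (gi (Gen.Xp i n)) (brF q⁻¹ (gi (Gen.Xp i m)) (gi (Gen.Xp j k)))) 0
  | serreM (i j : Idx M N) (m n k : ℤ) (h3 : 3 ≤ lvl)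
      (h : cc M i.1 j.1 = 1 ∨ cc M i.1 j.1 = -1) (hi : i.1 ≠ M) :
      rel q M N ext lvl
        (brF q (gi (Gen.Xm i m)) (brF q⁻¹ (gi (Gen.Xm i n)) (gi (Gen.Xm j k))) +
          brF q (gi (Gen.Xm i n)) (brF q⁻¹ (gi (Gen.Xm i m)) (gi (Gen.Xm j k)))) 0
  | oscP (m n k u : ℤ) (h3 : 3 ≤ lvl) (hM : 1 < M) (hN : 1 < N) :
      rel q M N ext lvl
        (oscOf q M (XpF M N ext) m n k u + oscOf q M (XpF M N ext) m u k n) 0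
  | oscM (m n k u : ℤ) (h3 : 3 ≤ lvl) (hM : 1 < M) (hN : 1 < N) :
      rel q M N ext lvl
        (oscOf q M (XmF M N ext) m n k u + oscOf q M (XmF M N ext) m u k n) 0
  | K0K0i (he : ext = true) : rel q M N ext lvl (gi (Gen.K0 he) * gi (Gen.K0i he)) 1
  | K0iK0 (he : ext = true) : rel q M N ext lvl (gi (Gen.K0i he) * gi (Gen.K0 he)) 1
  | K0K (he : ext = true) (i : Idx M N) :
      rel q M N ext lvl (gi (Gen.K0 he) * gi (Gen.K i)) (gi (Gen.K i) * gi (Gen.K0 he))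
  | K0Ki (he : ext = true) (i : Idx M N) :
      rel q M N ext lvl (gi (Gen.K0 he) * gi (Gen.Ki i)) (gi (Gen.Ki i) * gi (Gen.K0 he))
  | K0H (he : ext = true) (i : Idx M N) (s : {s : ℤ // s ≠ 0}) :
      rel q M N ext lvl (gi (Gen.K0 he) * gi (Gen.H i s)) (gi (Gen.H i s) * gi (Gen.K0 he))
  | K0Xp (he : ext = true) (i : Idx M N) (n : ℤ) :
      rel q M N ext lvl (gi (Gen.K0 he) * gi (Gen.Xp i n))
        ((q ^ (if i.1 = 1 then (1 : ℤ) else 0)) • (gi (Gen.Xp i n) * gi (Gen.K0 he)))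
  | K0Xm (he : ext = true) (i : Idx M N) (n : ℤ) :
      rel q M N ext lvl (gi (Gen.K0 he) * gi (Gen.Xm i n))
        ((q ^ (if i.1 = 1 then (-1 : ℤ) else 0)) • (gi (Gen.Xm i n) * gi (Gen.K0 he)))

/-! ### The quantum affine superalgebras -/

abbrev ALG (q : ℂ) (M N : ℕ) (ext : Bool) (lvl : ℕ) := RingQuot (rel q M N ext lvl)

def mkA (q : ℂ) (M N : ℕ) (ext : Bool) (lvl : ℕ) : FA M N ext →ₐ[ℂ] ALG q M N ext lvl :=
  RingQuot.mkAlgHom ℂ (rel q M N ext lvl)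

def XpA (q : ℂ) (M N : ℕ) (ext : Bool) (lvl : ℕ) (i : ℕ) (n : ℤ) : ALG q M N ext lvl :=
  mkA q M N ext lvl (XpF M N ext i n)

def XmA (q : ℂ) (M N : ℕ) (ext : Bool) (lvl : ℕ) (i : ℕ) (n : ℤ) : ALG q M N ext lvl :=
  mkA q M N ext lvl (XmF M N ext i n)

def KA (q : ℂ) (M N : ℕ) (ext : Bool) (lvl : ℕ) (i : ℕ) : ALG q M N ext lvl :=
  mkA q M N ext lvl (KF M N ext i)

def KiA (q : ℂ) (M N : ℕ) (ext : Bool) (lvl : ℕ) (i : ℕ) : ALG q M N ext lvl :=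
  mkA q M N ext lvl (KiF M N ext i)

def HA (q : ℂ) (M N : ℕ) (ext : Bool) (lvl : ℕ) (i : ℕ) (s : ℤ) : ALG q M N ext lvl :=
  mkA q M N ext lvl (HF M N ext i s)

def K0A (q : ℂ) (M N : ℕ) (ext : Bool) (lvl : ℕ) : ALG q M N ext lvl :=
  mkA q M N ext lvl (K0F M N ext)

def K0iA (q : ℂ) (M N : ℕ) (ext : Bool) (lvl : ℕ) : ALG q M N ext lvl :=
  mkA q M N ext lvl (K0iF M N ext)

def phiPA (q : ℂ) (M N : ℕ) (ext : Bool) (lvl : ℕ) (i : ℕ) (n : ℤ) : ALG q M N ext lvl :=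
  mkA q M N ext lvl (phiPF q M N ext i n)

def phiMA (q : ℂ) (M N : ℕ) (ext : Bool) (lvl : ℕ) (i : ℕ) (n : ℤ) : ALG q M N ext lvl :=
  mkA q M N ext lvl (phiMF q M N ext i n)

/-- `U⁺`: the subalgebra generated by the `X⁺_{i,n}`. -/
def Aplus (q : ℂ) (M N : ℕ) (ext : Bool) (lvl : ℕ) : Subalgebra ℂ (ALG q M N ext lvl) :=
  Algebra.adjoin ℂ {x | ∃ i : ℕ, ∃ n : ℤ, x = XpA q M N ext lvl i n}

/-- `U⁻`: the subalgebra generated by the `X⁻_{i,n}`. -/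
def Aminus (q : ℂ) (M N : ℕ) (ext : Bool) (lvl : ℕ) : Subalgebra ℂ (ALG q M N ext lvl) :=
  Algebra.adjoin ℂ {x | ∃ i : ℕ, ∃ n : ℤ, x = XmA q M N ext lvl i n}

/-- `U⁰`: the subalgebra generated by the `K_i^{±1}` and `h_{i,s}`. -/
def Azero (q : ℂ) (M N : ℕ) (ext : Bool) (lvl : ℕ) : Subalgebra ℂ (ALG q M N ext lvl) :=
  Algebra.adjoin ℂ {x | (∃ i : ℕ, x = KA q M N ext lvl i) ∨ (∃ i : ℕ, x = KiA q M N ext lvl i) ∨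
    ∃ i : ℕ, ∃ s : ℤ, x = HA q M N ext lvl i s}

/-- `U'⁰`: the subalgebra generated by `U⁰` and `K₀^{±1}`. -/
def AzeroE (q : ℂ) (M N : ℕ) (ext : Bool) (lvl : ℕ) : Subalgebra ℂ (ALG q M N ext lvl) :=
  Algebra.adjoin ℂ {x | (∃ i : ℕ, x = KA q M N ext lvl i) ∨ (∃ i : ℕ, x = KiA q M N ext lvl i) ∨
    (∃ i : ℕ, ∃ s : ℤ, x = HA q M N ext lvl i s) ∨ x = K0A q M N ext lvl ∨
      x = K0iA q M N ext lvl}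

/-! ### The multiplication map on the triple tensor product -/

def triMul (q : ℂ) (M N : ℕ) (ext : Bool) (lvl : ℕ)
    (S T R : Subalgebra ℂ (ALG q M N ext lvl)) :
    (↥S ⊗[ℂ] (↥T ⊗[ℂ] ↥R)) →ₗ[ℂ] ALG q M N ext lvl :=
  TensorProduct.lift
    (((LinearMap.mul ℂ (ALG q M N ext lvl)).comp S.val.toLinearMap).compl₂
      (TensorProduct.lift
        (((LinearMap.mul ℂ (ALG q M N ext lvl)).comp T.val.toLinearMap).compl₂
          R.val.toLinearMap)))

/-! ### Root vectors and PBW monomials -/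

def Xroot (q : ℂ) (M N : ℕ) (ext : Bool) (lvl : ℕ) (i : ℕ) : ℕ → ℤ → ALG q M N ext lvl
  | 0, n => XpA q M N ext lvl i n
  | k + 1, n =>
      brF (qpar q M (i + k + 1)) (Xroot q M N ext lvl i k n) (XpA q M N ext lvl (i + k + 1) 0)

/-- the root vector `X_{α_i + ⋯ + α_j}(n)`. -/
def XrootIJ (q : ℂ) (M N : ℕ) (ext : Bool) (lvl : ℕ) (i j : ℕ) (n : ℤ) : ALG q M N ext lvl :=
  Xroot q M N ext lvl i (j - i) n

def rootLE (a b : ℕ × ℕ) : Prop := a.1 < b.1 ∨ (a.1 = b.1 ∧ a.2 ≤ b.2)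

/-- the set of PBW ordered monomials in the root vectors. -/
def pbwSet (q : ℂ) (M N : ℕ) (ext : Bool) (lvl : ℕ) : Set (ALG q M N ext lvl) :=
  {x | ∃ L : List ((ℕ × ℕ) × ℤ),
      (∀ p ∈ L, 1 ≤ p.1.1 ∧ p.1.1 ≤ p.1.2 ∧ p.1.2 ≤ M + N - 1) ∧
      L.Chain' (fun a b => rootLE a.1 b.1) ∧
      x = (L.map fun p => XrootIJ q M N ext lvl p.1.1 p.1.2 p.2).prod}

/-- PBW ordered monomials of total degree `d` (`d i` counts the multiplicity of `α_i`). -/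
def pbwDegSet (q : ℂ) (M N : ℕ) (ext : Bool) (lvl : ℕ) (d : ℕ → ℕ) : Set (ALG q M N ext lvl) :=
  {x | ∃ L : List ((ℕ × ℕ) × ℤ),
      (∀ p ∈ L, 1 ≤ p.1.1 ∧ p.1.1 ≤ p.1.2 ∧ p.1.2 ≤ M + N - 1) ∧
      L.Chain' (fun a b => rootLE a.1 b.1) ∧
      (∀ i : ℕ, ((L.map fun p => if p.1.1 ≤ i ∧ i ≤ p.1.2 then 1 else 0).sum) = d i) ∧
      x = (L.map fun p => XrootIJ q M N ext lvl p.1.1 p.1.2 p.2).prod}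

/-- words in the generators `X⁺_{i,n}` of degree `d`. -/
def wordDegSet (q : ℂ) (M N : ℕ) (ext : Bool) (lvl : ℕ) (d : ℕ → ℕ) :
    Set (ALG q M N ext lvl) :=
  {x | ∃ w : List (ℕ × ℤ), (∀ p ∈ w, 1 ≤ p.1 ∧ p.1 ≤ M + N - 1) ∧
      (∀ i : ℕ, (w.map Prod.fst).count i = d i) ∧
      x = (w.map fun p => XpA q M N ext lvl p.1 p.2).prod}

/-! ### The subspaces `I^±_{i,j}` and `O^±` -/

def IElt (q : ℂ) (M N : ℕ) (ext : Bool) (lvl : ℕ) (pl : Bool) (i j : ℕ) (m n : ℤ) :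
    ALG q M N ext lvl :=
  let X : ℕ → ℤ → ALG q M N ext lvl := if pl then XpA q M N ext lvl else XmA q M N ext lvl
  let e : ℤ := if pl then cc M i j else -cc M i j
  if cc M i j = 0 then X i m * X j n - sgn M i j • (X j n * X i m)
  else
    X i (m + 1) * X j n - (q ^ e) • (X j n * X i (m + 1)) -
      (q ^ e) • (X i m * X j (n + 1)) + X j (n + 1) * X i m

def Isub (q : ℂ) (M N : ℕ) (ext : Bool) (lvl : ℕ) (pl : Bool) (i j : ℕ) :
    Submodule ℂ (ALG q M N ext lvl) :=
  Submodule.span ℂ (Set.range fun p : ℤ × ℤ => IElt q M N ext lvl pl i j p.1 p.2)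

def IsubAll (q : ℂ) (M N : ℕ) (ext : Bool) (lvl : ℕ) (pl : Bool) :
    Submodule ℂ (ALG q M N ext lvl) :=
  ⨆ p : ℕ × ℕ, ⨆ _ : 1 ≤ p.1 ∧ p.1 ≤ p.2 ∧ p.2 ≤ M + N - 1,
    Isub q M N ext lvl pl p.1 p.2

def OscElt (q : ℂ) (M N : ℕ) (ext : Bool) (lvl : ℕ) (pl : Bool) (m n k u : ℤ) :
    ALG q M N ext lvl :=
  let X : ℕ → ℤ → ALG q M N ext lvl := if pl then XpA q M N ext lvl else XmA q M N ext lvl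
  oscOf q M X m n k u + oscOf q M X m u k n

def Osub (q : ℂ) (M N : ℕ) (ext : Bool) (lvl : ℕ) (pl : Bool) :
    Submodule ℂ (ALG q M N ext lvl) :=
  Submodule.span ℂ
    (Set.range fun p : ℤ × ℤ × ℤ × ℤ => OscElt q M N ext lvl pl p.1 p.2.1 p.2.2.1 p.2.2.2)

/-- the sign `(−1)^{(p(α_k)+p(α_u))·p(α_i)}`. -/
def gsgn (M : ℕ) (k u i : ℕ) : ℂ :=
  if ((k = M ∧ ¬u = M) ∨ (¬k = M ∧ u = M)) ∧ i = M then -1 else 1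

/-! ### Highest weights and the associated eigenvalue sequences -/

/-- `Q·f = 0` for a bilateral formal series `f`. -/
def annih (Q : Polynomial ℂ) (f : ℤ → ℂ) : Prop :=
  ∀ n : ℤ, ∑ s ∈ Finset.range (Q.natDegree + 1), Q.coeff s * f (n - s) = 0

/-- an element of `R_{M,N}`: a highest weight `(P̲, f, c)`. -/
structure HW (q : ℂ) (M N : ℕ) : Type where
  P : ℕ → Polynomial ℂ
  f : ℤ → ℂ
  c : ℂ
  P_const : ∀ i, (P i).coeff 0 = 1
  c_ne : c ≠ 0
  torsion : ∃ Q : Polynomial ℂ, Q ≠ 0 ∧ annih Q f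
  f_zero : f 0 = (c - c⁻¹) / (q - q⁻¹)

def toPS (p : Polynomial ℂ) : PowerSeries ℂ := PowerSeries.mk fun n => p.coeff n

/-- `P(z·u)`. -/
def pscale (u : ℂ) (P : Polynomial ℂ) : Polynomial ℂ := P.comp (Polynomial.C u * Polynomial.X)

/-- the coefficient of `z^n` (`n ≥ 0`) in `q_i^{deg P} P(z q_i⁻¹)/P(z q_i)`,
expanded at `z = 0`. -/
def gammaP (q : ℂ) (M : ℕ) (i : ℕ) (P : Polynomial ℂ) (n : ℤ) : ℂ :=
  if 0 ≤ n then
    qpar q M i ^ P.natDegree *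
      PowerSeries.coeff (R := ℂ) n.toNat
        (toPS (pscale (qpar q M i)⁻¹ P) * (toPS (pscale (qpar q M i) P))⁻¹)
  else 0

/-- the coefficient of `z^n` (`n ≤ 0`) in `q_i^{deg P} P(z q_i⁻¹)/P(z q_i)`,
expanded at `z = ∞`. -/
def gammaM (q : ℂ) (M : ℕ) (i : ℕ) (P : Polynomial ℂ) (n : ℤ) : ℂ :=
  if n ≤ 0 then
    qpar q M i ^ P.natDegree *
      PowerSeries.coeff (R := ℂ) (-n).toNat
        (toPS ((pscale (qpar q M i)⁻¹ P).reflect P.natDegree) *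
          (toPS ((pscale (qpar q M i) P).reflect P.natDegree))⁻¹)
  else 0

/-! ### Verma, Weyl and simple modules -/

def vermaRels (q : ℂ) (M N : ℕ) (ext : Bool) (Λ : HW q M N) : Set (ALG q M N ext 3) :=
  {x | ∃ i : ℕ, ∃ n : ℤ, x = XpA q M N ext 3 i n} ∪
  {x | ∃ i : ℕ, ∃ n : ℤ, 1 ≤ i ∧ i ≤ M + N - 1 ∧ i ≠ M ∧
      (x = phiPA q M N ext 3 i n - algebraMap ℂ _ (gammaP q M i (Λ.P i) n) ∨
       x = phiMA q M N ext 3 i n - algebraMap ℂ _ (gammaM q M i (Λ.P i) n))} ∪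
  {x | x = KA q M N ext 3 M - algebraMap ℂ _ Λ.c} ∪
  {x | ∃ n : ℤ, x = phiPA q M N ext 3 M n - phiMA q M N ext 3 M n -
      algebraMap ℂ _ ((q - q⁻¹) * Λ.f n)} ∪
  {x | ext = true ∧ x = K0A q M N ext 3 - 1}

def evenRels (q : ℂ) (M N : ℕ) (ext : Bool) (Λ : HW q M N) : Set (ALG q M N ext 3) :=
  {x | ∃ i : ℕ, 1 ≤ i ∧ i ≤ M + N - 1 ∧ i ≠ M ∧
      x = XmA q M N ext 3 i 0 ^ (1 + (Λ.P i).natDegree)}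

def oddElt (q : ℂ) (M N : ℕ) (ext : Bool) (Q : Polynomial ℂ) (n : ℤ) : ALG q M N ext 3 :=
  ∑ s ∈ Finset.range (Q.natDegree + 1),
    Q.coeff (Q.natDegree - s) • XmA q M N ext 3 M ((s : ℤ) + n)

def oddRels (q : ℂ) (M N : ℕ) (ext : Bool) (Q : Polynomial ℂ) : Set (ALG q M N ext 3) :=
  if M = 1 ∧ N = 1 then {x | ∃ n : ℤ, x = oddElt q M N ext Q n}
  else {oddElt q M N ext Q 0}

def vermaIdeal (q : ℂ) (M N : ℕ) (ext : Bool) (Λ : HW q M N) : Ideal (ALG q M N ext 3) :=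
  Ideal.span (vermaRels q M N ext Λ)

def weylIdeal (q : ℂ) (M N : ℕ) (ext : Bool) (Λ : HW q M N) (Q : Polynomial ℂ) :
    Ideal (ALG q M N ext 3) :=
  Ideal.span (vermaRels q M N ext Λ ∪ evenRels q M N ext Λ ∪ oddRels q M N ext Q)

def uweylIdeal (q : ℂ) (M N : ℕ) (ext : Bool) (Λ : HW q M N) : Ideal (ALG q M N ext 3) :=
  Ideal.span (vermaRels q M N ext Λ ∪ evenRels q M N ext Λ)

/-- the Verma module `M(Λ)`. -/
def VermaMod (q : ℂ) (M N : ℕ) (ext : Bool) (Λ : HW q M N) : Type :=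
  ALG q M N ext 3 ⧸ vermaIdeal q M N ext Λ

/-- the Weyl module `W(Λ; Q)`. -/
def WeylMod (q : ℂ) (M N : ℕ) (ext : Bool) (Λ : HW q M N) (Q : Polynomial ℂ) : Type :=
  ALG q M N ext 3 ⧸ weylIdeal q M N ext Λ Q

/-- the universal Weyl module `W(Λ)`. -/
def UWeylMod (q : ℂ) (M N : ℕ) (ext : Bool) (Λ : HW q M N) : Type :=
  ALG q M N ext 3 ⧸ uweylIdeal q M N ext Λ

instance (q : ℂ) (M N : ℕ) (ext : Bool) (Λ : HW q M N) : AddCommGroup (VermaMod q M N ext Λ) :=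
  inferInstanceAs (AddCommGroup (ALG q M N ext 3 ⧸ vermaIdeal q M N ext Λ))
instance (q : ℂ) (M N : ℕ) (ext : Bool) (Λ : HW q M N) :
    Module (ALG q M N ext 3) (VermaMod q M N ext Λ) :=
  inferInstanceAs (Module (ALG q M N ext 3) (ALG q M N ext 3 ⧸ vermaIdeal q M N ext Λ))
instance (q : ℂ) (M N : ℕ) (ext : Bool) (Λ : HW q M N) : Module ℂ (VermaMod q M N ext Λ) :=
  inferInstanceAs (Module ℂ (ALG q M N ext 3 ⧸ vermaIdeal q M N ext Λ))
instance (q : ℂ) (M N : ℕ) (ext : Bool) (Λ : HW q M N) :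
    IsScalarTower ℂ (ALG q M N ext 3) (VermaMod q M N ext Λ) :=
  inferInstanceAs (IsScalarTower ℂ (ALG q M N ext 3) (ALG q M N ext 3 ⧸ vermaIdeal q M N ext Λ))

instance (q : ℂ) (M N : ℕ) (ext : Bool) (Λ : HW q M N) (Q : Polynomial ℂ) :
    AddCommGroup (WeylMod q M N ext Λ Q) :=
  inferInstanceAs (AddCommGroup (ALG q M N ext 3 ⧸ weylIdeal q M N ext Λ Q))
instance (q : ℂ) (M N : ℕ) (ext : Bool) (Λ : HW q M N) (Q : Polynomial ℂ) :
    Module (ALG q M N ext 3) (WeylMod q M N ext Λ Q) :=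
  inferInstanceAs (Module (ALG q M N ext 3) (ALG q M N ext 3 ⧸ weylIdeal q M N ext Λ Q))
instance (q : ℂ) (M N : ℕ) (ext : Bool) (Λ : HW q M N) (Q : Polynomial ℂ) :
    Module ℂ (WeylMod q M N ext Λ Q) :=
  inferInstanceAs (Module ℂ (ALG q M N ext 3 ⧸ weylIdeal q M N ext Λ Q))
instance (q : ℂ) (M N : ℕ) (ext : Bool) (Λ : HW q M N) (Q : Polynomial ℂ) :
    IsScalarTower ℂ (ALG q M N ext 3) (WeylMod q M N ext Λ Q) :=
  inferInstanceAs
    (IsScalarTower ℂ (ALG q M N ext 3) (ALG q M N ext 3 ⧸ weylIdeal q M N ext Λ Q))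

instance (q : ℂ) (M N : ℕ) (ext : Bool) (Λ : HW q M N) : AddCommGroup (UWeylMod q M N ext Λ) :=
  inferInstanceAs (AddCommGroup (ALG q M N ext 3 ⧸ uweylIdeal q M N ext Λ))
instance (q : ℂ) (M N : ℕ) (ext : Bool) (Λ : HW q M N) :
    Module (ALG q M N ext 3) (UWeylMod q M N ext Λ) :=
  inferInstanceAs (Module (ALG q M N ext 3) (ALG q M N ext 3 ⧸ uweylIdeal q M N ext Λ))
instance (q : ℂ) (M N : ℕ) (ext : Bool) (Λ : HW q M N) : Module ℂ (UWeylMod q M N ext Λ) :=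
  inferInstanceAs (Module ℂ (ALG q M N ext 3 ⧸ uweylIdeal q M N ext Λ))
instance (q : ℂ) (M N : ℕ) (ext : Bool) (Λ : HW q M N) :
    IsScalarTower ℂ (ALG q M N ext 3) (UWeylMod q M N ext Λ) :=
  inferInstanceAs (IsScalarTower ℂ (ALG q M N ext 3) (ALG q M N ext 3 ⧸ uweylIdeal q M N ext Λ))

/-- the highest weight vector (image of `1`). -/
def vgen (q : ℂ) (M N : ℕ) (Λ : HW q M N) : VermaMod q M N true Λ :=
  Submodule.Quotient.mk 1

/-- the sum of all submodules not containing the highest weight vector (the unique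
maximal submodule of the Verma module). -/
def radV (q : ℂ) (M N : ℕ) (Λ : HW q M N) :
    Submodule (ALG q M N true 3) (VermaMod q M N true Λ) :=
  sSup {p | vgen q M N Λ ∉ p}

/-- the simple quotient `S'(Λ)`. -/
def SimpMod (q : ℂ) (M N : ℕ) (Λ : HW q M N) : Type :=
  VermaMod q M N true Λ ⧸ radV q M N Λ

instance (q : ℂ) (M N : ℕ) (Λ : HW q M N) : AddCommGroup (SimpMod q M N Λ) :=
  inferInstanceAs (AddCommGroup (VermaMod q M N true Λ ⧸ radV q M N Λ))
instance (q : ℂ) (M N : ℕ) (Λ : HW q M N) :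
    Module (ALG q M N true 3) (SimpMod q M N Λ) :=
  inferInstanceAs (Module (ALG q M N true 3) (VermaMod q M N true Λ ⧸ radV q M N Λ))
instance (q : ℂ) (M N : ℕ) (Λ : HW q M N) : Module ℂ (SimpMod q M N Λ) :=
  inferInstanceAs (Module ℂ (VermaMod q M N true Λ ⧸ radV q M N Λ))
instance (q : ℂ) (M N : ℕ) (Λ : HW q M N) :
    IsScalarTower ℂ (ALG q M N true 3) (SimpMod q M N Λ) :=
  inferInstanceAs (IsScalarTower ℂ (ALG q M N true 3) (VermaMod q M N true Λ ⧸ radV q M N Λ))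

/-! ### Weight spaces -/

/-- `K_i` for `0 ≤ i`, with `K₀` at `i = 0`. -/
def Kgen (q : ℂ) (M N : ℕ) (ext : Bool) (lvl : ℕ) (i : ℕ) : ALG q M N ext lvl :=
  if i = 0 then K0A q M N ext lvl else KA q M N ext lvl i

/-- the `μ`-weight space of a module. -/
def wtSp (q : ℂ) (M N : ℕ) (ext : Bool) {W : Type} [AddCommGroup W] [Module ℂ W]
    [Module (ALG q M N ext 3) W] [IsScalarTower ℂ (ALG q M N ext 3) W] (μ : ℕ → ℂ) :
    Submodule ℂ W where
  carrier := {w | ∀ i < M + N, Kgen q M N ext 3 i • w = μ i • w}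
  add_mem' := by
    intro a b ha hb i hi
    rw [smul_add, ha i hi, hb i hi, smul_add]
  zero_mem' := by
    intro i hi
    rw [smul_zero, smul_zero]
  smul_mem' := by
    intro c w hw i hi
    have h1 : Kgen q M N ext 3 i • (c • w) = c • (Kgen q M N ext 3 i • w) := by
      rw [← algebraMap_smul (ALG q M N ext 3) c w, ← mul_smul, ← Algebra.commutes, mul_smul,
        algebraMap_smul]
    rw [h1, hw i hi, smul_comm]

/-- the character `λ_Λ`. -/
def lamF (q : ℂ) (M N : ℕ) (Λ : HW q M N) : ℕ → ℂ :=
  fun i => if i = 0 then 1 else if i = M then Λ.c else qpar q M i ^ (Λ.P i).natDegree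

/-- the character `α_j`. -/
def alF (q : ℂ) (M : ℕ) (j : ℕ) : ℕ → ℂ :=
  fun i => if i = 0 then (if j = 1 then q else 1) else q ^ cc M j i

/-! ### The generators of `U` inside `U'` -/

def UGenSet (q : ℂ) (M N : ℕ) : Set (ALG q M N true 3) :=
  {x | (∃ i : ℕ, ∃ n : ℤ, x = XpA q M N true 3 i n) ∨
    (∃ i : ℕ, ∃ n : ℤ, x = XmA q M N true 3 i n) ∨
    (∃ i : ℕ, x = KA q M N true 3 i) ∨ (∃ i : ℕ, x = KiA q M N true 3 i) ∨
    ∃ i : ℕ, ∃ s : ℤ, x = HA q M N true 3 i s}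

/-! ### One-sided presentations (for `U^±`) -/

def XgF (M N : ℕ) (i : ℕ) (n : ℤ) : FreeAlgebra ℂ (Idx M N × ℤ) :=
  if h : 1 ≤ i ∧ i ≤ M + N - 1 then FreeAlgebra.ι ℂ ((⟨i, h⟩, n) : Idx M N × ℤ) else 0

inductive rel1 (q : ℂ) (M N : ℕ) (pl : Bool) :
    FreeAlgebra ℂ (Idx M N × ℤ) → FreeAlgebra ℂ (Idx M N × ℤ) → Prop
  | comm0 (i j : Idx M N) (m n : ℤ) (h : cc M i.1 j.1 = 0) :
      rel1 q M N pl
        (FreeAlgebra.ι ℂ ((i, m) : Idx M N × ℤ) * FreeAlgebra.ι ℂ ((j, n) : Idx M N × ℤ) -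
          sgn M i.1 j.1 •
            (FreeAlgebra.ι ℂ ((j, n) : Idx M N × ℤ) * FreeAlgebra.ι ℂ ((i, m) : Idx M N × ℤ))) 0
  | deg2 (i j : Idx M N) (m n : ℤ) (h : cc M i.1 j.1 ≠ 0) :
      rel1 q M N pl
        (FreeAlgebra.ι ℂ ((i, m + 1) : Idx M N × ℤ) * FreeAlgebra.ι ℂ ((j, n) : Idx M N × ℤ) -
          (q ^ (if pl then cc M i.1 j.1 else -cc M i.1 j.1)) •
            (FreeAlgebra.ι ℂ ((j, n) : Idx M N × ℤ) *
              FreeAlgebra.ι ℂ ((i, m + 1) : Idx M N × ℤ)))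
        ((q ^ (if pl then cc M i.1 j.1 else -cc M i.1 j.1)) •
            (FreeAlgebra.ι ℂ ((i, m) : Idx M N × ℤ) *
              FreeAlgebra.ι ℂ ((j, n + 1) : Idx M N × ℤ)) -
          FreeAlgebra.ι ℂ ((j, n + 1) : Idx M N × ℤ) * FreeAlgebra.ι ℂ ((i, m) : Idx M N × ℤ))
  | serre (i j : Idx M N) (m n k : ℤ) (h : cc M i.1 j.1 = 1 ∨ cc M i.1 j.1 = -1)
      (hi : i.1 ≠ M) :
      rel1 q M N pl
        (brF q (FreeAlgebra.ι ℂ ((i, m) : Idx M N × ℤ))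
            (brF q⁻¹ (FreeAlgebra.ι ℂ ((i, n) : Idx M N × ℤ))
              (FreeAlgebra.ι ℂ ((j, k) : Idx M N × ℤ))) +
          brF q (FreeAlgebra.ι ℂ ((i, n) : Idx M N × ℤ))
            (brF q⁻¹ (FreeAlgebra.ι ℂ ((i, m) : Idx M N × ℤ))
              (FreeAlgebra.ι ℂ ((j, k) : Idx M N × ℤ)))) 0
  | osc (m n k u : ℤ) (hM : 1 < M) (hN : 1 < N) :
      rel1 q M N pl (oscOf q M (XgF M N) m n k u + oscOf q M (XgF M N) m u k n) 0

end QAS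

noncomputable section
namespace QASP
open QAS

section
open Finset

/-! ### exponential coefficients -/

theorem expC_zero {A : Type} [Ring A] [Algebra ℂ A] (t : ℂ) (a : ℕ → A) : expC t a 0 = 1 := by
  rw [expC]

theorem expC_succ {A : Type} [Ring A] [Algebra ℂ A] (t : ℂ) (a : ℕ → A) (n : ℕ) :
    expC t a (n + 1) = ((n : ℂ) + 1)⁻¹ •
        (t • ∑ s ∈ range (n + 1), ((s : ℂ) + 1) • (a (s + 1) * expC t a (n - s))) := by
  rw [expC]

theorem expC_map {A B : Type} [Ring A] [Algebra ℂ A] [Ring B] [Algebra ℂ B] (f : A →ₐ[ℂ] B)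
    (t : ℂ) (a : ℕ → A) (n : ℕ) : f (expC t a n) = expC t (fun s => f (a s)) n := by
  induction n using Nat.strong_induction_on with
  | _ n ih =>
    cases n with
    | zero => simp [expC_zero]
    | succ n =>
      rw [expC_succ, expC_succ, map_smul, map_smul, map_sum]
      congr 2
      refine sum_congr rfl fun s hs => ?_
      rw [map_smul, map_mul, ih _ (by omega)]

/-- `n e_n = Σ t s a_s e_{n-s}` -/
theorem expC_rec {A : Type} [Ring A] [Algebra ℂ A] (t : ℂ) (a : ℕ → A) (n : ℕ) :
    (n : ℂ) • expC t a n =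
      ∑ p ∈ Finset.HasAntidiagonal.antidiagonal n, (t * p.1) • (a p.1 * expC t a p.2) := by
  cases n with
  | zero => simp
  | succ n =>
    rw [expC_succ, Finset.Nat.sum_antidiagonal_succ]
    push_cast
    rw [smul_smul, mul_inv_cancel₀ (by exact_mod_cast Nat.succ_ne_zero n), one_smul,
      Finset.Nat.sum_antidiagonal_eq_sum_range_succ (fun i j => (t * ((i:ℂ) + 1)) • (a (i + 1) * expC t a j)),
      Finset.smul_sum]
    simp [smul_smul]

/-- membership of exponential coefficients in a subalgebra -/
theorem expC_mem {A : Type} [Ring A] [Algebra ℂ A] (S : Subalgebra ℂ A) (t : ℂ) (a : ℕ → A)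
    (ha : ∀ s, 1 ≤ s → a s ∈ S) (n : ℕ) : expC t a n ∈ S := by
  induction n using Nat.strong_induction_on with
  | _ n ih =>
    cases n with
    | zero => rw [expC_zero]; exact S.one_mem
    | succ n =>
      rw [expC_succ]
      refine S.smul_mem (S.smul_mem (S.sum_mem fun s hs => S.smul_mem (S.mul_mem (ha _ (by omega)) (ih _ (by omega))) _) _) _

/-- conversely -/
theorem expC_mem_inv {A : Type} [Ring A] [Algebra ℂ A] (S : Subalgebra ℂ A) (t : ℂ) (ht : t ≠ 0)
    (a : ℕ → A) (he : ∀ n, expC t a n ∈ S) (n : ℕ) (hn : 1 ≤ n) : a n ∈ S := by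
  induction n using Nat.strong_induction_on with
  | _ n ih =>
    obtain ⟨n, rfl⟩ : ∃ k, n = k + 1 := ⟨n - 1, by omega⟩
    have h := expC_succ t a n
    rw [sum_range_succ, Nat.sub_self, expC_zero, mul_one] at h
    have hn0 : ((n : ℂ) + 1) ≠ 0 := by exact_mod_cast Nat.succ_ne_zero n
    have h2 : a (n + 1) = ((n : ℂ) + 1)⁻¹ • ((t⁻¹ * (n + 1)) • expC t a (n + 1) -
        ∑ s ∈ range n, ((s : ℂ) + 1) • (a (s + 1) * expC t a (n - s))) := by
      have h1 : t⁻¹ * ((n : ℂ) + 1) * ((n : ℂ) + 1)⁻¹ * t = 1 := by field_simp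
      rw [h, smul_smul, smul_smul, h1,
        one_smul, add_sub_cancel_left, smul_smul, inv_mul_cancel₀ hn0, one_smul]
    rw [h2]
    refine S.smul_mem (S.sub_mem (S.smul_mem (he _) _) (S.sum_mem fun s hs => ?_)) _
    have := mem_range.1 hs
    exact S.smul_mem (S.mul_mem (ih _ (by omega) (by omega)) (he _)) _

theorem expC_commute {A : Type} [Ring A] [Algebra ℂ A] (t : ℂ) (a : ℕ → A) (y : A)
    (ha : ∀ s, 1 ≤ s → a s * y = y * a s) (n : ℕ) : expC t a n * y = y * expC t a n := by
  have := expC_mem (Subalgebra.centralizer ℂ {y}) t a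
    (fun s hs => by rw [Subalgebra.mem_centralizer_iff]; rintro g rfl; exact (ha s hs).symm) n
  rw [Subalgebra.mem_centralizer_iff] at this
  exact (this y rfl).symm

/-- coefficients of `(1-u⁻¹z)/(1-uz)` -/
def gco (u : ℂ) : ℕ → ℂ
  | 0 => 1
  | n + 1 => (u - u⁻¹) * u ^ n

theorem gco_rec (u : ℂ) (hu : u ≠ 0) (n : ℕ) :
    ∑ p ∈ Finset.HasAntidiagonal.antidiagonal n, (u ^ p.1 - u⁻¹ ^ p.1) * gco u p.2 = n * gco u n := by
  induction n with
  | zero => simp [gco]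
  | succ n ih =>
    rw [Finset.Nat.sum_antidiagonal_succ']
    cases n with
    | zero => simp [gco]
    | succ n =>
      rw [Finset.Nat.sum_antidiagonal_succ'] at ih ⊢
      have : ∑ p ∈ Finset.HasAntidiagonal.antidiagonal n, (u ^ p.1 - u⁻¹ ^ p.1) * gco u (p.2 + 1 + 1)
         = u * ∑ p ∈ Finset.HasAntidiagonal.antidiagonal n, (u ^ p.1 - u⁻¹ ^ p.1) * gco u (p.2 + 1) := by
        rw [Finset.mul_sum]
        refine sum_congr rfl fun p _ => ?_
        simp only [gco]; ring
      simp only [this]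
      simp only [gco] at ih ⊢
      have h1 : u * u⁻¹ = 1 := mul_inv_cancel₀ hu
      push_cast at ih ⊢
      linear_combination u * ih

/-- main commutation formula -/
theorem expC_comm_x {A : Type} [Ring A] [Algebra ℂ A] (t u : ℂ) (hu : u ≠ 0) (δ : ℤ) (a : ℕ → A)
    (x : ℤ → A)
    (hx : ∀ s : ℕ, 1 ≤ s → ∀ m, (t * s) • (a s * x m - x m * a s) = (u ^ s - u⁻¹ ^ s) • x (m + δ * s))
    (n : ℕ) (m : ℤ) :
    expC t a n * x m = ∑ p ∈ Finset.HasAntidiagonal.antidiagonal n, gco u p.1 • (x (m + δ * p.1) * expC t a p.2) := by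
  induction n using Nat.strong_induction_on generalizing m with
  | _ n ih =>
    rcases Nat.eq_zero_or_pos n with rfl | hn
    · simp [expC_zero, gco]
    have hx' : ∀ s : ℕ, ∀ m, (t * s) • (a s * x m) =
        (t * s) • (x m * a s) + (u ^ s - u⁻¹ ^ s) • x (m + δ * s) := by
      intro s m
      rcases Nat.eq_zero_or_pos s with rfl | hs
      · simp
      · rw [← hx s hs m, smul_sub]; abel
    have hnc : (n : ℂ) ≠ 0 := by exact_mod_cast hn.ne'
    refine smul_right_injective A hnc ?_
    simp only
    rw [← smul_mul_assoc, expC_rec, Finset.sum_mul]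
    have e1 : ∀ p ∈ Finset.HasAntidiagonal.antidiagonal n, (t * p.1) • (a p.1 * expC t a p.2) * x m =
        ∑ r ∈ Finset.HasAntidiagonal.antidiagonal p.2, ((gco u r.1 * (t * p.1)) • (x (m + δ * r.1) * (a p.1 * expC t a r.2))
          + (gco u r.1 * (u ^ p.1 - u⁻¹ ^ p.1)) • (x (m + δ * (p.1 + r.1 : ℕ)) * expC t a r.2)) := by
      intro p hp
      rw [Finset.HasAntidiagonal.mem_antidiagonal] at hp
      rcases Nat.eq_zero_or_pos p.1 with h0 | h0
      · simp [h0]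
      rw [smul_mul_assoc, mul_assoc, ih _ (by omega), Finset.mul_sum, Finset.smul_sum]
      refine sum_congr rfl fun r hr => ?_
      rw [mul_smul_comm, smul_comm, ← mul_assoc, ← smul_mul_assoc, hx', add_mul, smul_add,
        smul_mul_assoc, smul_mul_assoc, smul_smul, smul_smul, mul_assoc]
      have : m + δ * r.1 + δ * p.1 = m + δ * (p.1 + r.1 : ℕ) := by push_cast; ring
      rw [this]
    rw [sum_congr rfl e1]
    simp only [sum_add_distrib]
    have e2 : ∑ p ∈ Finset.HasAntidiagonal.antidiagonal n, ∑ r ∈ Finset.HasAntidiagonal.antidiagonal p.2,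
        (gco u r.1 * (t * p.1)) • (x (m + δ * r.1) * (a p.1 * expC t a r.2)) =
        ∑ p ∈ Finset.HasAntidiagonal.antidiagonal n, ((p.2 : ℂ) * gco u p.1) • (x (m + δ * p.1) * expC t a p.2) := by
      rw [sum_sigma']
      have : ∀ p : ℕ × ℕ, ((p.2 : ℂ) * gco u p.1) • (x (m + δ * p.1) * expC t a p.2) =
         ∑ r ∈ Finset.HasAntidiagonal.antidiagonal p.2, (gco u p.1 * (t * r.1)) • (x (m + δ * p.1) * (a r.1 * expC t a r.2)) := by
        intro p
        rw [mul_comm, mul_smul, ← mul_smul_comm, expC_rec, Finset.mul_sum, Finset.smul_sum]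
        refine sum_congr rfl fun r hr => ?_
        rw [mul_smul_comm, smul_smul]
      simp only [this]
      rw [sum_sigma']
      refine sum_nbij' (fun z => ⟨(z.2.1, z.1.1 + z.2.2), (z.1.1, z.2.2)⟩)
        (fun z => ⟨(z.2.1, z.1.1 + z.2.2), (z.1.1, z.2.2)⟩) ?_ ?_ ?_ ?_ ?_
      · rintro ⟨⟨a, b⟩, ⟨c, d⟩⟩ h; simp at h ⊢; omega
      · rintro ⟨⟨a, b⟩, ⟨c, d⟩⟩ h; simp at h ⊢; omega
      · rintro ⟨⟨a, b⟩, ⟨c, d⟩⟩ h; simp at h ⊢; omega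
      · rintro ⟨⟨a, b⟩, ⟨c, d⟩⟩ h; simp at h ⊢; omega
      · rintro ⟨⟨a, b⟩, ⟨c, d⟩⟩ h; rfl
    have e3 : ∑ p ∈ Finset.HasAntidiagonal.antidiagonal n, ∑ r ∈ Finset.HasAntidiagonal.antidiagonal p.2,
        (gco u r.1 * (u ^ p.1 - u⁻¹ ^ p.1)) • (x (m + δ * (p.1 + r.1 : ℕ)) * expC t a r.2) =
        ∑ p ∈ Finset.HasAntidiagonal.antidiagonal n, ((p.1 : ℂ) * gco u p.1) • (x (m + δ * p.1) * expC t a p.2) := by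
      simp only [← gco_rec u hu, sum_smul]
      rw [sum_sigma', sum_sigma']
      refine sum_nbij' (fun z => ⟨(z.1.1 + z.2.1, z.2.2), (z.1.1, z.2.1)⟩)
        (fun z => ⟨(z.2.1, z.1.2 + z.2.2), (z.2.2, z.1.2)⟩) ?_ ?_ ?_ ?_ ?_
      · rintro ⟨⟨a, b⟩, ⟨c, d⟩⟩ h; simp at h ⊢; omega
      · rintro ⟨⟨a, b⟩, ⟨c, d⟩⟩ h; simp at h ⊢; omega
      · rintro ⟨⟨a, b⟩, ⟨c, d⟩⟩ h; simp at h ⊢; omega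
      · rintro ⟨⟨a, b⟩, ⟨c, d⟩⟩ h; simp at h ⊢; omega
      · rintro ⟨⟨a, b⟩, ⟨c, d⟩⟩ h; simp [mul_comm]
    rw [e2, e3, ← sum_add_distrib, Finset.smul_sum]
    refine sum_congr rfl fun p hp => ?_
    rw [Finset.HasAntidiagonal.mem_antidiagonal] at hp
    rw [← add_smul, smul_smul, ← hp]
    congr 1
    push_cast; ring

theorem expC_comm_rec {A : Type} [Ring A] [Algebra ℂ A] (t u : ℂ) (hu : u ≠ 0) (δ : ℤ) (a : ℕ → A)
    (x : ℤ → A)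
    (hx : ∀ s : ℕ, 1 ≤ s → ∀ m, (t * s) • (a s * x m - x m * a s) = (u ^ s - u⁻¹ ^ s) • x (m + δ * s))
    (n : ℕ) (m : ℤ) :
    expC t a (n + 1) * x m - u • (expC t a n * x (m + δ)) =
      x m * expC t a (n + 1) - u⁻¹ • (x (m + δ) * expC t a n) := by
  rw [expC_comm_x t u hu δ a x hx, expC_comm_x t u hu δ a x hx, Finset.Nat.sum_antidiagonal_succ]
  cases n with
  | zero =>
    simp [gco]; module
  | succ n =>
    rw [Finset.Nat.sum_antidiagonal_succ, Finset.Nat.sum_antidiagonal_succ]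
    simp only [gco, smul_add, Finset.smul_sum]
    have : ∑ p ∈ Finset.HasAntidiagonal.antidiagonal n, ((u - u⁻¹) * u ^ (p.1 + 1)) •
        (x (m + δ * ((p.1 + 1 + 1 : ℕ) : ℤ)) * expC t a p.2) =
        ∑ p ∈ Finset.HasAntidiagonal.antidiagonal n, u • ((u - u⁻¹) * u ^ p.1) •
        (x (m + δ + δ * ((p.1 + 1 : ℕ) : ℤ)) * expC t a p.2) := by
      refine sum_congr rfl fun p hp => ?_
      rw [smul_smul]
      congr 1
      · ring
      · congr 2; push_cast; ring
    rw [this]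
    simp
    module
end

section
open MulOpposite

/-! ### Representation data -/

abbrev vld (M N i : ℕ) : Prop := 1 ≤ i ∧ i ≤ M + N - 1

/-- `φ⁺` in representation data -/
def fpOf {A : Type} [Ring A] [Algebra ℂ A] (t : ℂ) (k : A) (h : ℤ → A) (n : ℤ) : A :=
  if 0 ≤ n then k * expC t (fun s => h (s : ℤ)) n.toNat else 0

def fmOf {A : Type} [Ring A] [Algebra ℂ A] (t : ℂ) (ki : A) (h : ℤ → A) (n : ℤ) : A :=
  if n ≤ 0 then ki * expC (-t) (fun s => h (-(s : ℤ))) (-n).toNat else 0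

def tq (q : ℂ) (M i : ℕ) : ℂ := qpar q M i - (qpar q M i)⁻¹

/-- coefficient in `[h_{i,s}, X_{j,n}]` -/
def hco (q : ℂ) (M i j : ℕ) (s : ℤ) : ℂ :=
  qint (qpar q M i) (s * lof M i * cc M i j) / (s : ℂ)

structure RD (q : ℂ) (M N : ℕ) (A : Type) [Ring A] [Algebra ℂ A] where
  xp : ℕ → ℤ → A
  xm : ℕ → ℤ → A
  k : ℕ → A
  ki : ℕ → A
  h : ℕ → ℤ → A
  xp0 : ∀ i n, ¬ vld M N i → xp i n = 0
  xm0 : ∀ i n, ¬ vld M N i → xm i n = 0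
  k0 : ∀ i, ¬ vld M N i → k i = 0
  ki0 : ∀ i, ¬ vld M N i → ki i = 0
  h0 : ∀ i s, ¬ vld M N i → h i s = 0
  h00 : ∀ i, h i 0 = 0
  kki : ∀ i, vld M N i → k i * ki i = 1
  kik : ∀ i, vld M N i → ki i * k i = 1
  kk : ∀ i j, k i * k j = k j * k i
  kki2 : ∀ i j, k i * ki j = ki j * k i
  kiki : ∀ i j, ki i * ki j = ki j * ki i
  kh : ∀ i j s, k i * h j s = h j s * k i
  kih : ∀ i j s, ki i * h j s = h j s * ki i
  hh : ∀ i j s r, h i s * h j r = h j r * h i s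
  kxp : ∀ i j n, k i * xp j n = (q ^ cc M i j) • (xp j n * k i)
  kxm : ∀ i j n, k i * xm j n = (q ^ (-cc M i j)) • (xm j n * k i)
  hxp : ∀ i j s n, vld M N i → h i s * xp j n - xp j n * h i s = hco q M i j s • xp j (n + s)
  hxm : ∀ i j s n, vld M N i → h i s * xm j n - xm j n * h i s = -(hco q M i j s • xm j (n + s))
  xpxm : ∀ i j m n, xp i m * xm j n - sgn M i j • (xm j n * xp i m) =
    if i = j then (tq q M i)⁻¹ • (fpOf (tq q M i) (k i) (h i) (m + n) -
      fmOf (tq q M i) (ki i) (h i) (m + n)) else 0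

/-- relations of level 2 and 3 -/
structure SR2 {A : Type} [Ring A] [Algebra ℂ A] (w : ℂ) (M : ℕ) (X : ℕ → ℤ → A) : Prop where
  r4 : ∀ i j m n, cc M i j = 0 → X i m * X j n - sgn M i j • (X j n * X i m) = 0
  r5 : ∀ i j m n, cc M i j ≠ 0 → X i (m + 1) * X j n - (w ^ cc M i j) • (X j n * X i (m + 1)) =
    (w ^ cc M i j) • (X i m * X j (n + 1)) - X j (n + 1) * X i m

structure SR3 {A : Type} [Ring A] [Algebra ℂ A] (q : ℂ) (M : ℕ) (X : ℕ → ℤ → A) : Prop where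
  r6 : ∀ i j m n k, (cc M i j = 1 ∨ cc M i j = -1) → i ≠ M →
    brF q (X i m) (brF q⁻¹ (X i n) (X j k)) + brF q (X i n) (brF q⁻¹ (X i m) (X j k)) = 0
  r7 : ∀ m n k u, 1 < M → oscOf q M X m n k u + oscOf q M X m u k n = 0

/-! ### Cartan numbers -/

theorem cc_symm (M i j : ℕ) : cc M i j = cc M j i := by
  unfold cc form4 innerE
  rcases eq_or_ne i j with rfl | h
  · ring
  · split_ifs <;> (try omega) <;> (try subst_vars) <;> (try omega)

theorem cc_far (M i j : ℕ) (h : i + 2 ≤ j ∨ j + 2 ≤ i) : cc M i j = 0 := by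
  unfold cc form4 innerE
  simp only [show i ≠ j by omega, show i ≠ j + 1 by omega, show i + 1 ≠ j by omega,
    show i + 1 ≠ j + 1 by omega]
  simp

theorem cc_self (M i : ℕ) : cc M i i = lof M i + lof M (i + 1) := by
  unfold cc form4 innerE
  simp

theorem cc_self_M (M : ℕ) : cc M M M = 0 := by simp [cc_self, lof]

theorem cc_self_even (M i : ℕ) (h : i ≠ M) : cc M i i = 2 * lof M i := by
  rw [cc_self]; unfold lof; split_ifs <;> omega

theorem cc_succ (M i : ℕ) : cc M i (i + 1) = - lof M (i + 1) := by
  unfold cc form4 innerE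
  simp
  intro h
  omega

theorem cc_succ' (M i : ℕ) : cc M (i + 1) i = - lof M (i + 1) := by
  rw [cc_symm, cc_succ]

theorem lof_sq (M i : ℕ) : lof M i * lof M i = 1 := by unfold lof; split_ifs <;> rfl
theorem lof_or (M i : ℕ) : lof M i = 1 ∨ lof M i = -1 := by unfold lof; split_ifs <;> simp
theorem sgn_symm (M i j : ℕ) : sgn M i j = sgn M j i := by unfold sgn; simp only [and_comm]
theorem sgn_ne (M i j : ℕ) (h : i ≠ M ∨ j ≠ M) : sgn M i j = 1 := by
  unfold sgn; rw [if_neg]; tauto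
theorem sgn_MM (M : ℕ) : sgn M M M = -1 := by simp [sgn]
theorem sgn_sq (M i j : ℕ) : sgn M i j * sgn M i j = 1 := by unfold sgn; split_ifs <;> norm_num

/-! ### parameters -/

structure QOK (q : ℂ) : Prop where
  ne0 : q ≠ 0
  nr : ∀ k : ℕ, k ≠ 0 → q ^ k ≠ 1

theorem QOK.zpow_ne {q : ℂ} (hq : QOK q) (m : ℤ) (hm : m ≠ 0) : q ^ m ≠ 1 := by
  rcases lt_or_gt_of_ne hm with h | h
  · intro h1
    apply hq.nr (-m).toNat (by omega)
    rw [← zpow_natCast, Int.toNat_of_nonneg (by omega), zpow_neg, h1, inv_one]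
  · intro h1
    apply hq.nr m.toNat (by omega)
    rw [← zpow_natCast, Int.toNat_of_nonneg (by omega), h1]

theorem QOK.zpow_ne' {q : ℂ} (hq : QOK q) (m : ℤ) (hm : m ≠ 0) : q ^ m - q ^ (-m) ≠ 0 := by
  intro h
  apply hq.zpow_ne (m + m) (by omega)
  rw [zpow_add₀ hq.ne0]
  nth_rewrite 1 [sub_eq_zero.1 h]
  rw [← zpow_add₀ hq.ne0]; simp

theorem QOK.inv {q : ℂ} (hq : QOK q) : QOK q⁻¹ :=
  ⟨inv_ne_zero hq.ne0, fun k hk h => hq.nr k hk (by rwa [inv_pow, inv_eq_one] at h)⟩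

theorem QOK.qpar {q : ℂ} (hq : QOK q) (M i : ℕ) : QOK (qpar q M i) := by
  unfold QAS.qpar
  rcases lof_or M i with h | h <;> rw [h]
  · simpa using hq
  · simpa using hq.inv

theorem QOK.sub_inv_ne {q : ℂ} (hq : QOK q) : q - q⁻¹ ≠ 0 := by
  have := hq.zpow_ne' 1 (by norm_num)
  simpa using this

theorem QOK.tq_ne {q : ℂ} (hq : QOK q) (M i : ℕ) : tq q M i ≠ 0 := (hq.qpar M i).sub_inv_ne

theorem qpar_zpow_lof {q : ℂ} (M i : ℕ) (m : ℤ) : qpar q M i ^ (lof M i * m) = q ^ m := by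
  unfold qpar
  rw [← zpow_mul, ← mul_assoc, lof_sq, one_mul]

theorem hco_mul {q : ℂ} (hq : QOK q) (M i j : ℕ) (s : ℤ) :
    tq q M i * s * hco q M i j s = (q ^ cc M i j) ^ s - (q ^ cc M i j) ^ (-s) := by
  rcases eq_or_ne s 0 with rfl | hs
  · simp
  unfold hco qint
  have h1 : qpar q M i ^ (s * lof M i * cc M i j) = (q ^ cc M i j) ^ s := by
    rw [← zpow_mul, ← qpar_zpow_lof M i (cc M i j * s)]; congr 1; ring
  have h2 : qpar q M i ^ (-(s * lof M i * cc M i j)) = (q ^ cc M i j) ^ (-s) := by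
    rw [← zpow_mul, ← qpar_zpow_lof M i (cc M i j * -s)]; congr 1; ring
  rw [h1, h2]
  have h3 := hq.tq_ne M i
  have hs' : (s : ℂ) ≠ 0 := by exact_mod_cast hs
  change tq q M i * s * ((_ - _) / (tq q M i) / s) = _
  field_simp

theorem hco_ne {q : ℂ} (hq : QOK q) (M i j : ℕ) (s : ℤ) (hs : s ≠ 0) (hc : cc M i j ≠ 0) :
    hco q M i j s ≠ 0 := by
  intro h
  have := hco_mul hq M i j s
  rw [h, mul_zero, ← zpow_mul, ← zpow_mul, mul_neg] at this
  exact hq.zpow_ne' (cc M i j * s) (mul_ne_zero hc hs) this.symm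

/-! ### commutation of `φ` and `X` -/

theorem fpOf_comm {A : Type} [Ring A] [Algebra ℂ A] (t u : ℂ) (hu : u ≠ 0) (k : A)
    (h x : ℤ → A) (hk : ∀ m, k * x m = u • (x m * k))
    (_hkh : ∀ s, k * h s = h s * k)
    (hx : ∀ s m : ℤ, (t * s) • (h s * x m - x m * h s) = (u ^ s - u ^ (-s)) • x (m + s)) (n m : ℤ) :
    fpOf t k h (n + 1) * x m - u • (x m * fpOf t k h (n + 1)) =
      u • (fpOf t k h n * x (m + 1)) - x (m + 1) * fpOf t k h n := by
  rcases lt_trichotomy n (-1) with hn | hn | hn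
  · simp [fpOf, show ¬ 0 ≤ n + 1 by omega, show ¬ 0 ≤ n by omega]
  · subst hn; simp [fpOf, expC_zero, hk]
  · obtain ⟨n, rfl⟩ : ∃ a : ℕ, n = a := ⟨n.toNat, by omega⟩
    have := expC_comm_rec t u hu 1 (fun s => h (s : ℤ)) x (by
      intro s hs m
      have := hx s m
      simp only [zpow_neg, zpow_natCast, inv_pow] at this ⊢
      simpa using this) n m
    have h1 : ∀ r y, k * expC t (fun s => h (s : ℤ)) r * y = k * (expC t (fun s => h (s : ℤ)) r * y) :=
      fun r y => mul_assoc _ _ _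
    simp only [fpOf, show 0 ≤ (n : ℤ) + 1 by omega, show 0 ≤ (n : ℤ) by omega, if_true,
      show ((n : ℤ) + 1).toNat = n + 1 by omega, show (n : ℤ).toNat = n by omega]
    have h2 : ∀ r m, x m * (k * expC t (fun s => h (s : ℤ)) r) =
        u⁻¹ • (k * (x m * expC t (fun s => h (s : ℤ)) r)) := by
      intro r m
      rw [← mul_assoc k, hk, smul_mul_assoc, smul_smul, inv_mul_cancel₀ hu, one_smul, mul_assoc]
    have h3 := congrArg (fun y => k * y) this
    simp only [mul_sub, mul_smul_comm] at h3
    rw [h1, h1, h2, h2, smul_smul, mul_inv_cancel₀ hu, one_smul]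
    rw [sub_eq_sub_iff_add_eq_add] at h3 ⊢
    rw [add_comm, ← sub_eq_iff_eq_add, add_sub_assoc] at h3
    rw [← h3]; abel

theorem fmOf_comm {A : Type} [Ring A] [Algebra ℂ A] (t u : ℂ) (hu : u ≠ 0) (k : A)
    (h x : ℤ → A) (hk : ∀ m, k * x m = u⁻¹ • (x m * k))
    (_hkh : ∀ s, k * h s = h s * k)
    (hx : ∀ s m : ℤ, (t * s) • (h s * x m - x m * h s) = (u ^ s - u ^ (-s)) • x (m + s)) (n m : ℤ) :
    fmOf t k h (n + 1) * x m - u • (x m * fmOf t k h (n + 1)) =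
      u • (fmOf t k h n * x (m + 1)) - x (m + 1) * fmOf t k h n := by
  have key := fpOf_comm (-t) u⁻¹ (inv_ne_zero hu) k (fun s => h (-s)) (fun s => x (-s))
    (fun m => hk _) (fun s => _hkh _) (by
      intro s m
      have := hx (-s) (-m)
      simp only [neg_neg, inv_zpow'] at this ⊢
      rw [show -(m + s) = -m + -s by ring, ← this]; congr 1; push_cast; ring) (-n - 1) (-m - 1)
  have e : ∀ r, fmOf t k h r = fpOf (-t) k (fun s => h (-s)) (-r) := by
    intro r; unfold fmOf fpOf; simp
  rw [e, e]
  simp only [show -(-m - 1) = m + 1 by ring,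
    show -(-m - 1 + 1) = m by ring, show -n - 1 = -(n + 1) by ring] at key
  have h3 := congrArg (fun y => u • y) key
  simp only [smul_sub, smul_smul, mul_inv_cancel₀ hu, one_smul] at h3
  rw [sub_eq_sub_iff_add_eq_add] at h3 ⊢
  rw [← sub_eq_zero] at h3 ⊢
  rw [← neg_eq_zero, ← h3]; abel_nf

section RDlemmas
variable {q : ℂ} {M N : ℕ} {A : Type} [Ring A] [Algebra ℂ A]

def RD.fp (R : RD q M N A) (i : ℕ) (n : ℤ) : A := fpOf (tq q M i) (R.k i) (R.h i) n
def RD.fm (R : RD q M N A) (i : ℕ) (n : ℤ) : A := fmOf (tq q M i) (R.ki i) (R.h i) n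
def RD.Φ (R : RD q M N A) (i : ℕ) (n : ℤ) : A := (tq q M i)⁻¹ • (R.fp i n - R.fm i n)

theorem RD.fp_neg (R : RD q M N A) (i : ℕ) (n : ℤ) (h : n < 0) : R.fp i n = 0 := by
  simp [RD.fp, fpOf, show ¬ 0 ≤ n by omega]
theorem RD.fm_pos (R : RD q M N A) (i : ℕ) (n : ℤ) (h : 0 < n) : R.fm i n = 0 := by
  simp [RD.fm, fmOf, show ¬ n ≤ 0 by omega]
theorem RD.fp_zero (R : RD q M N A) (i : ℕ) : R.fp i 0 = R.k i := by
  simp [RD.fp, fpOf, expC_zero]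
theorem RD.fm_zero (R : RD q M N A) (i : ℕ) : R.fm i 0 = R.ki i := by
  simp [RD.fm, fmOf, expC_zero]

theorem RD.comm (R : RD q M N A) (i j : ℕ) (m n : ℤ) :
    R.xp i m * R.xm j n = sgn M i j • (R.xm j n * R.xp i m) +
      if i = j then R.Φ i (m + n) else 0 := by
  have := R.xpxm i j m n
  rw [sub_eq_iff_eq_add'] at this
  exact this

theorem RD.kixp (R : RD q M N A) (hq : QOK q) (i j : ℕ) (n : ℤ) :
    R.ki i * R.xp j n = (q ^ cc M i j)⁻¹ • (R.xp j n * R.ki i) := by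
  by_cases hi : vld M N i
  · have h1 := R.kxp i j n
    have h2 : R.xp j n * R.ki i = (q ^ cc M i j) • (R.ki i * R.xp j n) := by
      calc R.xp j n * R.ki i = R.ki i * (R.k i * R.xp j n) * R.ki i := by
            rw [← mul_assoc, R.kik i hi, one_mul]
        _ = (q ^ cc M i j) • (R.ki i * R.xp j n * (R.k i * R.ki i)) := by
            rw [h1, mul_smul_comm, smul_mul_assoc]; simp only [mul_assoc]
        _ = _ := by rw [R.kki i hi, mul_one]
    rw [h2, smul_smul, inv_mul_cancel₀ (zpow_ne_zero _ hq.ne0), one_smul]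
  · simp [R.ki0 i hi]

theorem RD.kixm (R : RD q M N A) (hq : QOK q) (i j : ℕ) (n : ℤ) :
    R.ki i * R.xm j n = (q ^ cc M i j) • (R.xm j n * R.ki i) := by
  by_cases hi : vld M N i
  · have h1 := R.kxm i j n
    have h2 : R.xm j n * R.ki i = (q ^ (-cc M i j)) • (R.ki i * R.xm j n) := by
      calc R.xm j n * R.ki i = R.ki i * (R.k i * R.xm j n) * R.ki i := by
            rw [← mul_assoc, R.kik i hi, one_mul]
        _ = (q ^ (-cc M i j)) • (R.ki i * R.xm j n * (R.k i * R.ki i)) := by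
            rw [h1, mul_smul_comm, smul_mul_assoc]; simp only [mul_assoc]
        _ = _ := by rw [R.kki i hi, mul_one]
    rw [h2, smul_smul, ← zpow_add₀ hq.ne0]; simp
  · simp [R.ki0 i hi]

theorem RD.hxp' (R : RD q M N A) (hq : QOK q) (i j : ℕ) (hi : vld M N i) (s m : ℤ) :
    (tq q M i * s) • (R.h i s * R.xp j m - R.xp j m * R.h i s) =
      ((q ^ cc M i j) ^ s - (q ^ cc M i j) ^ (-s)) • R.xp j (m + s) := by
  rw [R.hxp i j s m hi, smul_smul, hco_mul hq]

theorem RD.hxm' (R : RD q M N A) (hq : QOK q) (i j : ℕ) (hi : vld M N i) (s m : ℤ) :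
    (tq q M i * s) • (R.h i s * R.xm j m - R.xm j m * R.h i s) =
      ((q ^ (-cc M i j)) ^ s - (q ^ (-cc M i j)) ^ (-s)) • R.xm j (m + s) := by
  rw [R.hxm i j s m hi, smul_neg, smul_smul, hco_mul hq, ← neg_smul]
  congr 1
  rw [zpow_neg q, inv_zpow', inv_zpow', neg_neg]; ring

theorem RD.fp_xm (R : RD q M N A) (hq : QOK q) (i j : ℕ) (n m : ℤ) :
    R.fp i (n + 1) * R.xm j m - (q ^ (-cc M i j)) • (R.xm j m * R.fp i (n + 1)) =
      (q ^ (-cc M i j)) • (R.fp i n * R.xm j (m + 1)) - R.xm j (m + 1) * R.fp i n := by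
  by_cases hi : vld M N i
  · exact fpOf_comm _ _ (zpow_ne_zero _ hq.ne0) _ _ _ (R.kxm i j) (R.kh i i) (R.hxm' hq i j hi) n m
  · simp [RD.fp, fpOf, R.k0 i hi]

theorem RD.fm_xm (R : RD q M N A) (hq : QOK q) (i j : ℕ) (n m : ℤ) :
    R.fm i (n + 1) * R.xm j m - (q ^ (-cc M i j)) • (R.xm j m * R.fm i (n + 1)) =
      (q ^ (-cc M i j)) • (R.fm i n * R.xm j (m + 1)) - R.xm j (m + 1) * R.fm i n := by
  by_cases hi : vld M N i
  · exact fmOf_comm _ _ (zpow_ne_zero _ hq.ne0) _ _ _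
      (fun m => by rw [R.kixm hq, zpow_neg, inv_inv]) (R.kih i i) (R.hxm' hq i j hi) n m
  · simp [RD.fm, fmOf, R.ki0 i hi]

/-- the opposite data -/
def RD.op (R : RD q M N A) (hq : QOK q) : RD q M N Aᵐᵒᵖ where
  xp i n := MulOpposite.op (R.xm i n)
  xm i n := MulOpposite.op (R.xp i n)
  k i := MulOpposite.op (R.k i)
  ki i := MulOpposite.op (R.ki i)
  h i s := MulOpposite.op (R.h i s)
  xp0 i n h := by rw [R.xm0 i n h]; rfl
  xm0 i n h := by rw [R.xp0 i n h]; rfl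
  k0 i h := by rw [R.k0 i h]; rfl
  ki0 i h := by rw [R.ki0 i h]; rfl
  h0 i n h := by rw [R.h0 i n h]; rfl
  h00 i := by rw [R.h00 i]; rfl
  kki i h := by rw [← op_mul, R.kik i h]; rfl
  kik i h := by rw [← op_mul, R.kki i h]; rfl
  kk i j := by rw [← op_mul, ← op_mul, R.kk]
  kki2 i j := by rw [← op_mul, ← op_mul, R.kki2]
  kiki i j := by rw [← op_mul, ← op_mul, R.kiki]
  kh i j s := by rw [← op_mul, ← op_mul, R.kh]
  kih i j s := by rw [← op_mul, ← op_mul, R.kih]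
  hh i j s r := by rw [← op_mul, ← op_mul, R.hh]
  kxp i j n := by
    rw [← op_mul, ← op_mul, ← op_smul, R.kxm, smul_smul,
        ← zpow_add₀ hq.ne0]; simp
  kxm i j n := by
    rw [← op_mul, ← op_mul, ← op_smul, R.kxp, smul_smul,
        ← zpow_add₀ hq.ne0]; simp
  hxp i j s n hi := by
    rw [← op_mul, ← op_mul, ← op_sub, ← neg_sub, R.hxm _ _ _ _ hi]
    simp
  hxm i j s n hi := by
    rw [← op_mul, ← op_mul, ← op_sub, ← neg_sub, R.hxp _ _ _ _ hi]
    simp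
  xpxm i j m n := by
    rw [← op_mul, ← op_mul, ← op_smul, ← op_sub,
      sgn_symm, R.xpxm j i n m]
    have hc : ∀ (t : ℂ) (a : ℕ → A) (haa : ∀ s r, a s * a r = a r * a s) (n : ℕ),
        MulOpposite.op (expC t a n) = expC t (fun s => MulOpposite.op (a s)) n := by
      intro t a haa n
      induction n using Nat.strong_induction_on with
      | _ n ih =>
        cases n with
        | zero => simp [expC_zero]
        | succ n =>
          rw [expC_succ, expC_succ, op_smul, op_smul, Finset.op_sum]
          congr 2
          refine Finset.sum_congr rfl fun s hs => ?_
          rw [op_smul, ← expC_commute t a (a (s + 1)) (fun r _ => haa _ _),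
            op_mul, ih _ (by omega)]
    rcases eq_or_ne i j with rfl | hij
    · rw [if_pos rfl, if_pos rfl, op_smul, op_sub, add_comm n m]
      congr 2
      · unfold fpOf
        split_ifs
        · rw [← expC_commute _ _ (R.k i) (fun s _ => (R.kh _ _ _).symm), op_mul,
            hc _ _ (fun s r => R.hh _ _ _ _)]
        · rfl
      · unfold fmOf
        split_ifs
        · rw [← expC_commute _ _ (R.ki i) (fun s _ => (R.kih _ _ _).symm), op_mul,
            hc _ _ (fun s r => R.hh _ _ _ _)]
        · rfl
    · rw [if_neg hij, if_neg hij.symm]; rfl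

end RDlemmas
end

section
section
variable {q : ℂ} {M N : ℕ} {A : Type} [Ring A] [Algebra ℂ A]

/-- image of a generator -/
def RD.gen (R : RD q M N A) : Gen M N false → A
  | Gen.Xp i n => R.xp i.1 n
  | Gen.Xm i n => R.xm i.1 n
  | Gen.K i => R.k i.1
  | Gen.Ki i => R.ki i.1
  | Gen.H i s => R.h i.1 s.1
  | Gen.K0 _ => 0
  | Gen.K0i _ => 0

def RD.ρ (R : RD q M N A) : FA M N false →ₐ[ℂ] A := FreeAlgebra.lift ℂ R.gen

theorem RD.ρ_gi (R : RD q M N A) (g : Gen M N false) : R.ρ (gi g) = R.gen g := by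
  unfold RD.ρ gi; simp

theorem RD.ρ_Xp (R : RD q M N A) (i : ℕ) (n : ℤ) : R.ρ (XpF M N false i n) = R.xp i n := by
  unfold XpF
  split_ifs with h
  · rw [R.ρ_gi]; rfl
  · rw [R.xp0 i n h, map_zero]

theorem RD.ρ_Xm (R : RD q M N A) (i : ℕ) (n : ℤ) : R.ρ (XmF M N false i n) = R.xm i n := by
  unfold XmF
  split_ifs with h
  · rw [R.ρ_gi]; rfl
  · rw [R.xm0 i n h, map_zero]

theorem RD.ρ_K (R : RD q M N A) (i : ℕ) : R.ρ (KF M N false i) = R.k i := by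
  unfold KF
  split_ifs with h
  · rw [R.ρ_gi]; rfl
  · rw [R.k0 i h, map_zero]

theorem RD.ρ_Ki (R : RD q M N A) (i : ℕ) : R.ρ (KiF M N false i) = R.ki i := by
  unfold KiF
  split_ifs with h
  · rw [R.ρ_gi]; rfl
  · rw [R.ki0 i h, map_zero]

theorem RD.ρ_H (R : RD q M N A) (i : ℕ) (s : ℤ) : R.ρ (HF M N false i s) = R.h i s := by
  unfold HF
  split_ifs with h
  · rw [R.ρ_gi]; rfl
  · rw [map_zero]
    by_cases h1 : vld M N i
    · have : s = 0 := by by_contra h2; exact h ⟨h1, h2⟩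
      rw [this, R.h00]
    · rw [R.h0 i s h1]

theorem RD.ρ_phiP (R : RD q M N A) (i : ℕ) (n : ℤ) : R.ρ (phiPF q M N false i n) = R.fp i n := by
  unfold phiPF RD.fp fpOf
  split_ifs
  · rw [map_mul, R.ρ_K, expC_map]
    simp only [R.ρ_H]; rfl
  · simp

theorem RD.ρ_phiM (R : RD q M N A) (i : ℕ) (n : ℤ) : R.ρ (phiMF q M N false i n) = R.fm i n := by
  unfold phiMF RD.fm fmOf
  split_ifs
  · rw [map_mul, R.ρ_Ki, expC_map]
    simp only [R.ρ_H]; rfl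
  · simp

theorem RD.ρ_rel (R : RD q M N A) (hp : SR2 q M R.xp) (hm : SR2 q⁻¹ M R.xm) (hp3 : SR3 q M R.xp)
    (hm3 : SR3 q M R.xm) (a b : FA M N false) (h : rel q M N false 3 a b) : R.ρ a = R.ρ b := by
  cases h with
  | KKi i => simpa [R.ρ_gi, RD.gen] using R.kki i.1 i.2
  | KiK i => simpa [R.ρ_gi, RD.gen] using R.kik i.1 i.2
  | KK i j => simpa [R.ρ_gi, RD.gen] using R.kk i.1 j.1
  | KKi2 i j => simpa [R.ρ_gi, RD.gen] using R.kki2 i.1 j.1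
  | KiKi i j => simpa [R.ρ_gi, RD.gen] using R.kiki i.1 j.1
  | KH i j s => simpa [R.ρ_gi, RD.gen] using R.kh i.1 j.1 s.1
  | KiH i j s => simpa [R.ρ_gi, RD.gen] using R.kih i.1 j.1 s.1
  | HH i j s t => simpa [R.ρ_gi, RD.gen] using R.hh i.1 j.1 s.1 t.1
  | KXp i j n => simpa [R.ρ_gi, RD.gen] using R.kxp i.1 j.1 n
  | KXm i j n => simpa [R.ρ_gi, RD.gen] using R.kxm i.1 j.1 n
  | HXp i j s n => simpa [R.ρ_gi, RD.gen, hco] using R.hxp i.1 j.1 s.1 n i.2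
  | HXm i j s n => simpa [R.ρ_gi, RD.gen, hco] using R.hxm i.1 j.1 s.1 n i.2
  | XpXm i j m n =>
    have := R.xpxm i.1 j.1 m n
    simp only [map_sub, map_smul, map_mul, R.ρ_gi, RD.gen]
    rw [this]
    by_cases hij : i = j
    · rw [if_pos hij, if_pos (by rw [hij]), map_smul, map_sub, R.ρ_phiP, R.ρ_phiM]; rfl
    · rw [if_neg hij, if_neg (fun h => hij (Subtype.ext h)), map_zero]
  | XX0p i j m n h2 h => simpa [R.ρ_gi, RD.gen] using hp.r4 i.1 j.1 m n h
  | XX0m i j m n h2 h => simpa [R.ρ_gi, RD.gen] using hm.r4 i.1 j.1 m n h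
  | XXp i j m n h2 h => simpa [R.ρ_gi, RD.gen] using hp.r5 i.1 j.1 m n h
  | XXm i j m n h2 h => simpa [R.ρ_gi, RD.gen] using hm.r5 i.1 j.1 m n h
  | serreP i j m n k h3 h hi => simpa [R.ρ_gi, RD.gen, brF] using hp3.r6 i.1 j.1 m n k h hi
  | serreM i j m n k h3 h hi => simpa [R.ρ_gi, RD.gen, brF] using hm3.r6 i.1 j.1 m n k h hi
  | oscP m n k u h3 hM hN => simpa [R.ρ_Xp, oscOf, brF] using hp3.r7 m n k u hM
  | oscM m n k u h3 hM hN => simpa [R.ρ_Xm, oscOf, brF] using hm3.r7 m n k u hM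
  | K0K0i he => simp at he
  | K0iK0 he => simp at he
  | K0K he => simp at he
  | K0Ki he => simp at he
  | K0H he => simp at he
  | K0Xp he => simp at he
  | K0Xm he => simp at he

end

section alg
variable (q : ℂ) (M N : ℕ)

theorem mkA_rel {a b : FA M N false} (h : rel q M N false 3 a b) :
    mkA q M N false 3 a = mkA q M N false 3 b := RingQuot.mkAlgHom_rel ℂ h

theorem mkA_Xp {i : ℕ} (h : vld M N i) (n : ℤ) :
    XpA q M N false 3 i n = mkA q M N false 3 (gi (Gen.Xp ⟨i, h⟩ n)) := by
  unfold XpA XpF; rw [dif_pos h]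
theorem mkA_Xm {i : ℕ} (h : vld M N i) (n : ℤ) :
    XmA q M N false 3 i n = mkA q M N false 3 (gi (Gen.Xm ⟨i, h⟩ n)) := by
  unfold XmA XmF; rw [dif_pos h]
theorem mkA_K {i : ℕ} (h : vld M N i) :
    KA q M N false 3 i = mkA q M N false 3 (gi (Gen.K ⟨i, h⟩)) := by
  unfold KA KF; rw [dif_pos h]
theorem mkA_Ki {i : ℕ} (h : vld M N i) :
    KiA q M N false 3 i = mkA q M N false 3 (gi (Gen.Ki ⟨i, h⟩)) := by
  unfold KiA KiF; rw [dif_pos h]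
theorem mkA_H {i : ℕ} (h : vld M N i) {s : ℤ} (hs : s ≠ 0) :
    HA q M N false 3 i s = mkA q M N false 3 (gi (Gen.H ⟨i, h⟩ ⟨s, hs⟩)) := by
  unfold HA HF; rw [dif_pos ⟨h, hs⟩]
theorem XpA0 (i : ℕ) (n : ℤ) (h : ¬ vld M N i) : XpA q M N false 3 i n = 0 := by
  unfold XpA XpF; rw [dif_neg h, map_zero]
theorem XmA0 (i : ℕ) (n : ℤ) (h : ¬ vld M N i) : XmA q M N false 3 i n = 0 := by
  unfold XmA XmF; rw [dif_neg h, map_zero]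
theorem KA0 (i : ℕ) (h : ¬ vld M N i) : KA q M N false 3 i = 0 := by
  unfold KA KF; rw [dif_neg h, map_zero]
theorem KiA0 (i : ℕ) (h : ¬ vld M N i) : KiA q M N false 3 i = 0 := by
  unfold KiA KiF; rw [dif_neg h, map_zero]
theorem HA0 (i : ℕ) (s : ℤ) (h : ¬ vld M N i) : HA q M N false 3 i s = 0 := by
  unfold HA HF; rw [dif_neg (fun h' => h h'.1), map_zero]
theorem HA00 (i : ℕ) : HA q M N false 3 i 0 = 0 := by
  unfold HA HF; rw [dif_neg (fun h' => h'.2 rfl), map_zero]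

theorem phiPA_eq (i : ℕ) (n : ℤ) : phiPA q M N false 3 i n =
    fpOf (tq q M i) (KA q M N false 3 i) (HA q M N false 3 i) n := by
  unfold phiPA phiPF fpOf
  split_ifs
  · rw [map_mul, expC_map]; rfl
  · simp
theorem phiMA_eq (i : ℕ) (n : ℤ) : phiMA q M N false 3 i n =
    fmOf (tq q M i) (KiA q M N false 3 i) (HA q M N false 3 i) n := by
  unfold phiMA phiMF fmOf
  split_ifs
  · rw [map_mul, expC_map]; rfl
  · simp

def RA : RD q M N (ALG q M N false 3) where
  xp := XpA q M N false 3
  xm := XmA q M N false 3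
  k := KA q M N false 3
  ki := KiA q M N false 3
  h := HA q M N false 3
  xp0 := XpA0 q M N
  xm0 := XmA0 q M N
  k0 := KA0 q M N
  ki0 := KiA0 q M N
  h0 := HA0 q M N
  h00 := HA00 q M N
  kki i h := by rw [mkA_K q M N h, mkA_Ki q M N h, ← map_mul, mkA_rel q M N (rel.KKi _), map_one]
  kik i h := by rw [mkA_K q M N h, mkA_Ki q M N h, ← map_mul, mkA_rel q M N (rel.KiK _), map_one]
  kk i j := by
    by_cases hi : vld M N i <;> [skip; simp [KA0 q M N i hi]]
    by_cases hj : vld M N j <;> [skip; simp [KA0 q M N j hj]]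
    rw [mkA_K q M N hi, mkA_K q M N hj, ← map_mul, mkA_rel q M N (rel.KK _ _), map_mul]
  kki2 i j := by
    by_cases hi : vld M N i <;> [skip; simp [KA0 q M N i hi]]
    by_cases hj : vld M N j <;> [skip; simp [KiA0 q M N j hj]]
    rw [mkA_K q M N hi, mkA_Ki q M N hj, ← map_mul, mkA_rel q M N (rel.KKi2 _ _), map_mul]
  kiki i j := by
    by_cases hi : vld M N i <;> [skip; simp [KiA0 q M N i hi]]
    by_cases hj : vld M N j <;> [skip; simp [KiA0 q M N j hj]]
    rw [mkA_Ki q M N hi, mkA_Ki q M N hj, ← map_mul, mkA_rel q M N (rel.KiKi _ _), map_mul]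
  kh i j s := by
    by_cases hi : vld M N i <;> [skip; simp [KA0 q M N i hi]]
    by_cases hj : vld M N j <;> [skip; simp [HA0 q M N j s hj]]
    by_cases hs : s = 0
    · simp [hs, HA00]
    rw [mkA_K q M N hi, mkA_H q M N hj hs, ← map_mul, mkA_rel q M N (rel.KH _ _ _), map_mul]
  kih i j s := by
    by_cases hi : vld M N i <;> [skip; simp [KiA0 q M N i hi]]
    by_cases hj : vld M N j <;> [skip; simp [HA0 q M N j s hj]]
    by_cases hs : s = 0
    · simp [hs, HA00]
    rw [mkA_Ki q M N hi, mkA_H q M N hj hs, ← map_mul, mkA_rel q M N (rel.KiH _ _ _), map_mul]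
  hh i j s t := by
    by_cases hi : vld M N i <;> [skip; simp [HA0 q M N i s hi]]
    by_cases hj : vld M N j <;> [skip; simp [HA0 q M N j t hj]]
    by_cases hs : s = 0
    · simp [hs, HA00]
    by_cases ht : t = 0
    · simp [ht, HA00]
    rw [mkA_H q M N hi hs, mkA_H q M N hj ht, ← map_mul, mkA_rel q M N (rel.HH _ _ _ _), map_mul]
  kxp i j n := by
    by_cases hi : vld M N i <;> [skip; simp [KA0 q M N i hi]]
    by_cases hj : vld M N j <;> [skip; simp [XpA0 q M N j n hj]]
    rw [mkA_K q M N hi, mkA_Xp q M N hj, ← map_mul, mkA_rel q M N (rel.KXp _ _ _), map_smul, map_mul]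
  kxm i j n := by
    by_cases hi : vld M N i <;> [skip; simp [KA0 q M N i hi]]
    by_cases hj : vld M N j <;> [skip; simp [XmA0 q M N j n hj]]
    rw [mkA_K q M N hi, mkA_Xm q M N hj, ← map_mul, mkA_rel q M N (rel.KXm _ _ _), map_smul, map_mul]
  hxp i j s n hi := by
    by_cases hj : vld M N j <;> [skip; simp [XpA0 q M N j _ hj]]
    by_cases hs : s = 0
    · simp [hs, HA00, hco]
    rw [mkA_H q M N hi hs, mkA_Xp q M N hj, mkA_Xp q M N hj, ← map_mul, ← map_mul, ← map_sub,
      mkA_rel q M N (rel.HXp _ _ _ _), map_smul]; rfl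
  hxm i j s n hi := by
    by_cases hj : vld M N j <;> [skip; simp [XmA0 q M N j _ hj]]
    by_cases hs : s = 0
    · simp [hs, HA00, hco]
    rw [mkA_H q M N hi hs, mkA_Xm q M N hj, mkA_Xm q M N hj, ← map_mul, ← map_mul, ← map_sub,
      mkA_rel q M N (rel.HXm _ _ _ _), map_neg, map_smul]; rfl
  xpxm i j m n := by
    by_cases hi : vld M N i
    swap
    · simp [XpA0 q M N i m hi, fpOf, fmOf, KA0 q M N i hi, KiA0 q M N i hi]
    by_cases hj : vld M N j
    swap
    · have : i ≠ j := by rintro rfl; exact hj hi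
      simp [XmA0 q M N j _ hj, this]
    rw [mkA_Xp q M N hi, mkA_Xm q M N hj, ← map_mul, ← map_mul, ← map_smul, ← map_sub,
      mkA_rel q M N (rel.XpXm _ _ _ _)]
    by_cases hij : i = j
    · rw [if_pos hij, if_pos (Subtype.ext hij), map_smul, map_sub, ← phiPA_eq, ← phiMA_eq]; rfl
    · rw [if_neg hij, if_neg (fun h => hij (congrArg Subtype.val h)), map_zero]

theorem RA_SR2 : SR2 q⁻¹ M (RA q M N).xm where
  r4 i j m n hc := by
    change XmA q M N false 3 i m * XmA q M N false 3 j n - _ • (XmA q M N false 3 j n * XmA q M N false 3 i m) = 0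
    by_cases hi : vld M N i <;> [skip; simp [XmA0 q M N i _ hi]]
    by_cases hj : vld M N j <;> [skip; simp [XmA0 q M N j _ hj]]
    rw [mkA_Xm q M N hi, mkA_Xm q M N hj, ← map_mul, ← map_mul, ← map_smul, ← map_sub,
      mkA_rel q M N (rel.XX0m _ _ _ _ (by norm_num) hc), map_zero]
  r5 i j m n hc := by
    change XmA q M N false 3 i (m+1) * XmA q M N false 3 j n - _ • (XmA q M N false 3 j n * XmA q M N false 3 i (m+1)) =
      _ • (XmA q M N false 3 i m * XmA q M N false 3 j (n+1)) - (XmA q M N false 3 j (n+1) * XmA q M N false 3 i m)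
    by_cases hi : vld M N i <;> [skip; simp [XmA0 q M N i _ hi]]
    by_cases hj : vld M N j <;> [skip; simp [XmA0 q M N j _ hj]]
    have := mkA_rel q M N (rel.XXm (lvl := 3) (ext := false) (q := q) ⟨i, hi⟩ ⟨j, hj⟩ m n (by norm_num) hc)
    simp only [map_sub, map_smul, map_mul] at this
    rw [inv_zpow', mkA_Xm q M N hi, mkA_Xm q M N hj, mkA_Xm q M N hi, mkA_Xm q M N hj, this]

theorem RA_SR3 : SR3 q M (RA q M N).xm where
  r6 i j m n k hc hiM := by
    change brF q (XmA q M N false 3 i m) (brF q⁻¹ (XmA q M N false 3 i n) (XmA q M N false 3 j k)) +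
      brF q (XmA q M N false 3 i n) (brF q⁻¹ (XmA q M N false 3 i m) (XmA q M N false 3 j k)) = 0
    by_cases hi : vld M N i <;> [skip; simp [XmA0 q M N i _ hi, brF]]
    by_cases hj : vld M N j <;> [skip; simp [XmA0 q M N j _ hj, brF]]
    have := mkA_rel q M N (rel.serreM (lvl := 3) (ext := false) (q := q) ⟨i, hi⟩ ⟨j, hj⟩ m n k (by norm_num) hc hiM)
    simp only [brF, map_sub, map_add, map_smul, map_mul, map_zero] at this ⊢
    rw [mkA_Xm q M N hi, mkA_Xm q M N hj, mkA_Xm q M N hi, this]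
  r7 m n k u hM := by
    by_cases hN : 1 < N
    · have := mkA_rel q M N (rel.oscM (lvl := 3) (ext := false) (q := q) m n k u (by norm_num) hM hN)
      simp only [oscOf, brF, map_sub, map_add, map_smul, map_mul, map_zero] at this ⊢
      exact this
    · have h0 : ∀ n, (RA q M N).xm (M + 1) n = 0 := fun n => XmA0 q M N _ _ (by unfold vld; omega)
      simp [oscOf, brF, h0]

theorem ALG_induction {p : ALG q M N false 3 → Prop} (a : ALG q M N false 3)
    (hc : ∀ c : ℂ, p (algebraMap ℂ _ c))
    (hxp : ∀ i n, p (XpA q M N false 3 i n)) (hxm : ∀ i n, p (XmA q M N false 3 i n))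
    (hk : ∀ i, p (KA q M N false 3 i)) (hki : ∀ i, p (KiA q M N false 3 i))
    (hh : ∀ i s, p (HA q M N false 3 i s))
    (hadd : ∀ a b, p a → p b → p (a + b)) (hmul : ∀ a b, p a → p b → p (a * b)) : p a := by
  obtain ⟨a, rfl⟩ := RingQuot.mkAlgHom_surjective ℂ (rel q M N false 3) a
  change p (mkA q M N false 3 a)
  induction a using FreeAlgebra.induction with
  | grade0 r => rw [AlgHom.commutes]; exact hc r
  | grade1 g =>
    change p (mkA q M N false 3 (gi g))
    cases g with
    | Xp i n => have := hxp i.1 n; rwa [mkA_Xp q M N i.2] at this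
    | Xm i n => have := hxm i.1 n; rwa [mkA_Xm q M N i.2] at this
    | K i => have := hk i.1; rwa [mkA_K q M N i.2] at this
    | Ki i => have := hki i.1; rwa [mkA_Ki q M N i.2] at this
    | H i s => have := hh i.1 s.1; rwa [mkA_H q M N i.2 s.2] at this
    | K0 h => simp at h
    | K0i h => simp at h
  | mul a b ha hb => rw [map_mul]; exact hmul _ _ ha hb
  | add a b ha hb => rw [map_add]; exact hadd _ _ ha hb

end alg
end

section
open Submodule Finset

/-! ### finite generation helpers -/

theorem fg_of_le {V : Type} [AddCommGroup V] [Module ℂ V] {F G : Submodule ℂ V} (hG : G.FG)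
    (h : F ≤ G) : F.FG := by
  have : FiniteDimensional ℂ G := Module.Finite.iff_fg.2 hG
  have : FiniteDimensional ℂ F := finiteDimensional_of_le h
  exact Module.Finite.iff_fg.1 this

theorem fg_rec {V : Type} [AddCommGroup V] [Module ℂ V] (F : Submodule ℂ V) (hF : F.FG)
    (D : ℕ) (b : ℕ → ℂ) (hb : ∃ s ≤ D, b s ≠ 0) (u : ℤ → V)
    (hu : ∀ n : ℤ, ∑ s ∈ range (D + 1), b s • u (n + s) ∈ F) :
    ∃ F' : Submodule ℂ V, F'.FG ∧ ∀ n, u n ∈ F' := by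
  induction D generalizing b u with
  | zero =>
    obtain ⟨s, hs, hbs⟩ := hb
    obtain rfl : s = 0 := by omega
    refine ⟨F, hF, fun n => ?_⟩
    have := hu n
    simp at this
    simpa [smul_smul, inv_mul_cancel₀ hbs] using F.smul_mem (b 0)⁻¹ this
  | succ D ih =>
    by_cases h0 : b 0 = 0
    · refine ih (fun s => b (s + 1)) ?_ u ?_
      · obtain ⟨s, hs, hbs⟩ := hb
        obtain ⟨r, rfl⟩ : ∃ r, s = r + 1 := ⟨s - 1, by
          have : s ≠ 0 := by rintro rfl; exact hbs h0
          omega⟩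
        exact ⟨r, by omega, hbs⟩
      · intro n
        have := hu (n - 1)
        rw [sum_range_succ'] at this
        simp only [h0, zero_smul, add_zero] at this
        convert this using 4
        push_cast; ring
    by_cases hD : b (D + 1) = 0
    · refine ih b ?_ u ?_
      · obtain ⟨s, hs, hbs⟩ := hb
        exact ⟨s, by
          have : s ≠ D + 1 := by rintro rfl; exact hbs hD
          omega, hbs⟩
      · intro n
        have := hu n
        rw [sum_range_succ] at this
        simpa only [hD, zero_smul, add_zero] using this
    refine ⟨F ⊔ span ℂ (Set.range fun s : Fin (D + 1) => u s),
      hF.sup (fg_span (Set.finite_range _)), ?_⟩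
    set G := F ⊔ span ℂ (Set.range fun s : Fin (D + 1) => u s)
    have hG : ∀ s : ℕ, s ≤ D → u s ∈ G := fun s hs =>
      mem_sup_right (subset_span ⟨⟨s, by omega⟩, rfl⟩)
    have hFG : F ≤ G := le_sup_left
    have up : ∀ n : ℕ, u n ∈ G := by
      intro n
      induction n using Nat.strong_induction_on with
      | _ n ihn =>
        by_cases hn : n ≤ D
        · exact hG n hn
        obtain ⟨r, rfl⟩ : ∃ r, n = r + (D + 1) := ⟨n - (D + 1), by omega⟩
        have h1 := hu r
        rw [sum_range_succ] at h1
        have h2 : ∑ s ∈ range (D + 1), b s • u ((r : ℤ) + s) ∈ G := by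
          refine G.sum_mem fun s hs => G.smul_mem _ ?_
          have := mem_range.1 hs
          have := ihn (r + s) (by omega)
          exact_mod_cast this
        have h3 := G.smul_mem (b (D + 1))⁻¹ ((Submodule.add_mem_iff_right G h2).1 (hFG h1))
        rw [smul_smul, inv_mul_cancel₀ hD, one_smul] at h3
        exact_mod_cast h3
    have down : ∀ n : ℕ, ∀ r : ℕ, u ((r : ℤ) - n) ∈ G := by
      intro n
      induction n with
      | zero => intro r; simpa using up r
      | succ n ihn =>
        intro r
        have h1 := hu ((r : ℤ) - (n + 1 : ℕ))
        rw [sum_range_succ'] at h1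
        have h2 : ∑ s ∈ range (D + 1), b (s + 1) • u ((r : ℤ) - (n + 1 : ℕ) + (s + 1 : ℕ)) ∈ G := by
          refine G.sum_mem fun s hs => G.smul_mem _ ?_
          have := ihn (r + s)
          convert this using 2
          push_cast; ring
        have h3 := G.smul_mem (b 0)⁻¹ ((Submodule.add_mem_iff_right G h2).1 (hFG h1))
        rw [smul_smul, inv_mul_cancel₀ h0, one_smul] at h3
        simpa using h3
    intro n
    have := down n.natAbs (n + n.natAbs).toNat
    convert this using 2
    omega

/-- a sequence in a finitely generated submodule has a linear dependence -/
theorem fg_dep {V : Type} [AddCommGroup V] [Module ℂ V] (F : Submodule ℂ V) (hF : F.FG)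
    (u : ℕ → V) (hu : ∀ n, u n ∈ F) :
    ∃ D : ℕ, ∃ b : ℕ → ℂ, (∃ s ≤ D, b s ≠ 0) ∧ ∑ s ∈ range (D + 1), b s • u s = 0 := by
  have : FiniteDimensional ℂ F := Module.Finite.iff_fg.2 hF
  have hl : ¬ LinearIndependent ℂ (fun n : ℕ => (⟨u n, hu n⟩ : F)) := by
    intro h
    have := h.finite
    exact not_finite ℕ
  rw [linearIndependent_iff'] at hl
  push Not at hl
  obtain ⟨s, g, hsum, i, his, hgi⟩ := hl
  obtain ⟨D, hD⟩ : ∃ D, s ⊆ range (D + 1) := by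
    refine ⟨s.sup id, fun x hx => ?_⟩
    rw [mem_range]
    exact Nat.lt_succ_of_le (le_sup (f := id) hx)
  refine ⟨D, fun n => if n ∈ s then g n else 0, ⟨i, ?_, by simpa [his] using hgi⟩, ?_⟩
  · have := mem_range.1 (hD his); omega
  · have h2 := congrArg F.subtype hsum
    simp only [map_sum, map_smul, map_zero] at h2
    rw [← h2]
    simp only [ite_smul, zero_smul]
    rw [sum_ite_mem, inter_eq_right.2 hD]
    rfl

section
variable {q : ℂ} {M N : ℕ} {A : Type} [Ring A] [Algebra ℂ A]
variable {V : Type} [AddCommGroup V] [Module ℂ V] [Module A V] [IsScalarTower ℂ A V]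

/-- operator action -/
def act (a : A) : V →ₗ[ℂ] V where
  toFun w := a • w
  map_add' x y := smul_add a x y
  map_smul' c x := by
    have : SMulCommClass A ℂ V := IsScalarTower.to_smulCommClass'
    exact smul_comm a c x

theorem act_apply (a : A) (w : V) : act a w = a • w := rfl

theorem asmul_comm (a : A) (c : ℂ) (w : V) : a • c • w = c • a • w := (act a).map_smul c w

/-- scalar subalgebra -/
def Sc (v : V) : Subalgebra ℂ A where
  carrier := {a | ∃ c : ℂ, a • v = c • v}
  mul_mem' := by
    rintro a b ⟨c, hc⟩ ⟨d, hd⟩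
    refine ⟨d * c, ?_⟩
    rw [mul_smul, hd, asmul_comm, hc, smul_smul]
  add_mem' := by
    rintro a b ⟨c, hc⟩ ⟨d, hd⟩
    exact ⟨c + d, by rw [add_smul, add_smul, hc, hd]⟩
  algebraMap_mem' c := ⟨c, by rw [algebraMap_smul]⟩

/-- stabilizer of a subspace -/
def Stab (S : Submodule ℂ V) : Subalgebra ℂ A where
  carrier := {a | ∀ w ∈ S, a • w ∈ S}
  mul_mem' := by
    intro a b ha hb w hw
    rw [mul_smul]; exact ha _ (hb _ hw)
  add_mem' := by
    intro a b ha hb w hw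
    rw [add_smul]; exact S.add_mem (ha _ hw) (hb _ hw)
  algebraMap_mem' c := by
    intro w hw
    rw [algebraMap_smul]; exact S.smul_mem _ hw

theorem mem_Stab (S : Submodule ℂ V) (a : A) : a ∈ (Stab S : Subalgebra ℂ A) ↔ ∀ w ∈ S, a • w ∈ S :=
  Iff.rfl

theorem RD.fp_mem (R : RD q M N A) (S : Subalgebra ℂ A) (i : ℕ) (hk : R.k i ∈ S)
    (hh : ∀ s, R.h i s ∈ S) (n : ℤ) : R.fp i n ∈ S := by
  unfold RD.fp fpOf
  split_ifs
  · exact S.mul_mem hk (expC_mem S _ _ (fun s _ => hh _) _)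
  · exact S.zero_mem

theorem RD.fm_mem (R : RD q M N A) (S : Subalgebra ℂ A) (i : ℕ) (hk : R.ki i ∈ S)
    (hh : ∀ s, R.h i s ∈ S) (n : ℤ) : R.fm i n ∈ S := by
  unfold RD.fm fmOf
  split_ifs
  · exact S.mul_mem hk (expC_mem S _ _ (fun s _ => hh _) _)
  · exact S.zero_mem

theorem RD.Φ_mem (R : RD q M N A) (S : Subalgebra ℂ A) (i : ℕ) (hk : R.k i ∈ S)
    (hki : R.ki i ∈ S) (hh : ∀ s, R.h i s ∈ S) (n : ℤ) : R.Φ i n ∈ S :=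
  S.smul_mem (S.sub_mem (R.fp_mem S i hk hh n) (R.fm_mem S i hki hh n)) _

theorem RD.h_mem (R : RD q M N A) (hq : QOK q) (S : Subalgebra ℂ A) (i : ℕ) (hi : vld M N i)
    (hp : ∀ n, R.fp i n ∈ S) (hm : ∀ n, R.fm i n ∈ S) (s : ℤ) : R.h i s ∈ S := by
  have hk : R.k i ∈ S := by rw [← R.fp_zero]; exact hp 0
  have hki : R.ki i ∈ S := by rw [← R.fm_zero]; exact hm 0
  rcases lt_trichotomy s 0 with h | h | h
  · have := expC_mem_inv S (-(tq q M i)) (neg_ne_zero.2 (hq.tq_ne M i)) (fun s => R.h i (-(s : ℤ))) (by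
      intro n
      have h1 := S.mul_mem hk (hm (-n))
      unfold RD.fm fmOf at h1
      rw [if_pos (by omega), ← mul_assoc, R.kki i hi, one_mul] at h1
      simpa using h1) (-s).toNat (by omega)
    simpa [show max (-s) 0 = -s by omega] using this
  · rw [h, R.h00]; exact S.zero_mem
  · have := expC_mem_inv S (tq q M i) (hq.tq_ne M i) (fun s => R.h i (s : ℤ)) (by
      intro n
      have h1 := S.mul_mem hki (hp n)
      unfold RD.fp fpOf at h1
      rw [if_pos (by omega), ← mul_assoc, R.kik i hi, one_mul] at h1
      simpa using h1) s.toNat (by omega)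
    simpa [show max s 0 = s by omega] using this

/-- The hypotheses on a Weyl-type module used for the upper bound -/
structure UP (R : RD q M N A) (v : V) (d : ℕ → ℕ) : Prop where
  hq : QOK q
  hM : 1 ≤ M
  hN : 1 ≤ N
  s2 : SR2 q⁻¹ M R.xm
  s3 : SR3 q M R.xm
  xpv : ∀ i n, R.xp i n • v = 0
  fpv : ∀ i n, vld M N i → R.fp i n ∈ Sc v
  fmv : ∀ i n, vld M N i → R.fm i n ∈ Sc v
  kv : ∀ i, i ≠ M → vld M N i → R.k i • v = (qpar q M i ^ d i) • v
  even : ∀ i, i ≠ M → vld M N i → R.xm i 0 ^ (d i + 1) • v = 0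
  odd : ∃ D : ℕ, ∃ b : ℕ → ℂ, b D ≠ 0 ∧ ∀ n : ℤ,
    ∑ s ∈ range (D + 1), b s • R.xm M (n + s) • v = 0
  gen : ∀ S : Submodule ℂ V, v ∈ S → (∀ i n, R.xp i n ∈ (Stab S : Subalgebra ℂ A)) →
    (∀ i n, R.xm i n ∈ (Stab S : Subalgebra ℂ A)) → (∀ i, R.k i ∈ (Stab S : Subalgebra ℂ A)) →
    (∀ i, R.ki i ∈ (Stab S : Subalgebra ℂ A)) → (∀ i s, R.h i s ∈ (Stab S : Subalgebra ℂ A)) → S = ⊤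

/-- span of words of exact length -/
def Gw (R : RD q M N A) (v : V) : ℕ → Submodule ℂ V
  | 0 => span ℂ {v}
  | r + 1 => span ℂ {x | ∃ i n, ∃ w ∈ Gw R v r, x = R.xm i n • w}

theorem Gw_succ (R : RD q M N A) (v : V) (r : ℕ) (i : ℕ) (n : ℤ) (w : V) (hw : w ∈ Gw R v r) :
    R.xm i n • w ∈ Gw R v (r + 1) := subset_span ⟨i, n, w, hw, rfl⟩

theorem Gw_succ_ind (R : RD q M N A) (v : V) (r : ℕ) (S : Submodule ℂ V)
    (h : ∀ i n, ∀ w ∈ Gw R v r, R.xm i n • w ∈ S) : Gw R v (r + 1) ≤ S := by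
  refine span_le.2 ?_
  rintro x ⟨i, n, w, hw, rfl⟩
  exact h i n w hw

variable {R : RD q M N A} {v : V} {d : ℕ → ℕ}

theorem UP.hv (U : UP R v d) (i : ℕ) (s : ℤ) : R.h i s ∈ Sc v := by
  by_cases hi : vld M N i
  · exact R.h_mem U.hq _ i hi (fun n => U.fpv i n hi) (fun n => U.fmv i n hi) s
  · rw [R.h0 i s hi]; exact Subalgebra.zero_mem _

theorem UP.kv' (U : UP R v d) (i : ℕ) : R.k i ∈ Sc v := by
  by_cases hi : vld M N i
  · rw [← R.fp_zero]; exact U.fpv i 0 hi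
  · rw [R.k0 i hi]; exact Subalgebra.zero_mem _

theorem UP.kiv' (U : UP R v d) (i : ℕ) : R.ki i ∈ Sc v := by
  by_cases hi : vld M N i
  · rw [← R.fm_zero]; exact U.fmv i 0 hi
  · rw [R.ki0 i hi]; exact Subalgebra.zero_mem _

theorem UP.kG (U : UP R v d) (i r : ℕ) : R.k i ∈ (Stab (Gw R v r) : Subalgebra ℂ A) := by
  induction r with
  | zero =>
    obtain ⟨c, hc⟩ := U.kv' i
    intro w hw
    obtain ⟨e, rfl⟩ := mem_span_singleton.1 hw
    rw [asmul_comm, hc]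
    exact smul_mem _ _ (smul_mem _ _ (mem_span_singleton_self _))
  | succ r ih =>
    refine Gw_succ_ind R v r ((Gw R v (r + 1)).comap (act (R.k i))) fun j n w hw => ?_
    rw [mem_comap, act_apply, ← mul_smul, R.kxm, smul_assoc, mul_smul]
    exact smul_mem _ _ (Gw_succ R v r j n _ (ih w hw))

theorem UP.kiG (U : UP R v d) (i r : ℕ) : R.ki i ∈ (Stab (Gw R v r) : Subalgebra ℂ A) := by
  induction r with
  | zero =>
    obtain ⟨c, hc⟩ := U.kiv' i
    intro w hw
    obtain ⟨e, rfl⟩ := mem_span_singleton.1 hw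
    rw [asmul_comm, hc]
    exact smul_mem _ _ (smul_mem _ _ (mem_span_singleton_self _))
  | succ r ih =>
    refine Gw_succ_ind R v r ((Gw R v (r + 1)).comap (act (R.ki i))) fun j n w hw => ?_
    rw [mem_comap, act_apply, ← mul_smul, R.kixm U.hq, smul_assoc, mul_smul]
    exact smul_mem _ _ (Gw_succ R v r j n _ (ih w hw))

theorem UP.hG (U : UP R v d) (i : ℕ) (s : ℤ) (r : ℕ) :
    R.h i s ∈ (Stab (Gw R v r) : Subalgebra ℂ A) := by
  by_cases hi : vld M N i
  swap
  · rw [R.h0 i s hi]; exact Subalgebra.zero_mem _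
  induction r with
  | zero =>
    obtain ⟨c, hc⟩ := U.hv i s
    intro w hw
    obtain ⟨e, rfl⟩ := mem_span_singleton.1 hw
    rw [asmul_comm, hc]
    exact smul_mem _ _ (smul_mem _ _ (mem_span_singleton_self _))
  | succ r ih =>
    refine Gw_succ_ind R v r ((Gw R v (r + 1)).comap (act (R.h i s))) fun j n w hw => ?_
    rw [mem_comap, act_apply, ← mul_smul, sub_eq_iff_eq_add.1 (R.hxm i j s n hi), add_smul,
      neg_smul, mul_smul, smul_assoc]
    exact Submodule.add_mem _ (Submodule.neg_mem _ (smul_mem _ _ (Gw_succ R v r j _ _ hw)))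
      (Gw_succ R v r j n _ (ih w hw))

theorem UP.xpG (U : UP R v d) (i : ℕ) (n : ℤ) (r : ℕ) (w : V) (hw : w ∈ Gw R v (r + 1)) :
    R.xp i n • w ∈ Gw R v r := by
  induction r generalizing w with
  | zero =>
    revert w
    change Gw R v (0 + 1) ≤ (Gw R v 0).comap (act (R.xp i n))
    refine Gw_succ_ind R v 0 _ fun j m w hw => ?_
    rw [mem_comap, act_apply, ← mul_smul, R.comm]
    have h0 : R.xp i n • w = 0 := by
      obtain ⟨e, rfl⟩ := mem_span_singleton.1 hw
      rw [asmul_comm, U.xpv, smul_zero]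
    rw [add_smul, smul_assoc, mul_smul, h0, smul_zero, smul_zero, zero_add]
    split_ifs
    · exact R.Φ_mem _ i (U.kG i 0) (U.kiG i 0) (fun s => U.hG i s 0) _ w hw
    · rw [zero_smul]; exact Submodule.zero_mem _
  | succ r ih =>
    revert w
    change Gw R v (r + 1 + 1) ≤ (Gw R v (r + 1)).comap (act (R.xp i n))
    refine Gw_succ_ind R v _ _ fun j m w hw => ?_
    rw [mem_comap, act_apply, ← mul_smul, R.comm]
    rw [add_smul, smul_assoc, mul_smul]
    refine Submodule.add_mem _ (smul_mem _ _ (Gw_succ R v r _ _ _ (ih w hw))) ?_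
    split_ifs
    · exact R.Φ_mem _ i (U.kG i _) (U.kiG i _) (fun s => U.hG i s _) _ w hw
    · rw [zero_smul]; exact Submodule.zero_mem _

theorem UP.iSup_top (U : UP R v d) : ⨆ r, Gw R v r = ⊤ := by
  have hst : ∀ a : A, (∀ r, a ∈ (Stab (Gw R v r) : Subalgebra ℂ A)) →
      a ∈ (Stab (⨆ r, Gw R v r) : Subalgebra ℂ A) := by
    intro a ha
    rw [mem_Stab]
    change (⨆ r, Gw R v r) ≤ (⨆ r, Gw R v r).comap (act a)
    refine iSup_le fun r w hw => ?_
    exact (le_iSup (Gw R v) r) (ha r w hw)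
  refine U.gen _ ?_ ?_ ?_ ?_ ?_ ?_
  · exact (le_iSup (Gw R v) 0) (mem_span_singleton_self _)
  · intro i n
    change (⨆ r, Gw R v r) ≤ (⨆ r, Gw R v r).comap (act (R.xp i n))
    refine iSup_le fun r w hw => ?_
    cases r with
    | zero =>
      obtain ⟨e, rfl⟩ := mem_span_singleton.1 hw
      rw [mem_comap, act_apply, asmul_comm, U.xpv, smul_zero]
      exact Submodule.zero_mem _
    | succ r => exact (le_iSup (Gw R v) r) (U.xpG i n r w hw)
  · intro i n
    change (⨆ r, Gw R v r) ≤ (⨆ r, Gw R v r).comap (act (R.xm i n))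
    refine iSup_le fun r w hw => ?_
    exact (le_iSup (Gw R v) (r + 1)) (Gw_succ R v r i n w hw)
  · exact fun i => hst _ fun r => U.kG i r
  · exact fun i => hst _ fun r => U.kiG i r
  · exact fun i s => hst _ fun r => U.hG i s r

end
end

section
open Submodule Finset
variable {q : ℂ} {M N : ℕ} {A : Type} [Ring A] [Algebra ℂ A]
variable {V : Type} [AddCommGroup V] [Module ℂ V] [Module A V] [IsScalarTower ℂ A V]

/-- symbol calculus -/
inductive Sp (X : ℤ → A) (u : ℂ) (v : V) : ℕ → ℕ → V → ℂ → Prop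
  | base : Sp X u v 0 0 v 1
  | lift (j n n' : ℕ) (x : V) (c : ℂ) : Sp X u v j n x c → n < n' → Sp X u v j n' x 0
  | app (j n : ℕ) (x : V) (c : ℂ) (m : ℕ) : Sp X u v j n x c →
      Sp X u v (j + 1) (n + m) (X m • x) ((u ^ j) ^ m * c)
  | add (j n : ℕ) (x y : V) (c e : ℂ) : Sp X u v j n x c → Sp X u v j n y e →
      Sp X u v j n (x + y) (c + e)
  | smul (j n : ℕ) (x : V) (c e : ℂ) : Sp X u v j n x c → Sp X u v j n (e • x) (e * c)

theorem Sp.congr {X : ℤ → A} {u : ℂ} {v : V} {j n j' n' : ℕ} {x x' : V} {c c' : ℂ}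
    (h : Sp X u v j n x c) (hj : j = j') (hn : n = n') (hx : x = x') (hc : c = c') :
    Sp X u v j' n' x' c' := by
  subst hj hn hx hc; exact h

def aS (κ u : ℂ) (j : ℕ) : ℂ := κ * (u ^ j - 1) * (u ^ j - u) / (u ^ j * (u - 1))

def phS (κ u : ℂ) (j k : ℕ) : ℂ :=
  if k = 0 then κ * u ^ j else aS κ u (j + 1) * (u ^ j) ^ k - aS κ u j * (u ^ j * u⁻¹) ^ k

theorem phS_rec (κ u : ℂ) (hu : u ≠ 0) (hu1 : u ≠ 1) (j k : ℕ) :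
    phS κ u (j + 1) (k + 1) = u * phS κ u j (k + 1) + u * u ^ j * phS κ u (j + 1) k
      - u ^ j * phS κ u j k := by
  have h1 : u - 1 ≠ 0 := sub_ne_zero.2 hu1
  have hy : u ^ j ≠ 0 := pow_ne_zero _ hu
  unfold phS aS
  rcases k with _ | k
  · simp only [pow_succ, if_true, if_false, Nat.succ_ne_zero, zero_add, pow_zero, one_mul]
    generalize u ^ j = y at *
    field_simp
    ring
  · simp only [if_false, Nat.succ_ne_zero]
    simp only [pow_succ, mul_pow, inv_pow]
    generalize u ^ j = y at *
    have h2 : y ^ k ≠ 0 := pow_ne_zero _ hy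
    have h3 : u ^ k ≠ 0 := pow_ne_zero _ hu
    generalize y ^ k = z at *
    generalize u ^ k = w at *
    field_simp
    ring

theorem Sp.fp {R : RD q M N A} (hq : QOK q) {i : ℕ} {v : V} {u κ : ℂ}
    (hu : u = q ^ (-cc M i i)) (hu1 : u ≠ 1) (hk : R.k i • v = κ • v)
    (hf : ∀ n, R.fp i n ∈ (Sc v : Subalgebra ℂ A))
    {j n : ℕ} {x : V} {c : ℂ} (h : Sp (R.xm i) u v j n x c) (k : ℕ) :
    Sp (R.xm i) u v j (n + k) (R.fp i k • x) (phS κ u j k * c) := by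
  have hu0 : u ≠ 0 := by rw [hu]; exact zpow_ne_zero _ hq.ne0
  induction h generalizing k with
  | base =>
    rcases k with _ | k
    · rw [show ((0 : ℕ) : ℤ) = 0 from rfl, R.fp_zero, hk]
      refine (Sp.smul 0 0 v 1 κ Sp.base).congr rfl rfl rfl ?_
      simp [phS]
    · obtain ⟨e, he⟩ := hf (k + 1 : ℕ)
      rw [he]
      refine (Sp.lift 0 0 (0 + (k + 1)) _ _ (Sp.smul 0 0 v 1 e Sp.base) (by omega)).congr rfl rfl rfl ?_
      simp [phS, aS]
  | lift j n n' x c h hn ih =>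
    rw [mul_zero]
    exact Sp.lift j (n + k) (n' + k) _ _ (ih k) (by omega)
  | add j n x y c e h1 h2 ih1 ih2 =>
    rw [smul_add, mul_add]; exact Sp.add _ _ _ _ _ _ (ih1 k) (ih2 k)
  | smul j n x c e h ih =>
    rw [asmul_comm]
    exact (Sp.smul _ _ _ _ e (ih k)).congr rfl rfl rfl (by ring)
  | app j n x c m h ih =>
    induction k generalizing m with
    | zero =>
      rw [show ((0 : ℕ) : ℤ) = 0 from rfl, R.fp_zero, ← mul_smul, R.kxm, smul_assoc, mul_smul, ← hu]
      have := Sp.smul _ _ _ _ u (Sp.app _ _ _ _ m (ih 0))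
      rw [show ((0 : ℕ) : ℤ) = 0 from rfl, R.fp_zero] at this
      refine this.congr rfl rfl rfl ?_
      simp [phS, pow_succ]; ring
    | succ k ihk =>
      have h1 := R.fp_xm hq i i k m
      rw [← hu, sub_eq_iff_eq_add] at h1
      have h2 : R.fp i (k + 1 : ℕ) • R.xm i m • x =
          u • (R.xm i m • (R.fp i (k + 1 : ℕ) • x)) + (u • (R.fp i k • R.xm i (m + 1 : ℕ) • x)
            + (-1 : ℂ) • (R.xm i (m + 1 : ℕ) • R.fp i k • x)) := by
        simp only [← mul_smul, ← smul_assoc, ← add_smul]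
        push_cast
        rw [h1]; congr 1
        module
      rw [h2]
      refine (Sp.add _ _ _ _ _ _
        ((Sp.smul _ _ _ _ u (Sp.app _ _ _ _ m (ih (k + 1)))).congr rfl
          (show _ = n + m + (k + 1) by omega) rfl rfl)
        (Sp.add _ _ _ _ _ _ ((Sp.smul _ _ _ _ u (ihk (m + 1))).congr rfl (by omega) rfl rfl)
        ((Sp.smul _ _ _ _ (-1) (Sp.app _ _ _ _ (m + 1) (ih k))).congr rfl (by omega) rfl rfl))).congr
        rfl rfl rfl ?_
      rw [phS_rec κ u hu0 hu1]
      rw [pow_succ (u ^ j) m]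
      ring

theorem Sp.xp {R : RD q M N A} (hq : QOK q) {i : ℕ} (hiM : i ≠ M) {v : V} {u κ : ℂ}
    (hu : u = q ^ (-cc M i i)) (hu1 : u ≠ 1) (hk : R.k i • v = κ • v)
    (hf : ∀ n, R.fp i n ∈ (Sc v : Subalgebra ℂ A)) (hv : ∀ n, R.xp i n • v = 0) (l : ℕ) (hl : 1 ≤ l)
    {j n : ℕ} {x : V} {c : ℂ} (h : Sp (R.xm i) u v j n x c) :
    (j = 0 → R.xp i l • x = 0) ∧ (∀ j', j = j' + 1 →
      Sp (R.xm i) u v j' (n + l) (R.xp i l • x) (aS κ u j * (u ^ j') ^ l * (tq q M i)⁻¹ * c)) := by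
  have hu0 : u ≠ 0 := by rw [hu]; exact zpow_ne_zero _ hq.ne0
  induction h with
  | base => exact ⟨fun _ => hv _, fun j' h => by omega⟩
  | lift j n n' x c h hn ih =>
    refine ⟨ih.1, fun j' hj => ?_⟩
    rw [mul_zero]
    exact Sp.lift j' (n + l) (n' + l) _ _ (ih.2 j' hj) (by omega)
  | add j n x y c e h1 h2 ih1 ih2 =>
    refine ⟨fun h => by rw [smul_add, ih1.1 h, ih2.1 h, add_zero], fun j' hj => ?_⟩
    rw [smul_add, mul_add]; exact Sp.add _ _ _ _ _ _ (ih1.2 j' hj) (ih2.2 j' hj)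
  | smul j n x c e h ih =>
    refine ⟨fun h => by rw [asmul_comm, ih.1 h, smul_zero], fun j' hj => ?_⟩
    rw [asmul_comm]
    exact (Sp.smul _ _ _ _ e (ih.2 j' hj)).congr rfl rfl rfl (by ring)
  | app j n x c m h ih =>
    refine ⟨fun h => by omega, fun j' hj => ?_⟩
    obtain rfl : j = j' := by omega
    have h1 : R.xp i l • R.xm i m • x = R.xm i m • R.xp i l • x +
        (tq q M i)⁻¹ • (R.fp i (l + m : ℕ) • x) := by
      rw [← mul_smul, R.comm, sgn_ne M i i (Or.inl hiM), if_pos rfl, one_smul, add_smul, mul_smul]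
      congr 1
      unfold RD.Φ
      rw [R.fm_pos i _ (by omega), sub_zero, smul_assoc]
      push_cast; rfl
    rw [h1]
    have hF := Sp.smul _ _ _ _ (tq q M i)⁻¹ (Sp.fp hq hu hu1 hk hf h (l + m))
    rcases j with _ | j
    · rw [ih.1 rfl, smul_zero, zero_add]
      refine hF.congr rfl (by omega) rfl ?_
      simp [phS, aS, show ¬ (l = 0 ∧ m = 0) by omega]
    · refine (Sp.add _ _ _ _ _ _ ((Sp.app _ _ _ _ m (ih.2 j rfl)).congr rfl
        (show _ = n + m + l by omega) rfl rfl) (hF.congr rfl (by omega) rfl rfl)).congr rfl rfl rfl ?_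
      have : phS κ u (j + 1) (l + m) = aS κ u (j + 2) * (u ^ (j + 1)) ^ (l + m) -
          aS κ u (j + 1) * (u ^ j) ^ (l + m) := by
        unfold phS
        rw [if_neg (by omega), pow_succ u j, mul_assoc (u ^ j), mul_inv_cancel₀ hu0, mul_one]
      rw [this, pow_add, pow_add]
      ring

theorem Sp.zero_dec {X : ℤ → A} {u : ℂ} {v : V} {j n : ℕ} {x : V} {c : ℂ}
    (h : Sp X u v j n x c) (hj : j = 0) : ∃ a : ℂ, x = a • v ∧ c = if n = 0 then a else 0 := by
  induction h with
  | base => exact ⟨1, by simp, by simp⟩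
  | lift j n n' x c h hn ih =>
    obtain ⟨a, ha, _⟩ := ih hj
    exact ⟨a, ha, by rw [if_neg (by omega)]⟩
  | add j n x y c e h1 h2 ih1 ih2 =>
    obtain ⟨a, rfl, ha⟩ := ih1 hj
    obtain ⟨b, rfl, hb⟩ := ih2 hj
    refine ⟨a + b, by rw [add_smul], ?_⟩
    rw [ha, hb]; split_ifs <;> simp
  | smul j n x c e h ih =>
    obtain ⟨a, rfl, ha⟩ := ih hj
    refine ⟨e * a, by rw [mul_smul], ?_⟩
    rw [ha]; split_ifs <;> simp
  | app j n x c m h ih => omega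

theorem Sp.one_dec {X : ℤ → A} {u : ℂ} {v : V} {j n : ℕ} {x : V} {c : ℂ}
    (h : Sp X u v j n x c) (hj : j = 1) : ∃ b : ℕ → ℂ, (∀ m, n < m → b m = 0) ∧ b n = c ∧
      x = ∑ m ∈ range (n + 1), b m • X m • v := by
  induction h with
  | base => omega
  | lift j n n' x c h hn ih =>
    obtain ⟨b, hb, hb2, hx⟩ := ih hj
    refine ⟨b, fun m hm => hb m (by omega), hb n' hn, ?_⟩
    rw [hx]
    refine sum_subset (range_mono (by omega)) fun m _ hm => ?_
    rw [hb m (by simpa using hm), zero_smul]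
  | add j n x y c e h1 h2 ih1 ih2 =>
    obtain ⟨a, ha, ha2, rfl⟩ := ih1 hj
    obtain ⟨b, hb, hb2, rfl⟩ := ih2 hj
    refine ⟨a + b, fun m hm => by simp [ha m hm, hb m hm], by simp [ha2, hb2], ?_⟩
    simp [add_smul, sum_add_distrib]
  | smul j n x c e h ih =>
    obtain ⟨a, ha, ha2, rfl⟩ := ih hj
    refine ⟨e • a, fun m hm => by simp [ha m hm], by simp [ha2], ?_⟩
    simp [mul_smul, Finset.smul_sum]
  | app j n x c m h ih =>
    obtain ⟨a, rfl, rfl⟩ := h.zero_dec (by omega)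
    refine ⟨fun r => if r = m then a else 0, fun r hr => if_neg (by omega), ?_, ?_⟩
    · obtain rfl : j = 0 := by omega
      simp
    · simp only [ite_smul, zero_smul]
      rw [sum_ite_eq', if_pos (by simp), asmul_comm]

variable {R : RD q M N A} {v : V} {d : ℕ → ℕ}

theorem shift_rel (R : RD q M N A) (hq : QOK q) (v : V) (i j : ℕ) (hi : vld M N i)
    (hc : cc M i j ≠ 0) (hh : ∀ s, R.h i s ∈ (Sc v : Subalgebra ℂ A)) (D : ℕ) (b : ℕ → ℂ)
    (h0 : ∑ m ∈ range (D + 1), b m • R.xm j m • v = 0) (n : ℤ) :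
    ∑ m ∈ range (D + 1), b m • R.xm j (n + m) • v = 0 := by
  rcases eq_or_ne n 0 with rfl | hn
  · simpa using h0
  obtain ⟨c, hc'⟩ := hh n
  have h1 := congrArg (act (R.h i n)) h0
  rw [map_sum, map_zero] at h1
  have h2 : ∀ m : ℕ, act (R.h i n) (b m • R.xm j m • v) =
      c • (b m • R.xm j m • v) - hco q M i j n • (b m • R.xm j (n + m) • v) := by
    intro m
    have h3 := sub_eq_iff_eq_add.1 (R.hxm i j n m hi)
    rw [map_smul, act_apply, ← mul_smul, h3, add_smul, mul_smul, hc', asmul_comm, neg_smul,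
      smul_assoc, add_comm (m : ℤ)]
    generalize R.xm j (n + m) • v = x
    generalize R.xm j m • v = y
    module
  simp only [h2, sum_sub_distrib, ← Finset.smul_sum, h0, smul_zero, zero_sub] at h1
  rw [neg_eq_zero] at h1
  exact (smul_eq_zero.1 h1).resolve_left (hco_ne hq M i j n hn hc)

theorem UP.evenFG (U : UP R v d) (i : ℕ) (hiM : i ≠ M) (hi : vld M N i) :
    ∃ F : Submodule ℂ V, F.FG ∧ ∀ n, R.xm i n • v ∈ F := by
  have hq := U.hq
  set u := q ^ (-cc M i i) with hu
  have hcc : cc M i i ≠ 0 := by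
    rw [cc_self_even M i hiM]; rcases lof_or M i with h | h <;> rw [h] <;> norm_num
  have hun : ∀ j : ℕ, j ≠ 0 → u ^ j ≠ 1 := by
    intro j hj
    rw [hu, ← zpow_natCast, ← zpow_mul]
    exact hq.zpow_ne _ (mul_ne_zero (neg_ne_zero.2 hcc) (by exact_mod_cast hj))
  have hu1 : u ≠ 1 := by simpa using hun 1 (by norm_num)
  have hu0 : u ≠ 0 := zpow_ne_zero _ hq.ne0
  set κ := qpar q M i ^ d i with hκ
  have hκ0 : κ ≠ 0 := pow_ne_zero _ (hq.qpar M i).ne0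
  have hk := U.kv i hiM hi
  have hf := fun n => U.fpv i n hi
  have st : ∀ r : ℕ, Sp (R.xm i) u v r 0 (R.xm i 0 ^ r • v) 1 := by
    intro r
    induction r with
    | zero => simpa using Sp.base
    | succ r ih =>
      refine (Sp.app r 0 _ _ 0 ih).congr rfl rfl ?_ (by simp)
      rw [pow_succ', mul_smul]; rfl
  have go : ∀ r : ℕ, r ≤ d i → ∃ c : ℂ, c ≠ 0 ∧ Sp (R.xm i) u v (d i + 1 - r) r 0 c := by
    intro r
    induction r with
    | zero =>
      intro _
      refine ⟨1, one_ne_zero, ?_⟩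
      have := st (d i + 1)
      rw [U.even i hiM hi] at this
      exact this
    | succ r ih =>
      intro hr
      obtain ⟨c, hc, h⟩ := ih (by omega)
      have h1 := (Sp.xp hq hiM hu hu1 hk hf (U.xpv i) 1 le_rfl h).2 (d i + 1 - (r + 1)) (by omega)
      rw [smul_zero] at h1
      refine ⟨_, ?_, h1⟩
      obtain ⟨e, he⟩ : ∃ e, d i + 1 - r = e + 2 := ⟨d i - 1 - r, by omega⟩
      rw [he]
      refine mul_ne_zero (mul_ne_zero (mul_ne_zero ?_ (pow_ne_zero _ (pow_ne_zero _ hu0)))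
        (inv_ne_zero (hq.tq_ne M i))) hc
      unfold aS
      refine div_ne_zero (mul_ne_zero (mul_ne_zero hκ0 (sub_ne_zero.2 (hun _ (by omega)))) ?_)
        (mul_ne_zero (pow_ne_zero _ hu0) (sub_ne_zero.2 hu1))
      rw [show e + 2 = (e + 1) + 1 by omega, pow_succ]
      intro h
      apply hun (e + 1) (by omega)
      have : (u ^ (e + 1) - 1) * u = 0 := by rw [← h]; ring
      exact sub_eq_zero.1 ((mul_eq_zero.1 this).resolve_right hu0)
  obtain ⟨c, hc, h⟩ := go (d i) le_rfl
  obtain ⟨b, -, hbc, hx⟩ := h.one_dec (by omega)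
  refine fg_rec ⊥ fg_bot (d i) b ⟨d i, le_rfl, by rwa [hbc]⟩ (fun n => R.xm i n • v) ?_
  intro n
  rw [mem_bot]
  exact shift_rel R hq v i i hi hcc (U.hv i) (d i) b hx.symm n

theorem UP.oddFG (U : UP R v d) :
    ∃ F : Submodule ℂ V, F.FG ∧ ∀ n, R.xm M n • v ∈ F := by
  obtain ⟨D, b, hb, h⟩ := U.odd
  refine fg_rec ⊥ fg_bot D b ⟨D, le_rfl, hb⟩ (fun n => R.xm M n • v) ?_
  intro n
  rw [mem_bot]; exact h n

theorem UP.oneFG (U : UP R v d) (i : ℕ) :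
    ∃ F : Submodule ℂ V, F.FG ∧ ∀ n, R.xm i n • v ∈ F := by
  by_cases hi : vld M N i
  · rcases eq_or_ne i M with rfl | h
    · exact U.oddFG
    · exact U.evenFG i h hi
  · exact ⟨⊥, fg_bot, fun n => by rw [R.xm0 i n hi, zero_smul]; exact Submodule.zero_mem _⟩

end

section
open Submodule
variable {q : ℂ} {M N : ℕ} {A : Type} [Ring A] [Algebra ℂ A]
variable {V : Type} [AddCommGroup V] [Module ℂ V] [Module A V] [IsScalarTower ℂ A V]
variable {R : RD q M N A} {v : V} {d : ℕ → ℕ}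

theorem pairFG_fix (hq : QOK q) (s2 : SR2 q⁻¹ M R.xm) (i j : ℕ) (w : V) (F : Submodule ℂ V)
    (hF : F.FG) (hi : ∀ n, R.xm i n • w ∈ F) (hj : ∀ n, R.xm j n • w ∈ F) (m : ℤ) :
    ∃ F' : Submodule ℂ V, F'.FG ∧ ∀ n, R.xm i n • R.xm j m • w ∈ F' := by
  by_cases hc : cc M i j = 0
  · refine ⟨F.map (act (R.xm j m)), hF.map _, fun n => ?_⟩
    have := s2.r4 i j n m hc
    rw [sub_eq_zero] at this
    rw [← mul_smul, this, smul_assoc, mul_smul]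
    exact smul_mem _ _ (mem_map_of_mem (hi n))
  · set ω := q⁻¹ ^ cc M i j with hω
    have hω0 : ω ≠ 0 := zpow_ne_zero _ hq.inv.ne0
    obtain ⟨D, b, hb, hsum⟩ := fg_dep F hF (fun s => R.xm j (m + s) • w) (fun s => hj _)
    set B : Submodule ℂ V := ⨆ t : Fin (D + 2), F.map (act (R.xm j (m + (t : ℕ)))) with hB
    have hBF : B.FG := fg_iSup _ fun t => hF.map _
    have hBm : ∀ t : ℕ, t ≤ D + 1 → ∀ x ∈ F, R.xm j (m + t) • x ∈ B := by
      intro t ht x hx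
      exact (le_iSup (fun t : Fin (D + 2) => F.map (act (R.xm j (m + (t : ℕ))))) ⟨t, by omega⟩)
        (mem_map_of_mem (f := act (R.xm j (m + t))) hx)
    have step : ∀ s : ℕ, s ≤ D → ∀ n : ℤ, R.xm i n • R.xm j (m + s) • w -
        (ω⁻¹) ^ s • R.xm i (n + s) • R.xm j m • w ∈ B := by
      intro s
      induction s with
      | zero => intro _ n; simp
      | succ s ih =>
        intro hs n
        have h1 := s2.r5 i j n (m + s) hc
        rw [← hω] at h1
        have h2 : R.xm i n • R.xm j (m + (s + 1 : ℕ)) • w = ω⁻¹ • R.xm i (n + 1) • R.xm j (m + s) • w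
            - R.xm j (m + s) • R.xm i (n + 1) • w
            + ω⁻¹ • R.xm j (m + (s + 1 : ℕ)) • R.xm i n • w := by
          have h3 := congrArg (fun a => ω⁻¹ • (a • w)) h1
          simp only [sub_smul, smul_sub, smul_assoc, mul_smul, inv_smul_smul₀ hω0] at h3
          push_cast
          rw [← add_assoc]
          rw [h3]; abel
        rw [h2]
        have h4 := ih (by omega) (n + 1)
        have h5 := B.smul_mem ω⁻¹ h4
        have h6 : (ω⁻¹ ^ (s + 1) • R.xm i (n + (s + 1 : ℕ)) • R.xm j m • w) =
           ω⁻¹ • (ω⁻¹ ^ s • R.xm i (n + 1 + s) • R.xm j m • w) := by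
          rw [pow_succ', mul_smul, show n + ((s + 1 : ℕ) : ℤ) = n + 1 + s by push_cast; ring]
        rw [h6]
        have h7 := B.sub_mem h5 (hBm s (by omega) _ (hi (n + 1)))
        have h8 := B.add_mem h7 (B.smul_mem ω⁻¹ (hBm (s + 1) (by omega) _ (hi n)))
        convert h8 using 1
        rw [smul_sub]; abel
    refine fg_rec B hBF D (fun s => b s * (ω⁻¹) ^ s) ?_ (fun n => R.xm i n • R.xm j m • w) ?_
    · obtain ⟨s, hs, hbs⟩ := hb
      exact ⟨s, hs, mul_ne_zero hbs (pow_ne_zero _ (inv_ne_zero hω0))⟩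
    · intro n
      have h1 := congrArg (act (R.xm i n)) hsum
      rw [map_sum, map_zero] at h1
      have h2 : ∑ s ∈ Finset.range (D + 1), b s • (R.xm i n • R.xm j (m + s) • w -
        (ω⁻¹) ^ s • R.xm i (n + s) • R.xm j m • w) ∈ B :=
        B.sum_mem fun s hs => B.smul_mem _ (step s (by
          have := Finset.mem_range.1 hs; omega) n)
      simp only [smul_sub, Finset.sum_sub_distrib] at h2
      simp only [map_smul, act_apply] at h1
      rw [h1, zero_sub] at h2
      simpa only [mul_smul] using neg_mem_iff.1 h2

theorem pairFG (hq : QOK q) (s2 : SR2 q⁻¹ M R.xm) (i j : ℕ) (w : V) (F : Submodule ℂ V)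
    (hF : F.FG) (hi : ∀ n, R.xm i n • w ∈ F) (hj : ∀ n, R.xm j n • w ∈ F) :
    ∃ F' : Submodule ℂ V, F'.FG ∧ ∀ n m, R.xm i n • R.xm j m • w ∈ F' := by
  have h1 : (span ℂ (Set.range fun m => R.xm j m • w)).FG :=
    fg_of_le hF (span_le.2 (by rintro _ ⟨m, rfl⟩; exact hj m))
  obtain ⟨T, hT, hT2⟩ := (fg_span_iff_fg_span_finset_subset _).1 h1
  choose G hG hGm using pairFG_fix hq s2 i j w F hF hi hj
  have hch : ∀ t : T, ∃ m, R.xm j m • w = t := fun t => hT t.2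
  choose c hc using hch
  refine ⟨⨆ t : T, G (c t), fg_iSup _ fun t => hG _, fun n m => ?_⟩
  have h2 : R.xm j m • w ∈ span ℂ (T : Set V) := by
    rw [← hT2]; exact subset_span ⟨m, rfl⟩
  have h3 : span ℂ (T : Set V) ≤ (⨆ t : T, G (c t)).comap (act (R.xm i n)) := by
    refine span_le.2 fun t ht => ?_
    have := hGm (c ⟨t, ht⟩) n
    rw [hc] at this
    exact (le_iSup (fun t : T => G (c t)) ⟨t, ht⟩) this
  exact h3 h2

theorem UP.GwFG (U : UP R v d) (r : ℕ) : (Gw R v r).FG ∧ (Gw R v (r + 1)).FG := by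
  induction r with
  | zero =>
    refine ⟨⟨{v}, by simp [Gw]⟩, ?_⟩
    choose F hF hFm using U.oneFG
    refine fg_of_le (fg_iSup (fun i : Fin (M + N) => F i) fun i => hF i) ?_
    refine Gw_succ_ind R v 0 _ fun i n w hw => ?_
    obtain ⟨e, rfl⟩ := mem_span_singleton.1 hw
    by_cases hi : vld M N i
    · rw [asmul_comm]
      exact smul_mem _ _ ((le_iSup (fun i : Fin (M + N) => F i) ⟨i, by omega⟩) (hFm i n))
    · rw [R.xm0 i n hi, zero_smul]; exact Submodule.zero_mem _
  | succ r ih =>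
    refine ⟨ih.2, ?_⟩
    obtain ⟨T, hT⟩ := ih.1
    have hTm : ∀ t : T, (t : V) ∈ Gw R v r := fun t => by
      rw [← hT]; exact subset_span t.2
    have hch := fun (i j : Fin (M + N)) (t : T) => pairFG U.hq U.s2 i j (t : V) (Gw R v (r + 1)) ih.2
      (fun n => Gw_succ R v r _ n _ (hTm t)) (fun n => Gw_succ R v r _ n _ (hTm t))
    choose F hF hFm using hch
    set G : Submodule ℂ V := ⨆ i, ⨆ j, ⨆ t, F i j t with hG
    have hGF : G.FG := fg_iSup _ fun i => fg_iSup _ fun j =>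
      fg_iSup _ fun t => hF i j t
    refine fg_of_le hGF ?_
    refine Gw_succ_ind R v (r + 1) _ fun i n w hw => ?_
    by_cases hi : vld M N i
    swap
    · rw [R.xm0 i n hi, zero_smul]; exact Submodule.zero_mem _
    revert w
    change Gw R v (r + 1) ≤ G.comap (act (R.xm i n))
    refine Gw_succ_ind R v r _ fun j m w hw => ?_
    by_cases hj : vld M N j
    swap
    · rw [R.xm0 j m hj, zero_smul]; exact Submodule.zero_mem _
    revert w
    change Gw R v r ≤ (G.comap (act (R.xm i n))).comap (act (R.xm j m))
    rw [← hT]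
    refine span_le.2 fun t ht => ?_
    have h1 := hFm ⟨i, by omega⟩ ⟨j, by omega⟩ ⟨t, ht⟩ n m
    have h2 : F ⟨i, by omega⟩ ⟨j, by omega⟩ ⟨t, ht⟩ ≤ G :=
      le_iSup_of_le ⟨i, by omega⟩ (le_iSup_of_le ⟨j, by omega⟩ (le_iSup_of_le ⟨t, ht⟩ le_rfl))
    exact h2 h1

end

section
open List
variable {A : Type} [Ring A] [Algebra ℂ A]

/-- the span of words of a given shape -/
def Sh (U : ℕ → Submodule ℂ A) (I : List ℕ) : Submodule ℂ A := (I.map U).prod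

theorem Sh_nil (U : ℕ → Submodule ℂ A) : Sh U [] = 1 := rfl
theorem Sh_cons (U : ℕ → Submodule ℂ A) (i : ℕ) (I : List ℕ) : Sh U (i :: I) = U i * Sh U I := by
  simp [Sh]
theorem Sh_append (U : ℕ → Submodule ℂ A) (I J : List ℕ) : Sh U (I ++ J) = Sh U I * Sh U J := by
  simp [Sh]

def Red (U : ℕ → Submodule ℂ A) (I : List ℕ) (P : List ℕ → Prop) : Prop :=
  Sh U I ≤ ⨆ K : {K : List ℕ // K.Perm I ∧ P K}, Sh U K.1

variable {U : ℕ → Submodule ℂ A}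

theorem Red.of {I : List ℕ} {P : List ℕ → Prop} (h : P I) : Red U I P :=
  le_iSup (fun K : {K : List ℕ // K.Perm I ∧ P K} => Sh U K.1) ⟨I, List.Perm.refl _, h⟩

theorem Red.bind {I : List ℕ} {P Q : List ℕ → Prop} (h : Red U I P)
    (h' : ∀ K : List ℕ, K.Perm I → P K → Red U K Q) : Red U I Q := by
  refine h.trans (iSup_le fun K => (h' K.1 K.2.1 K.2.2).trans (iSup_le fun L => ?_))
  exact le_iSup (fun K : {K : List ℕ // K.Perm I ∧ Q K} => Sh U K.1)
    ⟨L.1, L.2.1.trans K.2.1, L.2.2⟩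

theorem Red.mono {I : List ℕ} {P Q : List ℕ → Prop} (h : Red U I P)
    (h' : ∀ K : List ℕ, K.Perm I → P K → Q K) : Red U I Q :=
  h.bind fun K hK hP => Red.of (h' K hK hP)

theorem Red.ctx {I : List ℕ} {P : List ℕ → Prop} (h : Red U I P) (a b : List ℕ) :
    Red U (a ++ I ++ b) (fun K => ∃ K', K'.Perm I ∧ P K' ∧ K = a ++ K' ++ b) := by
  unfold Red
  rw [Sh_append, Sh_append]
  refine (mul_le_mul' (mul_le_mul' le_rfl h) le_rfl).trans ?_
  rw [Submodule.mul_iSup, Submodule.iSup_mul]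
  refine iSup_le fun K => ?_
  rw [← Sh_append, ← Sh_append]
  exact le_iSup (fun K : {K : List ℕ // K.Perm (a ++ I ++ b) ∧
      ∃ K', K'.Perm I ∧ P K' ∧ K = a ++ K' ++ b} => Sh U K.1)
    ⟨a ++ K.1 ++ b, (K.2.1.append_left a).append_right b, K.1, K.2.1, K.2.2, rfl⟩

theorem Red.ctx_bind {I : List ℕ} {P Q : List ℕ → Prop} (h : Red U I P) (a b : List ℕ)
    (h' : ∀ K : List ℕ, K.Perm I → P K → Red U (a ++ K ++ b) Q) : Red U (a ++ I ++ b) Q :=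
  (h.ctx a b).bind fun K _ hP => by
    obtain ⟨K', hK', hP', rfl⟩ := hP
    exact h' K' hK' hP'

theorem Red.sh_eq {I I' : List ℕ} {P : List ℕ → Prop} (h : Red U I' P) (hp : I'.Perm I)
    (he : Sh U I = Sh U I') : Red U I P := by
  unfold Red at *
  rw [he]
  refine h.trans (iSup_le fun L => ?_)
  exact le_iSup (fun K : {K : List ℕ // K.Perm I ∧ P K} => Sh U K.1) ⟨L.1, L.2.1.trans hp, L.2.2⟩

theorem Red.bot {I : List ℕ} {P : List ℕ → Prop} (h : Sh U I = ⊥) : Red U I P := by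
  unfold Red; rw [h]; exact bot_le

theorem Sh_bot {I : List ℕ} {i : ℕ} (hi : i ∈ I) (h : U i = ⊥) : Sh U I = ⊥ := by
  obtain ⟨a, b, rfl⟩ := List.append_of_mem hi
  rw [Sh_append, Sh_cons, h, Submodule.bot_mul, Submodule.mul_bot]

/-- suffix predicate -/
def suf (i e : ℕ) (K : List ℕ) : Prop :=
  ∃ J J', K = J ++ J' ∧ (∀ x ∈ J', i ≤ x) ∧ e ≤ J'.count i

def brk (a : ℕ) (K : List ℕ) : Prop := ∃ J κ, K = J ++ a :: κ ∧ a + 1 ∈ κ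

structure SU (U : ℕ → Submodule ℂ A) (T : ℕ) : Prop where
  top : ∀ i, T ≤ i → U i = ⊥
  comm : ∀ i j, i + 2 ≤ j → U i * U j = U j * U i
  three : ∀ i, Red U [i + 1, i + 1, i] (brk i)
  four : ∀ i, Red U [i + 1, i + 2, i + 1, i] (brk i)

variable {T : ℕ}

theorem SU.move (h : SU U T) (a : ℕ) (γ : List ℕ) (hγ : ∀ x ∈ γ, a + 2 ≤ x) :
    Sh U (γ ++ [a]) = Sh U (a :: γ) := by
  induction γ with
  | nil => rfl
  | cons x γ ih =>
    rw [cons_append, Sh_cons, ih (fun y hy => hγ y (by simp [hy])), Sh_cons, Sh_cons, Sh_cons,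
      ← mul_assoc, ← mul_assoc, h.comm a x (hγ x (by simp))]

theorem perm_move (a : ℕ) (γ : List ℕ) : (a :: γ).Perm (γ ++ [a]) := by
  simpa using (perm_append_comm (l₁ := [a]) (l₂ := γ))

theorem suf.app {i e e' : ℕ} {K γ : List ℕ} (h : suf i e K) (hγ : ∀ x ∈ γ, i ≤ x)
    (he : e' ≤ e + γ.count i) : suf i e' (K ++ γ) := by
  obtain ⟨J, J', rfl, h1, h2⟩ := h
  refine ⟨J, J' ++ γ, by simp, ?_, ?_⟩
  · intro x hx; rcases mem_append.1 hx with h | h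
    · exact h1 x h
    · exact hγ x h
  · rw [count_append]; omega

theorem suf.pre {i e : ℕ} {K a : List ℕ} (h : suf i e K) : suf i e (a ++ K) := by
  obtain ⟨J, J', rfl, h1, h2⟩ := h
  exact ⟨a ++ J, J', by simp, h1, h2⟩

/-- last occurrence decomposition -/
theorem last_occ (i : ℕ) (w : List ℕ) (h : i ∈ w) : ∃ a b, w = a ++ i :: b ∧ i ∉ b := by
  induction w with
  | nil => simp at h
  | cons x w ih =>
    by_cases hw : i ∈ w
    · obtain ⟨a, b, rfl, hb⟩ := ih hw
      exact ⟨x :: a, b, rfl, hb⟩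
    · have : i = x := by simpa [hw] using h
      exact ⟨[], w, by simp [this], hw⟩

def Claim (U : ℕ → Submodule ℂ A) (a : ℕ) : Prop :=
  ∀ I : List ℕ, Red U I (suf (a + 1) (I.count (a + 1) - I.count a))

theorem count_zero_of {x i : ℕ} {L : List ℕ} (h : ∀ y ∈ L, i ≤ y) (hx : x < i) : L.count x = 0 := by
  rw [count_eq_zero]; intro hm; have := h x hm; omega

theorem SU.lemB_fin (a c : ℕ)
    (ih : ∀ c' < c, ∀ w : List ℕ, (∀ x ∈ w, a + 1 ≤ x) → w.count (a + 1) = c' →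
      Red U (w ++ [a]) (suf (a + 1) (c' - 1)))
    (w X γ : List ℕ) (hw : ∀ x ∈ w, a + 1 ≤ x) (hγ : ∀ x ∈ γ, a + 1 ≤ x)
    (hX : Red U X (brk a)) (hXa : ∀ x ∈ X, a ≤ x) (hXc : X.count a = 1) (hXi : X.count (a + 1) = 2)
    (hc : w.count (a + 1) + 2 = c) :
    Red U (w ++ X ++ γ) (suf (a + 1) (c - 1)) := by
  refine hX.ctx_bind w γ fun K hK hb => ?_
  obtain ⟨J, κ, rfl, hκ⟩ := hb
  have h1 : (J ++ a :: κ).count a = 1 := by rw [hK.count_eq, hXc]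
  have h2 : (J ++ a :: κ).count (a + 1) = 2 := by rw [hK.count_eq, hXi]
  have h3 : ∀ x ∈ J ++ a :: κ, a ≤ x := fun x hx => hXa x (hK.mem_iff.1 hx)
  have hκ' : 1 ≤ κ.count (a + 1) := List.one_le_count_iff.2 hκ
  simp only [count_append, List.count_cons_self] at h1
  simp [count_append] at h2
  have hJ0 : a ∉ J := count_eq_zero.1 (by omega)
  have hκ0 : a ∉ κ := count_eq_zero.1 (by omega)
  have hJ : ∀ x ∈ J, a + 1 ≤ x := fun x hx => by
    have := h3 x (by simp [hx])
    have : x ≠ a := fun h => hJ0 (h ▸ hx)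
    omega
  have hκ2 : ∀ x ∈ κ, a + 1 ≤ x := fun x hx => by
    have := h3 x (by simp [hx])
    have : x ≠ a := fun h => hκ0 (h ▸ hx)
    omega
  have h4 := ih (w.count (a + 1) + J.count (a + 1)) (by omega) (w ++ J) (by
    intro x hx
    rcases mem_append.1 hx with h | h
    · exact hw x h
    · exact hJ x h) (by rw [count_append])
  have h5 := h4.ctx_bind [] (κ ++ γ) (Q := suf (a + 1) (c - 1)) fun K _ hs => by
    refine Red.of ?_
    rw [nil_append]
    refine hs.app ?_ ?_
    · intro x hx
      rcases mem_append.1 hx with h | h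
      · exact hκ2 x h
      · exact hγ x h
    · rw [count_append]; omega
  simpa using h5

theorem SU.lemB (h : SU U T) (a : ℕ) (hC : Claim U (a + 1)) (c : ℕ) :
    ∀ w : List ℕ, (∀ x ∈ w, a + 1 ≤ x) → w.count (a + 1) = c →
      Red U (w ++ [a]) (suf (a + 1) (c - 1)) := by
  induction c using Nat.strong_induction_on with
  | _ c ih =>
    intro w hw hc
    by_cases hc1 : c ≤ 1
    · exact Red.of ⟨w ++ [a], [], by simp, by simp, by omega⟩
    obtain ⟨w1, γ, rfl, hγ⟩ := last_occ (a + 1) w (count_pos_iff.1 (by omega))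
    simp [count_append] at hc
    rw [count_eq_zero.2 hγ] at hc
    obtain ⟨w2, γ', rfl, hγ'⟩ := last_occ (a + 1) w1 (count_pos_iff.1 (by omega))
    simp [count_append] at hc
    rw [count_eq_zero.2 hγ'] at hc
    have lw2 : ∀ x ∈ w2, a + 1 ≤ x := fun x hx => hw x (by simp [hx])
    have lγ : ∀ x ∈ γ, a + 2 ≤ x := fun x hx => by
      have := hw x (by simp [hx])
      have : x ≠ a + 1 := fun h => hγ (h ▸ hx)
      omega
    have lγ' : ∀ x ∈ γ', a + 2 ≤ x := fun x hx => by
      have := hw x (by simp [hx])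
      have : x ≠ a + 1 := fun h => hγ' (h ▸ hx)
      omega
    -- apply the claim for the next index
    have s1 := (hC (γ' ++ [a + 1])).ctx_bind (w2 ++ [a + 1]) (γ ++ [a]) (Q := suf (a + 1) (c - 1))
    have e1 : w2 ++ (a + 1) :: γ' ++ (a + 1) :: γ ++ [a] =
      w2 ++ [a + 1] ++ (γ' ++ [a + 1]) ++ (γ ++ [a]) := by simp
    rw [e1]
    refine s1 fun K hK hs => ?_
    obtain ⟨J, J', rfl, lJ', hJ'⟩ := hs
    have cK : ∀ x, J.count x + J'.count x = (γ' ++ [a + 1]).count x := fun x => by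
      rw [← hK.count_eq, count_append]
    have c1 := cK (a + 1)
    have c2 := cK (a + 1 + 1)
    rw [count_zero_of lJ' (by omega), count_append, count_zero_of (i := a + 2) lγ' (by omega)] at c1
    simp [count_append] at c1 c2 hJ'
    rw [count_zero_of (i := a + 2) lγ' (x := a + 1) (by omega)] at hJ'
    have mK : ∀ x ∈ J ++ J', a + 1 ≤ x := fun x hx => by
      have := hK.mem_iff.1 hx
      rcases mem_append.1 this with h | h
      · have := lγ' x h; omega
      · simp at h; omega
    obtain ⟨J1, J2, rfl, hJ2⟩ := last_occ (a + 1) J (count_pos_iff.1 (by omega))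
    simp [count_append] at c1
    have hJ1 : a + 1 ∉ J1 := count_eq_zero.1 (by omega)
    have lJ1 : ∀ x ∈ J1, a + 2 ≤ x := fun x hx => by
      have := mK x (by simp [hx])
      have : x ≠ a + 1 := fun h => hJ1 (h ▸ hx)
      omega
    have lJ2 : ∀ x ∈ J2, a + 2 ≤ x := fun x hx => by
      have := mK x (by simp [hx])
      have : x ≠ a + 1 := fun h => hJ2 (h ▸ hx)
      omega
    have cJ1 : J1.count (a + 2) ≤ 1 := by
      simp [count_append] at c2
      have : count (a + 1 + 1) J1 = J1.count (a + 2) := rfl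
      omega
    -- move `a` left
    set δ := J2 ++ (J' ++ γ) with hδ
    have lδ : ∀ x ∈ δ, a + 2 ≤ x := by
      intro x hx
      simp only [hδ, mem_append] at hx
      rcases hx with h | h | h
      · exact lJ2 x h
      · exact lJ' x h
      · exact lγ x h
    by_cases hz : a + 2 ∈ J1
    · obtain ⟨A1, A2, rfl, hA2⟩ := last_occ (a + 2) J1 hz
      simp [count_append] at cJ1
      have hA1 : a + 2 ∉ A1 := count_eq_zero.1 (by omega)
      have lA1 : ∀ x ∈ A1, a + 3 ≤ x := fun x hx => by
        have := lJ1 x (by simp [hx])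
        have : x ≠ a + 2 := fun h => hA1 (h ▸ hx)
        omega
      have lA2 : ∀ x ∈ A2, a + 3 ≤ x := fun x hx => by
        have := lJ1 x (by simp [hx])
        have : x ≠ a + 2 := fun h => hA2 (h ▸ hx)
        omega
      have R := SU.lemB_fin a c ih (w2 ++ A1) [a + 1, a + 2, a + 1, a] (A2 ++ δ) (by
        intro x hx
        rcases mem_append.1 hx with h | h
        · exact lw2 x h
        · have := lA1 x h; omega) (by
        intro x hx
        rcases mem_append.1 hx with h | h
        · have := lA2 x h; omega
        · have := lδ x h; omega) (h.four a) (by simp) (by simp) (by simp) (by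
        rw [count_append, count_zero_of (i := a + 3) lA1 (by omega)]; omega)
      have m1 := h.move (a + 1) A1 lA1
      have m2 := h.move (a + 1) A2 lA2
      have m3 := h.move a A2 (fun x hx => by have := lA2 x hx; omega)
      have m4 := h.move a δ lδ
      have e2 : w2 ++ [a + 1] ++ (A1 ++ (a + 2) :: A2 ++ (a + 1) :: J2 ++ J') ++ (γ ++ [a]) =
        w2 ++ ((a + 1) :: A1) ++ [a + 2] ++ (A2 ++ [a + 1]) ++ (δ ++ [a]) := by simp [hδ]
      rw [e2]
      refine R.sh_eq ?_ ?_
      · rw [← Multiset.coe_eq_coe]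
        simp only [← Multiset.coe_add, ← Multiset.cons_coe, ← Multiset.singleton_add, Multiset.coe_nil]
        abel
      · rw [show w2 ++ A1 ++ [a + 1, a + 2, a + 1, a] ++ (A2 ++ δ) =
          w2 ++ (A1 ++ [a + 1]) ++ [a + 2] ++ [a + 1] ++ (a :: A2) ++ δ by simp]
        simp only [Sh_append, Sh_cons, Sh_nil, mul_one] at m1 m2 m3 m4 ⊢
        rw [← m1, m2, m4, ← m3]
        simp only [mul_assoc]
    · have lJ1' : ∀ x ∈ J1, a + 3 ≤ x := fun x hx => by
        have := lJ1 x hx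
        have : x ≠ a + 2 := fun h => hz (h ▸ hx)
        omega
      have R := SU.lemB_fin a c ih (w2 ++ J1) [a + 1, a + 1, a] δ (by
        intro x hx
        rcases mem_append.1 hx with h | h
        · exact lw2 x h
        · have := lJ1' x h; omega) (by
        intro x hx
        have := lδ x hx; omega) (h.three a) (by simp) (by simp) (by simp) (by
        rw [count_append, count_zero_of (i := a + 3) lJ1' (by omega)]; omega)
      have m1 := h.move (a + 1) J1 lJ1'
      have m4 := h.move a δ lδ
      have e2 : w2 ++ [a + 1] ++ (J1 ++ (a + 1) :: J2 ++ J') ++ (γ ++ [a]) =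
        w2 ++ ((a + 1) :: J1) ++ [a + 1] ++ (δ ++ [a]) := by simp [hδ]
      rw [e2]
      refine R.sh_eq ?_ ?_
      · rw [← Multiset.coe_eq_coe]
        simp only [← Multiset.coe_add, ← Multiset.cons_coe, ← Multiset.singleton_add, Multiset.coe_nil]
        abel
      · rw [show w2 ++ J1 ++ [a + 1, a + 1, a] ++ δ =
          w2 ++ (J1 ++ [a + 1]) ++ [a + 1] ++ (a :: δ) by simp]
        simp only [Sh_append _ w2, Sh_append _ _ [a + 1], Sh_append _ (w2 ++ _),
          Sh_append _ _ (δ ++ [a]), Sh_append _ _ (a :: δ)]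
        rw [← m1, m4, Sh_append _ J1]

theorem SU.claim (h : SU U T) (a : ℕ) : Claim U a := by
  have main : ∀ n a, T ≤ a + n → Claim U a := by
    intro n
    induction n with
    | zero =>
      intro a ha I
      by_cases hi : a + 1 ∈ I
      · exact Red.bot (Sh_bot hi (h.top _ (by omega)))
      · exact Red.of ⟨I, [], by simp, by simp, by rw [count_eq_zero.2 hi]; simp⟩
    | succ n ihn =>
      intro a ha
      have hC := ihn (a + 1) (by omega)
      intro I
      induction I using reverseRecOn with
      | nil => exact Red.of ⟨[], [], by simp, by simp, by simp⟩
      | append_singleton I x ih =>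
        have s := ih.ctx_bind [] [x] (Q := suf (a + 1) ((I ++ [x]).count (a + 1) - (I ++ [x]).count a))
        rw [nil_append] at s
        refine s fun K hK hs => ?_
        simp only [nil_append]
        simp only [count_append]
        rcases Nat.lt_or_ge a x with hx | hx
        · refine Red.of (hs.app (by simp; omega) ?_)
          have : count a [x] = 0 := count_eq_zero.2 (by simp; omega)
          omega
        · have hx1 : count (a + 1) [x] = 0 := count_eq_zero.2 (by simp; omega)
          obtain ⟨J, J', rfl, l1, l2⟩ := hs
          rcases Nat.lt_or_ge x a with hxa | hxa
          · have hx2 : count a [x] = 0 := count_eq_zero.2 (by simp; omega)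
            have m := h.move x J' (fun y hy => by have := l1 y hy; omega)
            have : Red U (J ++ (x :: J')) (suf (a + 1) (I.count (a + 1) + count (a + 1) [x] -
                (I.count a + count a [x]))) :=
              Red.of ⟨J ++ [x], J', by simp, l1, by omega⟩
            refine this.sh_eq ?_ ?_
            · rw [append_assoc]; exact (perm_move x J').append_left J
            · rw [append_assoc, Sh_append _ J, m, Sh_append _ J]
          · obtain rfl : x = a := by omega
            have hx2 : count x [x] = 1 := by simp
            have B := h.lemB x hC _ J' l1 rfl
            have := B.ctx_bind J [] (Q := suf (x + 1) (I.count (x + 1) + count (x + 1) [x] -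
                (I.count x + count x [x]))) fun K _ hs => by
              refine Red.of ?_
              rw [List.append_nil]
              have := hs.app (γ := []) (e' := I.count (x + 1) + count (x + 1) [x] -
                (I.count x + count x [x])) (by simp) (by simp; omega)
              simpa using this.pre (a := J)
            simpa using this
  exact main T a (by omega)

/-- mirror claim -/
theorem SU.mirror (h : SU U T) (M : ℕ)
    (h3 : Red U [M, M, M + 1] (fun K => K = [M, M + 1, M] ∨ K = [M + 1, M, M])) (I : List ℕ)
    (hI : ∀ x ∈ I, M ≤ x) :
    Red U I (fun K => ∃ J, K = J ++ replicate (I.count M - I.count (M + 1)) M) := by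
  have B : ∀ e : ℕ, Red U (replicate e M ++ [M + 1])
      (fun K => ∃ J, K = J ++ replicate (e - 1) M) := by
    intro e
    induction e using Nat.strong_induction_on with
    | _ e ih =>
      match e, ih with
      | 0, _ => exact Red.of ⟨[M + 1], by simp⟩
      | 1, _ => exact Red.of ⟨[M, M + 1], by simp⟩
      | e + 2, ih =>
        have s := h3.ctx_bind (replicate e M) []
          (Q := fun K => ∃ J, K = J ++ replicate (e + 1) M)
        have e1 : replicate e M ++ [M, M, M + 1] ++ [] = replicate (e + 2) M ++ [M + 1] := by
          rw [replicate_add]; simp [replicate]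
        rw [e1] at s
        refine s fun K _ hK => ?_
        rcases hK with rfl | rfl
        · have := (ih (e + 1) (by omega)).ctx_bind [] [M]
            (Q := fun K => ∃ J, K = J ++ replicate (e + 1) M) fun K _ hK => by
              obtain ⟨J, rfl⟩ := hK
              exact Red.of ⟨J, by simp [replicate_succ']⟩
          simpa [replicate_succ'] using this
        · have := (ih e (by omega)).ctx_bind [] [M, M]
            (Q := fun K => ∃ J, K = J ++ replicate (e + 1) M) fun K hp hK => by
              obtain ⟨J, rfl⟩ := hK
              rcases e with _ | e
              · exact Red.of ⟨J ++ [M], by simp⟩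
              · exact Red.of ⟨J, by simp [replicate_succ']⟩
          simpa using this
  induction I using reverseRecOn with
  | nil => exact Red.of ⟨[], by simp⟩
  | append_singleton I x ih =>
    have s := (ih (fun y hy => hI y (by simp [hy]))).ctx_bind [] [x]
      (Q := fun K => ∃ J, K = J ++ replicate ((I ++ [x]).count M - (I ++ [x]).count (M + 1)) M)
    rw [nil_append] at s
    refine s fun K hK hs => ?_
    obtain ⟨J, rfl⟩ := hs
    simp only [nil_append, count_append]
    have hxM := hI x (by simp)
    set e := I.count M - I.count (M + 1) with he
    have rep : ∀ e' L, e' ≤ e → Red U L (fun K => ∃ J, K = J ++ replicate e M) →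
       Red U L (fun K => ∃ J, K = J ++ replicate e' M) := by
      intro e' L he' hL
      refine hL.mono fun K _ hK => ?_
      obtain ⟨J, rfl⟩ := hK
      refine ⟨J ++ replicate (e - e') M, ?_⟩
      rw [append_assoc, ← replicate_add]; congr 2; omega
    rcases Nat.lt_or_ge x (M + 1) with h1 | h1
    · obtain rfl : x = M := by omega
      refine Red.mono (P := fun K => ∃ J, K = J ++ replicate (e + 1) x)
        (Red.of ⟨J, by simp [replicate_succ']⟩) fun K _ hK => ?_
      obtain ⟨J, rfl⟩ := hK
      refine ⟨J ++ replicate (e + 1 - (I.count x + count x [x] -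
        (I.count (x + 1) + count (x + 1) [x]))) x, ?_⟩
      rw [append_assoc, ← replicate_add]; congr 2
      simp
      omega
    · rcases Nat.lt_or_ge x (M + 2) with h2 | h2
      · obtain rfl : x = M + 1 := by omega
        have := (B e).ctx_bind J [] (Q := fun K => ∃ J, K = J ++ replicate
            (I.count M + count M [M + 1] - (I.count (M + 1) + count (M + 1) [M + 1])) M)
          fun K _ hK => by
            obtain ⟨J', rfl⟩ := hK
            refine Red.of ⟨J ++ J', ?_⟩
            simp
            omega
        simpa using this
      · have m : Sh U (J ++ replicate e M ++ [x]) = Sh U (J ++ [x] ++ replicate e M) := by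
          have : ∀ r, Sh U (replicate r M ++ [x]) = Sh U ([x] ++ replicate r M) := by
            intro r
            induction r with
            | zero => simp
            | succ r ih =>
              rw [replicate_succ, cons_append, Sh_cons, ih, Sh_append, Sh_append, Sh_cons _ M,
                ← mul_assoc, ← mul_assoc]
              simp only [Sh_cons, Sh_nil, mul_one]
              rw [h.comm M x h2]
          rw [append_assoc, Sh_append, this, ← Sh_append, append_assoc]
        refine Red.sh_eq (I' := J ++ [x] ++ replicate e M) (Red.of ⟨J ++ [x], ?_⟩) ?_ m
        · congr 2
          have a1 : count M [x] = 0 := count_eq_zero.2 (by simp; omega)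
          have a2 : count (M + 1) [x] = 0 := count_eq_zero.2 (by simp; omega)
          omega
        · rw [append_assoc, append_assoc]
          exact (perm_append_comm).append_left J

end

section
open Submodule
variable {A : Type} [Ring A] [Algebra ℂ A]

theorem antisym_mem (S : Submodule ℂ A) (f : ℤ → ℤ → A) (c : ℂ) (hc : 1 + c ≠ 0)
    (hs : ∀ m n, f m n + f n m ∈ S) (hr : ∀ m n, f (m + 1) n - c • f m (n + 1) ∈ S) (m n : ℤ) :
    f m n ∈ S := by
  have h0 : ∀ n, f n n ∈ S := fun n => by
    have := S.smul_mem (2⁻¹ : ℂ) (hs n n)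
    rwa [← two_smul ℂ (f n n), smul_smul, inv_mul_cancel₀ two_ne_zero, one_smul] at this
  have h1 : ∀ n, f (n + 1) n ∈ S := fun n => by
    have := S.add_mem (hr n n) (S.smul_mem c (hs n (n + 1)))
    have e : f (n + 1) n - c • f n (n + 1) + c • (f n (n + 1) + f (n + 1) n) = (1 + c) • f (n + 1) n := by
      module
    rw [e] at this
    have := S.smul_mem (1 + c)⁻¹ this
    rwa [smul_smul, inv_mul_cancel₀ hc, one_smul] at this
  have h2 : ∀ r : ℕ, ∀ n : ℤ, f (n + r) n ∈ S := by
    intro r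
    induction r using Nat.strong_induction_on with
    | _ r ih =>
      intro n
      match r, ih with
      | 0, _ => simpa using h0 n
      | 1, _ => simpa using h1 n
      | r + 2, ih =>
        have a := ih r (by omega) (n + 1)
        have b := S.add_mem (hr (n + 1 + r) n) (S.smul_mem c a)
        rw [sub_add_cancel] at b
        convert b using 2
        push_cast; ring
  rcases le_total n m with h | h
  · have := h2 (m - n).toNat n
    rwa [show n + ((m - n).toNat : ℤ) = m by omega] at this
  · have := h2 (n - m).toNat m
    rw [show m + ((n - m).toNat : ℤ) = n by omega] at this
    have h3 := S.sub_mem (hs m n) this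
    rwa [add_sub_cancel_right] at h3

def us (X : ℕ → ℤ → A) (i : ℕ) : Submodule ℂ A := span ℂ (Set.range (X i))

variable {X : ℕ → ℤ → A}

theorem us_mem (i : ℕ) (n : ℤ) : X i n ∈ us X i := subset_span ⟨n, rfl⟩

theorem us_le (i : ℕ) (S : Submodule ℂ A) (h : ∀ n, X i n ∈ S) : us X i ≤ S :=
  span_le.2 (by rintro _ ⟨n, rfl⟩; exact h n)

theorem us_mul_le (i : ℕ) (Y S : Submodule ℂ A) (h : ∀ n, ∀ y ∈ Y, X i n * y ∈ S) : us X i * Y ≤ S := by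
  rw [mul_le]
  intro x hx y hy
  have : us X i ≤ S.comap (LinearMap.mulRight ℂ y) := us_le i _ fun n => h n y hy
  exact this hx

theorem us_mul_us_le (i j : ℕ) (S : Submodule ℂ A) (h : ∀ m n, X i m * X j n ∈ S) :
    us X i * us X j ≤ S := by
  refine us_mul_le i _ _ fun m => ?_
  change us X j ≤ S.comap (LinearMap.mulLeft ℂ (X i m))
  exact us_le j _ fun n => h m n

theorem us3_le (i j k : ℕ) (S : Submodule ℂ A) (h : ∀ m n r, X i m * (X j n * X k r) ∈ S) :
    us X i * (us X j * us X k) ≤ S := by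
  refine us_mul_le i _ _ fun m => ?_
  change us X j * us X k ≤ S.comap (LinearMap.mulLeft ℂ (X i m))
  exact us_mul_us_le j k _ fun n => h m n

theorem us4_le (i j k l : ℕ) (S : Submodule ℂ A)
    (h : ∀ m n r s, X i m * (X j n * (X k r * X l s)) ∈ S) :
    us X i * (us X j * (us X k * us X l)) ≤ S := by
  refine us_mul_le i _ _ fun m => ?_
  change us X j * (us X k * us X l) ≤ S.comap (LinearMap.mulLeft ℂ (X i m))
  exact us3_le j k l _ fun n => h m n

theorem Sh3 (U : ℕ → Submodule ℂ A) (i j k : ℕ) : Sh U [i, j, k] = U i * (U j * U k) := by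
  simp [Sh]
theorem Sh4 (U : ℕ → Submodule ℂ A) (i j k l : ℕ) : Sh U [i, j, k, l] = U i * (U j * (U k * U l)) := by
  simp [Sh]

theorem mem3 (i j k : ℕ) (m n r : ℤ) : X i m * (X j n * X k r) ∈ Sh (us X) [i, j, k] := by
  rw [Sh3]
  exact mul_mem_mul (us_mem _ _) (mul_mem_mul (us_mem _ _) (us_mem _ _))

theorem mem4 (i j k l : ℕ) (m n r s : ℤ) :
    X i m * (X j n * (X k r * X l s)) ∈ Sh (us X) [i, j, k, l] := by
  rw [Sh4]
  exact mul_mem_mul (us_mem _ _) (mul_mem_mul (us_mem _ _)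
    (mul_mem_mul (us_mem _ _) (us_mem _ _)))

variable {q : ℂ} {M : ℕ}

theorem adj_cc (M i j : ℕ) (h : j = i + 1 ∨ i = j + 1) : cc M i j = 1 ∨ cc M i j = -1 := by
  rcases h with rfl | rfl
  · rw [cc_succ]; rcases lof_or M (i + 1) with h | h <;> rw [h] <;> simp
  · rw [cc_succ']; rcases lof_or M (j + 1) with h | h <;> rw [h] <;> simp

theorem QOK.one_add_zpow {q : ℂ} (hq : QOK q) (m : ℤ) (hm : m ≠ 0) : 1 + q ^ m ≠ 0 := by
  intro h
  apply hq.zpow_ne (m + m) (by omega)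
  rw [zpow_add₀ hq.ne0, eq_neg_of_add_eq_zero_right h]; ring

theorem serre_exp {q : ℂ} (hq : QOK q) (x x' y : A) :
    brF q x (brF q⁻¹ x' y) + brF q x' (brF q⁻¹ x y) =
      x * (x' * y) + x' * (x * y) + y * (x * x') + y * (x' * x)
        - (q + q⁻¹) • (x * (y * x') + x' * (y * x)) := by
  have e : q * q⁻¹ = 1 := mul_inv_cancel₀ hq.ne0
  simp only [brF, mul_sub, sub_mul, mul_smul_comm, smul_mul_assoc, smul_sub, smul_smul, mul_assoc, e]
  module

/-- Red from a sup inequality -/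
theorem Red.of_le {U : ℕ → Submodule ℂ A} {I : List ℕ} {P : List ℕ → Prop}
    (h : ∀ S : Submodule ℂ A, (∀ K : List ℕ, K.Perm I → P K → Sh U K ≤ S) → Sh U I ≤ S) :
    Red U I P :=
  h _ fun K hK hP => le_iSup (fun K : {K : List ℕ // K.Perm I ∧ P K} => Sh U K.1) ⟨K, hK, hP⟩

theorem red_three (hq : QOK q) (s2 : SR2 q⁻¹ M X) (s3 : SR3 q M X) (i j : ℕ)
    (hij : j = i + 1 ∨ i = j + 1) :
    Red (us X) [i, i, j] (fun K => K = [i, j, i] ∨ K = [j, i, i]) := by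
  refine Red.of_le fun S hS => ?_
  have g1 : Sh (us X) [i, j, i] ≤ S := hS _ (by grind) (Or.inl rfl)
  have g2 : Sh (us X) [j, i, i] ≤ S := hS _ (by grind) (Or.inr rfl)
  have m1 := fun m n r => g1 (mem3 (X := X) i j i m n r)
  have m2 := fun m n r => g2 (mem3 (X := X) j i i m n r)
  have hcc := adj_cc M i j hij
  rw [Sh3]
  refine us3_le _ _ _ _ fun m n k => ?_
  by_cases hiM : i = M
  · have r4 := fun m n => s2.r4 i i m n (by rw [hiM]; exact cc_self_M M)
    rw [hiM, sgn_MM, ← hiM] at r4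
    simp only [neg_smul, one_smul, sub_neg_eq_add] at r4
    have as : ∀ m n k, X i m * (X i n * X j k) + X i n * (X i m * X j k) ∈ S := by
      intro m n k
      rw [← mul_assoc, ← mul_assoc, ← add_mul, r4, zero_mul]; exact S.zero_mem
    set ω := q⁻¹ ^ cc M i j with hω
    have st : ∀ m n k, X i m * (X i (n + 1) * X j k) - ω • (X i m * (X i n * X j (k + 1))) ∈ S := by
      intro m n k
      have h5 := congrArg (fun z => X i m * z) (s2.r5 i j n k (by omega))
      simp only [mul_sub, mul_smul_comm, ← hω] at h5
      have : X i m * (X i (n + 1) * X j k) - ω • (X i m * (X i n * X j (k + 1))) =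
        ω • (X i m * (X j k * X i (n + 1))) - X i m * (X j (k + 1) * X i n) := by
        rw [sub_eq_sub_iff_add_eq_add] at h5 ⊢
        rw [h5]; abel
      rw [this]
      exact S.sub_mem (S.smul_mem _ (m1 _ _ _)) (m1 _ _ _)
    refine antisym_mem S (fun m n => X i m * (X i n * X j k)) 1 (by norm_num) (fun m n => as m n k)
      (fun m n => ?_) m n
    have := S.add_mem (S.sub_mem (S.sub_mem (as (m + 1) n k) (st n m k))
      (S.smul_mem ω (as m n (k + 1)))) (S.neg_mem (st m n k))
    convert this using 1
    module
  · have as : ∀ m n, X i m * (X i n * X j k) + X i n * (X i m * X j k) ∈ S := by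
      intro m n
      have h6 := s3.r6 i j m n k hcc hiM
      rw [serre_exp hq] at h6
      have : X i m * (X i n * X j k) + X i n * (X i m * X j k) = 
        (q + q⁻¹) • (X i m * (X j k * X i n) + X i n * (X j k * X i m)) -
        (X j k * (X i m * X i n) + X j k * (X i n * X i m)) := by
        rw [← sub_eq_zero, ← h6]; abel
      rw [this]
      exact S.sub_mem (S.smul_mem _ (S.add_mem (m1 _ _ _) (m1 _ _ _))) (S.add_mem (m2 _ _ _) (m2 _ _ _))
    set ω := q⁻¹ ^ cc M i i with hω
    have hci : cc M i i ≠ 0 := by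
      rw [cc_self_even M i hiM]; rcases lof_or M i with h | h <;> rw [h] <;> norm_num
    have hω1 : 1 + ω ≠ 0 := hq.inv.one_add_zpow _ hci
    refine antisym_mem S (fun m n => X i m * (X i n * X j k)) 1 (by norm_num) as
      (fun m n => ?_) m n
    have h5 := congrArg (fun z => z * X j k) (s2.r5 i i m n hci)
    simp only [sub_mul, smul_mul_assoc, ← hω, mul_assoc] at h5
    have h7 := S.add_mem (S.smul_mem ω (as n (m + 1))) (S.neg_mem (as (n + 1) m))
    have h8 : (1 + ω) • (X i (m + 1) * (X i n * X j k) - (1 : ℂ) • (X i m * (X i (n + 1) * X j k))) =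
      ω • (X i n * (X i (m + 1) * X j k) + X i (m + 1) * (X i n * X j k)) +
        -(X i (n + 1) * (X i m * X j k) + X i m * (X i (n + 1) * X j k)) := by
      rw [← sub_eq_zero] at h5 ⊢
      rw [← h5]; module
    rw [← h8] at h7
    have := S.smul_mem (1 + ω)⁻¹ h7
    rwa [smul_smul, inv_mul_cancel₀ hω1, one_smul] at this

theorem red_iji (hq : QOK q) (s2 : SR2 q⁻¹ M X) (s3 : SR3 q M X) (i j : ℕ)
    (hij : j = i + 1 ∨ i = j + 1) (hiM : i ≠ M) :
    Red (us X) [i, j, i] (fun K => K = [i, i, j] ∨ K = [j, i, i]) := by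
  refine Red.of_le fun S hS => ?_
  have g1 : Sh (us X) [i, i, j] ≤ S := hS _ (by grind) (Or.inl rfl)
  have g2 : Sh (us X) [j, i, i] ≤ S := hS _ (by grind) (Or.inr rfl)
  have m1 := fun m n r => g1 (mem3 (X := X) i i j m n r)
  have m2 := fun m n r => g2 (mem3 (X := X) j i i m n r)
  have hcc := adj_cc M i j hij
  rw [Sh3]
  refine us3_le _ _ _ _ fun m k n => ?_
  set ω := q⁻¹ ^ cc M i j with hω
  have hω' : q⁻¹ ^ cc M j i = ω := by rw [cc_symm]
  have hq2 : q + q⁻¹ ≠ 0 := by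
    intro h
    apply hq.one_add_zpow 2 (by norm_num)
    have := congrArg (fun z => z * q) h
    simp only [add_mul, inv_mul_cancel₀ hq.ne0, zero_mul] at this
    rw [← this]; norm_cast; ring
  refine antisym_mem S (fun m n => X i m * (X j k * X i n)) (ω * ω) ?_ (fun m n => ?_) (fun m n => ?_) m n
  · rw [hω, ← zpow_add₀ hq.inv.ne0]; exact hq.inv.one_add_zpow _ (by omega)
  · have h6 := s3.r6 i j m n k hcc hiM
    rw [serre_exp hq] at h6
    have : (q + q⁻¹) • (X i m * (X j k * X i n) + X i n * (X j k * X i m)) =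
        X i m * (X i n * X j k) + X i n * (X i m * X j k) + 
        (X j k * (X i m * X i n) + X j k * (X i n * X i m)) := by
      symm
      rw [← sub_eq_zero, ← h6]; abel
    have h7 := S.add_mem (S.add_mem (m1 m n k) (m1 n m k)) (S.add_mem (m2 k m n) (m2 k n m))
    rw [← this] at h7
    have := S.smul_mem (q + q⁻¹)⁻¹ h7
    rwa [smul_smul, inv_mul_cancel₀ hq2, one_smul] at this
  · have h5 := congrArg (fun z => z * X i n) (s2.r5 i j m k (by omega))
    have h5' := congrArg (fun z => X i m * z) (s2.r5 j i k n (by rw [cc_symm]; omega))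
    simp only [mul_sub, sub_mul, mul_smul_comm, smul_mul_assoc, ← hω, hω', mul_assoc] at h5 h5'
    have h7 := S.add_mem (S.sub_mem (S.smul_mem ω (m2 k (m + 1) n)) (m2 (k + 1) m n))
      (S.smul_mem ω (S.sub_mem (S.smul_mem ω (m1 m n (k + 1))) (m1 m (n + 1) k)))
    convert h7 using 1
    rw [← sub_eq_zero] at h5 h5' ⊢
    rw [← add_zero (0 : A)]
    nth_rewrite 1 [← h5]
    rw [← smul_zero ω, ← h5']
    module

theorem osc_exp {q : ℂ} (hq : QOK q) (X : ℕ → ℤ → A) (M : ℕ) (m n k u : ℤ) (a b c d : A)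
    (ha : a = X (M - 1) m) (hb : b = X M n) (hc : c = X (M + 1) k) (hd : d = X M u) :
    oscOf q M X m n k u = a * (b * (c * d)) - q⁻¹ • (b * (a * (c * d))) - q • (c * (a * (b * d)))
      + c * (b * (a * d)) + d * (a * (b * c)) - q⁻¹ • (d * (b * (a * c))) - q • (d * (c * (a * b)))
      + d * (c * (b * a)) := by
  have e : q * q⁻¹ = 1 := mul_inv_cancel₀ hq.ne0
  unfold oscOf
  rw [← ha, ← hb, ← hc, ← hd]
  simp only [brF, mul_sub, sub_mul, mul_smul_comm, smul_mul_assoc, smul_sub, smul_smul, mul_assoc, e]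
  module

theorem us_comm (s2 : SR2 q⁻¹ M X) (i j : ℕ) (hij : i + 2 ≤ j) : us X i * us X j = us X j * us X i := by
  have h : ∀ m n, X i m * X j n = X j n * X i m := by
    intro m n
    have := s2.r4 i j m n (cc_far M i j (Or.inl hij))
    rwa [sgn_ne M i j (by omega), one_smul, sub_eq_zero] at this
  apply le_antisymm
  · refine us_mul_us_le _ _ _ fun m n => ?_
    rw [h]; exact mul_mem_mul (us_mem _ _) (us_mem _ _)
  · refine us_mul_us_le _ _ _ fun m n => ?_
    rw [← h]; exact mul_mem_mul (us_mem _ _) (us_mem _ _)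

theorem red_three_brk (hq : QOK q) (s2 : SR2 q⁻¹ M X) (s3 : SR3 q M X) (i : ℕ) :
    Red (us X) [i + 1, i + 1, i] (brk i) := by
  refine (red_three hq s2 s3 (i + 1) i (Or.inr rfl)).mono fun K _ h => ?_
  rcases h with rfl | rfl
  · exact ⟨[i + 1], [i + 1], rfl, by simp⟩
  · exact ⟨[], [i + 1, i + 1], rfl, by simp⟩

theorem red_four_a (hq : QOK q) (s2 : SR2 q⁻¹ M X) (s3 : SR3 q M X) (i : ℕ) :
    Red (us X) [i + 1, i + 1, i, i + 2] (brk i) := by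
  refine (red_three_brk hq s2 s3 i).ctx_bind [] [i + 2] fun K _ h => ?_
  obtain ⟨J, κ, rfl, h⟩ := h
  exact Red.of ⟨J, κ ++ [i + 2], by simp, by simp [h]⟩

theorem red_four_b (hq : QOK q) (s2 : SR2 q⁻¹ M X) (s3 : SR3 q M X) (i : ℕ) :
    Red (us X) [i + 1, i + 1, i + 2, i] (brk i) := by
  refine (red_four_a hq s2 s3 i).sh_eq (by grind) ?_
  rw [Sh4, Sh4, us_comm s2 i (i + 2) le_rfl]

theorem red_four_c (hq : QOK q) (s2 : SR2 q⁻¹ M X) (s3 : SR3 q M X) (i : ℕ) :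
    Red (us X) [i + 2, i + 1, i + 1, i] (brk i) := by
  have := (red_three_brk hq s2 s3 i).ctx_bind [i + 2] [] (Q := brk i) fun K _ h => by
    obtain ⟨J, κ, rfl, h⟩ := h
    exact Red.of ⟨(i + 2) :: J, κ, by simp, by simp [h]⟩
  simpa using this

theorem red_four (hq : QOK q) (s2 : SR2 q⁻¹ M X) (s3 : SR3 q M X) (x0 : ∀ n, X 0 n = 0) (i : ℕ) :
    Red (us X) [i + 1, i + 2, i + 1, i] (brk i) := by
  by_cases hiM : i + 1 = M
  swap
  · have := (red_iji hq s2 s3 (i + 1) (i + 2) (Or.inl rfl) hiM).ctx_bind [] [i] (Q := brk i)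
      fun K _ h => by
        rcases h with rfl | rfl
        · exact red_four_b hq s2 s3 i
        · exact red_four_c hq s2 s3 i
    simpa using this
  by_cases hi0 : i = 0
  · subst hi0
    refine Red.bot (Sh_bot (i := 0) (by simp) ?_)
    rw [eq_bot_iff]
    exact us_le _ _ fun n => by rw [x0]; exact Submodule.zero_mem _
  refine Red.of_le fun S hS => ?_
  have fa : Sh (us X) [i + 1, i + 1, i, i + 2] ≤ S := (red_four_a hq s2 s3 i).trans
    (iSup_le fun K => hS _ (K.2.1.trans (by grind)) K.2.2)
  have fb : Sh (us X) [i + 1, i + 1, i + 2, i] ≤ S := (red_four_b hq s2 s3 i).trans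
    (iSup_le fun K => hS _ (K.2.1.trans (by grind)) K.2.2)
  have fc : Sh (us X) [i + 2, i + 1, i + 1, i] ≤ S := (red_four_c hq s2 s3 i).trans
    (iSup_le fun K => hS _ (K.2.1.trans (by grind)) K.2.2)
  have ga := fun m n r s => fa (mem4 (X := X) _ _ _ _ m n r s)
  have gb := fun m n r s => fb (mem4 (X := X) _ _ _ _ m n r s)
  have gc := fun m n r s => fc (mem4 (X := X) _ _ _ _ m n r s)
  have p1 := fun m n r s => hS [i, i + 1, i + 2, i + 1] (by grind) ⟨[], _, rfl, by simp⟩ (mem4 (X := X) _ _ _ _ m n r s)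
  have p2 := fun m n r s => hS [i + 1, i, i + 2, i + 1] (by grind) ⟨[i + 1], _, rfl, by simp⟩ (mem4 (X := X) _ _ _ _ m n r s)
  have p3 := fun m n r s => hS [i + 2, i, i + 1, i + 1] (by grind) ⟨[i + 2], _, rfl, by simp⟩ (mem4 (X := X) _ _ _ _ m n r s)
  have p4 := fun m n r s => hS [i + 2, i + 1, i, i + 1] (by grind) ⟨[i + 2, i + 1], _, rfl, by simp⟩ (mem4 (X := X) _ _ _ _ m n r s)
  have p5 := fun m n r s => hS [i + 1, i, i + 1, i + 2] (by grind) ⟨[i + 1], _, rfl, by simp⟩ (mem4 (X := X) _ _ _ _ m n r s)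
  have p6 := fun m n r s => hS [i + 1, i + 2, i, i + 1] (by grind) ⟨[i + 1, i + 2], _, rfl, by simp⟩ (mem4 (X := X) _ _ _ _ m n r s)
  rw [Sh4]
  refine us4_le _ _ _ _ _ fun n k u m => ?_
  set ω := q⁻¹ ^ cc M (i + 1) (i + 2) with hω
  have hω' : q⁻¹ ^ cc M (i + 2) (i + 1) = ω := by rw [cc_symm]
  have hcc := adj_cc M (i + 1) (i + 2) (Or.inl rfl)
  refine antisym_mem S (fun n u => X (i + 1) n * (X (i + 2) k * (X (i + 1) u * X i m))) (ω * ω)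
    ?_ (fun n u => ?_) (fun n u => ?_) n u
  · rw [hω, ← zpow_add₀ hq.inv.ne0]; exact hq.inv.one_add_zpow _ (by omega)
  · have h7 := s3.r7 m n k u (by omega)
    subst hiM
    rw [osc_exp hq X (i + 1) m n k u _ _ _ _ rfl rfl rfl rfl,
      osc_exp hq X (i + 1) m u k n _ _ _ _ rfl rfl rfl rfl] at h7
    simp only [Nat.add_sub_cancel, show i + 1 + 1 = i + 2 from rfl] at h7
    set a := X i m
    set b := X (i + 1) n
    set c := X (i + 2) k
    set d := X (i + 1) u
    have t : ∀ n u, X i m * (X (i + 1) n * (c * X (i + 1) u)) - q⁻¹ • (X (i + 1) n * (a * (c * X (i + 1) u))) - q • (c * (a * (X (i + 1) n * X (i + 1) u)))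
      + c * (X (i + 1) n * (a * X (i + 1) u)) + X (i + 1) u * (a * (X (i + 1) n * c)) - q⁻¹ • (X (i + 1) u * (X (i + 1) n * (a * c))) - q • (X (i + 1) u * (c * (a * X (i + 1) n))) ∈ S := by
      intro n u
      exact S.sub_mem (S.sub_mem (S.add_mem (S.add_mem (S.sub_mem (S.sub_mem (p1 _ _ _ _)
        (S.smul_mem _ (p2 _ _ _ _))) (S.smul_mem _ (p3 _ _ _ _))) (p4 _ _ _ _)) (p5 _ _ _ _))
        (S.smul_mem _ (ga _ _ _ _))) (S.smul_mem _ (p6 _ _ _ _))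
    have h8 := S.neg_mem (S.add_mem (t n u) (t u n))
    convert h8 using 1
    rw [← sub_eq_zero, ← h7]
    abel
  · have h5 := congrArg (fun z => z * (X (i + 1) u * X i m)) (s2.r5 (i + 1) (i + 2) n k (by omega))
    have h5' := congrArg (fun z => X (i + 1) n * (z * X i m)) (s2.r5 (i + 2) (i + 1) k u (by rw [cc_symm]; omega))
    simp only [mul_sub, sub_mul, mul_smul_comm, smul_mul_assoc, ← hω, hω', mul_assoc] at h5 h5'
    have h7 := S.add_mem (S.sub_mem (S.smul_mem ω (gc k (n + 1) u m)) (gc (k + 1) n u m))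
      (S.smul_mem ω (S.sub_mem (S.smul_mem ω (gb n u (k + 1) m)) (gb n (u + 1) k m)))
    convert h7 using 1
    rw [← sub_eq_zero] at h5 h5' ⊢
    rw [← add_zero (0 : A)]
    nth_rewrite 1 [← h5]
    rw [← smul_zero ω, ← h5']
    module

theorem us_SU (hq : QOK q) (N : ℕ) (s2 : SR2 q⁻¹ M X) (s3 : SR3 q M X)
    (hx : ∀ i n, ¬ vld M N i → X i n = 0) : SU (us X) (M + N) where
  top i hi := by
    rw [eq_bot_iff]
    exact us_le _ _ fun n => by
      by_cases h : vld M N i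
      · exfalso; omega
      · rw [hx i n h]; exact Submodule.zero_mem _
  comm i j h := us_comm s2 i j h
  three i := red_three_brk hq s2 s3 i
  four i := red_four hq s2 s3 (fun n => hx 0 n (by omega)) i

end

section
open Submodule
variable {q : ℂ} {M N : ℕ} {A : Type} [Ring A] [Algebra ℂ A]
variable {V : Type} [AddCommGroup V] [Module ℂ V] [Module A V] [IsScalarTower ℂ A V]

/-- evaluation at a vector -/
def evv (v : V) : A →ₗ[ℂ] V where
  toFun a := a • v
  map_add' a b := add_smul a b v
  map_smul' c a := smul_assoc c a v

/-- words with letters `I` applied to `v` -/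
def Ws (R : RD q M N A) (v : V) (I : List ℕ) : Submodule ℂ V := (Sh (us R.xm) I).map (evv v)

theorem Ws_nil (R : RD q M N A) (v : V) : Ws R v [] = span ℂ {v} := by
  unfold Ws
  rw [Sh_nil, one_eq_span, map_span, Set.image_singleton]
  simp [evv]

theorem Ws_cons (R : RD q M N A) (v : V) (i : ℕ) (n : ℤ) (I : List ℕ) (w : V) (hw : w ∈ Ws R v I) :
    R.xm i n • w ∈ Ws R v (i :: I) := by
  obtain ⟨a, ha, rfl⟩ := hw
  refine ⟨R.xm i n * a, ?_, mul_smul _ _ _⟩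
  rw [Sh_cons]
  exact mul_mem_mul (us_mem i n) ha

theorem Ws_cons_ind (R : RD q M N A) (v : V) (i : ℕ) (I : List ℕ) (S : Submodule ℂ V)
    (h : ∀ n, ∀ w ∈ Ws R v I, R.xm i n • w ∈ S) : Ws R v (i :: I) ≤ S := by
  unfold Ws
  rw [map_le_iff_le_comap, Sh_cons]
  refine us_mul_le i _ _ fun n y hy => ?_
  rw [mem_comap]
  have := h n (y • v) ⟨y, hy, rfl⟩
  rw [← mul_smul] at this
  exact this

theorem Ws_append_bot (R : RD q M N A) (v : V) (J I : List ℕ) (h : Ws R v I = ⊥) :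
    Ws R v (J ++ I) = ⊥ := by
  induction J with
  | nil => exact h
  | cons j J ih =>
    rw [eq_bot_iff]
    refine Ws_cons_ind R v j (J ++ I) ⊥ fun n w hw => ?_
    rw [ih, mem_bot] at hw
    rw [hw, smul_zero]; exact Submodule.zero_mem _

theorem Ws_red (R : RD q M N A) (v : V) {I : List ℕ} {P : List ℕ → Prop} (h : Red (us R.xm) I P)
    (hI : Ws R v I ≠ ⊥) : ∃ K, K.Perm I ∧ P K ∧ Ws R v K ≠ ⊥ := by
  by_contra hc
  push Not at hc
  apply hI
  rw [eq_bot_iff]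
  refine (map_mono h).trans ?_
  rw [Submodule.map_iSup]
  exact iSup_le fun K => (hc K.1 K.2.1 K.2.2).le

theorem Ws_vld (R : RD q M N A) (v : V) {I : List ℕ} (hI : Ws R v I ≠ ⊥) : ∀ x ∈ I, vld M N x := by
  intro x hx
  by_contra hv
  apply hI
  unfold Ws
  rw [Sh_bot hx, Submodule.map_bot]
  rw [eq_bot_iff]
  exact us_le _ _ fun n => by rw [R.xm0 _ _ hv]; exact Submodule.zero_mem _

theorem Gw_le_Ws (R : RD q M N A) (v : V) (r : ℕ) :
    Gw R v r ≤ ⨆ I : {I : List ℕ // I.length = r}, Ws R v I.1 := by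
  induction r with
  | zero =>
    refine le_trans (Ws_nil R v).ge ?_
    exact le_iSup (fun I : {I : List ℕ // I.length = 0} => Ws R v I.1) ⟨[], rfl⟩
  | succ r ih =>
    refine Gw_succ_ind R v r _ fun i n w hw => ?_
    have h1 : (⨆ I : {I : List ℕ // I.length = r}, Ws R v I.1) ≤
      (⨆ I : {I : List ℕ // I.length = r + 1}, Ws R v I.1).comap (act (R.xm i n)) := by
      refine iSup_le fun I w hw => ?_
      exact (le_iSup (fun I : {I : List ℕ // I.length = r + 1} => Ws R v I.1)
        ⟨i :: I.1, by simp [I.2]⟩) (Ws_cons R v i n _ w hw)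
    exact h1 (ih hw)

variable {R : RD q M N A} {v : V} {d : ℕ → ℕ}

/-! ### the odd bound -/

theorem anti_move (X : ℤ → A) (hX : ∀ m n, X m * X n = - (X n * X m)) (a : ℤ) (l : List ℤ) :
    ∃ ε : ℂ, X a * (l.map X).prod = ε • ((l.map X).prod * X a) := by
  induction l with
  | nil => exact ⟨1, by simp⟩
  | cons b l ih =>
    obtain ⟨ε, h⟩ := ih
    refine ⟨-ε, ?_⟩
    rw [List.map_cons, List.prod_cons, ← mul_assoc, hX, neg_mul, mul_assoc, h, mul_smul_comm,
      mul_assoc, neg_smul]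

theorem anti_mem (X : ℤ → A) (hX : ∀ m n, X m * X n = - (X n * X m)) (a : ℤ) (l : List ℤ)
    (h : a ∈ l) : (l.map X).prod * X a = 0 := by
  have sq : X a * X a = 0 := by
    have h2 : (2 : ℂ) • (X a * X a) = 0 := by
      rw [two_smul]; nth_rewrite 1 [hX]; simp
    exact (smul_eq_zero.1 h2).resolve_left two_ne_zero
  induction l with
  | nil => simp at h
  | cons b l ih =>
    rw [List.map_cons, List.prod_cons, mul_assoc]
    by_cases hl : a ∈ l
    · rw [ih hl, mul_zero]
    · have hb : a = b := by simpa [hl] using h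
      subst hb
      obtain ⟨ε, h⟩ := anti_move X hX a l
      by_cases hε : ε = 0
      · rw [← mul_assoc, h, hε, zero_smul, zero_mul]
      · have := congrArg (fun z => ε⁻¹ • (X a * z)) h
        simp only [mul_smul_comm, inv_smul_smul₀ hε] at this
        rw [← this, ← mul_assoc, sq, zero_mul, smul_zero]

theorem anti_nodup (X : ℤ → A) (hX : ∀ m n, X m * X n = - (X n * X m)) (l : List ℤ)
    (h : ¬ l.Nodup) : (l.map X).prod = 0 := by
  induction l with
  | nil => simp at h
  | cons b l ih =>
    rw [List.map_cons, List.prod_cons]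
    by_cases hl : l.Nodup
    · have : b ∈ l := by
        by_contra hb; exact h (List.nodup_cons.2 ⟨hb, hl⟩)
      obtain ⟨ε, h⟩ := anti_move X hX b l
      rw [h, anti_mem X hX b l this, smul_zero]
    · rw [ih hl, mul_zero]

theorem fin_sub {u : ℤ → V} (F : Submodule ℂ V) (hF : F.FG) (hu : ∀ n, u n ∈ F) :
    ∃ S : Finset ℤ, ∀ n, u n ∈ span ℂ (u '' (S : Set ℤ)) := by
  classical
  have hfin : FiniteDimensional ℂ F := Module.Finite.iff_fg.2 hF
  obtain ⟨b, hb, hs, hl⟩ := exists_linearIndependent ℂ (Set.range fun n => (⟨u n, hu n⟩ : F))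
  have hbf : b.Finite := by
    have := hl.finite
    exact Set.toFinite b
  obtain ⟨S, hS⟩ := hbf.exists_finset_coe
  subst hS
  have hb' : (S : Set F) ⊆ (fun n => (⟨u n, hu n⟩ : F)) '' Set.univ := by simpa using hb
  obtain ⟨T, -, hT⟩ := Finset.subset_set_image_iff.1 hb'
  refine ⟨T, fun n => ?_⟩
  have h1 : (⟨u n, hu n⟩ : F) ∈ span ℂ (S : Set F) := by
    rw [hs]; exact subset_span ⟨n, rfl⟩
  have h2 := mem_map_of_mem (f := F.subtype) h1
  rw [map_span, ← hT] at h2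
  simpa [Set.image_image] using h2

theorem UP.anti (U : UP R v d) (m n : ℤ) : R.xm M m * R.xm M n = - (R.xm M n * R.xm M m) := by
  have := U.s2.r4 M M m n (cc_self_M M)
  rw [sgn_MM, neg_smul, one_smul, sub_neg_eq_add] at this
  exact eq_neg_of_add_eq_zero_left this

theorem UP.oddDead (U : UP R v d) : ∃ D : ℕ, ∀ e, D < e → Ws R v (List.replicate e M) = ⊥ := by
  obtain ⟨F, hF, hF'⟩ := U.oneFG M
  obtain ⟨S, hS⟩ := fin_sub (u := fun n => R.xm M n • v) F hF hF'
  refine ⟨S.card, fun e he => ?_⟩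
  have key : ∀ e, Ws R v (List.replicate e M) ≤
      span ℂ {x | ∃ l : List ℤ, (∀ a ∈ l, a ∈ S) ∧ l.length = e ∧
        x = (l.map (R.xm M)).prod • v} := by
    intro e
    induction e with
    | zero =>
      rw [List.replicate_zero, Ws_nil]
      refine span_mono ?_
      rintro _ rfl
      exact ⟨[], by simp, rfl, by simp⟩
    | succ e ih =>
      rw [List.replicate_succ]
      refine Ws_cons_ind R v M _ _ fun n w hw => ?_
      have hw' := ih hw
      revert hw'
      generalize hG : span ℂ {x | ∃ l : List ℤ, (∀ a ∈ l, a ∈ S) ∧ l.length = e + 1 ∧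
        x = (l.map (R.xm M)).prod • v} = G
      intro hw'
      have : span ℂ {x | ∃ l : List ℤ, (∀ a ∈ l, a ∈ S) ∧ l.length = e ∧
        x = (l.map (R.xm M)).prod • v} ≤ G.comap (act (R.xm M n)) := by
        refine span_le.2 ?_
        rintro _ ⟨l, hl, hle, rfl⟩
        rw [SetLike.mem_coe, mem_comap, act_apply, ← mul_smul]
        obtain ⟨ε, h⟩ := anti_move _ U.anti n l
        rw [h, smul_assoc, mul_smul]
        refine G.smul_mem _ ?_
        have h2 : span ℂ ((fun n => R.xm M n • v) '' (S : Set ℤ)) ≤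
            G.comap (act (l.map (R.xm M)).prod) := by
          refine span_le.2 ?_
          rintro _ ⟨s, hs, rfl⟩
          rw [SetLike.mem_coe, mem_comap, act_apply, ← mul_smul, ← hG]
          refine subset_span ⟨l ++ [s], ?_, by simp [hle], by simp⟩
          intro a ha
          rcases List.mem_append.1 ha with ha | ha
          · exact hl a ha
          · rw [List.mem_singleton.1 ha]; exact hs
        exact h2 (hS n)
      exact this hw'
  rw [eq_bot_iff]
  refine (key e).trans (span_le.2 ?_)
  rintro _ ⟨l, hl, hle, rfl⟩
  rw [anti_nodup _ U.anti l, zero_smul]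
  · exact Submodule.zero_mem _
  · intro hn
    have h1 := List.toFinset_card_of_nodup hn
    have h2 : l.toFinset ⊆ S := fun a ha => hl a (List.mem_toFinset.1 ha)
    have := Finset.card_le_card h2
    omega

theorem UP.SU (U : UP R v d) : SU (us R.xm) (M + N) := us_SU U.hq N U.s2 U.s3 R.xm0

theorem UP.right (U : UP R v d) : ∃ D : ℕ, ∀ I, Ws R v I ≠ ⊥ → (∀ x ∈ I, M ≤ x) →
    I.count M ≤ I.count (M + 1) + D := by
  obtain ⟨D, hD⟩ := U.oddDead
  refine ⟨D, fun I hI hx => ?_⟩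
  obtain ⟨K, -, ⟨J, rfl⟩, hK⟩ := Ws_red R v
    (U.SU.mirror M (red_three U.hq U.s2 U.s3 M (M + 1) (Or.inl rfl)) I hx) hI
  by_contra hc
  exact hK (Ws_append_bot R v J _ (hD _ (by omega)))

theorem UP.left (U : UP R v d) (I : List ℕ) (hI : Ws R v I ≠ ⊥) :
    ∃ J, Ws R v J ≠ ⊥ ∧ (∀ x ∈ J, M ≤ x) ∧ I.count M ≤ J.count M + I.count (M - 1) := by
  obtain ⟨K, -, ⟨J, J', rfl, h1, h2⟩, hK⟩ := Ws_red R v (U.SU.claim (M - 1) I) hI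
  have := U.hM
  rw [show M - 1 + 1 = M by omega] at h1 h2
  exact ⟨J', fun h => hK (Ws_append_bot R v J _ h), h1, by omega⟩

/-! ### stability of the word spaces -/

theorem Ws_nil_stab (R : RD q M N A) (v : V) (a : A) (h : a ∈ (Sc v : Subalgebra ℂ A)) :
    a ∈ (Stab (Ws R v []) : Subalgebra ℂ A) := by
  obtain ⟨c, hc⟩ := h
  intro w hw
  rw [Ws_nil] at *
  obtain ⟨e, rfl⟩ := mem_span_singleton.1 hw
  rw [asmul_comm, hc]
  exact smul_mem _ _ (smul_mem _ _ (mem_span_singleton_self _))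

theorem UP.kW (U : UP R v d) (i : ℕ) (I : List ℕ) : R.k i ∈ (Stab (Ws R v I) : Subalgebra ℂ A) := by
  induction I with
  | nil => exact Ws_nil_stab R v _ (U.kv' i)
  | cons j I ih =>
    refine Ws_cons_ind R v j I ((Ws R v (j :: I)).comap (act (R.k i))) fun n w hw => ?_
    rw [mem_comap, act_apply, ← mul_smul, R.kxm, smul_assoc, mul_smul]
    exact smul_mem _ _ (Ws_cons R v j n _ _ (ih w hw))

theorem UP.kiW (U : UP R v d) (i : ℕ) (I : List ℕ) : R.ki i ∈ (Stab (Ws R v I) : Subalgebra ℂ A) := by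
  induction I with
  | nil => exact Ws_nil_stab R v _ (U.kiv' i)
  | cons j I ih =>
    refine Ws_cons_ind R v j I ((Ws R v (j :: I)).comap (act (R.ki i))) fun n w hw => ?_
    rw [mem_comap, act_apply, ← mul_smul, R.kixm U.hq, smul_assoc, mul_smul]
    exact smul_mem _ _ (Ws_cons R v j n _ _ (ih w hw))

theorem UP.hW (U : UP R v d) (i : ℕ) (s : ℤ) (I : List ℕ) :
    R.h i s ∈ (Stab (Ws R v I) : Subalgebra ℂ A) := by
  by_cases hi : vld M N i
  swap
  · rw [R.h0 i s hi]; exact Subalgebra.zero_mem _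
  induction I with
  | nil => exact Ws_nil_stab R v _ (U.hv i s)
  | cons j I ih =>
    refine Ws_cons_ind R v j I ((Ws R v (j :: I)).comap (act (R.h i s))) fun n w hw => ?_
    rw [mem_comap, act_apply, ← mul_smul, sub_eq_iff_eq_add.1 (R.hxm i j s n hi), add_smul,
      neg_smul, mul_smul, smul_assoc]
    exact Submodule.add_mem _ (Submodule.neg_mem _ (smul_mem _ _ (Ws_cons R v j _ _ _ hw)))
      (Ws_cons R v j n _ _ (ih w hw))

theorem UP.xpW (U : UP R v d) (i : ℕ) (n : ℤ) (I : List ℕ) (w : V) (hw : w ∈ Ws R v I) :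
    R.xp i n • w ∈ ⨆ J : {J : List ℕ // (i :: J).Perm I}, Ws R v J.1 := by
  induction I generalizing w with
  | nil =>
    rw [Ws_nil] at hw
    obtain ⟨e, rfl⟩ := mem_span_singleton.1 hw
    rw [asmul_comm, U.xpv, smul_zero]; exact Submodule.zero_mem _
  | cons j I ih =>
    revert w
    change Ws R v (j :: I) ≤ (⨆ J : {J : List ℕ // (i :: J).Perm (j :: I)}, Ws R v J.1).comap
      (act (R.xp i n))
    refine Ws_cons_ind R v j I _ fun m w hw => ?_
    rw [mem_comap, act_apply, ← mul_smul, R.comm, add_smul, smul_assoc, mul_smul]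
    refine Submodule.add_mem _ (smul_mem _ _ ?_) ?_
    · have : (⨆ J : {J : List ℕ // (i :: J).Perm I}, Ws R v J.1) ≤
        (⨆ J : {J : List ℕ // (i :: J).Perm (j :: I)}, Ws R v J.1).comap (act (R.xm j m)) := by
        refine iSup_le fun J w hw => ?_
        exact (le_iSup (fun J : {J : List ℕ // (i :: J).Perm (j :: I)} => Ws R v J.1)
          ⟨j :: J.1, (List.Perm.swap j i J.1).trans (J.2.cons j)⟩) (Ws_cons R v j m _ w hw)
      exact this (ih w hw)
    · split_ifs with hij
      · subst hij
        exact (le_iSup (fun J : {J : List ℕ // (i :: J).Perm (i :: I)} => Ws R v J.1)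
          ⟨I, List.Perm.refl _⟩) (R.Φ_mem _ i (U.kW i _) (U.kiW i _) (fun s => U.hW i s _) _ w hw)
      · rw [zero_smul]; exact Submodule.zero_mem _

theorem UP.xpWpow (U : UP R v d) (i : ℕ) (r : ℕ) (I : List ℕ) (w : V) (hw : w ∈ Ws R v I) :
    R.xp i 0 ^ r • w ∈ ⨆ J : {J : List ℕ // (List.replicate r i ++ J).Perm I}, Ws R v J.1 := by
  induction r with
  | zero =>
    rw [pow_zero, one_smul]
    exact (le_iSup (fun J : {J : List ℕ // (List.replicate 0 i ++ J).Perm I} => Ws R v J.1)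
      ⟨I, List.Perm.refl _⟩) hw
  | succ r ih =>
    rw [pow_succ', mul_smul]
    have : (⨆ J : {J : List ℕ // (List.replicate r i ++ J).Perm I}, Ws R v J.1) ≤
      (⨆ J : {J : List ℕ // (List.replicate (r + 1) i ++ J).Perm I}, Ws R v J.1).comap
        (act (R.xp i 0)) := by
      refine iSup_le fun J w hw => ?_
      have h1 := U.xpW i 0 J.1 w hw
      rw [mem_comap, act_apply]
      have h2 : (⨆ K : {K : List ℕ // (i :: K).Perm J.1}, Ws R v K.1) ≤
          ⨆ J : {J : List ℕ // (List.replicate (r + 1) i ++ J).Perm I}, Ws R v J.1 := ?_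
      · exact h2 h1
      refine iSup_le fun K => ?_
      refine le_iSup (fun J : {J : List ℕ // (List.replicate (r + 1) i ++ J).Perm I} => Ws R v J.1)
        ⟨K.1, ?_⟩
      refine List.Perm.trans ?_ ((K.2.append_left _).trans J.2)
      rw [List.replicate_succ']
      simp
    exact this ih

/-- weights -/
theorem UP.kWt (U : UP R v d) (i : ℕ) (hi : i ≠ M) (hv : vld M N i) (I : List ℕ) (w : V)
    (hw : w ∈ Ws R v I) :
    R.k i • w = (qpar q M i ^ ((d i : ℤ) - 2 * I.count i + I.count (i - 1) + I.count (i + 1))) • w := by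
  have hne := (U.hq.qpar M i).ne0
  induction I generalizing w with
  | nil =>
    rw [Ws_nil] at hw
    obtain ⟨e, rfl⟩ := mem_span_singleton.1 hw
    rw [asmul_comm, U.kv i hi hv, smul_comm]
    simp
  | cons j I ih =>
    revert w
    change Ws R v (j :: I) ≤ LinearMap.eqLocus (act (R.k i) : V →ₗ[ℂ] V)
      ((qpar q M i ^ ((d i : ℤ) - 2 * (j :: I).count i + (j :: I).count (i - 1) + (j :: I).count (i + 1))) •
        (LinearMap.id : V →ₗ[ℂ] V))
    refine Ws_cons_ind R v j I _ fun n w hw => ?_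
    rw [LinearMap.mem_eqLocus, act_apply, ← mul_smul, R.kxm, smul_assoc, mul_smul, ih w hw,
      asmul_comm, smul_smul, ← qpar_zpow_lof M i, ← zpow_add₀ hne]
    simp only [LinearMap.smul_apply, LinearMap.id_apply]
    congr 2
    simp only [List.count_cons]
    have hl := lof_sq M i
    by_cases h1 : j = i
    · subst h1
      rw [cc_self_even M j hi]
      simp [show j ≠ j - 1 by have := hv.1; omega]
      linear_combination (-2) * hl
    by_cases h2 : j = i + 1
    · subst h2
      rw [cc_succ, show lof M (i + 1) = lof M i by unfold lof; split_ifs <;> omega]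
      simp [show i + 1 ≠ i - 1 by omega]
      linear_combination hl
    by_cases h3 : j = i - 1
    · obtain ⟨i, rfl⟩ : ∃ a, i = a + 1 := ⟨i - 1, by have := hv.1; omega⟩
      simp at h3
      subst h3
      rw [cc_succ']
      simp [show j ≠ j + 1 + 1 by omega]
      linear_combination hl
    · rw [cc_far M i j (by omega)]
      simp [h1, h2, h3]

/-! ### local nilpotency -/

/-- vectors killed by a power -/
def Lnil (F : A) : Submodule ℂ V where
  carrier := {w | ∃ r : ℕ, F ^ r • w = 0}
  add_mem' := by
    rintro a b ⟨r, hr⟩ ⟨s, hs⟩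
    refine ⟨r + s, ?_⟩
    rw [smul_add, pow_add]
    nth_rewrite 1 [(Commute.pow_pow (Commute.refl F) r s).eq]
    rw [mul_smul, mul_smul, hr, hs, smul_zero, smul_zero, add_zero]
  zero_mem' := ⟨0, smul_zero _⟩
  smul_mem' := by
    rintro c a ⟨r, hr⟩
    exact ⟨r, by rw [asmul_comm, hr, smul_zero]⟩

theorem Lnil_of (F : A) (w : V) (h : F • w ∈ (Lnil F : Submodule ℂ V)) : w ∈ (Lnil F : Submodule ℂ V) := by
  obtain ⟨r, hr⟩ := h
  exact ⟨r + 1, by rw [pow_succ, mul_smul, hr]⟩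

theorem Lnil_to (F : A) (w : V) (h : w ∈ (Lnil F : Submodule ℂ V)) : F • w ∈ (Lnil F : Submodule ℂ V) := by
  obtain ⟨r, hr⟩ := h
  exact ⟨r, by rw [← mul_smul, ← pow_succ, pow_succ', mul_smul, hr, smul_zero]⟩

/-- if `F x = c x F + g` on the nil space, with `g` stabilizing, then `x` stabilizes -/
theorem Lnil_step (F x g : A) (c : ℂ) (h : F * x = c • (x * F) + g)
    (hg : g ∈ (Stab (Lnil F : Submodule ℂ V) : Subalgebra ℂ A)) :
    x ∈ (Stab (Lnil F : Submodule ℂ V) : Subalgebra ℂ A) := by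
  have key : ∀ r : ℕ, ∀ w : V, F ^ r • w = 0 → x • w ∈ (Lnil F : Submodule ℂ V) := by
    intro r
    induction r with
    | zero => intro w hw; rw [pow_zero, one_smul] at hw; rw [hw, smul_zero]; exact Submodule.zero_mem _
    | succ r ih =>
      intro w hw
      apply Lnil_of
      rw [← mul_smul, h, add_smul, smul_assoc, mul_smul]
      refine Submodule.add_mem _ (smul_mem _ _ (ih _ ?_)) (hg w ⟨r + 1, hw⟩)
      rw [← mul_smul, ← pow_succ, hw]
  rintro w ⟨r, hr⟩
  exact key r w hr

theorem Lnil_serre (F y : A) (c : ℂ) (h : F * (F * y) = c • (F * (y * F)) - y * (F * F)) :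
    y ∈ (Stab (Lnil F : Submodule ℂ V) : Subalgebra ℂ A) := by
  have key : ∀ s : ℕ, (∃ P, F ^ (s + 1) * y = P * F ^ s) ∧ (∃ P, F ^ (s + 2) * y = P * F ^ (s + 1)) := by
    intro s
    induction s with
    | zero =>
      refine ⟨⟨F * y, by simp⟩, ⟨c • (F * y) - y * F, ?_⟩⟩
      rw [pow_two, mul_assoc, h]
      simp [sub_mul, mul_assoc]
    | succ s ih =>
      obtain ⟨⟨P, hP⟩, ⟨P', hP'⟩⟩ := ih
      refine ⟨⟨P', hP'⟩, c • P' - P, ?_⟩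
      have : F ^ (s + 1 + 2) * y = F ^ (s + 1) * (F * (F * y)) := by
        simp only [pow_add, pow_one, pow_two, mul_assoc]
      rw [this, h, mul_sub, mul_smul_comm, ← mul_assoc, ← mul_assoc, ← mul_assoc, ← pow_succ, hP', hP]
      simp only [sub_mul, smul_mul_assoc, pow_succ, mul_assoc]
  rintro w ⟨s, hs⟩
  obtain ⟨⟨P, hP⟩, -⟩ := key s
  exact ⟨s + 1, by rw [← mul_smul, hP, mul_smul, hs, smul_zero]⟩

theorem UP.nil_self (U : UP R v d) (i : ℕ) (hi : i ≠ M) (n : ℤ) :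
    R.xm i n ∈ (Stab (Lnil (R.xm i 0) : Submodule ℂ V) : Subalgebra ℂ A) := by
  have hc : cc M i i ≠ 0 := by
    rw [cc_self_even M i hi]; rcases lof_or M i with h | h <;> rw [h] <;> norm_num
  obtain ⟨ω, hω, h5⟩ : ∃ ω : ℂ, ω ≠ 0 ∧ ∀ m n, R.xm i (m + 1) * R.xm i n - ω • (R.xm i n * R.xm i (m + 1)) =
    ω • (R.xm i m * R.xm i (n + 1)) - R.xm i (n + 1) * R.xm i m :=
    ⟨_, zpow_ne_zero _ (inv_ne_zero U.hq.ne0), fun m n => U.s2.r5 i i m n hc⟩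
  have hs : ∀ m, R.xm i (m + 1) * R.xm i m = ω • (R.xm i m * R.xm i (m + 1)) := by
    intro m
    have := h5 m m
    have h2 : (2 : ℂ) • (R.xm i (m + 1) * R.xm i m - ω • (R.xm i m * R.xm i (m + 1))) = 0 := by
      rw [two_smul]; nth_rewrite 1 [this]; abel
    exact sub_eq_zero.1 ((smul_eq_zero.1 h2).resolve_left two_ne_zero)
  have h0 : R.xm i 0 ∈ (Stab (Lnil (R.xm i 0) : Submodule ℂ V) : Subalgebra ℂ A) := fun w => Lnil_to _ w
  have h1 : R.xm i 1 ∈ (Stab (Lnil (R.xm i 0) : Submodule ℂ V) : Subalgebra ℂ A) := by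
    refine Lnil_step _ _ 0 ω⁻¹ ?_ (Subalgebra.zero_mem _)
    have := hs 0
    simp only [zero_add] at this
    rw [this, inv_smul_smul₀ hω, add_zero]
  have h1' : R.xm i (-1) ∈ (Stab (Lnil (R.xm i 0) : Submodule ℂ V) : Subalgebra ℂ A) := by
    refine Lnil_step _ _ 0 ω ?_ (Subalgebra.zero_mem _)
    have := hs (-1)
    simpa using this
  have up : ∀ m : ℕ, R.xm i m ∈ (Stab (Lnil (R.xm i 0) : Submodule ℂ V) : Subalgebra ℂ A) := by
    intro m
    induction m with
    | zero => exact_mod_cast h0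
    | succ m ih =>
      push_cast
      refine Lnil_step _ _ (ω⁻¹ • (R.xm i 1 * R.xm i m) - R.xm i m * R.xm i 1) ω⁻¹ ?_ ?_
      · have := h5 m 0
        rw [zero_add, sub_eq_iff_eq_add] at this
        rw [this, smul_add, inv_smul_smul₀ hω, smul_sub, inv_smul_smul₀ hω]
        abel
      · exact Subalgebra.sub_mem _ (Subalgebra.smul_mem _ (Subalgebra.mul_mem _ h1 ih) _)
          (Subalgebra.mul_mem _ ih h1)
  have down : ∀ m : ℕ, R.xm i (-(m : ℤ)) ∈ (Stab (Lnil (R.xm i 0) : Submodule ℂ V) : Subalgebra ℂ A) := by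
    intro m
    induction m with
    | zero => simpa using h0
    | succ m ih =>
      push_cast
      refine Lnil_step _ _ (ω • (R.xm i (-1) * R.xm i (-(m : ℤ))) - R.xm i (-(m : ℤ)) * R.xm i (-1)) ω ?_ ?_
      · have := h5 (-1) (-((m : ℤ) + 1))
        rw [show (-1 : ℤ) + 1 = 0 by norm_num, show -((m : ℤ) + 1) + 1 = -m by ring,
          sub_eq_iff_eq_add'] at this
        exact this
      · exact Subalgebra.sub_mem _ (Subalgebra.smul_mem _ (Subalgebra.mul_mem _ h1' ih) _)
          (Subalgebra.mul_mem _ ih h1')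
  rcases le_total 0 n with h | h
  · have := up n.toNat
    rwa [Int.toNat_of_nonneg h] at this
  · have := down (-n).toNat
    rwa [Int.toNat_of_nonneg (by omega), neg_neg] at this

theorem UP.nil_stab (U : UP R v d) (i : ℕ) (hi : i ≠ M) (j : ℕ) (n : ℤ) :
    R.xm j n ∈ (Stab (Lnil (R.xm i 0) : Submodule ℂ V) : Subalgebra ℂ A) := by
  by_cases h1 : j = i
  · subst h1; exact U.nil_self j hi n
  by_cases h2 : j = i + 1 ∨ i = j + 1
  · have := U.s3.r6 i j 0 0 n (adj_cc M i j h2) hi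
    rw [serre_exp U.hq] at this
    refine Lnil_serre _ _ (q + q⁻¹) ?_
    have h2 : (2 : ℂ) • (R.xm i 0 * (R.xm i 0 * R.xm j n) - ((q + q⁻¹) • (R.xm i 0 * (R.xm j n * R.xm i 0)) -
      R.xm j n * (R.xm i 0 * R.xm i 0))) = 0 := by
      rw [← this]; module
    exact sub_eq_zero.1 ((smul_eq_zero.1 h2).resolve_left two_ne_zero)
  · refine Lnil_step _ _ 0 1 ?_ (Subalgebra.zero_mem _)
    have := U.s2.r4 i j 0 n (cc_far M i j (by omega))
    rw [sgn_ne M i j (by omega), sub_eq_zero] at this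
    rw [this, add_zero]

theorem UP.nilW (U : UP R v d) (i : ℕ) (hi : i ≠ M) (hv : vld M N i) (I : List ℕ) :
    Ws R v I ≤ Lnil (R.xm i 0) := by
  induction I with
  | nil =>
    rw [Ws_nil, span_singleton_le_iff_mem]
    exact ⟨d i + 1, U.even i hi hv⟩
  | cons j I ih =>
    exact Ws_cons_ind R v j I _ fun n w hw => U.nil_stab i hi j n w (ih hw)

/-! ### sl2 -/

structure SL (p : ℂ) (E F k ki : A) : Prop where
  hp : QOK p
  ef : E * F = F * E + (p - p⁻¹)⁻¹ • (k - ki)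
  ke : k * E = (p ^ (2 : ℤ)) • (E * k)
  kf : k * F = (p ^ (-2 : ℤ)) • (F * k)
  kik : ki * k = 1

variable {p : ℂ} {E F k ki : A}

theorem SL.ki_wt (h : SL p E F k ki) (μ : ℤ) (w : V) (hw : k • w = (p ^ μ) • w) :
    ki • w = (p ^ (-μ)) • w := by
  have h1 : ki • k • w = w := by rw [← mul_smul, h.kik, one_smul]
  rw [hw, asmul_comm] at h1
  rw [zpow_neg, eq_inv_smul_iff₀ (zpow_ne_zero _ h.hp.ne0), h1]

theorem SL.comm (h : SL p E F k ki) (a : ℕ) : ∀ (μ : ℤ) (w : V), k • w = (p ^ μ) • w →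
    E ^ (a + 1) • F • w = F • E ^ (a + 1) • w +
      ((p ^ ((a : ℤ) + 1) - p ^ (-((a : ℤ) + 1))) * (p ^ (μ + a) - p ^ (-(μ + a))) / (p - p⁻¹) ^ 2) • E ^ a • w := by
  have hne := h.hp.ne0
  have hs := h.hp.sub_inv_ne
  have ef : ∀ (μ : ℤ) (w : V), k • w = (p ^ μ) • w →
      E • F • w = F • E • w + ((p ^ μ - p ^ (-μ)) / (p - p⁻¹)) • w := by
    intro μ w hw
    rw [← mul_smul, h.ef, add_smul, mul_smul, smul_assoc, sub_smul, hw, h.ki_wt μ w hw, ← sub_smul,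
      div_eq_inv_mul, mul_smul ((p - p⁻¹)⁻¹)]
  induction a with
  | zero =>
    intro μ w hw
    simp only [zero_add, pow_one, pow_zero, one_smul, Nat.cast_zero, add_zero]
    rw [ef μ w hw]
    congr 2
    rw [zpow_one, zpow_neg_one]
    field_simp
  | succ a ih =>
    intro μ w hw
    have hE : k • E • w = (p ^ (μ + 2)) • E • w := by
      rw [← mul_smul, h.ke, smul_assoc, mul_smul, hw, asmul_comm, smul_smul, ← zpow_add₀ hne, add_comm]
    have e1 : ∀ u : V, E ^ (a + 1) • E • u = E ^ (a + 1 + 1) • u := fun u => by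
      rw [← mul_smul, ← pow_succ]
    have e2 : ∀ u : V, E ^ a • E • u = E ^ (a + 1) • u := fun u => by
      rw [← mul_smul, ← pow_succ]
    rw [← e1, ef μ w hw, smul_add, ih _ _ hE, asmul_comm, e1, e2, add_assoc, ← add_smul]
    congr 2
    have hs2 : (p - p⁻¹) ^ 2 ≠ 0 := pow_ne_zero _ hs
    rw [div_add_div _ _ hs2 hs, div_eq_div_iff (mul_ne_zero hs2 hs) hs2]
    push_cast
    simp only [neg_add, zpow_add₀ hne, zpow_neg, zpow_ofNat, zpow_natCast, zpow_one]
    have ha : (p ^ a) ≠ 0 := pow_ne_zero _ hne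
    have hm : (p ^ μ) ≠ 0 := zpow_ne_zero _ hne
    generalize p ^ μ = y at *
    generalize p ^ a = x at *
    field_simp
    ring

theorem SL.main (h : SL p E F k ki) (s : ℕ) : ∀ (m : ℕ) (w : V), 0 < m → k • w = (p ^ (-(m : ℤ))) • w →
    F ^ s • w = 0 → E ^ m • w = 0 → w = 0 := by
  have hne := h.hp.ne0
  have hs := h.hp.sub_inv_ne
  induction s with
  | zero => intro m w _ _ hF _; simpa using hF
  | succ s ih =>
    intro m w hm hw hF hE
    have hEr : ∀ r, m ≤ r → E ^ r • w = 0 := by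
      intro r hr
      obtain ⟨t, rfl⟩ := Nat.exists_eq_add_of_le' hr
      rw [pow_add, mul_smul, hE, smul_zero]
    have hFw : F • w = 0 := by
      refine ih (m + 2) _ (by omega) ?_ ?_ ?_
      · rw [← mul_smul, h.kf, smul_assoc, mul_smul, hw, asmul_comm, smul_smul, ← zpow_add₀ hne]
        congr 2; push_cast; ring
      · rw [← mul_smul, ← pow_succ, hF]
      · rw [h.comm (m + 1) _ w hw, hEr _ (by omega), hEr _ (by omega), smul_zero, smul_zero, add_zero]
    have desc : ∀ a, a ≤ m → E ^ (m - a) • w = 0 := by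
      intro a
      induction a with
      | zero => intro _; simpa using hE
      | succ a iha =>
        intro ha
        have h1 := iha (by omega)
        obtain ⟨b, hb⟩ : ∃ b, m - a = b + 1 := ⟨m - a - 1, by omega⟩
        rw [hb] at h1
        have h2 := h.comm b _ w hw
        rw [hFw, h1, smul_zero, smul_zero, zero_add] at h2
        rw [show m - (a + 1) = b by omega]
        refine (smul_eq_zero.1 h2.symm).resolve_left ?_
        refine div_ne_zero (mul_ne_zero (h.hp.zpow_ne' _ (by omega)) (h.hp.zpow_ne' _ (by omega))) (pow_ne_zero _ hs)
    simpa using desc m le_rfl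

theorem UP.SL (U : UP R v d) (i : ℕ) (hi : i ≠ M) (hv : vld M N i) :
    SL (qpar q M i) (R.xp i 0) (R.xm i 0) (R.k i) (R.ki i) where
  hp := U.hq.qpar M i
  ef := by
    have := R.comm i i 0 0
    rw [sgn_ne M i i (Or.inl hi), one_smul, if_pos rfl] at this
    rw [this, RD.Φ, add_zero, R.fp_zero, R.fm_zero, tq]
  ke := by
    rw [R.kxp, cc_self_even M i hi, ← qpar_zpow_lof M i, ← mul_assoc, mul_comm (lof M i), mul_assoc,
      lof_sq, mul_one]
  kf := by
    rw [R.kxm, cc_self_even M i hi, ← qpar_zpow_lof M i, mul_neg, ← mul_assoc, mul_comm (lof M i),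
      mul_assoc, lof_sq, mul_one]
  kik := R.kik i hv

/-- the simple reflection of a live content -/
theorem UP.reflect (U : UP R v d) (i : ℕ) (hi : i ≠ M) (hv : vld M N i) (I : List ℕ)
    (hI : Ws R v I ≠ ⊥) (hlt : d i + I.count (i - 1) + I.count (i + 1) < 2 * I.count i) :
    ∃ J, Ws R v J ≠ ⊥ ∧
      (List.replicate (2 * I.count i - (d i + I.count (i - 1) + I.count (i + 1))) i ++ J).Perm I := by
  set m := 2 * I.count i - (d i + I.count (i - 1) + I.count (i + 1)) with hm
  obtain ⟨w, hw, hw0⟩ := exists_mem_ne_zero_of_ne_bot hI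
  have hk : R.k i • w = (qpar q M i ^ (-(m : ℤ))) • w := by
    rw [U.kWt i hi hv I w hw]
    congr 2
    omega
  obtain ⟨s, hs⟩ := U.nilW i hi hv I hw
  by_contra hc
  push Not at hc
  refine hw0 ((U.SL i hi hv).main s m w (by omega) hk hs ?_)
  have h1 := U.xpWpow i m I w hw
  have h2 : (⨆ J : {J : List ℕ // (List.replicate m i ++ J).Perm I}, Ws R v J.1) = ⊥ := by
    rw [eq_bot_iff]
    refine iSup_le fun J => ?_
    by_contra hJ
    exact hc J.1 (fun h => hJ h.le) J.2
  rw [h2] at h1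
  exact h1

end

section
open Finset
variable {q : ℂ} {M N : ℕ} {A : Type} [Ring A] [Algebra ℂ A]
variable {V : Type} [AddCommGroup V] [Module ℂ V] [Module A V] [IsScalarTower ℂ A V]
variable {R : RD q M N A} {v : V} {d : ℕ → ℕ}

theorem UP.dom_ind (U : UP R v d) (p : ℕ → Prop) (hp : ∀ i, p i → i ≠ M ∧ vld M N i)
    (Pr : (ℕ → ℕ) → Prop)
    (hdom : ∀ I, Ws R v I ≠ ⊥ → (∀ i, p i → 2 * I.count i ≤ d i + I.count (i - 1) + I.count (i + 1)) →
      Pr (fun j => I.count j))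
    (href : ∀ (k k' : ℕ → ℕ) i, p i → k i + k' i = d i + k (i - 1) + k (i + 1) → (∀ j, j ≠ i → k' j = k j) →
      Pr k' → Pr k) : ∀ I, Ws R v I ≠ ⊥ → Pr (fun j => I.count j) := by
  have key : ∀ n : ℕ, ∀ I : List ℕ, I.length ≤ n → Ws R v I ≠ ⊥ → Pr (fun j => I.count j) := by
    intro n
    induction n with
    | zero =>
      intro I hn hI
      obtain rfl : I = [] := List.length_eq_zero_iff.1 (by omega)
      exact hdom _ hI (by simp)
    | succ n ih =>
      intro I hn hI
      by_cases hd : ∀ i, p i → 2 * I.count i ≤ d i + I.count (i - 1) + I.count (i + 1)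
      · exact hdom I hI hd
      · push Not at hd
        obtain ⟨i, hi, hlt⟩ := hd
        obtain ⟨J, hJ, hp'⟩ := U.reflect i (hp i hi).1 (hp i hi).2 I hI hlt
        have hl := hp'.length_eq
        rw [List.length_append, List.length_replicate] at hl
        refine href _ (fun j => J.count j) i hi ?_ ?_ (ih J (by omega) hJ)
        · have := hp'.count_eq i
          rw [List.count_append, List.count_replicate_self] at this
          omega
        · intro j hj
          have := hp'.count_eq j
          rw [List.count_append, List.count_replicate] at this
          simp only [beq_iff_eq, if_neg (Ne.symm hj)] at this
          omega
  exact fun I hI => key I.length I le_rfl hI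

theorem count_out (R : RD q M N A) (v : V) {I : List ℕ} (hI : Ws R v I ≠ ⊥) (j : ℕ)
    (hj : ¬ vld M N j) : I.count j = 0 :=
  List.count_eq_zero.2 fun h => hj (Ws_vld R v hI j h)

theorem UP.bd1 (U : UP R v d) : ∃ K : ℕ, ∀ I, Ws R v I ≠ ⊥ → (∀ x ∈ I, M ≤ x) → I.count M ≤ K := by
  obtain ⟨D, hD⟩ := U.right
  let c : ℕ → ℕ := fun t => D + ∑ s ∈ range t, d (M + 1 + s)
  refine ⟨∑ t ∈ range N, c t, fun I hI hx => ?_⟩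
  refine U.dom_ind (fun i => M < i ∧ vld M N i) (fun i h => ⟨h.1.ne', h.2⟩)
    (fun k => (∀ j, j < M → k j = 0) → k M ≤ ∑ t ∈ range N, c t) ?_ ?_ I hI ?_
  · intro I hI hd h0
    have h1 := hD I hI (fun x hx => by
      by_contra hc
      exact List.count_eq_zero.1 (h0 x (by omega)) hx)
    have h2 : ∀ t, t < N → I.count (M + t) ≤ I.count (M + t + 1) + c t := by
      intro t
      induction t with
      | zero => intro _; simpa [c] using h1
      | succ t ih =>
        intro ht
        have h3 := ih (by omega)
        have h4 := hd (M + t + 1) ⟨by omega, by omega, by omega⟩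
        have h5 : c (t + 1) = c t + d (M + t + 1) := by
          simp only [c, sum_range_succ]
          rw [show M + 1 + t = M + t + 1 by omega]
          omega
        rw [h5]
        simp only [Nat.add_sub_cancel] at h4
        rw [← add_assoc]
        omega
    have h3 : ∀ t, t ≤ N → I.count M ≤ I.count (M + t) + ∑ s ∈ range t, c s := by
      intro t
      induction t with
      | zero => simp
      | succ t ih =>
        intro ht
        have := ih (by omega)
        have := h2 t (by omega)
        rw [sum_range_succ, show M + (t + 1) = M + t + 1 by omega]
        omega
    have := h3 N le_rfl
    rw [count_out R v hI (M + N) (by have := U.hM; have := U.hN; simp only [vld]; omega), zero_add] at this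
    exact this
  · intro k k' i hi _ hne hP h0
    have := hP (fun j hj => by rw [hne j (by omega)]; exact h0 j hj)
    rwa [hne M (by omega)] at this
  · intro j hj
    refine List.count_eq_zero.2 fun h => ?_
    have := hx j h
    omega

theorem UP.bd2 (U : UP R v d) : ∃ K : ℕ, ∀ I, Ws R v I ≠ ⊥ → I.count M ≤ K := by
  obtain ⟨K, hK⟩ := U.bd1
  let c : ℕ → ℕ := fun t => K + ∑ s ∈ range t, d (M - 1 - s)
  refine ⟨∑ t ∈ range M, c t, fun I hI => ?_⟩
  refine U.dom_ind (fun i => i < M ∧ vld M N i) (fun i h => ⟨h.1.ne, h.2⟩)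
    (fun k => k M ≤ ∑ t ∈ range M, c t) ?_ ?_ I hI
  · intro I hI hd
    have h1 : I.count M ≤ I.count (M - 1) + K := by
      obtain ⟨J, hJ, hx, hle⟩ := U.left I hI
      have := hK J hJ hx
      omega
    have h2 : ∀ t, t < M → I.count (M - t) ≤ I.count (M - t - 1) + c t := by
      intro t
      induction t with
      | zero => intro _; simpa [c] using h1
      | succ t ih =>
        intro ht
        have h3 := ih (by omega)
        have h4 := hd (M - t - 1) ⟨by omega, by omega, by omega⟩
        have h5 : c (t + 1) = c t + d (M - t - 1) := by
          simp only [c, sum_range_succ]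
          rw [show M - 1 - t = M - t - 1 by omega]
          omega
        rw [h5, show M - (t + 1) = M - t - 1 by omega]
        rw [show M - t - 1 + 1 = M - t by omega] at h4
        omega
    have h3 : ∀ t, t ≤ M → I.count M ≤ I.count (M - t) + ∑ s ∈ range t, c s := by
      intro t
      induction t with
      | zero => simp
      | succ t ih =>
        intro ht
        have := ih (by omega)
        have := h2 t (by omega)
        rw [sum_range_succ, show M - (t + 1) = M - t - 1 by omega]
        omega
    have := h3 M le_rfl
    rw [count_out R v hI (M - M) (by simp [vld]), zero_add] at this
    exact this
  · intro k k' i hi _ hne hP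
    rwa [hne M (by omega)] at hP

theorem UP.bdR (U : UP R v d) : ∃ L : ℕ, ∀ I, Ws R v I ≠ ⊥ → ∀ t, t < N →
    I.count (M + t + 1) ≤ I.count (M + t) + L := by
  let e : ℕ → ℕ := fun t => ∑ s ∈ range t, d (M + t - t + 1 + s)
  have he : ∀ t, e (t + 1) = e t + d (M + t + 1) := by
    intro t
    simp only [e, sum_range_succ, Nat.add_sub_cancel]
    rw [show M + 1 + t = M + t + 1 by omega]
  refine ⟨e (N - 1), fun I hI => ?_⟩
  have := U.dom_ind (fun i => M < i ∧ vld M N i) (fun i h => ⟨h.1.ne', h.2⟩)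
    (fun k => ∀ t, t < N → k (M + t + 1) + e t ≤ k (M + t) + e (N - 1)) ?_ ?_ I hI
  · intro t ht
    have := this t ht
    simp only at this
    omega
  · intro I hI hd
    have h0 := count_out R v hI (M + N) (by have := U.hM; have := U.hN; simp only [vld]; omega)
    have h1 : ∀ s, s < N → I.count (M + (N - 1 - s) + 1) + e (N - 1 - s) ≤
        I.count (M + (N - 1 - s)) + e (N - 1) := by
      intro s
      induction s with
      | zero =>
        intro _
        rw [Nat.sub_zero, show M + (N - 1) + 1 = M + N by omega, h0]
        omega
      | succ s ih =>
        intro hs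
        have h2 := ih (by omega)
        have h3 := he (N - 1 - (s + 1))
        have h4 := hd (M + (N - 1 - s)) ⟨by omega, by omega, by omega⟩
        rw [show N - 1 - (s + 1) + 1 = N - 1 - s by omega,
          show M + (N - 1 - (s + 1)) + 1 = M + (N - 1 - s) by omega] at h3
        rw [show M + (N - 1 - s) - 1 = M + (N - 1 - (s + 1)) by omega] at h4
        rw [show M + (N - 1 - (s + 1)) + 1 = M + (N - 1 - s) by omega]
        omega
    intro t ht
    have := h1 (N - 1 - t) (by omega)
    rwa [show N - 1 - (N - 1 - t) = t by omega] at this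
  · intro k k' i hi hs hne hP t ht
    obtain ⟨a, rfl⟩ : ∃ a, i = M + a + 1 := ⟨i - M - 1, by omega⟩
    have hv := hi.2.2
    simp only [Nat.add_sub_cancel] at hs
    by_cases h1 : t = a
    · subst h1
      have := hP (t + 1) (by omega)
      rw [he, show M + (t + 1) = M + t + 1 by omega, hne (M + t + 1 + 1) (by omega)] at this
      omega
    by_cases h2 : t = a + 1
    · subst h2
      have := hP a (by omega)
      rw [hne (M + a) (by omega)] at this
      rw [he, show M + (a + 1) = M + a + 1 by omega]
      omega
    · have := hP t ht
      rwa [hne (M + t + 1) (by omega), hne (M + t) (by omega)] at this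

theorem UP.bdL (U : UP R v d) : ∃ L : ℕ, ∀ I, Ws R v I ≠ ⊥ → ∀ t, t < M →
    I.count t ≤ I.count (t + 1) + L := by
  let e : ℕ → ℕ := fun t => ∑ s ∈ range t, d (s + 1)
  have he : ∀ t, e (t + 1) = e t + d (t + 1) := fun t => sum_range_succ _ _
  have hmono : Monotone e := monotone_nat_of_le_succ fun t => by rw [he]; omega
  refine ⟨e M, fun I hI => ?_⟩
  have := U.dom_ind (fun i => i < M ∧ vld M N i) (fun i h => ⟨h.1.ne, h.2⟩)
    (fun k => ∀ t, t < M → k t ≤ k (t + 1) + e t) ?_ ?_ I hI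
  · intro t ht
    have := this t ht
    have := hmono ht.le
    simp only at *
    omega
  · intro I hI hd t
    have h0 := count_out R v hI 0 (by simp [vld])
    change t < M → I.count t ≤ I.count (t + 1) + e t
    induction t with
    | zero => intro _; rw [h0]; omega
    | succ t ih =>
      intro ht
      have h1 := ih (by omega)
      have h2 := hd (t + 1) ⟨by omega, by omega, by omega⟩
      simp only [Nat.add_sub_cancel] at h2
      rw [he]
      omega
  · intro k k' i hi hs hne hP t ht
    obtain ⟨a, rfl⟩ : ∃ a, i = a + 1 := ⟨i - 1, by have := hi.2.1; omega⟩
    simp only [Nat.add_sub_cancel] at hs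
    by_cases h1 : t = a
    · subst h1
      have := hP (t + 1) (by omega)
      rw [he, hne (t + 1 + 1) (by omega)] at this
      omega
    by_cases h2 : t = a + 1
    · subst h2
      have := hP a (by omega)
      rw [hne a (by omega)] at this
      rw [he]
      omega
    · have := hP t ht
      rwa [hne (t + 1) (by omega), hne t (by omega)] at this

theorem UP.bd_all (U : UP R v d) : ∃ C : ℕ, ∀ I, Ws R v I ≠ ⊥ → ∀ j, I.count j ≤ C := by
  obtain ⟨K, hK⟩ := U.bd2
  obtain ⟨L, hL⟩ := U.bdR
  obtain ⟨L', hL'⟩ := U.bdL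
  refine ⟨K + N * L + M * L', fun I hI j => ?_⟩
  have h1 : ∀ t, t ≤ N → I.count (M + t) ≤ K + t * L := by
    intro t
    induction t with
    | zero => intro _; simpa using hK I hI
    | succ t ih =>
      intro ht
      have := ih (by omega)
      have := hL I hI t (by omega)
      rw [← add_assoc, Nat.succ_mul]
      omega
  have h2 : ∀ t, t ≤ M → I.count (M - t) ≤ K + t * L' := by
    intro t
    induction t with
    | zero => intro _; simpa using hK I hI
    | succ t ih =>
      intro ht
      have := ih (by omega)
      have := hL' I hI (M - (t + 1)) (by omega)
      rw [show M - (t + 1) + 1 = M - t by omega] at this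
      rw [Nat.succ_mul]
      omega
  by_cases hv : vld M N j
  · rcases le_total M j with h | h
    · have h3 := h1 (j - M) (by have := hv.2; omega)
      have : (j - M) * L ≤ N * L := Nat.mul_le_mul_right _ (by have := hv.2; omega)
      rw [show M + (j - M) = j by omega] at h3
      omega
    · have h3 := h2 (M - j) (by omega)
      have : (M - j) * L' ≤ M * L' := Nat.mul_le_mul_right _ (by omega)
      rw [show M - (M - j) = j by omega] at h3
      omega
  · rw [count_out R v hI j hv]; omega

theorem UP.bd_len (U : UP R v d) : ∃ C : ℕ, ∀ I, Ws R v I ≠ ⊥ → I.length ≤ C := by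
  obtain ⟨C, hC⟩ := U.bd_all
  refine ⟨(M + N) * C, fun I hI => ?_⟩
  rw [← List.sum_toFinset_count_eq_length]
  have hs : I.toFinset ⊆ range (M + N) := by
    intro x hx
    have := Ws_vld R v hI x (List.mem_toFinset.1 hx)
    have h1 := this.1
    have h2 := this.2
    have := U.hM
    rw [mem_range]; omega
  refine (sum_le_card_nsmul _ _ C fun x _ => hC I hI x).trans ?_
  rw [smul_eq_mul]
  refine Nat.mul_le_mul_right _ ?_
  simpa using card_le_card hs

theorem UP.finite (U : UP R v d) : FiniteDimensional ℂ V := by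
  obtain ⟨C, hC⟩ := U.bd_len
  have h0 : ∀ r, C < r → Gw R v r = ⊥ := by
    intro r hr
    rw [eq_bot_iff]
    refine (Gw_le_Ws R v r).trans (iSup_le fun I => ?_)
    by_contra hc
    have := hC I.1 (fun h => hc h.le)
    have := I.2
    omega
  have h1 : (⨆ r : Fin (C + 1), Gw R v r) = ⊤ := by
    rw [eq_top_iff, ← U.iSup_top]
    refine iSup_le fun r => ?_
    by_cases hr : C < r
    · rw [h0 r hr]; exact bot_le
    · exact le_iSup (fun r : Fin (C + 1) => Gw R v r) ⟨r, by omega⟩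
  have h2 : (⊤ : Submodule ℂ V).FG := by
    rw [← h1]
    exact Submodule.fg_iSup _ fun r => (U.GwFG r).1
  exact Module.finite_def.2 h2

end

section
open Submodule

variable {q : ℂ} {M N : ℕ}

theorem pscale_coeff (u : ℂ) (P : Polynomial ℂ) (n : ℕ) : (pscale u P).coeff n = P.coeff n * u ^ n := by
  unfold pscale
  rw [Polynomial.comp_C_mul_X_coeff]

theorem gammaP_zero (i : ℕ) (P : Polynomial ℂ) (hP : P.coeff 0 = 1) :
    gammaP q M i P 0 = qpar q M i ^ P.natDegree := by
  unfold gammaP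
  simp [toPS, pscale_coeff, hP]

def wv (q : ℂ) (M N : ℕ) (Λ : HW q M N) (Q : Polynomial ℂ) : WeylMod q M N false Λ Q :=
  Submodule.Quotient.mk 1

theorem wv_smul (Λ : HW q M N) (Q : Polynomial ℂ) (a : ALG q M N false 3) :
    a • wv q M N Λ Q = (Submodule.Quotient.mk a : ALG q M N false 3 ⧸ weylIdeal q M N false Λ Q) := by
  change a • (Submodule.Quotient.mk 1 : ALG q M N false 3 ⧸ weylIdeal q M N false Λ Q) = _
  rw [← Submodule.Quotient.mk_smul, smul_eq_mul, mul_one]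

theorem wv_zero (Λ : HW q M N) (Q : Polynomial ℂ) (a : ALG q M N false 3)
    (h : a ∈ vermaRels q M N false Λ ∪ evenRels q M N false Λ ∪ oddRels q M N false Q) :
    a • wv q M N Λ Q = 0 := by
  rw [wv_smul]
  exact (Submodule.Quotient.mk_eq_zero _).2 (Ideal.subset_span h)

theorem wv_sub (Λ : HW q M N) (Q : Polynomial ℂ) (a : ALG q M N false 3) (c : ℂ)
    (h : a - algebraMap ℂ _ c ∈ vermaRels q M N false Λ) :
    a • wv q M N Λ Q = c • wv q M N Λ Q := by
  have := wv_zero Λ Q _ (Or.inl (Or.inl h))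
  rwa [sub_smul, sub_eq_zero, algebraMap_smul] at this

theorem weyl_UP (hq : QOK q) (hM : 1 ≤ M) (hN : 1 ≤ N) (Λ : HW q M N) (Q : Polynomial ℂ)
    (hQ1 : Q.coeff 0 = 1) : UP (RA q M N) (wv q M N Λ Q) (fun i => (Λ.P i).natDegree) := by
  have hfp : ∀ i n, (RA q M N).fp i n = phiPA q M N false 3 i n := fun i n => (phiPA_eq q M N i n).symm
  have hfm : ∀ i n, (RA q M N).fm i n = phiMA q M N false 3 i n := fun i n => (phiMA_eq q M N i n).symm
  have hMv : vld M N M := ⟨hM, by omega⟩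
  have hKM : (RA q M N).k M • wv q M N Λ Q = Λ.c • wv q M N Λ Q :=
    wv_sub _ _ _ _ (by simp only [vermaRels, Set.mem_union]; exact Or.inl (Or.inl (Or.inr rfl)))
  have hKiM : (RA q M N).ki M • wv q M N Λ Q = Λ.c⁻¹ • wv q M N Λ Q := by
    have := congrArg (fun x => Λ.c⁻¹ • (RA q M N).ki M • x) hKM
    rw [← mul_smul ((RA q M N).ki M), (RA q M N).kik M hMv, one_smul, asmul_comm, inv_smul_smul₀ Λ.c_ne] at this
    exact this.symm
  have hF : ∀ n, ((RA q M N).fp M n - (RA q M N).fm M n) • wv q M N Λ Q =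
      ((q - q⁻¹) * Λ.f n) • wv q M N Λ Q := fun n => by
    rw [hfp, hfm]
    exact wv_sub _ _ _ _ (by simp only [vermaRels, Set.mem_union]; exact Or.inl (Or.inr ⟨n, rfl⟩))
  have hfpv : ∀ i n, vld M N i → (RA q M N).fp i n ∈ (Sc (wv q M N Λ Q) : Subalgebra ℂ (ALG q M N false 3)) := by
    intro i n hi
    by_cases h : i = M
    · subst h
      rcases lt_trichotomy n 0 with h | h | h
      · rw [RD.fp_neg _ _ _ h]; exact Subalgebra.zero_mem _
      · subst h; rw [RD.fp_zero]; exact ⟨_, hKM⟩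
      · have := hF n
        rw [RD.fm_pos _ _ _ h, sub_zero] at this
        exact ⟨_, this⟩
    · rw [hfp]
      exact ⟨_, wv_sub _ _ _ _ (by simp only [vermaRels, Set.mem_union]; exact Or.inl (Or.inl (Or.inl (Or.inr ⟨i, n, hi.1, hi.2, h, Or.inl rfl⟩))))⟩
  have hfmv : ∀ i n, vld M N i → (RA q M N).fm i n ∈ (Sc (wv q M N Λ Q) : Subalgebra ℂ (ALG q M N false 3)) := by
    intro i n hi
    by_cases h : i = M
    · subst h
      rcases lt_trichotomy n 0 with h | h | h
      · have := hF n
        rw [RD.fp_neg _ _ _ h, zero_sub, neg_smul, neg_eq_iff_eq_neg, ← neg_smul] at this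
        exact ⟨_, this⟩
      · subst h; rw [RD.fm_zero]; exact ⟨_, hKiM⟩
      · rw [RD.fm_pos _ _ _ h]; exact Subalgebra.zero_mem _
    · rw [hfm]
      exact ⟨_, wv_sub _ _ _ _ (by simp only [vermaRels, Set.mem_union]; exact Or.inl (Or.inl (Or.inl (Or.inr ⟨i, n, hi.1, hi.2, h, Or.inr rfl⟩))))⟩
  have hhv : ∀ i, vld M N i → ∀ s, (RA q M N).h i s ∈ (Sc (wv q M N Λ Q) : Subalgebra ℂ (ALG q M N false 3)) :=
    fun i hi s => RD.h_mem _ hq _ i hi (fun n => hfpv i n hi) (fun n => hfmv i n hi) s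
  refine ⟨hq, hM, hN, RA_SR2 q M N, RA_SR3 q M N, ?_, hfpv, hfmv, ?_, ?_, ?_, ?_⟩
  · intro i n
    exact wv_zero _ _ _ (by simp only [vermaRels, Set.mem_union]; exact Or.inl (Or.inl (Or.inl (Or.inl (Or.inl (Or.inl ⟨i, n, rfl⟩))))))
  · intro i hi hv
    rw [← gammaP_zero (M := M) i (Λ.P i) (Λ.P_const i), ← RD.fp_zero, hfp]
    exact wv_sub _ _ _ _ (by simp only [vermaRels, Set.mem_union]; exact Or.inl (Or.inl (Or.inl (Or.inr ⟨i, 0, hv.1, hv.2, hi, Or.inl rfl⟩))))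
  · intro i hi hv
    rw [add_comm]
    exact wv_zero _ _ _ (Or.inl (Or.inr ⟨i, hv.1, hv.2, hi, rfl⟩))
  · refine ⟨Q.natDegree, fun s => Q.coeff (Q.natDegree - s), by simp [hQ1], ?_⟩
    have key : ∀ n : ℤ, oddElt q M N false Q n • wv q M N Λ Q =
        ∑ s ∈ Finset.range (Q.natDegree + 1), Q.coeff (Q.natDegree - s) • (RA q M N).xm M (n + s) • wv q M N Λ Q := by
      intro n
      unfold oddElt
      rw [Finset.sum_smul]
      refine Finset.sum_congr rfl fun s _ => ?_
      rw [smul_assoc, add_comm n]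
      rfl
    intro n
    by_cases h11 : M = 1 ∧ N = 1
    · rw [← key]
      refine wv_zero _ _ _ (Or.inr ?_)
      rw [oddRels, if_pos h11]
      exact ⟨n, rfl⟩
    have h0 := wv_zero Λ Q (oddElt q M N false Q 0) (Or.inr (by rw [oddRels, if_neg h11]; rfl))
    rw [key] at h0
    simp only [zero_add] at h0
    by_cases hM1 : 1 < M
    · refine shift_rel (RA q M N) hq _ (M - 1) M ⟨by omega, by omega⟩ ?_ (hhv _ ⟨by omega, by omega⟩) _ _ h0 n
      obtain ⟨m, rfl⟩ : ∃ m, M = m + 1 := ⟨M - 1, by omega⟩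
      rw [Nat.add_sub_cancel, cc_succ]
      rcases lof_or (m + 1) (m + 1) with h | h <;> rw [h] <;> norm_num
    · refine shift_rel (RA q M N) hq _ (M + 1) M ⟨by omega, by omega⟩ ?_ (hhv _ ⟨by omega, by omega⟩) _ _ h0 n
      rw [cc_succ']
      rcases lof_or M (M + 1) with h | h <;> rw [h] <;> norm_num
  · intro S hv hxp hxm hk hki hh
    rw [eq_top_iff]
    intro x _
    obtain ⟨a, rfl⟩ : ∃ a : ALG q M N false 3, a • wv q M N Λ Q = x := by
      obtain ⟨a, ha⟩ := Submodule.Quotient.mk_surjective (weylIdeal q M N false Λ Q) x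
      exact ⟨a, by rw [wv_smul]; exact ha⟩
    have : a ∈ (Stab S : Subalgebra ℂ (ALG q M N false 3)) := by
      refine ALG_induction q M N (p := fun a => a ∈ (Stab S : Subalgebra ℂ (ALG q M N false 3))) a ?_ hxp hxm hk hki hh ?_ ?_
      · exact fun c => Subalgebra.algebraMap_mem _ c
      · exact fun a b => Subalgebra.add_mem _
      · exact fun a b => Subalgebra.mul_mem _
    exact this _ hv

theorem weyl_finite (hq : QOK q) (hM : 1 ≤ M) (hN : 1 ≤ N) (Λ : HW q M N) (Q : Polynomial ℂ)
    (hQ1 : Q.coeff 0 = 1) : FiniteDimensional ℂ (WeylMod q M N false Λ Q) :=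
  (weyl_UP hq hM hN Λ Q hQ1).finite
end

section
variable {A : Type} [Ring A] [Algebra ℂ A]

/-- exchange relation -/
def XC (β : ℂ) (φ x : ℤ → A) : Prop := ∀ n m, φ (n + 1) * x m - β • (x m * φ (n + 1)) =
  β • (φ n * x (m + 1)) - x (m + 1) * φ n

theorem XC.rel {β : ℂ} {φ x : ℤ → A} (h : XC β φ x) (n m : ℤ) :
    φ (n + 1) * x m - β • (x m * φ (n + 1)) - β • (φ n * x (m + 1)) + x (m + 1) * φ n = 0 := by
  have := h n m
  rw [this]; abel

def HB (φ : ℤ → A) : Prop := (∀ k, k < 0 → φ k = 0) ∨ (∀ k, 0 < k → φ k = 0)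

theorem rec_zero (α β : ℂ) (hα : α ≠ 0) (hβ : β ≠ 0) (f : ℤ → ℤ → ℤ → A)
    (hf : ∀ k m n, f (k + 1 + 1) m n - α • f (k + 1) (m + 1) n - β • f (k + 1) m (n + 1)
      + (α * β) • f k (m + 1) (n + 1) = 0)
    (hz : (∀ k, k < 0 → ∀ m n, f k m n = 0) ∨ (∀ k, 0 < k → ∀ m n, f k m n = 0)) (k m n : ℤ) :
    f k m n = 0 := by
  rcases hz with hz | hz
  · have key : ∀ r : ℕ, ∀ k : ℤ, k < r → ∀ m n, f k m n = 0 := by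
      intro r
      induction r with
      | zero => intro k hk; exact hz k (by simpa using hk)
      | succ r ih =>
        intro k hk m n
        have := hf (k - 1 - 1) m n
        rw [sub_add_cancel, sub_add_cancel, ih (k - 1) (by omega), ih (k - 1) (by omega),
          ih (k - 1 - 1) (by omega)] at this
        simpa using this
    exact key (k.toNat + 1) k (by omega) m n
  · have key : ∀ r : ℕ, ∀ k : ℤ, -(r : ℤ) < k → ∀ m n, f k m n = 0 := by
      intro r
      induction r with
      | zero => intro k hk; exact hz k (by simpa using hk)
      | succ r ih =>
        intro k hk m n
        have := hf k (m - 1) (n - 1)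
        rw [sub_add_cancel, sub_add_cancel, ih (k + 1) (by omega), ih (k + 1) (by omega),
          ih (k + 1 + 1) (by omega)] at this
        simp only [smul_zero, sub_zero, zero_add] at this
        exact (smul_eq_zero.1 this).resolve_left (mul_ne_zero hα hβ)
    exact key ((-k).toNat + 1) k (by omega) m n

theorem serre_j (β γ : ℂ) (hβ : β ≠ 0) (hγ : γ = β⁻¹ ^ 2) (φ x : ℤ → A) (hz : HB φ)
    (hφ : XC β φ x) (hx : XC γ x x) (k m n : ℤ) :
    x m * (x n * φ k) + x n * (x m * φ k) - (β + β⁻¹) • (x m * (φ k * x n) + x n * (φ k * x m))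
      + φ k * (x m * x n) + φ k * (x n * x m) = 0 := by
  refine rec_zero β β hβ hβ (fun k m n => x m * (x n * φ k) + x n * (x m * φ k)
    - (β + β⁻¹) • (x m * (φ k * x n) + x n * (φ k * x m))
      + φ k * (x m * x n) + φ k * (x n * x m)) (fun k m n => ?_) ?_ k m n
  · have hmul : ∀ (m n k l : ℤ), φ (k + 1) * (x m * x n) - β • (x m * (φ (k + 1) * x n))
        - β • (φ k * (x (m + 1) * x n)) + x (m + 1) * (φ k * x n) = 0 := fun m n k l => by
      have := congrArg (fun z => z * x n) (hφ.rel k m)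
      simpa only [add_mul, sub_mul, smul_mul_assoc, mul_assoc, zero_mul] using this
    have hmul' : ∀ (m n k : ℤ), x m * (φ (k + 1) * x n) - β • (x m * (x n * φ (k + 1)))
        - β • (x m * (φ k * x (n + 1))) + x m * (x (n + 1) * φ k) = 0 := fun m n k => by
      have := congrArg (fun z => x m * z) (hφ.rel k n)
      simpa only [mul_add, mul_sub, mul_smul_comm, mul_assoc, mul_zero] using this
    have hG : x (m + 1) * (x n * φ (k + 1)) - γ • (x n * (x (m + 1) * φ (k + 1)))
        - γ • (x m * (x (n + 1) * φ (k + 1))) + x (n + 1) * (x m * φ (k + 1)) = 0 := by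
      have := congrArg (fun z => z * φ (k + 1)) (hx.rel m n)
      simpa only [add_mul, sub_mul, smul_mul_assoc, mul_assoc, zero_mul] using this
    subst hγ
    have e1 := hmul m n (k + 1) 0
    have e2 := hmul m (n + 1) k 0
    have e3 := hmul n m (k + 1) 0
    have e4 := hmul n (m + 1) k 0
    have e5 := hmul' m n (k + 1)
    have e6 := hmul' (m + 1) n k
    have e7 := hmul' n m (k + 1)
    have e8 := hmul' (n + 1) m k
    linear_combination (norm := skip) e1 - β • e2 + e3 - β • e4 + (β - (β + β⁻¹)) • e5
      - (1 - (β + β⁻¹) * β) • e6 + (β - (β + β⁻¹)) • e7 - (1 - (β + β⁻¹) * β) • e8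
      + ((β ^ 2 - 1) * β) • hG
    match_scalars <;> field_simp <;> ring
  · rcases hz with h | h
    · left; intro k hk m n; simp [h k hk]
    · right; intro k hk m n; simp [h k hk]

theorem serre_i (β γ : ℂ) (hβ : β ≠ 0) (hγ : γ = β⁻¹ ^ 2) (φ x y : ℤ → A) (hz : HB φ)
    (hφx : XC γ φ x) (hφy : XC β φ y) (hxy : XC β x y) (k n l : ℤ) :
    φ k * (x n * y l) - (β + β⁻¹) • (φ k * (y l * x n)) + y l * (φ k * x n) + x n * (φ k * y l)
      - (β + β⁻¹) • (x n * (y l * φ k)) + y l * (x n * φ k) = 0 := by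
  refine rec_zero γ β (by rw [hγ]; exact pow_ne_zero _ (inv_ne_zero hβ)) hβ (fun k n l => φ k * (x n * y l) - (β + β⁻¹) • (φ k * (y l * x n)) + y l * (φ k * x n) + x n * (φ k * y l)
      - (β + β⁻¹) • (x n * (y l * φ k)) + y l * (x n * φ k)) (fun k n l => ?_) ?_ k n l
  · have hR : ∀ (u y : ℤ → A) (δ : ℂ) (h : XC δ φ u) (n : ℤ) (z : A) (k : ℤ), φ (k + 1) * (u n * z) - δ • (u n * (φ (k + 1) * z))
        - δ • (φ k * (u (n + 1) * z)) + u (n + 1) * (φ k * z) = 0 := fun u y δ h n z k => by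
      have := congrArg (fun w => w * z) (h.rel k n)
      simpa only [add_mul, sub_mul, smul_mul_assoc, mul_assoc, zero_mul] using this
    have hL : ∀ (u y : ℤ → A) (δ : ℂ) (h : XC δ φ u) (n : ℤ) (z : A) (k : ℤ), z * (φ (k + 1) * u n) - δ • (z * (u n * φ (k + 1)))
        - δ • (z * (φ k * u (n + 1))) + z * (u (n + 1) * φ k) = 0 := fun u y δ h n z k => by
      have := congrArg (fun w => z * w) (h.rel k n)
      simpa only [mul_add, mul_sub, mul_smul_comm, mul_assoc, mul_zero] using this
    have hG : x (n + 1) * (y l * φ (k + 1)) - β • (y l * (x (n + 1) * φ (k + 1)))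
        - β • (x n * (y (l + 1) * φ (k + 1))) + y (l + 1) * (x n * φ (k + 1)) = 0 := by
      have := congrArg (fun z => z * φ (k + 1)) (hxy.rel n l)
      simpa only [add_mul, sub_mul, smul_mul_assoc, mul_assoc, zero_mul] using this
    subst hγ
    have a1 := hR x y _ hφx n (y l) (k + 1)
    have a2 := hR x y _ hφx n (y (l + 1)) k
    have a3 := hL y y _ hφy l (x n) (k + 1)
    have a4 := hL y y _ hφy l (x (n + 1)) k
    have b1 := hR y y _ hφy l (x n) (k + 1)
    have b2 := hR y y _ hφy l (x (n + 1)) k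
    have b3 := hL x y _ hφx n (y l) (k + 1)
    have b4 := hL x y _ hφx n (y (l + 1)) k
    linear_combination (norm := skip) a1 - β • a2 + (β⁻¹ ^ 2) • a3 - a4
      - (β + β⁻¹) • (b1 - (β⁻¹ ^ 2) • b2 + β • b3 - b4) + (b3 - β • b4) + (a3 - (β⁻¹ ^ 2) • a4)
      - ((β + β⁻¹) * β⁻¹ * (β - β⁻¹)) • hG
    match_scalars <;> field_simp <;> ring
  · rcases hz with h | h
    · left; intro k hk m n; simp [h k hk]
    · right; intro k hk m n; simp [h k hk]
end

section
variable {A : Type} [Ring A] [Algebra ℂ A]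

/-- multiplied exchange relation -/
theorem XC.rel3 {β : ℂ} {φ x : ℤ → A} (h : XC β φ x) (y z : A) (n m : ℤ) :
    y * (φ (n + 1) * (x m * z)) - β • (y * (x m * (φ (n + 1) * z)))
      - β • (y * (φ n * (x (m + 1) * z))) + y * (x (m + 1) * (φ n * z)) = 0 := by
  have := congrArg (fun w => y * (w * z)) (h.rel n m)
  simpa only [add_mul, sub_mul, smul_mul_assoc, mul_assoc, zero_mul, mul_add, mul_sub,
    mul_smul_comm, mul_zero] using this

theorem osc_M (β : ℂ) (hβ : β ≠ 0) (φ a c : ℤ → A) (d : ℤ → A) (hz : HB φ)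
    (hd : ∀ k t, φ k * d t = d t * φ k) (hc : ∀ m n, c n * a m = a m * c n)
    (ha : XC β φ a) (hcc : XC β⁻¹ φ c) (had : XC β a d) (hcd : XC β⁻¹ c d) (k m n t : ℤ) :
    a m * (φ k * (c n * d t)) - a m * (d t * (c n * φ k)) + c n * (φ k * (a m * d t))
    - c n * (d t * (a m * φ k)) - d t * (a m * (φ k * c n)) + φ k * (a m * (d t * c n))
    - d t * (c n * (φ k * a m)) + φ k * (c n * (d t * a m))
    - (β + β⁻¹) • (φ k * (a m * (c n * d t)) - d t * (a m * (c n * φ k))) = 0 := by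
  have hd' : ∀ k t z, φ k * (d t * z) = d t * (φ k * z) := fun k t z => by
    rw [← mul_assoc, hd, mul_assoc]
  have hc' : ∀ m n z, c n * (a m * z) = a m * (c n * z) := fun m n z => by
    rw [← mul_assoc, hc, mul_assoc]
  refine rec_zero β β⁻¹ hβ (inv_ne_zero hβ) (fun k m n => a m * (φ k * (c n * d t)) - a m * (d t * (c n * φ k)) + c n * (φ k * (a m * d t))
    - c n * (d t * (a m * φ k)) - d t * (a m * (φ k * c n)) + φ k * (a m * (d t * c n))
    - d t * (c n * (φ k * a m)) + φ k * (c n * (d t * a m))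
    - (β + β⁻¹) • (φ k * (a m * (c n * d t)) - d t * (a m * (c n * φ k)))) (fun k m n => ?_) ?_ k m n
  · have e1 := hcc.rel3 (a m) (d t) (k + 1) n
    have e2 := hcc.rel3 (a (m + 1)) (d t) k n
    have e3 := ha.rel3 (c n) (d t) (k + 1) m
    have e4 := ha.rel3 (c (n + 1)) (d t) k m
    have e5 := hcc.rel3 (d t * a m) 1 (k + 1) n
    have e6 := hcc.rel3 (d t * a (m + 1)) 1 k n
    have e7 := ha.rel3 1 (d t * c n) (k + 1) m
    have e8 := ha.rel3 1 (d t * c (n + 1)) k m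
    have e9 := hcc.rel3 (a m * d t) 1 (k + 1) n
    have e10 := hcc.rel3 (a (m + 1) * d t) 1 k n
    have e11 := ha.rel3 (d t * c n) 1 (k + 1) m
    have e12 := ha.rel3 (d t * c (n + 1)) 1 k m
    have e13 := hcc.rel3 1 (d t * a m) (k + 1) n
    have e14 := hcc.rel3 1 (d t * a (m + 1)) k n
    have e15 := ha.rel3 (c n * d t) 1 (k + 1) m
    have e16 := ha.rel3 (c (n + 1) * d t) 1 k m
    have e17 := ha.rel3 1 (c n * d t) (k + 1) m
    have e18 := ha.rel3 1 (c (n + 1) * d t) k m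
    have g1 := had.rel3 (c n) (φ (k + 1)) m t
    have g2 := had.rel3 1 (c n * φ (k + 1)) m t
    have g3 := hcd.rel3 (a m) (φ (k + 1)) n t
    have g4 := hcd.rel3 1 (a m * φ (k + 1)) n t
    simp only [mul_one, one_mul, mul_assoc, hd, hd', hc, hc'] at *
    linear_combination (norm := skip) (e1 - β • e2) + (e3 - β⁻¹ • e4) - (e5 - β • e6)
      + (e7 - β⁻¹ • e8 + β • e9 - e10) - (e11 - β⁻¹ • e12) + (e13 - β • e14 + β⁻¹ • e15 - e16)
      - (β + β⁻¹) • (e17 - β⁻¹ • e18 + β • e1 - e2)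
      + (β - β⁻¹) • (-(β⁻¹ • g1) + g2 + β • g3 - g4)
    match_scalars <;> field_simp <;> ring
  · rcases hz with h | h
    · left; intro k hk m n; simp [h k hk]
    · right; intro k hk m n; simp [h k hk]

theorem osc_a (β : ℂ) (hβ : β ≠ 0) (φ b d : ℤ → A) (c : ℤ → A) (hz : HB φ)
    (hc : ∀ k l, φ k * c l = c l * φ k) (hdb : ∀ m n, d n * b m = - (b m * d n))
    (hb : XC β φ b) (hd : XC β φ d) (hcb : XC β⁻¹ c b) (hcd : XC β⁻¹ c d) (k m n l : ℤ) :
    φ k * (b m * (c l * d n)) + φ k * (d n * (c l * b m)) + c l * (b m * (φ k * d n))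
    + c l * (d n * (φ k * b m)) + d n * (φ k * (b m * c l)) + b m * (φ k * (d n * c l))
    + d n * (c l * (b m * φ k)) + b m * (c l * (d n * φ k))
    - (β + β⁻¹) • (b m * (φ k * (c l * d n)) + d n * (φ k * (c l * b m))) = 0 := by
  have hc' : ∀ k t z, φ k * (c t * z) = c t * (φ k * z) := fun k t z => by
    rw [← mul_assoc, hc, mul_assoc]
  have hdb' : ∀ m n z, d n * (b m * z) = - (b m * (d n * z)) := fun m n z => by
    rw [← mul_assoc, hdb, neg_mul, mul_assoc]
  refine rec_zero β β hβ hβ (fun k m n => φ k * (b m * (c l * d n)) + φ k * (d n * (c l * b m)) + c l * (b m * (φ k * d n))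
    + c l * (d n * (φ k * b m)) + d n * (φ k * (b m * c l)) + b m * (φ k * (d n * c l))
    + d n * (c l * (b m * φ k)) + b m * (c l * (d n * φ k))
    - (β + β⁻¹) • (b m * (φ k * (c l * d n)) + d n * (φ k * (c l * b m)))) (fun k m n => ?_) ?_ k m n
  · have e1 := hb.rel3 1 (c l * d n) (k + 1) m
    have e2 := hb.rel3 1 (c l * d (n + 1)) k m
    have e3 := hd.rel3 (b m * c l) 1 (k + 1) n
    have e4 := hd.rel3 (b (m + 1) * c l) 1 k n
    have f1 := hd.rel3 1 (c l * b m) (k + 1) n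
    have f2 := hd.rel3 1 (c l * b (m + 1)) k n
    have f3 := hb.rel3 (d n * c l) 1 (k + 1) m
    have f4 := hb.rel3 (d (n + 1) * c l) 1 k m
    have e5 := hd.rel3 (c l * b m) 1 (k + 1) n
    have e6 := hd.rel3 (c l * b (m + 1)) 1 k n
    have f5 := hb.rel3 (c l * d n) 1 (k + 1) m
    have f6 := hb.rel3 (c l * d (n + 1)) 1 k m
    have e7 := hd.rel3 (b m) (c l) (k + 1) n
    have e8 := hd.rel3 (b (m + 1)) (c l) k n
    have f7 := hb.rel3 (d n) (c l) (k + 1) m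
    have f8 := hb.rel3 (d (n + 1)) (c l) k m
    have g1 := hcb.rel3 1 (d n * φ (k + 1)) l m
    have g2 := hcd.rel3 (b m) (φ (k + 1)) l n
    have g3 := hcb.rel3 (d n) (φ (k + 1)) l m
    have g4 := hcd.rel3 1 (b m * φ (k + 1)) l n
    simp only [mul_one, one_mul, mul_assoc, hc, hc', hdb, hdb', mul_neg, neg_mul] at *
    linear_combination (norm := skip) (e1 - β • e2 + β • e3 - e4) + (f1 - β • f2 + β • f3 - f4)
      + (e5 - β • e6) + (f5 - β • f6) + (e7 - β • e8) + (f7 - β • f8)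
      - (β + β⁻¹) • (e3 - β • e4 + f3 - β • f4)
      + (β - β⁻¹) • ((β ^ 2) • g1 + β • g2 + β • g3 + (β ^ 2) • g4)
    match_scalars <;> field_simp <;> ring
  · rcases hz with h | h
    · left; intro k hk m n; simp [h k hk]
    · right; intro k hk m n; simp [h k hk]
end

section
section
variable {A : Type} [Ring A] [Algebra ℂ A]

def D4 (s : ℂ) (x y : A) : A := x * y - s • (y * x)
def D5 (β : ℂ) (X Y : ℤ → A) (m n : ℤ) : A :=
  X (m + 1) * Y n - β • (Y n * X (m + 1)) - β • (X m * Y (n + 1)) + Y (n + 1) * X m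
def S6 (s : ℂ) (x x' y : A) : A :=
  x * (x' * y) + x' * (x * y) + y * (x * x') + y * (x' * x) - s • (x * (y * x') + x' * (y * x))
def S7 (s : ℂ) (a b c d : A) : A :=
  a * (b * (c * d)) + a * (d * (c * b)) + c * (b * (a * d)) + c * (d * (a * b))
  + d * (a * (b * c)) + b * (a * (d * c)) + d * (c * (b * a)) + b * (c * (d * a))
  - s • (b * (a * (c * d)) + d * (a * (c * b)))

theorem D4_comm (s sx sy : ℂ) (x y C fx fy : A) (hx : x * C = sx • (C * x) + fx)
    (hy : y * C = sy • (C * y) + fy) (h1 : x * fy = (s * sx) • (fy * x))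
    (h2 : sy • (fx * y) = s • (y * fx)) :
    D4 s x y * C = (sx * sy) • (C * D4 s x y) := by
  have hx' : ∀ z, x * (C * z) = sx • (C * (x * z)) + fx * z := fun z => by
    rw [← mul_assoc, hx, add_mul, smul_mul_assoc, mul_assoc]
  have hy' : ∀ z, y * (C * z) = sy • (C * (y * z)) + fy * z := fun z => by
    rw [← mul_assoc, hy, add_mul, smul_mul_assoc, mul_assoc]
  simp only [D4, sub_mul, mul_sub, smul_mul_assoc, mul_assoc, hx, hy, hx', hy', mul_add,
    mul_smul_comm, smul_add, smul_sub]
  linear_combination (norm := module) h1 + h2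

theorem D5_comm (β sx sy : ℂ) (X Y fx fy : ℤ → A) (C : A) (hx : ∀ m, X m * C = sx • (C * X m) + fx m)
    (hy : ∀ m, Y m * C = sy • (C * Y m) + fy m) (m n : ℤ)
    (h1 : X (m + 1) * fy n - (β * sx) • (fy n * X (m + 1)) - β • (X m * fy (n + 1)) +
      sx • (fy (n + 1) * X m) = 0)
    (h2 : sy • (fx (m + 1) * Y n) - β • (Y n * fx (m + 1)) - (β * sy) • (fx m * Y (n + 1))
      + Y (n + 1) * fx m = 0) :
    D5 β X Y m n * C = (sx * sy) • (C * D5 β X Y m n) := by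
  have hx' : ∀ m z, X m * (C * z) = sx • (C * (X m * z)) + fx m * z := fun m z => by
    rw [← mul_assoc, hx, add_mul, smul_mul_assoc, mul_assoc]
  have hy' : ∀ m z, Y m * (C * z) = sy • (C * (Y m * z)) + fy m * z := fun m z => by
    rw [← mul_assoc, hy, add_mul, smul_mul_assoc, mul_assoc]
  simp only [D5, sub_mul, mul_sub, add_mul, smul_mul_assoc, mul_assoc, hx, hy, hx', hy', mul_add,
    mul_smul_comm, smul_add, smul_sub]
  linear_combination (norm := module) h1 + h2

theorem S6_comm_j (s sy : ℂ) (x x' y C fy : A) (hx : x * C = C * x) (hx1 : x' * C = C * x')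
    (hy : y * C = sy • (C * y) + fy)
    (h1 : x * (x' * fy) + x' * (x * fy) - s • (x * (fy * x') + x' * (fy * x))
      + fy * (x * x') + fy * (x' * x) = 0) :
    S6 s x x' y * C = sy • (C * S6 s x x' y) := by
  have hx' : ∀ z, x * (C * z) = C * (x * z) := fun z => by rw [← mul_assoc, hx, mul_assoc]
  have hx1' : ∀ z, x' * (C * z) = C * (x' * z) := fun z => by rw [← mul_assoc, hx1, mul_assoc]
  have hy' : ∀ z, y * (C * z) = sy • (C * (y * z)) + fy * z := fun z => by
    rw [← mul_assoc, hy, add_mul, smul_mul_assoc, mul_assoc]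
  simp only [S6, sub_mul, mul_sub, add_mul, smul_mul_assoc, mul_assoc, hx, hx1, hy, hx', hx1', hy',
    mul_add, mul_smul_comm, smul_add, smul_sub] at h1 ⊢
  linear_combination (norm := module) h1

theorem S6_comm_i (s : ℂ) (x x' y C f f' : A) (hx : x * C = C * x + f)
    (hx1 : x' * C = C * x' + f') (hy : y * C = C * y)
    (h1 : f * (x' * y) - s • (f * (y * x')) + y * (f * x') + x' * (f * y)
      - s • (x' * (y * f)) + y * (x' * f) = 0)
    (h2 : f' * (x * y) - s • (f' * (y * x)) + y * (f' * x) + x * (f' * y)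
      - s • (x * (y * f')) + y * (x * f') = 0) :
    S6 s x x' y * C = (1 : ℂ) • (C * S6 s x x' y) := by
  have hx' : ∀ z, x * (C * z) = C * (x * z) + f * z := fun z => by
    rw [← mul_assoc, hx, add_mul, mul_assoc]
  have hx1' : ∀ z, x' * (C * z) = C * (x' * z) + f' * z := fun z => by
    rw [← mul_assoc, hx1, add_mul, mul_assoc]
  have hy' : ∀ z, y * (C * z) = C * (y * z) := fun z => by rw [← mul_assoc, hy, mul_assoc]
  simp only [S6, sub_mul, mul_sub, add_mul, smul_mul_assoc, mul_assoc, hx, hx1, hy, hx', hx1', hy',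
    mul_add, mul_smul_comm, smul_add, smul_sub] at h1 h2 ⊢
  linear_combination (norm := module) h1 + h2

theorem S7_comm_even (s : ℂ) (a b c d C fa fc : A) (ha : a * C = C * a + fa)
    (hb : b * C = C * b) (hc : c * C = C * c + fc) (hd : d * C = C * d)
    (h1 : fa * (b * (c * d)) + fa * (d * (c * b)) + c * (b * (fa * d))
    + c * (d * (fa * b)) + d * (fa * (b * c)) + b * (fa * (d * c))
    + d * (c * (b * fa)) + b * (c * (d * fa))
    - s • (b * (fa * (c * d)) + d * (fa * (c * b))) = 0)
    (h2 : fc * (b * (a * d)) + fc * (d * (a * b)) + a * (b * (fc * d))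
    + a * (d * (fc * b)) + d * (fc * (b * a)) + b * (fc * (d * a))
    + d * (a * (b * fc)) + b * (a * (d * fc))
    - s • (b * (a * (fc * d)) + d * (a * (fc * b))) = 0) :
    S7 s a b c d * C = (1 : ℂ) • (C * S7 s a b c d) := by
  have ha' : ∀ z, a * (C * z) = C * (a * z) + fa * z := fun z => by
    rw [← mul_assoc, ha, add_mul, mul_assoc]
  have hc' : ∀ z, c * (C * z) = C * (c * z) + fc * z := fun z => by
    rw [← mul_assoc, hc, add_mul, mul_assoc]
  have hb' : ∀ z, b * (C * z) = C * (b * z) := fun z => by rw [← mul_assoc, hb, mul_assoc]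
  have hd' : ∀ z, d * (C * z) = C * (d * z) := fun z => by rw [← mul_assoc, hd, mul_assoc]
  simp only [S7, sub_mul, mul_sub, add_mul, smul_mul_assoc, mul_assoc, ha, hb, hc, hd, ha', hb',
    hc', hd', mul_add, mul_smul_comm, smul_add, smul_sub] at h1 h2 ⊢
  linear_combination (norm := module) h1 + h2

theorem S7_comm_odd (s : ℂ) (a b c d C fb fd : A) (ha : a * C = C * a)
    (hb : b * C = -(C * b) + fb) (hc : c * C = C * c) (hd : d * C = -(C * d) + fd)
    (h1 : a * (fb * (c * d)) - a * (d * (c * fb)) + c * (fb * (a * d))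
    - c * (d * (a * fb)) - d * (a * (fb * c)) + fb * (a * (d * c))
    - d * (c * (fb * a)) + fb * (c * (d * a))
    - s • (fb * (a * (c * d)) - d * (a * (c * fb))) = 0)
    (h2 : a * (fd * (c * b)) - a * (b * (c * fd)) + c * (fd * (a * b))
    - c * (b * (a * fd)) - b * (a * (fd * c)) + fd * (a * (b * c))
    - b * (c * (fd * a)) + fd * (c * (b * a))
    - s • (fd * (a * (c * b)) - b * (a * (c * fd))) = 0) :
    S7 s a b c d * C = (1 : ℂ) • (C * S7 s a b c d) := by
  have hb' : ∀ z, b * (C * z) = -(C * (b * z)) + fb * z := fun z => by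
    rw [← mul_assoc, hb, add_mul, neg_mul, mul_assoc]
  have hd' : ∀ z, d * (C * z) = -(C * (d * z)) + fd * z := fun z => by
    rw [← mul_assoc, hd, add_mul, neg_mul, mul_assoc]
  have ha' : ∀ z, a * (C * z) = C * (a * z) := fun z => by rw [← mul_assoc, ha, mul_assoc]
  have hc' : ∀ z, c * (C * z) = C * (c * z) := fun z => by rw [← mul_assoc, hc, mul_assoc]
  simp only [S7, sub_mul, mul_sub, add_mul, smul_mul_assoc, mul_assoc, ha, hb, hc, hd, ha', hb',
    hc', hd', mul_add, mul_smul_comm, smul_add, smul_sub, mul_neg, neg_mul] at h1 h2 ⊢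
  linear_combination (norm := module) -h1 - h2

end

section
variable {q : ℂ} {M N : ℕ} {A : Type} [Ring A] [Algebra ℂ A]

theorem RD.fp_xp (R : RD q M N A) (hq : QOK q) (i j : ℕ) : XC (q ^ cc M i j) (R.fp i) (R.xp j) := by
  intro n m
  by_cases hi : vld M N i
  · exact fpOf_comm _ _ (zpow_ne_zero _ hq.ne0) _ _ _ (R.kxp i j) (R.kh i i) (R.hxp' hq i j hi) n m
  · simp [RD.fp, fpOf, R.k0 i hi]

theorem RD.fm_xp (R : RD q M N A) (hq : QOK q) (i j : ℕ) : XC (q ^ cc M i j) (R.fm i) (R.xp j) := by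
  intro n m
  by_cases hi : vld M N i
  · exact fmOf_comm _ _ (zpow_ne_zero _ hq.ne0) _ _ _ (R.kixp hq i j) (R.kih i i) (R.hxp' hq i j hi) n m
  · simp [RD.fm, fmOf, R.ki0 i hi]

theorem RD.fp_hb (R : RD q M N A) (i : ℕ) : HB (R.fp i) := Or.inl fun k hk => R.fp_neg i k hk
theorem RD.fm_hb (R : RD q M N A) (i : ℕ) : HB (R.fm i) := Or.inr fun k hk => R.fm_pos i k hk

theorem XC_comm {φ x : ℤ → A} (h : XC 1 φ x) (hz : HB φ) (k m : ℤ) : φ k * x m = x m * φ k := by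
  have key : ∀ k m, φ (k + 1) * x m - x m * φ (k + 1) = φ k * x (m + 1) - x (m + 1) * φ k := by
    intro k m; simpa using h k m
  rcases hz with hz | hz
  · have : ∀ r : ℕ, ∀ k : ℤ, k < r → ∀ m, φ k * x m - x m * φ k = 0 := by
      intro r
      induction r with
      | zero => intro k hk m; simp [hz k (by simpa using hk)]
      | succ r ih =>
        intro k hk m
        have := key (k - 1) m
        rw [sub_add_cancel] at this
        rw [this, ih _ (by omega)]
    exact sub_eq_zero.1 (this (k.toNat + 1) k (by omega) m)
  · have : ∀ r : ℕ, ∀ k : ℤ, -(r : ℤ) < k → ∀ m, φ k * x m - x m * φ k = 0 := by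
      intro r
      induction r with
      | zero => intro k hk m; simp [hz k (by simpa using hk)]
      | succ r ih =>
        intro k hk m
        have := key k (m - 1)
        rw [sub_add_cancel] at this
        rw [← this, ih _ (by omega)]
    exact sub_eq_zero.1 (this ((-k).toNat + 1) k (by omega) m)

theorem RD.Φ_xp (R : RD q M N A) (hq : QOK q) (i j : ℕ) : XC (q ^ cc M i j) (R.Φ i) (R.xp j) := by
  intro n m
  have h1 := (R.fp_xp hq i j).rel n m
  have h2 := (R.fm_xp hq i j).rel n m
  unfold RD.Φ
  simp only [smul_mul_assoc, mul_smul_comm, sub_mul, mul_sub]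
  linear_combination (norm := module) (tq q M i)⁻¹ • (h1 - h2)

theorem RD.fp_xp0 (R : RD q M N A) (hq : QOK q) (i j : ℕ) (h : cc M i j = 0) (n m : ℤ) :
    R.fp i n * R.xp j m = R.xp j m * R.fp i n :=
  XC_comm (by have := R.fp_xp hq i j; rwa [h, zpow_zero] at this) (R.fp_hb i) n m
theorem RD.fm_xp0 (R : RD q M N A) (hq : QOK q) (i j : ℕ) (h : cc M i j = 0) (n m : ℤ) :
    R.fm i n * R.xp j m = R.xp j m * R.fm i n :=
  XC_comm (by have := R.fm_xp hq i j; rwa [h, zpow_zero] at this) (R.fm_hb i) n m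
theorem RD.Φ_xp0 (R : RD q M N A) (hq : QOK q) (i j : ℕ) (h : cc M i j = 0) (n m : ℤ) :
    R.Φ i n * R.xp j m = R.xp j m * R.Φ i n := by
  unfold RD.Φ
  rw [smul_mul_assoc, mul_smul_comm, sub_mul, mul_sub, R.fp_xp0 hq i j h, R.fm_xp0 hq i j h]

theorem RD.c4 (R : RD q M N A) (hq : QOK q) (i j l : ℕ) (m n p : ℤ) (h : cc M i j = 0) :
    ∃ s : ℂ, D4 (sgn M i j) (R.xp i m) (R.xp j n) * R.xm l p =
      s • (R.xm l p * D4 (sgn M i j) (R.xp i m) (R.xp j n)) := by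
  refine ⟨_, D4_comm _ _ _ _ _ _ _ _ (R.comm i l m p) (R.comm j l n p) ?_ ?_⟩
  · split_ifs with hl
    · subst hl
      rw [sgn_sq, one_smul, R.Φ_xp0 hq _ _ (by rw [cc_symm]; exact h)]
    · simp
  · split_ifs with hl
    · subst hl
      rw [R.Φ_xp0 hq _ _ h, sgn_symm]
    · simp

theorem cc_ne_sgn (M i j : ℕ) (h : cc M i j ≠ 0) : sgn M i j = 1 := by
  apply sgn_ne
  by_contra hc
  push Not at hc
  obtain ⟨rfl, rfl⟩ := hc
  exact h (cc_self_M _)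

theorem RD.c5 (R : RD q M N A) (hq : QOK q) (i j l : ℕ) (m n p : ℤ) (h : cc M i j ≠ 0) :
    ∃ s : ℂ, D5 (q ^ cc M i j) (R.xp i) (R.xp j) m n * R.xm l p =
      s • (R.xm l p * D5 (q ^ cc M i j) (R.xp i) (R.xp j) m n) := by
  refine ⟨_, D5_comm _ _ _ _ _ _ _ _ (fun m => R.comm i l m p) (fun m => R.comm j l m p) _ _ ?_ ?_⟩
  · split_ifs with hl
    · subst hl
      rw [cc_ne_sgn _ _ _ h]
      have := (R.Φ_xp hq j i).rel (n + p) m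
      rw [cc_symm, show n + 1 + p = n + p + 1 by ring]
      linear_combination (norm := module) this
    · simp
  · split_ifs with hl
    · subst hl
      rw [cc_ne_sgn _ _ _ (by rw [cc_symm]; exact h)]
      have := (R.Φ_xp hq i j).rel (m + p) n
      rw [show m + 1 + p = m + p + 1 by ring]
      linear_combination (norm := module) this
    · simp

end
end

section
variable {q : ℂ} {M N : ℕ} {A : Type} [Ring A] [Algebra ℂ A]

theorem SR2.xc {X : ℕ → ℤ → A} (h : SR2 q M X) (i j : ℕ) (hc : cc M i j ≠ 0) :
    XC (q ^ cc M i j) (X i) (X j) := fun n m => h.r5 i j n m hc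

theorem q_sum (hq : QOK q) {c : ℤ} (h : c = 1 ∨ c = -1) : q ^ c + (q ^ c)⁻¹ = q + q⁻¹ := by
  rcases h with rfl | rfl
  · simp
  · simp [add_comm]

theorem cc_ii (M i j : ℕ) (h : cc M i j = 1 ∨ cc M i j = -1) (hi : i ≠ M) :
    cc M i i = -2 * cc M i j := by
  rw [cc_self_even M i hi]
  have hh : j = i + 1 ∨ i = j + 1 ∨ i = j := by
    by_contra hc
    push Not at hc
    have := cc_far M i j (by omega)
    omega
  rcases hh with rfl | rfl | rfl
  · rw [cc_succ]; unfold lof; split_ifs <;> omega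
  · rw [cc_succ']; omega
  · rw [cc_self_even M i hi] at h
    unfold lof at h; split_ifs at h <;> omega

theorem RD.serre_jΦ (R : RD q M N A) (hq : QOK q) (hs : SR2 q M R.xp) (i j : ℕ)
    (hc : cc M i j = 1 ∨ cc M i j = -1) (hi : i ≠ M) (k m n : ℤ) :
    R.xp i m * (R.xp i n * R.Φ j k) + R.xp i n * (R.xp i m * R.Φ j k) -
      (q + q⁻¹) • (R.xp i m * (R.Φ j k * R.xp i n) + R.xp i n * (R.Φ j k * R.xp i m))
      + R.Φ j k * (R.xp i m * R.xp i n) + R.Φ j k * (R.xp i n * R.xp i m) = 0 := by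
  have hcii := cc_ii M i j hc hi
  have hγ : q ^ cc M i i = (q ^ cc M i j)⁻¹ ^ 2 := by
    rw [hcii, ← zpow_neg, ← zpow_natCast, ← zpow_mul]; congr 1; push_cast; ring
  have hcij : cc M i i ≠ 0 := by omega
  have h1 := serre_j _ _ (zpow_ne_zero _ hq.ne0) hγ (R.fp j) (R.xp i) (R.fp_hb j)
    (by rw [cc_symm]; exact R.fp_xp hq j i) (hs.xc i i hcij) k m n
  have h2 := serre_j _ _ (zpow_ne_zero _ hq.ne0) hγ (R.fm j) (R.xp i) (R.fm_hb j)
    (by rw [cc_symm]; exact R.fm_xp hq j i) (hs.xc i i hcij) k m n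
  rw [q_sum hq hc] at h1 h2
  unfold RD.Φ
  simp only [smul_mul_assoc, mul_smul_comm, sub_mul, mul_sub]
  linear_combination (norm := module) (tq q M j)⁻¹ • (h1 - h2)

theorem RD.serre_iΦ (R : RD q M N A) (hq : QOK q) (hs : SR2 q M R.xp) (i j : ℕ)
    (hc : cc M i j = 1 ∨ cc M i j = -1) (hi : i ≠ M) (k n l : ℤ) :
    R.Φ i k * (R.xp i n * R.xp j l) - (q + q⁻¹) • (R.Φ i k * (R.xp j l * R.xp i n))
      + R.xp j l * (R.Φ i k * R.xp i n) + R.xp i n * (R.Φ i k * R.xp j l)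
      - (q + q⁻¹) • (R.xp i n * (R.xp j l * R.Φ i k)) + R.xp j l * (R.xp i n * R.Φ i k) = 0 := by
  have hcii := cc_ii M i j hc hi
  have hγ : q ^ cc M i i = (q ^ cc M i j)⁻¹ ^ 2 := by
    rw [hcii, ← zpow_neg, ← zpow_natCast, ← zpow_mul]; congr 1; push_cast; ring
  have hcij : cc M i j ≠ 0 := by omega
  have h1 := serre_i _ _ (zpow_ne_zero _ hq.ne0) hγ (R.fp i) (R.xp i) (R.xp j) (R.fp_hb i)
    (R.fp_xp hq i i) (R.fp_xp hq i j) (hs.xc i j hcij) k n l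
  have h2 := serre_i _ _ (zpow_ne_zero _ hq.ne0) hγ (R.fm i) (R.xp i) (R.xp j) (R.fm_hb i)
    (R.fm_xp hq i i) (R.fm_xp hq i j) (hs.xc i j hcij) k n l
  rw [q_sum hq hc] at h1 h2
  unfold RD.Φ
  simp only [smul_mul_assoc, mul_smul_comm, sub_mul, mul_sub]
  linear_combination (norm := module) (tq q M i)⁻¹ • (h1 - h2)

theorem RD.c6 (R : RD q M N A) (hq : QOK q) (hs : SR2 q M R.xp) (i j l : ℕ) (m n k p : ℤ)
    (hc : cc M i j = 1 ∨ cc M i j = -1) (hi : i ≠ M) :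
    ∃ s : ℂ, S6 (q + q⁻¹) (R.xp i m) (R.xp i n) (R.xp j k) * R.xm l p =
      s • (R.xm l p * S6 (q + q⁻¹) (R.xp i m) (R.xp i n) (R.xp j k)) := by
  have hij : i ≠ j := by
    rintro rfl
    have := cc_ii M i i hc hi
    omega
  have hs1 : sgn M i l = 1 := sgn_ne _ _ _ (Or.inl hi)
  by_cases hl : i = l
  · subst hl
    refine ⟨_, S6_comm_i _ _ _ _ _ (R.Φ i (m + p)) (R.Φ i (n + p)) ?_ ?_ ?_ ?_ ?_⟩
    · rw [R.comm, hs1, one_smul, if_pos rfl]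
    · rw [R.comm, hs1, one_smul, if_pos rfl]
    · rw [R.comm, if_neg hij.symm, sgn_ne _ _ _ (Or.inr hi), one_smul, add_zero]
    · exact R.serre_iΦ hq hs i j hc hi _ _ _
    · exact R.serre_iΦ hq hs i j hc hi _ _ _
  · refine ⟨_, S6_comm_j _ _ _ _ _ _ _ ?_ ?_ (R.comm j l k p) ?_⟩
    · rw [R.comm, hs1, one_smul, if_neg hl, add_zero]
    · rw [R.comm, hs1, one_smul, if_neg hl, add_zero]
    · split_ifs with hjl
      · exact R.serre_jΦ hq hs i j hc hi _ _ _
      · simp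

theorem cc_ab (M : ℕ) (h : 1 < M) : cc M (M - 1) M = -1 := by
  have := cc_succ M (M - 1)
  rw [show M - 1 + 1 = M by omega] at this
  rw [this]; simp [lof]
theorem cc_bc (M : ℕ) : cc M M (M + 1) = 1 := by
  rw [cc_succ]; simp [lof]
theorem cc_ac (M : ℕ) (h : 1 < M) : cc M (M - 1) (M + 1) = 0 := cc_far _ _ _ (by omega)

theorem RD.osc_MΦ (R : RD q M N A) (hq : QOK q) (hs : SR2 q M R.xp) (hM : 1 < M) (k m n t : ℤ) :
    let a := R.xp (M - 1); let c := R.xp (M + 1); let d := R.xp M; let φ := R.Φ M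
    a m * (φ k * (c n * d t)) - a m * (d t * (c n * φ k)) + c n * (φ k * (a m * d t))
    - c n * (d t * (a m * φ k)) - d t * (a m * (φ k * c n)) + φ k * (a m * (d t * c n))
    - d t * (c n * (φ k * a m)) + φ k * (c n * (d t * a m))
    - (q + q⁻¹) • (φ k * (a m * (c n * d t)) - d t * (a m * (c n * φ k))) = 0 := by
  have hca : ∀ m n, R.xp (M + 1) n * R.xp (M - 1) m = R.xp (M - 1) m * R.xp (M + 1) n := by
    intro m n
    have := hs.r4 (M + 1) (M - 1) n m (by rw [cc_symm]; exact cc_ac M hM)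
    rw [sgn_ne _ _ _ (Or.inl (by omega)), one_smul] at this
    exact sub_eq_zero.1 this
  have e1 : q⁻¹ ≠ 0 := inv_ne_zero hq.ne0
  have had : XC q⁻¹ (R.xp (M - 1)) (R.xp M) := by
    have := hs.xc (M - 1) M (by rw [cc_ab M hM]; omega)
    rwa [cc_ab M hM, zpow_neg_one] at this
  have hcd : XC q⁻¹⁻¹ (R.xp (M + 1)) (R.xp M) := by
    have := hs.xc (M + 1) M (by rw [cc_symm, cc_bc]; omega)
    rw [cc_symm, cc_bc, zpow_one] at this; rwa [inv_inv]
  have hbr : cc M M (M - 1) = -1 := by rw [cc_symm, cc_ab M hM]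
  have h1 := osc_M q⁻¹ e1 (R.fp M) _ _ _ (R.fp_hb M) (R.fp_xp0 hq M M (cc_self_M M)) hca
    (by have := R.fp_xp hq M (M - 1); rwa [hbr, zpow_neg_one] at this)
    (by have := R.fp_xp hq M (M + 1); rw [cc_bc, zpow_one] at this; rwa [inv_inv]) had hcd k m n t
  have h2 := osc_M q⁻¹ e1 (R.fm M) _ _ _ (R.fm_hb M) (R.fm_xp0 hq M M (cc_self_M M)) hca
    (by have := R.fm_xp hq M (M - 1); rwa [hbr, zpow_neg_one] at this)
    (by have := R.fm_xp hq M (M + 1); rw [cc_bc, zpow_one] at this; rwa [inv_inv]) had hcd k m n t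
  rw [inv_inv, add_comm q⁻¹] at h1 h2
  intro a c d φ
  simp only [a, c, d, φ]
  unfold RD.Φ
  simp only [smul_mul_assoc, mul_smul_comm, sub_mul, mul_sub, mul_add]
  linear_combination (norm := module) (tq q M M)⁻¹ • (h1 - h2)

theorem RD.osc_aΦ (R : RD q M N A) (hq : QOK q) (hs : SR2 q M R.xp) (j j' : ℕ) (β : ℂ)
    (hβ : q ^ cc M j M = β) (hβ0 : cc M j M ≠ 0) (hβs : β + β⁻¹ = q + q⁻¹)
    (hβ' : q ^ cc M j' M = β⁻¹) (hβ0' : cc M j' M ≠ 0) (hjj' : cc M j j' = 0) (k m n l : ℤ) :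
    let b := R.xp M; let c := R.xp j'; let d := R.xp M; let φ := R.Φ j
    φ k * (b m * (c l * d n)) + φ k * (d n * (c l * b m)) + c l * (b m * (φ k * d n))
    + c l * (d n * (φ k * b m)) + d n * (φ k * (b m * c l)) + b m * (φ k * (d n * c l))
    + d n * (c l * (b m * φ k)) + b m * (c l * (d n * φ k))
    - (q + q⁻¹) • (b m * (φ k * (c l * d n)) + d n * (φ k * (c l * b m))) = 0 := by
  have hdb : ∀ m n, R.xp M n * R.xp M m = -(R.xp M m * R.xp M n) := by
    intro m n
    have := hs.r4 M M n m (cc_self_M M)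
    rw [sgn_MM] at this
    rw [sub_eq_zero.1 this, neg_one_smul]
  have hcb : XC β⁻¹ (R.xp j') (R.xp M) := by
    have := hs.xc j' M hβ0'
    rwa [hβ'] at this
  have h0 : β ≠ 0 := by rw [← hβ]; exact zpow_ne_zero _ hq.ne0
  have h1 := osc_a β h0 (R.fp j) _ _ _ (R.fp_hb j) (R.fp_xp0 hq j j' hjj') hdb
    (by have := R.fp_xp hq j M; rwa [hβ] at this)
    (by have := R.fp_xp hq j M; rwa [hβ] at this) hcb hcb k m n l
  have h2 := osc_a β h0 (R.fm j) _ _ _ (R.fm_hb j) (R.fm_xp0 hq j j' hjj') hdb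
    (by have := R.fm_xp hq j M; rwa [hβ] at this)
    (by have := R.fm_xp hq j M; rwa [hβ] at this) hcb hcb k m n l
  rw [hβs] at h1 h2
  intro b c d φ
  simp only [b, c, d, φ]
  unfold RD.Φ
  simp only [smul_mul_assoc, mul_smul_comm, sub_mul, mul_sub, mul_add]
  linear_combination (norm := module) (tq q M j)⁻¹ • (h1 - h2)

theorem RD.c7 (R : RD q M N A) (hq : QOK q) (hs : SR2 q M R.xp) (hM : 1 < M) (l : ℕ)
    (m n k u p : ℤ) :
    ∃ s : ℂ, S7 (q + q⁻¹) (R.xp (M - 1) m) (R.xp M n) (R.xp (M + 1) k) (R.xp M u) * R.xm l p =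
      s • (R.xm l p * S7 (q + q⁻¹) (R.xp (M - 1) m) (R.xp M n) (R.xp (M + 1) k) (R.xp M u)) := by
  by_cases hl : M = l
  · subst hl
    refine ⟨_, S7_comm_odd _ _ _ _ _ _ (R.Φ M (n + p)) (R.Φ M (u + p)) ?_ ?_ ?_ ?_ ?_ ?_⟩
    · rw [R.comm, if_neg (by omega), sgn_ne _ _ _ (Or.inl (by omega)), one_smul, add_zero]
    · rw [R.comm, if_pos rfl, sgn_MM, neg_one_smul]
    · rw [R.comm, if_neg (by omega), sgn_ne _ _ _ (Or.inl (by omega)), one_smul, add_zero]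
    · rw [R.comm, if_pos rfl, sgn_MM, neg_one_smul]
    · exact R.osc_MΦ hq hs hM _ _ _ _
    · exact R.osc_MΦ hq hs hM _ _ _ _
  · have hbl : ∀ n, R.xp M n * R.xm l p = R.xm l p * R.xp M n := fun n => by
      rw [R.comm, if_neg hl, sgn_ne _ _ _ (Or.inr (Ne.symm hl)), one_smul, add_zero]
    refine ⟨_, S7_comm_even _ _ _ _ _ _ (if M - 1 = l then R.Φ (M - 1) (m + p) else 0)
      (if M + 1 = l then R.Φ (M + 1) (k + p) else 0) ?_ (hbl _) ?_ (hbl _) ?_ ?_⟩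
    · rw [R.comm, sgn_ne _ _ _ (Or.inl (by omega)), one_smul]
    · rw [R.comm, sgn_ne _ _ _ (Or.inl (by omega)), one_smul]
    · split_ifs
      · exact R.osc_aΦ hq hs (M - 1) (M + 1) q⁻¹ (by rw [cc_ab M hM, zpow_neg_one])
          (by rw [cc_ab M hM]; omega) (by rw [inv_inv, add_comm])
          (by rw [cc_symm, cc_bc, zpow_one, inv_inv]) (by rw [cc_symm, cc_bc]; omega)
          (cc_ac M hM) _ _ _ _
      · simp
    · split_ifs
      · have hca : ∀ z m k, R.Φ (M + 1) k * (R.xp (M - 1) m * z) = R.xp (M - 1) m * (R.Φ (M + 1) k * z) := by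
          intro z m k
          rw [← mul_assoc, R.Φ_xp0 hq _ _ (by rw [cc_symm]; exact cc_ac M hM), mul_assoc]
        have := R.osc_aΦ hq hs (M + 1) (M - 1) q (by rw [cc_symm, cc_bc, zpow_one])
          (by rw [cc_symm, cc_bc]; omega) rfl
          (by rw [cc_ab M hM, zpow_neg_one]) (by rw [cc_ab M hM]; omega)
          (by rw [cc_symm]; exact cc_ac M hM) (k + p) n u m
        simp only [hca] at this ⊢
        exact this
      · simp

/-! ### relation forms -/

theorem S6_eq (hq : QOK q) (x x' y : A) :
    brF q x (brF q⁻¹ x' y) + brF q x' (brF q⁻¹ x y) = S6 (q + q⁻¹) x x' y := by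
  rw [serre_exp hq]; rfl

theorem S7_eq (hq : QOK q) (X : ℕ → ℤ → A) (hs4 : ∀ i j m n, cc M i j = 0 →
    X i m * X j n - sgn M i j • (X j n * X i m) = 0) (hM : 1 < M) (m n k u : ℤ) :
    oscOf q M X m n k u + oscOf q M X m u k n =
      S7 (q + q⁻¹) (X (M - 1) m) (X M n) (X (M + 1) k) (X M u) := by
  have hca : ∀ m n, X (M + 1) n * X (M - 1) m = X (M - 1) m * X (M + 1) n := by
    intro m n
    have := hs4 (M + 1) (M - 1) n m (by rw [cc_symm]; exact cc_ac M hM)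
    rw [sgn_ne _ _ _ (Or.inl (by omega)), one_smul] at this
    exact sub_eq_zero.1 this
  have hca' : ∀ m n z, X (M + 1) n * (X (M - 1) m * z) = X (M - 1) m * (X (M + 1) n * z) := by
    intro m n z; rw [← mul_assoc, hca, mul_assoc]
  have hdb : X M u * X M n = -(X M n * X M u) := by
    have := hs4 M M u n (cc_self_M M)
    rw [sgn_MM] at this
    rw [sub_eq_zero.1 this, neg_one_smul]
  have hdb' : ∀ z, X M u * (X M n * z) = -(X M n * (X M u * z)) := by
    intro z; rw [← mul_assoc, hdb, neg_mul, mul_assoc]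
  rw [osc_exp hq X M m n k u _ _ _ _ rfl rfl rfl rfl, osc_exp hq X M m u k n _ _ _ _ rfl rfl rfl rfl]
  simp only [S7, hca, hca', hdb, hdb', mul_neg]
  module

end

section
variable {q : ℂ} {M N : ℕ} {A : Type} [Ring A] [Algebra ℂ A]
open MulOpposite

theorem op_D4 (s : ℂ) (x y : A) : op (D4 s x y) = D4 s (op y) (op x) := by
  simp [D4]
theorem op_D5 (β : ℂ) (hβ : β ≠ 0) (X Y : ℤ → A) (m n : ℤ) :
    op (D5 β⁻¹ X Y m n) = -β⁻¹ • D5 β (fun m => op (X m)) (fun m => op (Y m)) m n := by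
  simp only [D5, op_add, op_sub, op_smul, op_mul]
  match_scalars <;> field_simp
theorem op_S6 (s : ℂ) (x x' y : A) : op (S6 s x x' y) = S6 s (op x) (op x') (op y) := by
  simp only [S6, op_add, op_sub, op_smul, op_mul, mul_assoc]
  module
theorem op_S7 (s : ℂ) (a b c d : A) (h : c * a = a * c) :
    op (S7 s a b c d) = S7 s (op a) (op b) (op c) (op d) := by
  have h1 : op c * op a = op a * op c := by rw [← op_mul, ← op_mul, h]
  have h2 : ∀ z, op c * (op a * z) = op a * (op c * z) := fun z => by
    rw [← mul_assoc, h1, mul_assoc]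
  simp only [S7, op_add, op_sub, op_smul, op_mul, mul_assoc, h1, h2]
  module

theorem op_trans (R : RD q M N A) (hq : QOK q) (l : ℕ) (p : ℤ) (r : A) (r' : Aᵐᵒᵖ) (u : ℂ)
    (hr : op r = u • r')
    (h : ∃ s : ℂ, r' * (R.op hq).xm l p = s • ((R.op hq).xm l p * r')) :
    ∃ s : ℂ, R.xp l p * r = s • (r * R.xp l p) := by
  obtain ⟨s, hs⟩ := h
  refine ⟨s, op_injective ?_⟩
  rw [op_mul, op_smul, op_mul, hr, smul_mul_assoc]
  change u • (r' * (R.op hq).xm l p) = s • ((R.op hq).xm l p * u • r')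
  rw [hs, mul_smul_comm, smul_comm]

theorem SR2.opp (R : RD q M N A) (hq : QOK q) (hs : SR2 q⁻¹ M R.xm) : SR2 q M (R.op hq).xp where
  r4 i j m n h := by
    have := hs.r4 j i n m (by rw [cc_symm]; exact h)
    change D4 _ (op (R.xm i m)) (op (R.xm j n)) = 0
    rw [← op_D4, sgn_symm]
    change op (R.xm j n * R.xm i m - _) = _
    rw [this]; rfl
  r5 i j m n h := by
    have := hs.r5 i j m n h
    have h2 : D5 (q ^ cc M i j)⁻¹ (R.xm i) (R.xm j) m n = 0 := by
      rw [inv_zpow] at this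
      unfold D5; rw [this]; abel
    have h3 := op_D5 (q ^ cc M i j) (zpow_ne_zero _ hq.ne0) (R.xm i) (R.xm j) m n
    rw [h2, op_zero] at h3
    have h4 := (smul_eq_zero.1 h3.symm).resolve_left
      (neg_ne_zero.2 (inv_ne_zero (zpow_ne_zero _ hq.ne0)))
    unfold D5 at h4
    change op (R.xm i (m + 1)) * op (R.xm j n) - _ • (op (R.xm j n) * op (R.xm i (m + 1))) =
      _ • (op (R.xm i m) * op (R.xm j (n + 1))) - op (R.xm j (n + 1)) * op (R.xm i m)
    rw [← sub_eq_zero, ← h4]; abel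

theorem RD.m4 (R : RD q M N A) (hq : QOK q) (i j l : ℕ) (m n p : ℤ) (h : cc M i j = 0) :
    ∃ s : ℂ, R.xp l p * D4 (sgn M i j) (R.xm i m) (R.xm j n) =
      s • (D4 (sgn M i j) (R.xm i m) (R.xm j n) * R.xp l p) := by
  rw [sgn_symm]
  exact op_trans R hq l p _ _ 1 (by rw [one_smul]; exact op_D4 _ _ _)
    ((R.op hq).c4 hq j i l n m p (by rw [cc_symm]; exact h))

theorem RD.m5 (R : RD q M N A) (hq : QOK q) (i j l : ℕ) (m n p : ℤ) (h : cc M i j ≠ 0) :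
    ∃ s : ℂ, R.xp l p * D5 (q ^ cc M i j)⁻¹ (R.xm i) (R.xm j) m n =
      s • (D5 (q ^ cc M i j)⁻¹ (R.xm i) (R.xm j) m n * R.xp l p) :=
  op_trans R hq l p _ _ _ (op_D5 _ (zpow_ne_zero _ hq.ne0) _ _ _ _)
    ((R.op hq).c5 hq i j l m n p h)

theorem RD.m6 (R : RD q M N A) (hq : QOK q) (hs : SR2 q⁻¹ M R.xm) (i j l : ℕ) (m n k p : ℤ)
    (hc : cc M i j = 1 ∨ cc M i j = -1) (hi : i ≠ M) :
    ∃ s : ℂ, R.xp l p * S6 (q + q⁻¹) (R.xm i m) (R.xm i n) (R.xm j k) =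
      s • (S6 (q + q⁻¹) (R.xm i m) (R.xm i n) (R.xm j k) * R.xp l p) :=
  op_trans R hq l p _ _ 1 (by rw [one_smul]; exact op_S6 _ _ _ _)
    ((R.op hq).c6 hq (SR2.opp R hq hs) i j l m n k p hc hi)

theorem RD.m7 (R : RD q M N A) (hq : QOK q) (hs : SR2 q⁻¹ M R.xm) (hM : 1 < M) (l : ℕ)
    (m n k u p : ℤ) :
    ∃ s : ℂ, R.xp l p * S7 (q + q⁻¹) (R.xm (M - 1) m) (R.xm M n) (R.xm (M + 1) k) (R.xm M u) =
      s • (S7 (q + q⁻¹) (R.xm (M - 1) m) (R.xm M n) (R.xm (M + 1) k) (R.xm M u) * R.xp l p) := by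
  have hca : R.xm (M + 1) k * R.xm (M - 1) m = R.xm (M - 1) m * R.xm (M + 1) k := by
    have := hs.r4 (M + 1) (M - 1) k m (by rw [cc_symm]; exact cc_ac M hM)
    rw [sgn_ne _ _ _ (Or.inl (by omega)), one_smul] at this
    exact sub_eq_zero.1 this
  exact op_trans R hq l p _ _ 1 (by rw [one_smul]; exact op_S7 _ _ _ _ _ hca)
    ((R.op hq).c7 hq (SR2.opp R hq hs) hM l m n k u p)

end

section
open Module

/-! ### the free module on words -/

def TW (M N : ℕ) : Type := List (Idx M N × ℤ) →₀ ℂ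
instance (M N : ℕ) : AddCommGroup (TW M N) := inferInstanceAs (AddCommGroup (List (Idx M N × ℤ) →₀ ℂ))
instance (M N : ℕ) : Module ℂ (TW M N) := inferInstanceAs (Module ℂ (List (Idx M N × ℤ) →₀ ℂ))
def TB (M N : ℕ) : Module.Basis (List (Idx M N × ℤ)) ℂ (TW M N) :=
  .ofRepr (LinearEquiv.refl ℂ (List (Idx M N × ℤ) →₀ ℂ))
abbrev TE (M N : ℕ) := End ℂ (TW M N)

section
variable (q : ℂ) (M N : ℕ)

def sg (w : List (Idx M N × ℤ)) : TW M N := TB M N w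
/-- operator given on words -/
def ofW {Y : Type} [AddCommGroup Y] [Module ℂ Y] (f : List (Idx M N × ℤ) → Y) : TW M N →ₗ[ℂ] Y :=
  (TB M N).constr ℂ f
def CO (x : Idx M N × ℤ) : TE M N := ofW M N (fun w => sg M N (x :: w))

variable {M N}
theorem ofW_sg {Y : Type} [AddCommGroup Y] [Module ℂ Y] (f : List (Idx M N × ℤ) → Y) (w : List (Idx M N × ℤ)) :
    ofW M N f (sg M N w) = f w := by
  simp [ofW, sg]
theorem CO_sg (x : Idx M N × ℤ) (w : List (Idx M N × ℤ)) : CO M N x (sg M N w) = sg M N (x :: w) := by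
  rw [CO, ofW_sg]
theorem TE_ext {Y : Type} [AddCommGroup Y] [Module ℂ Y] {D D' : TW M N →ₗ[ℂ] Y} (h : ∀ w, D (sg M N w) = D' (sg M N w)) : D = D' :=
  (TB M N).ext h

theorem TE_zero (D : TE M N) (h0 : D (sg M N []) = 0)
    (h1 : ∀ x, ∃ c : ℂ, D * CO M N x = c • (CO M N x * D)) : D = 0 := by
  apply TE_ext
  intro w
  induction w with
  | nil => simpa using h0
  | cons x w ih =>
    obtain ⟨c, hc⟩ := h1 x
    have := congrArg (fun f : TE M N => f (sg M N w)) hc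
    simp only [End.mul_apply, LinearMap.smul_apply, CO_sg, ih] at this
    rw [this]; simp

variable (M N) (κ : ℕ → ℂ) (η : ℕ → ℤ → ℂ)

def hw (i : ℕ) (s : ℤ) : List (Idx M N × ℤ) → TW M N
  | [] => η i s • sg M N []
  | x :: w => CO M N x (hw i s w) - hco q M i x.1.1 s • sg M N ((x.1, x.2 + s) :: w)
def hO (i : ℕ) (s : ℤ) : TE M N := ofW M N (hw q M N η i s)

def kw (i : ℕ) : List (Idx M N × ℤ) → TW M N
  | [] => κ i • sg M N []
  | x :: w => (q ^ (-cc M i x.1.1)) • CO M N x (kw i w)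
def kO (i : ℕ) : TE M N := ofW M N (kw q M N κ i)
def kiw (i : ℕ) : List (Idx M N × ℤ) → TW M N
  | [] => (κ i)⁻¹ • sg M N []
  | x :: w => (q ^ (cc M i x.1.1)) • CO M N x (kiw i w)
def kiO (i : ℕ) : TE M N := ofW M N (kiw q M N κ i)

def ΦO (i : ℕ) (n : ℤ) : TE M N := (tq q M i)⁻¹ • (fpOf (tq q M i) (kO q M N κ i) (hO q M N η i) n -
      fmOf (tq q M i) (kiO q M N κ i) (hO q M N η i) n)

def xw (i : ℕ) (m : ℤ) : List (Idx M N × ℤ) → TW M N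
  | [] => 0
  | x :: w => sgn M i x.1.1 • CO M N x (xw i m w) +
      if i = x.1.1 then ΦO q M N κ η i (m + x.2) (sg M N w) else 0
def xO (i : ℕ) (m : ℤ) : TE M N := ofW M N (xw q M N κ η i m)

variable {M N} {κ η}

theorem hO_CO (i : ℕ) (s : ℤ) (x : Idx M N × ℤ) : hO q M N η i s * CO M N x =
    CO M N x * hO q M N η i s - hco q M i x.1.1 s • CO M N (x.1, x.2 + s) := by
  apply TE_ext; intro w
  simp only [End.mul_apply, LinearMap.sub_apply, LinearMap.smul_apply, CO_sg]
  simp only [hO, ofW_sg, hw]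
theorem kO_CO (i : ℕ) (x : Idx M N × ℤ) : kO q M N κ i * CO M N x =
    (q ^ (-cc M i x.1.1)) • (CO M N x * kO q M N κ i) := by
  apply TE_ext; intro w
  simp only [End.mul_apply, LinearMap.smul_apply, CO_sg]
  simp only [kO, ofW_sg, kw]
theorem kiO_CO (i : ℕ) (x : Idx M N × ℤ) : kiO q M N κ i * CO M N x =
    (q ^ (cc M i x.1.1)) • (CO M N x * kiO q M N κ i) := by
  apply TE_ext; intro w
  simp only [End.mul_apply, LinearMap.smul_apply, CO_sg]
  simp only [kiO, ofW_sg, kiw]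
theorem hO_CO_mul (i : ℕ) (s : ℤ) (x : Idx M N × ℤ) (z : TE M N) : hO q M N η i s * (CO M N x * z) =
    CO M N x * (hO q M N η i s * z) - hco q M i x.1.1 s • (CO M N (x.1, x.2 + s) * z) := by
  rw [← mul_assoc, hO_CO, sub_mul, smul_mul_assoc, mul_assoc]
theorem kO_CO_mul (i : ℕ) (x : Idx M N × ℤ) (z : TE M N) : kO q M N κ i * (CO M N x * z) =
    (q ^ (-cc M i x.1.1)) • (CO M N x * (kO q M N κ i * z)) := by
  rw [← mul_assoc, kO_CO, smul_mul_assoc, mul_assoc]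
theorem kiO_CO_mul (i : ℕ) (x : Idx M N × ℤ) (z : TE M N) : kiO q M N κ i * (CO M N x * z) =
    (q ^ (cc M i x.1.1)) • (CO M N x * (kiO q M N κ i * z)) := by
  rw [← mul_assoc, kiO_CO, smul_mul_assoc, mul_assoc]
theorem xO_CO (i : ℕ) (m : ℤ) (x : Idx M N × ℤ) : xO q M N κ η i m * CO M N x =
    sgn M i x.1.1 • (CO M N x * xO q M N κ η i m) +
      if i = x.1.1 then ΦO q M N κ η i (m + x.2) else 0 := by
  apply TE_ext; intro w
  simp only [End.mul_apply, LinearMap.add_apply, LinearMap.smul_apply, CO_sg]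
  simp only [xO, ofW_sg, xw]
  split_ifs <;> simp
theorem hO_vac (i : ℕ) (s : ℤ) : hO q M N η i s (sg M N []) = η i s • sg M N [] := by
  simp only [hO, ofW_sg, hw]
theorem kO_vac (i : ℕ) : kO q M N κ i (sg M N []) = κ i • sg M N [] := by
  simp only [kO, ofW_sg, kw]
theorem kiO_vac (i : ℕ) : kiO q M N κ i (sg M N []) = (κ i)⁻¹ • sg M N [] := by
  simp only [kiO, ofW_sg, kiw]
theorem xO_vac (i : ℕ) (m : ℤ) : xO q M N κ η i m (sg M N []) = 0 := by
  simp only [xO, ofW_sg, xw]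

theorem hO0 (hη : ∀ i, η i 0 = 0) (i : ℕ) : hO q M N η i 0 = 0 := by
  apply TE_zero
  · simp [hO_vac, hη]
  · intro x; refine ⟨1, ?_⟩; simp [hO_CO, hco]

theorem zadd (hq : QOK q) (a : ℤ) : q ^ a * q ^ (-a) = 1 := by
  rw [← zpow_add₀ hq.ne0]; simp

theorem kkiO (hq : QOK q) (hκ : ∀ i, κ i ≠ 0) (i : ℕ) : kO q M N κ i * kiO q M N κ i = 1 := by
  rw [← sub_eq_zero]
  apply TE_zero
  · simp [kO_vac, kiO_vac, smul_smul, inv_mul_cancel₀ (hκ i)]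
  · intro x; refine ⟨1, ?_⟩
    rw [sub_mul, mul_assoc, kiO_CO, mul_smul_comm, ← mul_assoc, kO_CO, smul_mul_assoc, smul_smul,
      zadd q hq, mul_sub, mul_assoc]
    simp

theorem kikO (hq : QOK q) (hκ : ∀ i, κ i ≠ 0) (i : ℕ) : kiO q M N κ i * kO q M N κ i = 1 := by
  rw [← sub_eq_zero]
  apply TE_zero
  · simp [kO_vac, kiO_vac, smul_smul, mul_inv_cancel₀ (hκ i)]
  · intro x; refine ⟨1, ?_⟩
    rw [sub_mul, mul_assoc, kO_CO, mul_smul_comm, ← mul_assoc, kiO_CO, smul_mul_assoc, smul_smul,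
      mul_comm, zadd q hq, mul_sub, mul_assoc]
    simp

theorem kkO (i j : ℕ) : kO q M N κ i * kO q M N κ j = kO q M N κ j * kO q M N κ i := by
  rw [← sub_eq_zero]
  apply TE_zero
  · simp [kO_vac, smul_smul, mul_comm]
  · intro x; refine ⟨(q ^ (-cc M i x.1.1)) * (q ^ (-cc M j x.1.1)), ?_⟩
    simp only [sub_mul, mul_sub, mul_assoc, kO_CO, kO_CO_mul, mul_smul_comm]
    module

theorem kki2O (i j : ℕ) : kO q M N κ i * kiO q M N κ j = kiO q M N κ j * kO q M N κ i := by
  rw [← sub_eq_zero]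
  apply TE_zero
  · simp [kO_vac, kiO_vac, smul_smul, mul_comm]
  · intro x; refine ⟨(q ^ (-cc M i x.1.1)) * (q ^ (cc M j x.1.1)), ?_⟩
    simp only [sub_mul, mul_sub, mul_assoc, kO_CO, kiO_CO, kO_CO_mul, kiO_CO_mul, mul_smul_comm]
    module

theorem kikiO (i j : ℕ) : kiO q M N κ i * kiO q M N κ j = kiO q M N κ j * kiO q M N κ i := by
  rw [← sub_eq_zero]
  apply TE_zero
  · simp [kiO_vac, smul_smul, mul_comm]
  · intro x; refine ⟨(q ^ (cc M i x.1.1)) * (q ^ (cc M j x.1.1)), ?_⟩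
    simp only [sub_mul, mul_sub, mul_assoc, kiO_CO, kiO_CO_mul, mul_smul_comm]
    module

theorem khO (i j : ℕ) (s : ℤ) : kO q M N κ i * hO q M N η j s = hO q M N η j s * kO q M N κ i := by
  rw [← sub_eq_zero]
  apply TE_zero
  · simp [kO_vac, hO_vac, smul_smul, mul_comm]
  · intro x; refine ⟨(q ^ (-cc M i x.1.1)), ?_⟩
    simp only [sub_mul, mul_sub, mul_assoc, kO_CO, hO_CO, kO_CO_mul, hO_CO_mul, mul_smul_comm]
    module

theorem kihO (i j : ℕ) (s : ℤ) : kiO q M N κ i * hO q M N η j s = hO q M N η j s * kiO q M N κ i := by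
  rw [← sub_eq_zero]
  apply TE_zero
  · simp [kiO_vac, hO_vac, smul_smul, mul_comm]
  · intro x; refine ⟨(q ^ (cc M i x.1.1)), ?_⟩
    simp only [sub_mul, mul_sub, mul_assoc, kiO_CO, hO_CO, kiO_CO_mul, hO_CO_mul, mul_smul_comm]
    module

theorem hhO (i j : ℕ) (s r : ℤ) : hO q M N η i s * hO q M N η j r = hO q M N η j r * hO q M N η i s := by
  rw [← sub_eq_zero]
  apply TE_zero
  · simp [hO_vac, smul_smul, mul_comm]
  · intro x; refine ⟨1, ?_⟩
    simp only [sub_mul, mul_sub, mul_assoc, hO_CO, hO_CO_mul, mul_smul_comm, add_right_comm x.2 r s]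
    module

theorem fpOf_commute {A : Type} [Ring A] [Algebra ℂ A] (t : ℂ) (k : A) (h : ℤ → A) (y : A)
    (hk : y * k = k * y) (hh : ∀ s, y * h s = h s * y) (n : ℤ) :
    y * fpOf t k h n = fpOf t k h n * y := by
  unfold fpOf
  split_ifs
  · exact ((show Commute y k from hk).mul_right (expC_mem (Subalgebra.centralizer ℂ {y}) t _
      (fun s _ => by
        rw [Subalgebra.mem_centralizer_iff]
        rintro z rfl; exact hh _) n.toNat _ rfl)).eq
  · simp
theorem fmOf_commute {A : Type} [Ring A] [Algebra ℂ A] (t : ℂ) (k : A) (h : ℤ → A) (y : A)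
    (hk : y * k = k * y) (hh : ∀ s, y * h s = h s * y) (n : ℤ) :
    y * fmOf t k h n = fmOf t k h n * y := by
  unfold fmOf
  split_ifs
  · exact ((show Commute y k from hk).mul_right (expC_mem (Subalgebra.centralizer ℂ {y}) (-t) _
      (fun s _ => by
        rw [Subalgebra.mem_centralizer_iff]
        rintro z rfl; exact hh _) (-n).toNat _ rfl)).eq
  · simp

theorem ΦO_k (i j : ℕ) (n : ℤ) : kO q M N κ j * ΦO q M N κ η i n = ΦO q M N κ η i n * kO q M N κ j := by
  unfold ΦO
  rw [mul_smul_comm, smul_mul_assoc, mul_sub, sub_mul,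
    fpOf_commute _ _ _ _ (kkO q j i) (fun s => khO q j i s),
    fmOf_commute _ _ _ _ (kki2O q j i) (fun s => khO q j i s)]
theorem ΦO_h (i j : ℕ) (s n : ℤ) : hO q M N η j s * ΦO q M N κ η i n = ΦO q M N κ η i n * hO q M N η j s := by
  unfold ΦO
  rw [mul_smul_comm, smul_mul_assoc, mul_sub, sub_mul,
    fpOf_commute _ _ _ _ (khO q i j s).symm (fun r => hhO q j i s r),
    fmOf_commute _ _ _ _ (kihO q i j s).symm (fun r => hhO q j i s r)]

theorem kxpO (hq : QOK q) (i j : ℕ) (n : ℤ) : kO q M N κ i * xO q M N κ η j n =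
    (q ^ cc M i j) • (xO q M N κ η j n * kO q M N κ i) := by
  rw [← sub_eq_zero]
  apply TE_zero
  · simp [kO_vac, xO_vac]
  · intro x; refine ⟨(q ^ (-cc M i x.1.1)) * sgn M j x.1.1, ?_⟩
    by_cases hj : j = x.1.1
    · have e' : ∀ z, xO q M N κ η j n * (CO M N x * z) = sgn M j x.1.1 • (CO M N x * (xO q M N κ η j n * z)) +
          ΦO q M N κ η j (n + x.2) * z :=
        fun z => by rw [← mul_assoc, xO_CO, if_pos hj, add_mul, smul_mul_assoc, mul_assoc]
      simp only [sub_mul, mul_sub, mul_assoc, kO_CO, xO_CO, kO_CO_mul, e', mul_smul_comm, if_pos hj,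
        mul_add, ΦO_k, smul_mul_assoc]
      have := zadd q hq (cc M i x.1.1)
      rw [← hj] at this ⊢
      simp only [smul_add, smul_smul, this, one_smul, ← mul_assoc, mul_comm (q ^ cc M i j)]
      module
    · have e' : ∀ z, xO q M N κ η j n * (CO M N x * z) = sgn M j x.1.1 • (CO M N x * (xO q M N κ η j n * z)) :=
        fun z => by rw [← mul_assoc, xO_CO, if_neg hj, add_zero, smul_mul_assoc, mul_assoc]
      simp only [sub_mul, mul_sub, mul_assoc, kO_CO, xO_CO, kO_CO_mul, e', mul_smul_comm, if_neg hj,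
        add_zero, smul_mul_assoc]
      module

theorem hxpO (i j : ℕ) (s n : ℤ) : hO q M N η i s * xO q M N κ η j n -
    xO q M N κ η j n * hO q M N η i s = hco q M i j s • xO q M N κ η j (n + s) := by
  rw [← sub_eq_zero]
  apply TE_zero
  · simp [hO_vac, xO_vac]
  · intro x; refine ⟨sgn M j x.1.1, ?_⟩
    by_cases hj : j = x.1.1
    · have e' : ∀ x : Idx M N × ℤ, j = x.1.1 → ∀ z, xO q M N κ η j n * (CO M N x * z) = sgn M j x.1.1 • (CO M N x * (xO q M N κ η j n * z)) +
          ΦO q M N κ η j (n + x.2) * z :=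
        fun x hj z => by rw [← mul_assoc, xO_CO, if_pos hj, add_mul, smul_mul_assoc, mul_assoc]
      simp only [sub_mul, mul_sub, mul_assoc, hO_CO, xO_CO, hO_CO_mul, e' x hj, mul_smul_comm,
        mul_add, ΦO_h, smul_mul_assoc, show n + (x.2 + s) = n + s + x.2 by ring, ← hj, if_true]
      module
    · have e' : ∀ x : Idx M N × ℤ, j ≠ x.1.1 → ∀ z, xO q M N κ η j n * (CO M N x * z) = sgn M j x.1.1 • (CO M N x * (xO q M N κ η j n * z)) :=
        fun x hj z => by rw [← mul_assoc, xO_CO, if_neg hj, add_zero, smul_mul_assoc, mul_assoc]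
      simp only [sub_mul, mul_sub, mul_assoc, hO_CO, xO_CO, hO_CO_mul, e' x hj, mul_smul_comm, if_neg hj,
        add_zero, smul_mul_assoc]
      module

end
end

section
variable {q : ℂ} (hq : QOK q) (M N : ℕ) {κ : ℕ → ℂ} {η : ℕ → ℤ → ℂ}
  (hκ : ∀ i, κ i ≠ 0) (hη : ∀ i, η i 0 = 0)

def RT : RD q M N (TE M N) where
  xp i n := if vld M N i then xO q M N κ η i n else 0
  xm i n := if h : vld M N i then CO M N (⟨i, h⟩, n) else 0
  k i := if vld M N i then kO q M N κ i else 0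
  ki i := if vld M N i then kiO q M N κ i else 0
  h i s := if vld M N i then hO q M N η i s else 0
  xp0 i n h := if_neg h
  xm0 i n h := dif_neg h
  k0 i h := if_neg h
  ki0 i h := if_neg h
  h0 i s h := if_neg h
  h00 i := by split_ifs; exacts [hO0 q hη i, rfl]
  kki i h := by rw [if_pos h, if_pos h, kkiO q hq hκ]
  kik i h := by rw [if_pos h, if_pos h, kikO q hq hκ]
  kk i j := by split_ifs <;> simp [kkO]
  kki2 i j := by split_ifs <;> simp [kki2O]
  kiki i j := by split_ifs <;> simp [kikiO]
  kh i j s := by split_ifs <;> simp [khO]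
  kih i j s := by split_ifs <;> simp [kihO]
  hh i j s r := by split_ifs <;> simp [hhO]
  kxp i j n := by split_ifs <;> simp [kxpO q hq]
  kxm i j n := by split_ifs <;> simp [kO_CO]
  hxp i j s n h := by rw [if_pos h]; split_ifs <;> simp [hxpO]
  hxm i j s n h := by rw [if_pos h]; split_ifs <;> simp [hO_CO]
  xpxm i j m n := by
    by_cases hi : vld M N i <;> by_cases hj : vld M N j
    · simp only [if_pos hi, dif_pos hj, xO_CO]
      split_ifs
      · simp [ΦO]
      · simp
    · simp only [if_pos hi, dif_neg hj]
      rw [if_neg (by rintro rfl; exact hj hi)]; simp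
    · simp only [if_neg hi, dif_pos hj]
      rw [if_neg (by rintro rfl; exact hi hj)]; simp
    · simp only [if_neg hi, dif_neg hj]
      simp [fpOf, fmOf]

theorem RT_xm (x : Idx M N × ℤ) : (RT hq M N hκ hη).xm x.1.1 x.2 = CO M N x := dif_pos x.1.2
theorem RT_xp_vac (i : ℕ) (n : ℤ) : (RT hq M N hκ hη).xp i n (sg M N []) = 0 := by
  change (if vld M N i then xO q M N κ η i n else 0) (sg M N []) = 0
  split_ifs
  · exact xO_vac q i n
  · rfl

theorem RT_SR2 : SR2 q M (RT hq M N hκ hη).xp := by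
  constructor
  · intro i j m n h
    apply TE_zero
    · simp [Module.End.mul_apply, RT_xp_vac]
    · intro x
      rw [← RT_xm hq M N hκ hη]
      exact RD.c4 _ hq i j x.1.1 m n x.2 h
  · intro i j m n h
    have : D5 (q ^ cc M i j) ((RT hq M N hκ hη).xp i) ((RT hq M N hκ hη).xp j) m n = 0 := by
      apply TE_zero
      · simp [D5, Module.End.mul_apply, RT_xp_vac]
      · intro x
        rw [← RT_xm hq M N hκ hη]
        exact RD.c5 _ hq i j x.1.1 m n x.2 h
    unfold D5 at this
    rw [← sub_eq_zero, ← this]; abel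

theorem RT_SR3 : SR3 q M (RT hq M N hκ hη).xp := by
  constructor
  · intro i j m n k hc hi
    rw [S6_eq hq]
    apply TE_zero
    · simp [S6, Module.End.mul_apply, RT_xp_vac]
    · intro x
      rw [← RT_xm hq M N hκ hη]
      exact RD.c6 _ hq (RT_SR2 hq M N hκ hη) i j x.1.1 m n k x.2 hc hi
  · intro m n k u hM
    rw [S7_eq hq _ (RT_SR2 hq M N hκ hη).r4 hM]
    apply TE_zero
    · simp [S7, Module.End.mul_apply, RT_xp_vac]
    · intro x
      rw [← RT_xm hq M N hκ hη]
      exact RD.c7 _ hq (RT_SR2 hq M N hκ hη) hM x.1.1 m n k u x.2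
end

section
open Submodule Module

section
variable {q : ℂ} {M N : ℕ} {A B : Type} [Ring A] [Algebra ℂ A] [Ring B] [Algebra ℂ B]

theorem fpOf_map (f : A →ₐ[ℂ] B) (t : ℂ) (k : A) (h : ℤ → A) (n : ℤ) :
    f (fpOf t k h n) = fpOf t (f k) (fun s => f (h s)) n := by
  unfold fpOf; split_ifs <;> simp [expC_map]
theorem fmOf_map (f : A →ₐ[ℂ] B) (t : ℂ) (k : A) (h : ℤ → A) (n : ℤ) :
    f (fmOf t k h n) = fmOf t (f k) (fun s => f (h s)) n := by
  unfold fmOf; split_ifs <;> simp [expC_map]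

def RD.map (R : RD q M N A) (f : A →ₐ[ℂ] B) : RD q M N B where
  xp i n := f (R.xp i n)
  xm i n := f (R.xm i n)
  k i := f (R.k i)
  ki i := f (R.ki i)
  h i s := f (R.h i s)
  xp0 i n h := by rw [R.xp0 i n h, map_zero]
  xm0 i n h := by rw [R.xm0 i n h, map_zero]
  k0 i h := by rw [R.k0 i h, map_zero]
  ki0 i h := by rw [R.ki0 i h, map_zero]
  h0 i n h := by rw [R.h0 i n h, map_zero]
  h00 i := by rw [R.h00 i, map_zero]
  kki i h := by rw [← map_mul, R.kki i h, map_one]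
  kik i h := by rw [← map_mul, R.kik i h, map_one]
  kk i j := by rw [← map_mul, ← map_mul, R.kk]
  kki2 i j := by rw [← map_mul, ← map_mul, R.kki2]
  kiki i j := by rw [← map_mul, ← map_mul, R.kiki]
  kh i j s := by rw [← map_mul, ← map_mul, R.kh]
  kih i j s := by rw [← map_mul, ← map_mul, R.kih]
  hh i j s r := by rw [← map_mul, ← map_mul, R.hh]
  kxp i j n := by rw [← map_mul, ← map_mul, R.kxp, map_smul]
  kxm i j n := by rw [← map_mul, ← map_mul, R.kxm, map_smul]
  hxp i j s n hi := by rw [← map_mul, ← map_mul, ← map_sub, R.hxp _ _ _ _ hi, map_smul]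
  hxm i j s n hi := by rw [← map_mul, ← map_mul, ← map_sub, R.hxm _ _ _ _ hi, map_neg, map_smul]
  xpxm i j m n := by
    rw [← map_mul, ← map_mul, ← map_smul, ← map_sub, R.xpxm]
    split_ifs
    · rw [map_smul, map_sub, fpOf_map, fmOf_map]
    · rw [map_zero]

def RD.pull (R : RD q M N A) (f : B →ₐ[ℂ] A) (hf : Function.Injective f)
    (xp xm : ℕ → ℤ → B) (k ki : ℕ → B) (h : ℕ → ℤ → B)
    (exp : ∀ i n, f (xp i n) = R.xp i n) (exm : ∀ i n, f (xm i n) = R.xm i n)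
    (ek : ∀ i, f (k i) = R.k i) (eki : ∀ i, f (ki i) = R.ki i) (eh : ∀ i s, f (h i s) = R.h i s) :
    RD q M N B where
  xp := xp
  xm := xm
  k := k
  ki := ki
  h := h
  xp0 i n h := hf (by rw [exp, R.xp0 i n h, map_zero])
  xm0 i n h := hf (by rw [exm, R.xm0 i n h, map_zero])
  k0 i h := hf (by rw [ek, R.k0 i h, map_zero])
  ki0 i h := hf (by rw [eki, R.ki0 i h, map_zero])
  h0 i n h := hf (by rw [eh, R.h0 i n h, map_zero])
  h00 i := hf (by rw [eh, R.h00 i, map_zero])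
  kki i h := hf (by rw [map_mul, ek, eki, R.kki i h, map_one])
  kik i h := hf (by rw [map_mul, ek, eki, R.kik i h, map_one])
  kk i j := hf (by rw [map_mul, map_mul, ek, ek, R.kk])
  kki2 i j := hf (by rw [map_mul, map_mul, ek, eki, R.kki2])
  kiki i j := hf (by rw [map_mul, map_mul, eki, eki, R.kiki])
  kh i j s := hf (by rw [map_mul, map_mul, ek, eh, R.kh])
  kih i j s := hf (by rw [map_mul, map_mul, eki, eh, R.kih])
  hh i j s r := hf (by rw [map_mul, map_mul, eh, eh, R.hh])
  kxp i j n := hf (by rw [map_smul, map_mul, map_mul, ek, exp, R.kxp])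
  kxm i j n := hf (by rw [map_smul, map_mul, map_mul, ek, exm, R.kxm])
  hxp i j s n hi := hf (by rw [map_smul, map_sub, map_mul, map_mul, eh, exp, exp, R.hxp _ _ _ _ hi])
  hxm i j s n hi := hf (by
    rw [map_neg, map_smul, map_sub, map_mul, map_mul, eh, exm, exm, R.hxm _ _ _ _ hi])
  xpxm i j m n := hf (by
    rw [map_sub, map_smul, map_mul, map_mul, exp, exm, R.xpxm]
    split_ifs
    · rw [map_smul, map_sub, fpOf_map, fmOf_map]; simp only [ek, eki, eh]
    · rw [map_zero])

theorem SR2.map {w : ℂ} {X : ℕ → ℤ → A} (hs : SR2 w M X) (f : A →ₐ[ℂ] B) :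
    SR2 w M (fun i n => f (X i n)) where
  r4 i j m n h := by rw [← map_mul, ← map_mul, ← map_smul, ← map_sub, hs.r4 i j m n h, map_zero]
  r5 i j m n h := by
    have := congrArg f (hs.r5 i j m n h)
    simpa only [map_sub, map_smul, map_mul] using this
theorem SR2.pull {w : ℂ} {X : ℕ → ℤ → A} (hs : SR2 w M X) (f : B →ₐ[ℂ] A)
    (hf : Function.Injective f) (x : ℕ → ℤ → B) (ex : ∀ i n, f (x i n) = X i n) : SR2 w M x where
  r4 i j m n h := hf (by simpa only [map_sub, map_smul, map_mul, ex, map_zero] using hs.r4 i j m n h)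
  r5 i j m n h := hf (by simpa only [map_sub, map_smul, map_mul, ex] using hs.r5 i j m n h)
theorem SR3.map {X : ℕ → ℤ → A} (hs : SR3 q M X) (f : A →ₐ[ℂ] B) :
    SR3 q M (fun i n => f (X i n)) where
  r6 i j m n k h hi := by
    have := congrArg f (hs.r6 i j m n k h hi)
    simpa only [map_sub, map_smul, map_mul, map_add, map_zero, brF] using this
  r7 m n k u h := by
    have := congrArg f (hs.r7 m n k u h)
    simpa only [map_sub, map_smul, map_mul, map_add, map_zero, brF, oscOf] using this
theorem SR3.pull {X : ℕ → ℤ → A} (hs : SR3 q M X) (f : B →ₐ[ℂ] A)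
    (hf : Function.Injective f) (x : ℕ → ℤ → B) (ex : ∀ i n, f (x i n) = X i n) : SR3 q M x where
  r6 i j m n k h hi := hf (by
    simpa only [map_sub, map_smul, map_mul, map_add, map_zero, brF, ex] using hs.r6 i j m n k h hi)
  r7 m n k u h := hf (by
    simpa only [map_sub, map_smul, map_mul, map_add, map_zero, brF, oscOf, ex] using hs.r7 m n k u h)
end

/-! ### quotient -/
section
variable {q : ℂ} {M N : ℕ} {V : Type} [AddCommGroup V] [Module ℂ V]

abbrev StA (S : Submodule ℂ V) : Subalgebra ℂ (End ℂ V) := Stab (A := End ℂ V) S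

def qh (S : Submodule ℂ V) : StA S →ₐ[ℂ] End ℂ (V ⧸ S) :=
  AlgHom.ofLinearMap
    { toFun := fun a => S.mapQ S a.1 a.2
      map_add' := fun a b => by
        apply linearMap_qext; ext v; rfl
      map_smul' := fun c a => by
        apply linearMap_qext; ext v; rfl }
    (by apply linearMap_qext; ext v; rfl)
    (by intro a b; apply linearMap_qext; ext v; rfl)

theorem qh_mk (S : Submodule ℂ V) (a : StA S) (v : V) :
    qh S a (S.mkQ v) = S.mkQ (a.1 v) := by
  rfl

theorem RD.mem_gens {A : Type} [Ring A] [Algebra ℂ A] (R : RD q M N A) (S : Subalgebra ℂ A)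
    (h1 : ∀ i n, R.xp i n ∈ S)
    (h2 : ∀ i n, R.xm i n ∈ S) (h3 : ∀ i, R.k i ∈ S) (h4 : ∀ i, R.ki i ∈ S) (h5 : ∀ i s, R.h i s ∈ S)
    (a : FA M N false) : R.ρ a ∈ S := by
  induction a using FreeAlgebra.induction with
  | grade0 r => rw [AlgHom.commutes]; exact S.algebraMap_mem r
  | grade1 g =>
    have : R.ρ (FreeAlgebra.ι ℂ g) = R.gen g := R.ρ_gi g
    rw [this]
    cases g with
    | Xp i n => exact h1 _ _
    | Xm i n => exact h2 _ _
    | K i => exact h3 _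
    | Ki i => exact h4 _
    | H i s => exact h5 _ _
    | K0 h => cases h
    | K0i h => cases h
  | mul a b ha hb => rw [map_mul]; exact S.mul_mem ha hb
  | add a b ha hb => rw [map_add]; exact S.add_mem ha hb

end

/-! ### nondegenerate quotients -/

/-- nondegeneracy data -/
structure NDG {q : ℂ} {M N : ℕ} {V Y : Type} [AddCommGroup V] [Module ℂ V] [AddCommGroup Y] [Module ℂ Y]
    (R : RD q M N (End ℂ V)) (p : V →ₗ[ℂ] Y) : Prop where
  nd : ∀ e, (∀ a, p (R.ρ a e) = 0) → e = 0
  p2 : ∀ i j m n e, p (R.xm i m (R.xm j n e)) = 0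

section
variable {q : ℂ} {M N : ℕ} {V Y : Type} [AddCommGroup V] [Module ℂ V] [AddCommGroup Y] [Module ℂ Y]
    {R : RD q M N (End ℂ V)} {p : V →ₗ[ℂ] Y}

theorem NDG.kill (h : NDG R p) (hq : QOK q) (S : Submodule ℂ V)
    (s1 : ∀ i n, ∀ e ∈ S, R.xp i n e ∈ S) (s3 : ∀ i, ∀ e ∈ S, R.k i e ∈ S)
    (s4 : ∀ i, ∀ e ∈ S, R.ki i e ∈ S) (s5 : ∀ i s, ∀ e ∈ S, R.h i s e ∈ S)
    (z0 : ∀ e ∈ S, p e = 0) (z1 : ∀ i n, ∀ e ∈ S, p (R.xm i n e) = 0) : ∀ e ∈ S, e = 0 := by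
  let F : Set (Submodule ℂ V) := {P | S ≤ P ∧ ∀ i n, ∀ e ∈ P, R.xm i n e ∈ P}
  let W : Submodule ℂ V := sInf F
  have hSW : S ≤ W := le_sInf fun P hP => hP.1
  have hW2 : ∀ i n, ∀ e ∈ W, R.xm i n e ∈ W := by
    intro i n e he
    rw [mem_sInf] at he ⊢
    intro P hP
    exact hP.2 i n e (he P hP)
  have ind : ∀ P : Submodule ℂ V, S ≤ P → (∀ i n, ∀ e ∈ W, e ∈ P → R.xm i n e ∈ P) → W ≤ P := by
    intro P h1 h2
    have : W ≤ W ⊓ P := sInf_le ⟨le_inf hSW h1, fun i n e he => ⟨hW2 i n e he.1, h2 i n e he.1 he.2⟩⟩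
    exact this.trans inf_le_right
  have hk : ∀ i, ∀ e ∈ W, R.k i e ∈ W := by
    intro i
    apply ind (W.comap (R.k i)) (fun e he => hSW (s3 i e he))
    intro j n e _ he
    have := LinearMap.congr_fun (R.kxm i j n) e
    rw [mem_comap, ← End.mul_apply, this]
    exact W.smul_mem _ (hW2 _ _ _ he)
  have hki : ∀ i, ∀ e ∈ W, R.ki i e ∈ W := by
    intro i
    apply ind (W.comap (R.ki i)) (fun e he => hSW (s4 i e he))
    intro j n e _ he
    have := LinearMap.congr_fun (R.kixm hq i j n) e
    rw [mem_comap, ← End.mul_apply, this]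
    exact W.smul_mem _ (hW2 _ _ _ he)
  have hh : ∀ i s, ∀ e ∈ W, R.h i s e ∈ W := by
    intro i s
    by_cases hi : vld M N i
    swap
    · intro e _; rw [R.h0 i s hi]; simp
    apply ind (W.comap (R.h i s)) (fun e he => hSW (s5 i s e he))
    intro j n e hew he
    have := LinearMap.congr_fun (sub_eq_iff_eq_add.1 (R.hxm i j s n hi)) e
    rw [mem_comap, ← End.mul_apply, this]
    simp only [LinearMap.add_apply, LinearMap.neg_apply, LinearMap.smul_apply, End.mul_apply]
    exact W.add_mem (W.neg_mem (W.smul_mem _ (hW2 _ _ _ hew))) (hW2 _ _ _ he)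
  have hΦ : ∀ i n, ∀ e ∈ W, R.Φ i n e ∈ W := by
    intro i n
    have := R.Φ_mem (StA W) i (hk i) (hki i) (hh i) n
    exact this
  have hxp : ∀ i n, ∀ e ∈ W, R.xp i n e ∈ W := by
    intro i n
    apply ind (W.comap (R.xp i n)) (fun e he => hSW (s1 i n e he))
    intro j m e hew he
    have := LinearMap.congr_fun (R.comm i j n m) e
    rw [mem_comap, ← End.mul_apply, this]
    simp only [LinearMap.add_apply, LinearMap.smul_apply, End.mul_apply]
    refine W.add_mem (W.smul_mem _ (hW2 _ _ _ he)) ?_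
    split_ifs
    · exact hΦ _ _ _ hew
    · simp
  have hp : ∀ e ∈ W, p e = 0 := by
    let P : Submodule ℂ V :=
      { carrier := {e | p e = 0 ∧ ∀ i n, p (R.xm i n e) = 0}
        add_mem' := by
          rintro a b ⟨h1, h2⟩ ⟨h3, h4⟩
          exact ⟨by rw [map_add, h1, h3, add_zero], fun i n => by rw [map_add, map_add, h2, h4, add_zero]⟩
        zero_mem' := ⟨map_zero _, fun i n => by rw [map_zero, map_zero]⟩
        smul_mem' := by
          rintro c a ⟨h1, h2⟩
          exact ⟨by rw [map_smul, h1, smul_zero], fun i n => by rw [map_smul, map_smul, h2, smul_zero]⟩ }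
    have : W ≤ P := ind P (fun e he => ⟨z0 e he, fun i n => z1 i n e he⟩)
      (fun i n e _ he => ⟨he.2 i n, fun j m => h.p2 j i m n e⟩)
    exact fun e he => (this he).1
  intro e he
  apply h.nd
  intro a
  exact hp _ (R.mem_gens (StA W) hxp hW2 hk hki hh a e (hSW he))

theorem NDG.kill_rel (h : NDG R p) (hq : QOK q) {ι : Type} (r : ι → End ℂ V)
    (s1 : ∀ l n α, ∃ s : ℂ, R.xp l n * r α = s • (r α * R.xp l n))
    (s3 : ∀ i α, ∃ s : ℂ, R.k i * r α = s • (r α * R.k i))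
    (s4 : ∀ i α, ∃ s : ℂ, R.ki i * r α = s • (r α * R.ki i))
    (s5 : ∀ i s α, vld M N i → R.h i s * r α - r α * R.h i s ∈ span ℂ (Set.range r))
    (z0 : ∀ α e, p (r α e) = 0) (z1 : ∀ i n α e, p (R.xm i n (r α e)) = 0) : ∀ α, r α = 0 := by
  let S : Submodule ℂ V := span ℂ {y | ∃ α e, y = r α e}
  have st : ∀ D : End ℂ V, (∀ α e, D (r α e) ∈ S) → ∀ e ∈ S, D e ∈ S := by
    intro D hD
    change S ≤ S.comap D
    apply span_le.2
    rintro _ ⟨α, e, rfl⟩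
    exact hD α e
  have st2 : ∀ D : V →ₗ[ℂ] Y, (∀ α e, D (r α e) = 0) → ∀ e ∈ S, D e = 0 := by
    intro D hD
    change S ≤ LinearMap.ker D
    apply span_le.2
    rintro _ ⟨α, e, rfl⟩
    exact hD α e
  have inS : ∀ α e, r α e ∈ S := fun α e => subset_span ⟨α, e, rfl⟩
  have sp : ∀ D ∈ span ℂ (Set.range r), ∀ e, D e ∈ S := by
    intro D hD e
    have : span ℂ (Set.range r) ≤ S.comap (LinearMap.applyₗ e) := by
      apply span_le.2
      rintro _ ⟨α, rfl⟩
      exact inS α e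
    exact this hD
  have key := h.kill hq S
    (fun i n => st _ fun α e => by
      obtain ⟨s, hs⟩ := s1 i n α
      rw [← End.mul_apply, hs]; exact S.smul_mem _ (inS _ _))
    (fun i => st _ fun α e => by
      obtain ⟨s, hs⟩ := s3 i α
      rw [← End.mul_apply, hs]; exact S.smul_mem _ (inS _ _))
    (fun i => st _ fun α e => by
      obtain ⟨s, hs⟩ := s4 i α
      rw [← End.mul_apply, hs]; exact S.smul_mem _ (inS _ _))
    (fun i s => st _ fun α e => by
      by_cases hi : vld M N i
      · have := sp _ (s5 i s α hi) e
        rw [LinearMap.sub_apply, End.mul_apply, End.mul_apply] at this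
        exact (sub_mem_iff_left S (inS _ _)).1 this
      · rw [R.h0 i s hi]; exact S.zero_mem)
    (st2 p z0) (fun i n => st2 (p ∘ₗ R.xm i n) (z1 i n))
  intro α
  ext e
  exact key _ (inS α e)
end
end

section
open Submodule LinearMap Module

section
variable {A : Type} [Ring A] [Algebra ℂ A]

theorem D4_k (s a b : ℂ) (k x y : A) (hx : k * x = a • (x * k)) (hy : k * y = b • (y * k)) :
    k * D4 s x y = (a * b) • (D4 s x y * k) := by
  have ex : ∀ z, k * (x * z) = a • (x * (k * z)) := fun z => by
    rw [← mul_assoc, hx, smul_mul_assoc, mul_assoc]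
  have ey : ∀ z, k * (y * z) = b • (y * (k * z)) := fun z => by
    rw [← mul_assoc, hy, smul_mul_assoc, mul_assoc]
  simp only [D4, mul_sub, sub_mul, mul_add, add_mul, mul_smul_comm, smul_mul_assoc, mul_assoc, ex, ey, hx, hy]
  module

theorem D5_k (s a b : ℂ) (k : A) (X Y : ℤ → A) (hx : ∀ m, k * X m = a • (X m * k))
    (hy : ∀ m, k * Y m = b • (Y m * k)) (m n : ℤ) :
    k * D5 s X Y m n = (a * b) • (D5 s X Y m n * k) := by
  have ex : ∀ m z, k * (X m * z) = a • (X m * (k * z)) := fun m z => by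
    rw [← mul_assoc, hx, smul_mul_assoc, mul_assoc]
  have ey : ∀ m z, k * (Y m * z) = b • (Y m * (k * z)) := fun m z => by
    rw [← mul_assoc, hy, smul_mul_assoc, mul_assoc]
  simp only [D5, mul_sub, sub_mul, mul_add, add_mul, mul_smul_comm, smul_mul_assoc, mul_assoc, ex, ey, hx, hy]
  module

theorem S6_k (s a b : ℂ) (k x x' y : A) (hx : k * x = a • (x * k)) (hx' : k * x' = a • (x' * k))
    (hy : k * y = b • (y * k)) :
    k * S6 s x x' y = (a * a * b) • (S6 s x x' y * k) := by
  have ex : ∀ z, k * (x * z) = a • (x * (k * z)) := fun z => by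
    rw [← mul_assoc, hx, smul_mul_assoc, mul_assoc]
  have ex' : ∀ z, k * (x' * z) = a • (x' * (k * z)) := fun z => by
    rw [← mul_assoc, hx', smul_mul_assoc, mul_assoc]
  have ey : ∀ z, k * (y * z) = b • (y * (k * z)) := fun z => by
    rw [← mul_assoc, hy, smul_mul_assoc, mul_assoc]
  simp only [S6, mul_sub, sub_mul, mul_add, add_mul, mul_smul_comm, smul_mul_assoc, mul_assoc, ex, ex', ey, hx, hx', hy]
  module

theorem S7_k (s a b c d : ℂ) (k x y z w : A) (hx : k * x = a • (x * k)) (hy : k * y = b • (y * k))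
    (hz : k * z = c • (z * k)) (hw : k * w = d • (w * k)) :
    k * S7 s x y z w = (a * b * c * d) • (S7 s x y z w * k) := by
  have ex : ∀ t, k * (x * t) = a • (x * (k * t)) := fun z => by
    rw [← mul_assoc, hx, smul_mul_assoc, mul_assoc]
  have ey : ∀ t, k * (y * t) = b • (y * (k * t)) := fun z => by
    rw [← mul_assoc, hy, smul_mul_assoc, mul_assoc]
  have ez : ∀ t, k * (z * t) = c • (z * (k * t)) := fun t => by
    rw [← mul_assoc, hz, smul_mul_assoc, mul_assoc]
  have ew : ∀ t, k * (w * t) = d • (w * (k * t)) := fun z => by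
    rw [← mul_assoc, hw, smul_mul_assoc, mul_assoc]
  simp only [S7, mul_sub, sub_mul, mul_add, add_mul, mul_smul_comm, smul_mul_assoc, mul_assoc, ex, ey,
    ez, ew, hx, hy, hz, hw]
  module

theorem D4_h (s : ℂ) (k x y x1 y1 : A) (hx : k * x = x * k + x1) (hy : k * y = y * k + y1) :
    k * D4 s x y - D4 s x y * k = D4 s x1 y + D4 s x y1 := by
  have ex : ∀ z, k * (x * z) = x * (k * z) + x1 * z := fun z => by
    rw [← mul_assoc, hx, add_mul, mul_assoc]
  have ey : ∀ z, k * (y * z) = y * (k * z) + y1 * z := fun z => by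
    rw [← mul_assoc, hy, add_mul, mul_assoc]
  simp only [D4, mul_sub, sub_mul, mul_add, add_mul, mul_smul_comm, smul_mul_assoc, mul_assoc, ex, ey, hx, hy]
  module

theorem D5_h (s : ℂ) (k : A) (X Y X1 Y1 : ℤ → A) (hx : ∀ m, k * X m = X m * k + X1 m)
    (hy : ∀ m, k * Y m = Y m * k + Y1 m) (m n : ℤ) :
    k * D5 s X Y m n - D5 s X Y m n * k = D5 s X1 Y m n + D5 s X Y1 m n := by
  have ex : ∀ m z, k * (X m * z) = X m * (k * z) + X1 m * z := fun m z => by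
    rw [← mul_assoc, hx, add_mul, mul_assoc]
  have ey : ∀ m z, k * (Y m * z) = Y m * (k * z) + Y1 m * z := fun m z => by
    rw [← mul_assoc, hy, add_mul, mul_assoc]
  simp only [D5, mul_sub, sub_mul, mul_add, add_mul, mul_smul_comm, smul_mul_assoc, mul_assoc, ex, ey, hx, hy]
  module

theorem S6_h (s : ℂ) (k x x' y x1 x1' y1 : A) (hx : k * x = x * k + x1) (hx' : k * x' = x' * k + x1')
    (hy : k * y = y * k + y1) :
    k * S6 s x x' y - S6 s x x' y * k = S6 s x1 x' y + S6 s x x1' y + S6 s x x' y1 := by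
  have ex : ∀ z, k * (x * z) = x * (k * z) + x1 * z := fun z => by
    rw [← mul_assoc, hx, add_mul, mul_assoc]
  have ex' : ∀ z, k * (x' * z) = x' * (k * z) + x1' * z := fun z => by
    rw [← mul_assoc, hx', add_mul, mul_assoc]
  have ey : ∀ z, k * (y * z) = y * (k * z) + y1 * z := fun z => by
    rw [← mul_assoc, hy, add_mul, mul_assoc]
  simp only [S6, mul_sub, sub_mul, mul_add, add_mul, mul_smul_comm, smul_mul_assoc, mul_assoc, ex, ex', ey, hx, hx', hy]
  module

theorem S7_h (s : ℂ) (k x y z w x1 y1 z1 w1 : A) (hx : k * x = x * k + x1) (hy : k * y = y * k + y1)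
    (hz : k * z = z * k + z1) (hw : k * w = w * k + w1) :
    k * S7 s x y z w - S7 s x y z w * k =
      S7 s x1 y z w + S7 s x y1 z w + S7 s x y z1 w + S7 s x y z w1 := by
  have ex : ∀ t, k * (x * t) = x * (k * t) + x1 * t := fun z => by
    rw [← mul_assoc, hx, add_mul, mul_assoc]
  have ey : ∀ t, k * (y * t) = y * (k * t) + y1 * t := fun z => by
    rw [← mul_assoc, hy, add_mul, mul_assoc]
  have ez : ∀ t, k * (z * t) = z * (k * t) + z1 * t := fun t => by
    rw [← mul_assoc, hz, add_mul, mul_assoc]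
  have ew : ∀ t, k * (w * t) = w * (k * t) + w1 * t := fun z => by
    rw [← mul_assoc, hw, add_mul, mul_assoc]
  simp only [S7, mul_sub, sub_mul, mul_add, add_mul, mul_smul_comm, smul_mul_assoc, mul_assoc, ex, ey,
    ez, ew, hx, hy, hz, hw]
  module
end

section
variable {q : ℂ} {M N : ℕ} {V Y : Type} [AddCommGroup V] [Module ℂ V] [AddCommGroup Y] [Module ℂ Y]
    {R : RD q M N (End ℂ V)} {p : V →ₗ[ℂ] Y}

theorem span_aux {ι W : Type} [AddCommGroup W] [Module ℂ W] (r : ι → W) (α : ι) (c : ℂ) {y : W}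
    (h : y = c • r α) : y ∈ span ℂ (Set.range r) := by
  rw [h]; exact smul_mem _ _ (subset_span ⟨α, rfl⟩)

theorem RD.hxm2 {A : Type} [Ring A] [Algebra ℂ A] (R : RD q M N A) (i j : ℕ) (s n : ℤ) (hi : vld M N i) :
    R.h i s * R.xm j n = R.xm j n * R.h i s + (-hco q M i j s) • R.xm j (n + s) := by
  rw [sub_eq_iff_eq_add.1 (R.hxm i j s n hi), neg_smul, add_comm]

theorem NDG.sr2 (h : NDG R p) (hq : QOK q) : SR2 q⁻¹ M R.xm := by
  have a4 := h.kill_rel hq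
    (r := fun α : {α : ℕ × ℕ × ℤ × ℤ // cc M α.1 α.2.1 = 0} =>
      D4 (sgn M α.1.1 α.1.2.1) (R.xm α.1.1 α.1.2.2.1) (R.xm α.1.2.1 α.1.2.2.2))
    (fun l n α => R.m4 hq _ _ _ _ _ _ α.2)
    (fun i α => ⟨_, D4_k _ _ _ _ _ _ (R.kxm _ _ _) (R.kxm _ _ _)⟩)
    (fun i α => ⟨_, D4_k _ _ _ _ _ _ (R.kixm hq _ _ _) (R.kixm hq _ _ _)⟩)
    (by
      rintro i s ⟨⟨a, b, m, n⟩, hα⟩ hi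
      dsimp only
      rw [D4_h _ _ _ _ _ _ (R.hxm2 i a s m hi) (R.hxm2 i b s n hi)]
      refine Submodule.add_mem _ ?_ ?_
      · refine span_aux _ ⟨⟨a, b, m + s, n⟩, hα⟩ (-hco q M i a s) ?_
        simp only [D4, smul_mul_assoc, mul_smul_comm]; module
      · refine span_aux _ ⟨⟨a, b, m, n + s⟩, hα⟩ (-hco q M i b s) ?_
        simp only [D4, smul_mul_assoc, mul_smul_comm]; module)
    (by
      rintro ⟨⟨a, b, m, n⟩, hα⟩ e
      simp [D4, End.mul_apply, h.p2])
    (by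
      rintro i s ⟨⟨a, b, m, n⟩, hα⟩ e
      simp [D4, End.mul_apply, h.p2])
  have a5 := h.kill_rel hq
    (r := fun α : {α : ℕ × ℕ × ℤ × ℤ // cc M α.1 α.2.1 ≠ 0} =>
      D5 (q ^ (cc M α.1.1 α.1.2.1))⁻¹ (R.xm α.1.1) (R.xm α.1.2.1) α.1.2.2.1 α.1.2.2.2)
    (fun l n α => R.m5 hq _ _ _ _ _ _ α.2)
    (fun i α => ⟨_, D5_k _ _ _ _ _ _ (R.kxm _ _) (R.kxm _ _) _ _⟩)
    (fun i α => ⟨_, D5_k _ _ _ _ _ _ (R.kixm hq _ _) (R.kixm hq _ _) _ _⟩)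
    (by
      rintro i s ⟨⟨a, b, m, n⟩, hα⟩ hi
      dsimp only
      rw [D5_h _ _ _ _ _ _ (fun m => R.hxm2 i a s m hi) (fun n => R.hxm2 i b s n hi)]
      refine Submodule.add_mem _ ?_ ?_
      · refine span_aux _ ⟨⟨a, b, m + s, n⟩, hα⟩ (-hco q M i a s) ?_
        simp only [D5, smul_mul_assoc, mul_smul_comm, add_right_comm m 1 s]; module
      · refine span_aux _ ⟨⟨a, b, m, n + s⟩, hα⟩ (-hco q M i b s) ?_
        simp only [D5, smul_mul_assoc, mul_smul_comm, add_right_comm n 1 s]; module)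
    (by
      rintro ⟨⟨a, b, m, n⟩, hα⟩ e
      simp [D5, End.mul_apply, h.p2])
    (by
      rintro i s ⟨⟨a, b, m, n⟩, hα⟩ e
      simp [D5, End.mul_apply, h.p2])
  constructor
  · intro i j m n hc
    exact a4 ⟨⟨i, j, m, n⟩, hc⟩
  · intro i j m n hc
    have := a5 ⟨⟨i, j, m, n⟩, hc⟩
    simp only [D5] at this
    rw [inv_zpow, ← sub_eq_zero, ← this]
    abel

theorem NDG.sr3 (h : NDG R p) (hq : QOK q) : SR3 q M R.xm := by
  have hs := h.sr2 hq
  have a6 := h.kill_rel hq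
    (r := fun α : {α : ℕ × ℕ × ℤ × ℤ × ℤ // (cc M α.1 α.2.1 = 1 ∨ cc M α.1 α.2.1 = -1) ∧ α.1 ≠ M} =>
      S6 (q + q⁻¹) (R.xm α.1.1 α.1.2.2.1) (R.xm α.1.1 α.1.2.2.2.1) (R.xm α.1.2.1 α.1.2.2.2.2))
    (fun l n α => R.m6 hq hs _ _ _ _ _ _ _ α.2.1 α.2.2)
    (fun i α => ⟨_, S6_k _ _ _ _ _ _ _ (R.kxm _ _ _) (R.kxm _ _ _) (R.kxm _ _ _)⟩)
    (fun i α => ⟨_, S6_k _ _ _ _ _ _ _ (R.kixm hq _ _ _) (R.kixm hq _ _ _) (R.kixm hq _ _ _)⟩)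
    (by
      rintro i s ⟨⟨a, b, m, n, k⟩, hα⟩ hi
      dsimp only
      rw [S6_h _ _ _ _ _ _ _ _ (R.hxm2 i a s m hi) (R.hxm2 i a s n hi) (R.hxm2 i b s k hi)]
      refine Submodule.add_mem _ (Submodule.add_mem _ ?_ ?_) ?_
      · refine span_aux _ ⟨⟨a, b, m + s, n, k⟩, hα⟩ (-hco q M i a s) ?_
        simp only [S6, smul_mul_assoc, mul_smul_comm]; module
      · refine span_aux _ ⟨⟨a, b, m, n + s, k⟩, hα⟩ (-hco q M i a s) ?_
        simp only [S6, smul_mul_assoc, mul_smul_comm]; module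
      · refine span_aux _ ⟨⟨a, b, m, n, k + s⟩, hα⟩ (-hco q M i b s) ?_
        simp only [S6, smul_mul_assoc, mul_smul_comm]; module)
    (by
      rintro ⟨⟨a, b, m, n, k⟩, hα⟩ e
      simp [S6, End.mul_apply, h.p2])
    (by
      rintro i s ⟨⟨a, b, m, n, k⟩, hα⟩ e
      simp [S6, End.mul_apply, h.p2])
  have a7 := fun hM : 1 < M => h.kill_rel hq
    (r := fun α : ℤ × ℤ × ℤ × ℤ =>
      S7 (q + q⁻¹) (R.xm (M - 1) α.1) (R.xm M α.2.1) (R.xm (M + 1) α.2.2.1) (R.xm M α.2.2.2))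
    (fun l n α => R.m7 hq hs hM _ _ _ _ _ _)
    (fun i α => ⟨_, S7_k _ _ _ _ _ _ _ _ _ _ (R.kxm _ _ _) (R.kxm _ _ _) (R.kxm _ _ _) (R.kxm _ _ _)⟩)
    (fun i α => ⟨_, S7_k _ _ _ _ _ _ _ _ _ _ (R.kixm hq _ _ _) (R.kixm hq _ _ _) (R.kixm hq _ _ _) (R.kixm hq _ _ _)⟩)
    (by
      rintro i s ⟨m, n, k, u⟩ hi
      dsimp only
      rw [S7_h _ _ _ _ _ _ _ _ _ _ (R.hxm2 i (M - 1) s m hi) (R.hxm2 i M s n hi)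
        (R.hxm2 i (M + 1) s k hi) (R.hxm2 i M s u hi)]
      refine Submodule.add_mem _ (Submodule.add_mem _ (Submodule.add_mem _ ?_ ?_) ?_) ?_
      · refine span_aux _ ⟨m + s, n, k, u⟩ (-hco q M i (M - 1) s) ?_
        simp only [S7, smul_mul_assoc, mul_smul_comm]; module
      · refine span_aux _ ⟨m, n + s, k, u⟩ (-hco q M i M s) ?_
        simp only [S7, smul_mul_assoc, mul_smul_comm]; module
      · refine span_aux _ ⟨m, n, k + s, u⟩ (-hco q M i (M + 1) s) ?_
        simp only [S7, smul_mul_assoc, mul_smul_comm]; module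
      · refine span_aux _ ⟨m, n, k, u + s⟩ (-hco q M i M s) ?_
        simp only [S7, smul_mul_assoc, mul_smul_comm]; module)
    (by
      rintro ⟨m, n, k, u⟩ e
      simp [S7, End.mul_apply, h.p2])
    (by
      rintro i s ⟨m, n, k, u⟩ e
      simp [S7, End.mul_apply, h.p2])
  constructor
  · intro i j m n k hc hi
    rw [S6_eq hq]
    exact a6 ⟨⟨i, j, m, n, k⟩, hc, hi⟩
  · intro m n k u hM
    rw [S7_eq hq _ hs.r4 hM]
    exact a7 hM ⟨m, n, k, u⟩
end
end

section
section
variable {q : ℂ} {M N : ℕ} {A B : Type} [Ring A] [Algebra ℂ A] [Ring B] [Algebra ℂ B]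

theorem RD.map_ρ (R : RD q M N A) (f : A →ₐ[ℂ] B) (a : FA M N false) :
    (R.map f).ρ a = f (R.ρ a) := by
  have : (R.map f).ρ = f.comp R.ρ := by
    apply FreeAlgebra.hom_ext
    funext g
    have h1 := (R.map f).ρ_gi g
    have h2 := R.ρ_gi g
    unfold gi at h1 h2
    simp only [Function.comp_apply, AlgHom.comp_apply, h1, h2]
    cases g with
    | K0 h => cases h
    | K0i h => cases h
    | _ => rfl
  rw [this]; rfl

end

section
variable {q : ℂ} {M N : ℕ} {V Y : Type} [AddCommGroup V] [Module ℂ V] [AddCommGroup Y] [Module ℂ Y]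
    (R : RD q M N (Module.End ℂ V)) (p : V →ₗ[ℂ] Y)

def NN : Submodule ℂ V where
  carrier := {w | ∀ a, p (R.ρ a w) = 0}
  add_mem' := by
    intro a b ha hb c
    rw [map_add, map_add, ha c, hb c, add_zero]
  zero_mem' c := by rw [map_zero, map_zero]
  smul_mem' := by
    intro s a ha c
    rw [map_smul, map_smul, ha c, smul_zero]

theorem NN_ρ (b : FA M N false) : R.ρ b ∈ StA (NN R p) := by
  intro w hw a
  change p (R.ρ a (R.ρ b w)) = 0
  rw [← Module.End.mul_apply, ← map_mul]
  exact hw _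

def RS : RD q M N (StA (NN R p)) :=
  R.pull (StA (NN R p)).val Subtype.val_injective
    (fun i n => ⟨R.xp i n, by rw [← R.ρ_Xp]; exact NN_ρ R p _⟩)
    (fun i n => ⟨R.xm i n, by rw [← R.ρ_Xm]; exact NN_ρ R p _⟩)
    (fun i => ⟨R.k i, by rw [← R.ρ_K]; exact NN_ρ R p _⟩)
    (fun i => ⟨R.ki i, by rw [← R.ρ_Ki]; exact NN_ρ R p _⟩)
    (fun i n => ⟨R.h i n, by rw [← R.ρ_H]; exact NN_ρ R p _⟩)
    (fun _ _ => rfl) (fun _ _ => rfl) (fun _ => rfl) (fun _ => rfl) (fun _ _ => rfl)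

theorem RS_val : (RS R p).map (StA (NN R p)).val = R := rfl

def RE : RD q M N (Module.End ℂ (V ⧸ NN R p)) := (RS R p).map (qh (NN R p))

theorem RE_ρ (a : FA M N false) (v : V) : (RE R p).ρ a ((NN R p).mkQ v) = (NN R p).mkQ (R.ρ a v) := by
  unfold RE
  rw [RD.map_ρ, qh_mk]
  have := (RS R p).map_ρ (StA (NN R p)).val a
  rw [RS_val] at this
  rw [this]; rfl

theorem RE_xp (i : ℕ) (n : ℤ) (v : V) : (RE R p).xp i n ((NN R p).mkQ v) = (NN R p).mkQ (R.xp i n v) := by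
  rw [← RD.ρ_Xp, RE_ρ, RD.ρ_Xp]
theorem RE_xm (i : ℕ) (n : ℤ) (v : V) : (RE R p).xm i n ((NN R p).mkQ v) = (NN R p).mkQ (R.xm i n v) := by
  rw [← RD.ρ_Xm, RE_ρ, RD.ρ_Xm]
theorem RE_k (i : ℕ) (v : V) : (RE R p).k i ((NN R p).mkQ v) = (NN R p).mkQ (R.k i v) := by
  rw [← RD.ρ_K, RE_ρ, RD.ρ_K]
theorem RE_fp (i : ℕ) (n : ℤ) (v : V) : (RE R p).fp i n ((NN R p).mkQ v) = (NN R p).mkQ (R.fp i n v) := by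
  rw [← RD.ρ_phiP, RE_ρ, RD.ρ_phiP]
theorem RE_fm (i : ℕ) (n : ℤ) (v : V) : (RE R p).fm i n ((NN R p).mkQ v) = (NN R p).mkQ (R.fm i n v) := by
  rw [← RD.ρ_phiM, RE_ρ, RD.ρ_phiM]

def pE : (V ⧸ NN R p) →ₗ[ℂ] Y := (NN R p).liftQ p (fun w hw => by
  have := hw 1
  rw [map_one] at this
  exact this)
theorem pE_mk (v : V) : pE R p ((NN R p).mkQ v) = p v := rfl

theorem RE_NDG (h2 : ∀ i j m n e, p (R.xm i m (R.xm j n e)) = 0) : NDG (RE R p) (pE R p) where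
  nd e he := by
    obtain ⟨v, rfl⟩ := (NN R p).mkQ_surjective e
    rw [Submodule.mkQ_apply, Submodule.Quotient.mk_eq_zero]
    intro a
    have := he a
    rwa [RE_ρ, pE_mk] at this
  p2 i j m n e := by
    obtain ⟨v, rfl⟩ := (NN R p).mkQ_surjective e
    rw [RE_xm, RE_xm, pE_mk, h2]

theorem RE_SR2 (hs : SR2 q M R.xp) : SR2 q M (RE R p).xp :=
  (hs.pull (StA (NN R p)).val Subtype.val_injective (RS R p).xp (fun _ _ => rfl)).map (qh (NN R p))
theorem RE_SR3 (hs : SR3 q M R.xp) : SR3 q M (RE R p).xp :=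
  (hs.pull (StA (NN R p)).val Subtype.val_injective (RS R p).xp (fun _ _ => rfl)).map (qh (NN R p))
end

/-! ### the projection on the word module -/
section
variable {M N : ℕ} {Y : Type} [AddCommGroup Y] [Module ℂ Y] (u : ℤ → Y)

def pw (M N : ℕ) (u : ℤ → Y) : List (Idx M N × ℤ) → ℂ × Y
  | [] => (1, 0)
  | [x] => if x.1.1 = M then (0, u x.2) else 0
  | _ :: _ :: _ => 0
def pT (M N : ℕ) (u : ℤ → Y) : TW M N →ₗ[ℂ] ℂ × Y := ofW M N (pw M N u)

theorem pT_nil : pT M N u (sg M N []) = (1, 0) := by rw [pT, ofW_sg]; rfl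
theorem pT_one (x : Idx M N × ℤ) : pT M N u (sg M N [x]) = if x.1.1 = M then (0, u x.2) else 0 := by
  rw [pT, ofW_sg]; rfl
theorem pT_two (x y : Idx M N × ℤ) (e : TW M N) : pT M N u (CO M N x (CO M N y e)) = 0 := by
  have : pT M N u ∘ₗ CO M N x ∘ₗ CO M N y = 0 := by
    apply TE_ext
    intro w
    simp only [LinearMap.comp_apply, CO_sg]
    rw [pT, ofW_sg]; rfl
  exact LinearMap.congr_fun this e

variable {q : ℂ} (hq : QOK q) {κ : ℕ → ℂ} {η : ℕ → ℤ → ℂ}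
  (hκ : ∀ i, κ i ≠ 0) (hη : ∀ i, η i 0 = 0)

theorem RT_p2 (i j : ℕ) (m n : ℤ) (e : TW M N) :
    pT M N u ((RT hq M N hκ hη).xm i m ((RT hq M N hκ hη).xm j n e)) = 0 := by
  by_cases hi : vld M N i
  swap
  · rw [RD.xm0 _ _ _ hi]; simp
  by_cases hj : vld M N j
  swap
  · rw [RD.xm0 _ _ _ hj]; simp
  rw [show (RT hq M N hκ hη).xm i m = CO M N (⟨i, hi⟩, m) from RT_xm hq M N hκ hη (⟨i, hi⟩, m),
    show (RT hq M N hκ hη).xm j n = CO M N (⟨j, hj⟩, n) from RT_xm hq M N hκ hη (⟨j, hj⟩, n)]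
  exact pT_two _ _ _ _
end
end

section
open PowerSeries Finset Module

theorem exists_exp (t : ℂ) (ht : t ≠ 0) (g : ℕ → ℂ) (hg : g 0 = 1) :
    ∃ η : ℕ → ℂ, η 0 = 0 ∧ ∀ n, expC t η n = g n := by
  let G : PowerSeries ℂ := PowerSeries.mk g
  let D : PowerSeries ℂ := PowerSeries.mk fun n => ((n : ℂ) + 1) * g (n + 1)
  let Z : PowerSeries ℂ := D * G⁻¹
  have hZ : Z * G = D := by
    rw [mul_assoc, PowerSeries.inv_mul_cancel, mul_one]
    simp [G, ← coeff_zero_eq_constantCoeff_apply, hg]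
  refine ⟨fun n => (n : ℂ)⁻¹ * (t⁻¹ * coeff (n - 1) Z), by simp, ?_⟩
  intro n
  induction n using Nat.strong_induction_on with
  | _ n ih =>
    rcases n with _ | n
    · rw [expC_zero, hg]
    · rw [expC_succ]
      have h1 := congrArg (coeff n) hZ
      rw [coeff_mul, Finset.Nat.sum_antidiagonal_eq_sum_range_succ_mk] at h1
      have h2 : ∑ s ∈ range (n + 1), ((s : ℂ) + 1) • ((((s + 1 : ℕ) : ℂ)⁻¹ *
          (t⁻¹ * coeff (s + 1 - 1) Z)) * expC t
            (fun n : ℕ => (n : ℂ)⁻¹ * (t⁻¹ * coeff (n - 1) Z)) (n - s)) =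
          t⁻¹ * ∑ s ∈ range n.succ, coeff s Z * coeff (n - s) G := by
        rw [Finset.mul_sum]
        refine sum_congr rfl fun s hs => ?_
        rw [ih (n - s) (by omega)]
        have : ((s : ℂ) + 1) ≠ 0 := by exact_mod_cast Nat.succ_ne_zero s
        simp only [G, coeff_mk, Nat.add_sub_cancel, smul_eq_mul]
        push_cast
        field_simp
      rw [h2, h1]
      have : ((n : ℂ) + 1) ≠ 0 := by exact_mod_cast Nat.succ_ne_zero n
      simp only [D, coeff_mk, smul_eq_mul]
      field_simp

section
variable {V : Type} [AddCommGroup V] [Module ℂ V]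
theorem expC_eig (t : ℂ) (a : ℕ → End ℂ V) (c : ℕ → ℂ) (v : V)
    (h : ∀ s, a s v = c s • v) (n : ℕ) : expC t a n v = expC t c n • v := by
  induction n using Nat.strong_induction_on with
  | _ n ih =>
    rcases n with _ | n
    · rw [expC_zero, expC_zero]; simp
    · rw [expC_succ, expC_succ]
      simp only [LinearMap.smul_apply, LinearMap.sum_apply, End.mul_apply, smul_assoc,
        sum_smul]
      congr 2
      refine sum_congr rfl fun s hs => ?_
      rw [ih _ (by omega), map_smul, h]
      simp only [smul_smul]
      congr 1; ring
end

/-- highest weight representation with a nondegenerate projection -/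
structure HWR (q : ℂ) (M N : ℕ) (κ : ℕ → ℂ) (gp gm : ℕ → ℕ → ℂ) {Y : Type} [AddCommGroup Y]
    [Module ℂ Y] (u : ℤ → Y) where
  V : Type
  [i1 : AddCommGroup V]
  [i2 : Module ℂ V]
  R : RD q M N (End ℂ V)
  p : V →ₗ[ℂ] ℂ × Y
  v : V
  ndg : NDG R p
  sr2 : SR2 q M R.xp
  sr3 : SR3 q M R.xp
  xpv : ∀ i n, R.xp i n v = 0
  fpv : ∀ i, vld M N i → ∀ n : ℕ, R.fp i n v = gp i n • v
  fmv : ∀ i, vld M N i → ∀ n : ℕ, R.fm i (-(n : ℤ)) v = gm i n • v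
  kv : ∀ i, vld M N i → R.k i v = κ i • v
  kiv : ∀ i, vld M N i → R.ki i v = (κ i)⁻¹ • v
  hv : ∀ i s, ∃ c : ℂ, R.h i s v = c • v
  pv : p v = (1, 0)
  pxv : ∀ i n, vld M N i → p (R.xm i n v) = if i = M then (0, u n) else 0

attribute [instance] HWR.i1 HWR.i2

theorem exists_HWR {q : ℂ} (hq : QOK q) (M N : ℕ) (κ : ℕ → ℂ) (hκ : ∀ i, κ i ≠ 0)
    (gp gm : ℕ → ℕ → ℂ) (hgp : ∀ i, gp i 0 = κ i) (hgm : ∀ i, gm i 0 = (κ i)⁻¹)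
    {Y : Type} [AddCommGroup Y] [Module ℂ Y] (u : ℤ → Y) :
    Nonempty (HWR q M N κ gp gm u) := by
  have e1 : ∀ i, ∃ η : ℕ → ℂ, η 0 = 0 ∧ ∀ n, expC (tq q M i) η n = (κ i)⁻¹ * gp i n := fun i =>
    exists_exp _ (hq.tq_ne M i) _ (by rw [hgp, inv_mul_cancel₀ (hκ i)])
  have e2 : ∀ i, ∃ η : ℕ → ℂ, η 0 = 0 ∧ ∀ n, expC (-(tq q M i)) η n = κ i * gm i n := fun i =>
    exists_exp _ (neg_ne_zero.2 (hq.tq_ne M i)) _ (by rw [hgm, mul_inv_cancel₀ (hκ i)])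
  choose a ha0 ha using e1
  choose b hb0 hb using e2
  let η : ℕ → ℤ → ℂ := fun i s => if 0 ≤ s then a i s.toNat else b i (-s).toNat
  have hη : ∀ i, η i 0 = 0 := fun i => by simp [η, ha0]
  have hηp : ∀ i (s : ℕ), η i s = a i s := fun i s => by simp [η]
  have hηm : ∀ i (s : ℕ), η i (-(s : ℤ)) = b i s := fun i s => by
    rcases s with _ | s
    · simp [η, ha0, hb0]
    · simp only [η]
      rw [if_neg (by push_cast; omega)]
      congr 1
  let R := RT hq M N hκ hη
  let vac := sg M N []
  let p := pT M N u
  have hh : ∀ i, vld M N i → ∀ s, R.h i s vac = η i s • vac := fun i hi s => by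
    change (if vld M N i then hO q M N η i s else 0) (sg M N []) = _
    rw [if_pos hi, hO_vac]
  have hk : ∀ i, vld M N i → R.k i vac = κ i • vac := fun i hi => by
    change (if vld M N i then kO q M N κ i else 0) (sg M N []) = _
    rw [if_pos hi, kO_vac]
  have hki : ∀ i, vld M N i → R.ki i vac = (κ i)⁻¹ • vac := fun i hi => by
    change (if vld M N i then kiO q M N κ i else 0) (sg M N []) = _
    rw [if_pos hi, kiO_vac]
  refine ⟨{ V := TW M N ⧸ NN R p, R := RE R p, p := pE R p, v := (NN R p).mkQ vac,
            ndg := RE_NDG R p (RT_p2 u hq hκ hη), sr2 := RE_SR2 R p (RT_SR2 hq M N hκ hη),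
            sr3 := RE_SR3 R p (RT_SR3 hq M N hκ hη),
            xpv := ?_, fpv := ?_, fmv := ?_, kv := ?_, kiv := ?_, hv := ?_, pv := ?_, pxv := ?_ }⟩
  · intro i n
    rw [RE_xp, RT_xp_vac, map_zero]
  · intro i hi n
    rw [RE_fp, ← map_smul]
    congr 1
    change fpOf (tq q M i) (R.k i) (R.h i) n vac = _
    rw [fpOf, if_pos (by omega), End.mul_apply,
      expC_eig _ _ (a i) vac (fun s => by rw [hh i hi, hηp]), map_smul, hk i hi, Int.toNat_natCast, ha,
      smul_smul, mul_right_comm, inv_mul_cancel₀ (hκ i), one_mul]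
  · intro i hi n
    rw [RE_fm, ← map_smul]
    congr 1
    change fmOf (tq q M i) (R.ki i) (R.h i) _ vac = _
    rw [fmOf, if_pos (by omega), End.mul_apply,
      expC_eig _ _ (b i) vac (fun s => by rw [hh i hi, hηm]), map_smul, hki i hi, neg_neg,
      Int.toNat_natCast, hb,
      smul_smul, mul_right_comm, mul_inv_cancel₀ (hκ i), one_mul]
  · intro i hi
    rw [RE_k, hk i hi, map_smul]
  · intro i hi
    rw [← RD.ρ_Ki, RE_ρ, RD.ρ_Ki, hki i hi, map_smul]
  · intro i s
    rw [← RD.ρ_H, RE_ρ, RD.ρ_H]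
    by_cases hi : vld M N i
    · exact ⟨η i s, by rw [hh i hi, map_smul]⟩
    · exact ⟨0, by rw [RD.h0 _ _ _ hi]; simp⟩
  · rw [pE_mk]; exact pT_nil u
  · intro i n hi
    rw [RE_xm, pE_mk, show R.xm i n = CO M N (⟨i, hi⟩, n) from RT_xm hq M N hκ hη (⟨i, hi⟩, n), CO_sg]
    exact pT_one u _
end

section
open Polynomial Submodule Finset Module

/-- a target for the odd part -/
structure YD (Q : Polynomial ℂ) where
  Y : Type
  [i1 : AddCommGroup Y]
  [i2 : Module ℂ Y]
  u : ℤ → Y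
  fin : FiniteDimensional ℂ Y
  rec0 : ∀ n : ℤ, ∑ s ∈ range (Q.natDegree + 1), Q.coeff (Q.natDegree - s) • u ((s : ℤ) + n) = 0
  sp : span ℂ (Set.range u) = ⊤
  rk : finrank ℂ Y = Q.natDegree
attribute [instance] YD.i1 YD.i2

theorem exists_YD (Q : Polynomial ℂ) (hQ : Q.coeff 0 = 1) : Nonempty (YD Q) := by
  have hne : Q ≠ 0 := by rintro rfl; simp at hQ
  have htd : Q.natTrailingDegree = 0 := by
    rw [natTrailingDegree_eq_zero]; right; rw [hQ]; exact one_ne_zero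
  have hmon : Q.reverse.Monic := by
    rw [Monic, reverse_leadingCoeff, trailingCoeff, htd, hQ]
  have hdeg : Q.reverse.natDegree = Q.natDegree := by
    rw [reverse_natDegree, htd, Nat.sub_zero]
  let x := AdjoinRoot.root Q.reverse
  let pb := AdjoinRoot.powerBasis' hmon
  have hx : aeval x Q.reverse = 0 := by
    rw [AdjoinRoot.aeval_eq, AdjoinRoot.mk_self]
  have hlc : Q.leadingCoeff ≠ 0 := leadingCoeff_ne_zero.2 hne
  have hu : IsUnit x := by
    have h1 := congrArg (aeval x) (divX_mul_X_add Q.reverse)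
    rw [hx, map_add, map_mul, aeval_X,
      aeval_C, coeff_zero_reverse] at h1
    refine IsUnit.of_mul_eq_one ((-(Q.leadingCoeff)⁻¹) • aeval x Q.reverse.divX) ?_
    rw [mul_smul_comm, mul_comm, eq_neg_of_add_eq_zero_left h1, Algebra.algebraMap_eq_smul_one,
      neg_smul, smul_neg, neg_neg, smul_smul, inv_mul_cancel₀ hlc, one_smul]
  obtain ⟨U, hU⟩ := hu
  have hsum : ∑ s ∈ range (Q.natDegree + 1), Q.coeff (Q.natDegree - s) • x ^ s = 0 := by
    rw [aeval_eq_sum_range, hdeg] at hx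
    rw [← hx]
    refine sum_congr rfl fun s hs => ?_
    rw [coeff_reverse, revAt_le (by simpa [Nat.lt_succ_iff] using hs)]
  refine ⟨{ Y := AdjoinRoot Q.reverse, u := fun n => ((U ^ n : (AdjoinRoot Q.reverse)ˣ) : AdjoinRoot Q.reverse),
            fin := pb.finite, rec0 := ?_, sp := ?_, rk := ?_ }⟩
  · intro n
    have : ∀ s : ℕ, ((U ^ ((s : ℤ) + n) : (AdjoinRoot Q.reverse)ˣ) : AdjoinRoot Q.reverse) =
        ((U ^ n : (AdjoinRoot Q.reverse)ˣ) : AdjoinRoot Q.reverse) * x ^ s := by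
      intro s
      rw [add_comm, zpow_add, Units.val_mul, zpow_natCast, Units.val_pow_eq_pow_val, hU]
    simp only [this]
    rw [← mul_zero ((U ^ n : (AdjoinRoot Q.reverse)ˣ) : AdjoinRoot Q.reverse), ← hsum, Finset.mul_sum]
    simp only [mul_smul_comm]
  · rw [eq_top_iff, ← pb.basis.span_eq]
    apply span_mono
    rintro _ ⟨j, rfl⟩
    refine ⟨(j : ℕ), ?_⟩
    rw [pb.basis_eq_pow]
    simp only [zpow_natCast, Units.val_pow_eq_pow_val, hU]
    rfl
  · rw [pb.finrank, AdjoinRoot.powerBasis'_dim, hdeg]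

section
variable {q : ℂ} {M N : ℕ} {κ : ℕ → ℂ} {gp gm : ℕ → ℕ → ℂ} {Q : Polynomial ℂ} (D : YD Q)
  (W : HWR q M N κ gp gm D.u)

def oV (n : ℤ) : W.V := ∑ s ∈ range (Q.natDegree + 1),
    Q.coeff (Q.natDegree - s) • W.R.xm M ((s : ℤ) + n) W.v

theorem oV_zero (hq : QOK q) (hM : vld M N M) (f : ℤ → ℂ) (hf : annih Q f)
    (hΦ : ∀ n, W.R.Φ M n W.v = f n • W.v) (n : ℤ) : oV D W n = 0 := by
  let S : Submodule ℂ W.V := span ℂ (Set.range (oV D W))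
  have st : ∀ T : End ℂ W.V, (∀ n, T (oV D W n) ∈ S) → ∀ e ∈ S, T e ∈ S := by
    intro T hT
    change S ≤ S.comap T
    apply span_le.2
    rintro _ ⟨n, rfl⟩
    exact hT n
  have st2 : ∀ T : W.V →ₗ[ℂ] ℂ × D.Y, (∀ n, T (oV D W n) = 0) → ∀ e ∈ S, T e = 0 := by
    intro T hT
    change S ≤ LinearMap.ker T
    apply span_le.2
    rintro _ ⟨n, rfl⟩
    exact hT n
  have key : ∀ (T : End ℂ W.V) (c d : ℂ) (r : ℤ),
      (∀ m, T (W.R.xm M m W.v) = c • W.R.xm M m W.v + d • W.R.xm M (m + r) W.v) →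
      ∀ n, T (oV D W n) = c • oV D W n + d • oV D W (n + r) := by
    intro T c d r hT n
    unfold oV
    simp only [map_sum, map_smul, hT, Finset.smul_sum, smul_add, sum_add_distrib, ← add_assoc]
    congr 1 <;> exact sum_congr rfl fun s _ => smul_comm _ _ _
  refine W.ndg.kill hq S ?_ ?_ ?_ ?_ ?_ ?_ _ (subset_span ⟨n, rfl⟩)
  · intro i m
    refine st _ fun n => ?_
    have : W.R.xp i m (oV D W n) = 0 := by
      unfold oV
      simp only [map_sum, map_smul, ← End.mul_apply, W.R.comm]
      simp only [LinearMap.add_apply, LinearMap.smul_apply, End.mul_apply, W.xpv, map_zero,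
        smul_zero, zero_add]
      split_ifs with h
      · subst h
        simp only [hΦ, smul_smul, ← sum_smul]
        convert zero_smul ℂ W.v
        rw [← hf (m + n + Q.natDegree), ← sum_range_reflect]
        refine sum_congr rfl fun s hs => ?_
        have : s ≤ Q.natDegree := by simpa [Nat.lt_succ_iff] using hs
        rw [show Q.natDegree + 1 - 1 - s = Q.natDegree - s by omega,
          show Q.natDegree - (Q.natDegree - s) = s by omega]
        congr 2
        push_cast [this]; ring
      · simp
    rw [this]; exact S.zero_mem
  · intro i
    by_cases hi : vld M N i
    · refine st _ fun n => ?_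
      rw [key (W.R.k i) (q ^ (-cc M i M) * κ i) 0 0 (fun m => by
        rw [← End.mul_apply, W.R.kxm]
        simp [W.kv i hi, smul_smul]) n]
      exact S.add_mem (S.smul_mem _ (subset_span ⟨_, rfl⟩)) (S.smul_mem _ (subset_span ⟨_, rfl⟩))
    · rw [W.R.k0 _ hi]; intro e _; exact S.zero_mem
  · intro i
    by_cases hi : vld M N i
    · refine st _ fun n => ?_
      rw [key (W.R.ki i) (q ^ (cc M i M) * (κ i)⁻¹) 0 0 (fun m => by
        rw [← End.mul_apply, W.R.kixm hq]
        simp [W.kiv i hi, smul_smul]) n]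
      exact S.add_mem (S.smul_mem _ (subset_span ⟨_, rfl⟩)) (S.smul_mem _ (subset_span ⟨_, rfl⟩))
    · rw [W.R.ki0 _ hi]; intro e _; exact S.zero_mem
  · intro i s
    by_cases hi : vld M N i
    · refine st _ fun n => ?_
      obtain ⟨c, hc⟩ := W.hv i s
      rw [key (W.R.h i s) c (-hco q M i M s) s (fun m => by
        rw [← End.mul_apply, W.R.hxm2 _ _ _ _ hi]
        simp [hc]) n]
      exact S.add_mem (S.smul_mem _ (subset_span ⟨_, rfl⟩)) (S.smul_mem _ (subset_span ⟨_, rfl⟩))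
    · rw [W.R.h0 _ _ hi]; intro e _; exact S.zero_mem
  · refine st2 W.p fun n => ?_
    unfold oV
    simp only [map_sum, map_smul, W.pxv _ _ hM, if_true]
    have : ∀ s : ℤ, ((0 : ℂ), D.u s) = LinearMap.inr ℂ ℂ D.Y (D.u s) := fun _ => rfl
    simp only [this, ← map_smul, ← map_sum, D.rec0, map_zero]
  · intro i m
    refine st2 (W.p ∘ₗ W.R.xm i m) fun n => ?_
    unfold oV
    simp only [LinearMap.comp_apply, map_sum, map_smul, W.ndg.p2, smul_zero, sum_const_zero]
end
end

section
variable {q : ℂ} {M N : ℕ} {κ : ℕ → ℂ} {gp gm : ℕ → ℕ → ℂ} {Q : Polynomial ℂ} (D : YD Q)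
  (W : HWR q M N κ gp gm D.u)

def HWR.π (hq : QOK q) : ALG q M N false 3 →ₐ[ℂ] Module.End ℂ W.V :=
  RingQuot.liftAlgHom ℂ ⟨W.R.ρ, fun a b h =>
    W.R.ρ_rel W.sr2 (W.ndg.sr2 hq) W.sr3 (W.ndg.sr3 hq) a b h⟩

theorem HWR.π_mk (hq : QOK q) (a : FA M N false) : W.π D hq (mkA q M N false 3 a) = W.R.ρ a :=
  RingQuot.liftAlgHom_mkAlgHom_apply _ _ _ _

theorem lower_of (hq : QOK q) (hM : 1 ≤ M) (hN : 1 ≤ N) (Λ : HW q M N) (hQ1 : Q.coeff 0 = 1)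
    (hQf : annih Q Λ.f)
    (h1 : ∀ i, vld M N i → i ≠ M → ∀ n, W.R.fp i n W.v = gammaP q M i (Λ.P i) n • W.v)
    (h2 : ∀ i, vld M N i → i ≠ M → ∀ n, W.R.fm i n W.v = gammaM q M i (Λ.P i) n • W.v)
    (h3 : W.R.k M W.v = Λ.c • W.v)
    (h4 : ∀ n, W.R.fp M n W.v - W.R.fm M n W.v = ((q - q⁻¹) * Λ.f n) • W.v)
    (h5 : ∀ i, vld M N i → i ≠ M → (W.R.xm i 0 ^ (1 + (Λ.P i).natDegree)) W.v = 0) :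
    Q.natDegree < Module.finrank ℂ (WeylMod q M N false Λ Q) := by
  have hMv : vld M N M := ⟨hM, by omega⟩
  have hpM : qpar q M M = q := by simp [qpar, lof]
  have ho : ∀ n, oV D W n = 0 := oV_zero D W hq hMv Λ.f hQf (fun n => by
    have := hq.sub_inv_ne
    rw [RD.Φ, LinearMap.smul_apply, LinearMap.sub_apply, h4, smul_smul, tq, hpM, ← mul_assoc,
      inv_mul_cancel₀ this, one_mul])
  let π := W.π D hq
  let I : Submodule (ALG q M N false 3) (ALG q M N false 3) := weylIdeal q M N false Λ Q
  let ev : ALG q M N false 3 →ₗ[ℂ] W.V := (LinearMap.applyₗ W.v) ∘ₗ π.toLinearMap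
  have hev : ∀ a, ev a = π a W.v := fun _ => rfl
  let J : Ideal (ALG q M N false 3) :=
    { carrier := {a | π a W.v = 0}
      add_mem' := by
        intro a b ha hb
        simp only [Set.mem_setOf_eq] at ha hb ⊢
        rw [map_add, LinearMap.add_apply, ha, hb, add_zero]
      zero_mem' := by simp
      smul_mem' := by
        intro c a ha
        simp only [Set.mem_setOf_eq] at ha ⊢
        rw [smul_eq_mul, map_mul, Module.End.mul_apply, ha, map_zero] }
  have hoe : ∀ n, π (oddElt q M N false Q n) W.v = 0 := by
    intro n
    rw [← ho n]
    unfold oddElt oV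
    rw [map_sum, LinearMap.sum_apply]
    refine Finset.sum_congr rfl fun s _ => ?_
    rw [map_smul, LinearMap.smul_apply, XmA, W.π_mk D hq, RD.ρ_Xm]
  have hIJ : weylIdeal q M N false Λ Q ≤ J := by
    refine Ideal.span_le.2 ?_
    intro x hx
    change π x W.v = 0
    rcases hx with (((((hx | hx) | hx) | hx) | hx) | hx) | hx
    · obtain ⟨i, n, rfl⟩ := hx
      rw [XpA, W.π_mk D hq, RD.ρ_Xp, W.xpv]
    · obtain ⟨i, n, a, b, c, rfl | rfl⟩ := hx
      · rw [map_sub, phiPA, W.π_mk D hq, RD.ρ_phiP, LinearMap.sub_apply, h1 i ⟨a, b⟩ c, AlgHom.commutes,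
          Module.algebraMap_end_apply, sub_self]
      · rw [map_sub, phiMA, W.π_mk D hq, RD.ρ_phiM, LinearMap.sub_apply, h2 i ⟨a, b⟩ c, AlgHom.commutes,
          Module.algebraMap_end_apply, sub_self]
    · rw [Set.mem_setOf_eq] at hx
      rw [hx, map_sub, KA, W.π_mk D hq, RD.ρ_K, LinearMap.sub_apply, h3, AlgHom.commutes,
          Module.algebraMap_end_apply, sub_self]
    · obtain ⟨n, rfl⟩ := hx
      rw [map_sub, map_sub, phiPA, phiMA, W.π_mk D hq, W.π_mk D hq, RD.ρ_phiP, RD.ρ_phiM, LinearMap.sub_apply,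
        LinearMap.sub_apply, h4, AlgHom.commutes, Module.algebraMap_end_apply, sub_self]
    · exact absurd hx.1 (by simp)
    · obtain ⟨i, a, b, c, rfl⟩ := hx
      rw [map_pow, XmA, W.π_mk D hq, RD.ρ_Xm, h5 i ⟨a, b⟩ c]
    · unfold oddRels at hx
      split_ifs at hx
      · obtain ⟨n, rfl⟩ := hx
        exact hoe n
      · rw [Set.mem_singleton_iff] at hx
        rw [hx]; exact hoe 0
  let g0 : (ALG q M N false 3 ⧸ (I.restrictScalars ℂ)) →ₗ[ℂ] ℂ × D.Y :=
    (I.restrictScalars ℂ).liftQ (W.p ∘ₗ ev) (fun a ha => by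
      rw [LinearMap.mem_ker, LinearMap.comp_apply, hev, show π a W.v = 0 from hIJ ha, map_zero])
  let g : WeylMod q M N false Λ Q →ₗ[ℂ] ℂ × D.Y :=
    g0 ∘ₗ (Submodule.Quotient.restrictScalarsEquiv ℂ I).symm.toLinearMap
  have hg : ∀ a, W.p (π a W.v) ∈ LinearMap.range g := by
    intro a
    exact ⟨(Submodule.Quotient.mk a : ALG q M N false 3 ⧸ I), rfl⟩
  have hsurj : LinearMap.range g = ⊤ := by
    have ha : LinearMap.range (LinearMap.inl ℂ ℂ D.Y) ≤ LinearMap.range g := by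
      rintro _ ⟨c, rfl⟩
      have := (LinearMap.range g).smul_mem c (hg 1)
      rw [map_one, Module.End.one_apply, W.pv] at this
      convert this using 1
      simp
    have hb : LinearMap.range (LinearMap.inr ℂ ℂ D.Y) ≤ LinearMap.range g := by
      rw [← Submodule.map_top, ← D.sp, Submodule.map_span_le]
      rintro _ ⟨n, rfl⟩
      have := hg (XmA q M N false 3 M n)
      rw [XmA, W.π_mk D hq, RD.ρ_Xm, W.pxv _ _ hMv, if_pos rfl] at this
      exact this
    rw [eq_top_iff, ← LinearMap.sup_range_inl_inr]
    exact sup_le ha hb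
  haveI := weyl_finite hq hM hN Λ Q hQ1
  haveI := D.fin
  have := LinearMap.finrank_range_le g
  rw [hsurj, finrank_top, Module.finrank_prod, D.rk, Module.finrank_self] at this
  omega
end

section
open Submodule Module

/-! ### rank one words over a general ring -/
section
variable {O G : Type} [CommRing O] [AddCommGroup G] [Module O G] (xm : ℤ → End O G) (g : G)

def wd (ns : List ℤ) : G := ns.foldr (fun n y => xm n y) g
theorem wd_nil : wd xm g [] = g := rfl
theorem wd_cons (n : ℤ) (ns : List ℤ) : wd xm g (n :: ns) = xm n (wd xm g ns) := rfl

def Om (r : ℕ) : Submodule O G := span O {y | ∃ ns : List ℤ, ns.length = r ∧ y = wd xm g ns}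

variable {xm g}
theorem Om_wd (ns : List ℤ) (r : ℕ) (h : ns.length = r) : wd xm g ns ∈ Om xm g r :=
  subset_span ⟨ns, h, rfl⟩

theorem Om_op {r s : ℕ} (T : End O G) (h : ∀ ns : List ℤ, ns.length = r → T (wd xm g ns) ∈ Om xm g s) :
    ∀ y ∈ Om xm g r, T y ∈ Om xm g s := by
  change Om xm g r ≤ (Om xm g s).comap T
  apply span_le.2
  rintro _ ⟨ns, hn, rfl⟩
  exact h ns hn

theorem Om_xm (n : ℤ) (r : ℕ) : ∀ y ∈ Om xm g r, xm n y ∈ Om xm g (r + 1) :=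
  Om_op _ fun ns hn => by rw [← wd_cons]; exact Om_wd _ _ (by simp [hn])

theorem Om_zero (y : G) (h : y ∈ Om xm g 0) : ∃ c : O, y = c • g := by
  have : Om xm g 0 ≤ span O {g} := by
    apply span_le.2
    rintro _ ⟨ns, hn, rfl⟩
    rw [List.length_eq_zero_iff.1 hn]
    exact subset_span rfl
  obtain ⟨c, hc⟩ := mem_span_singleton.1 (this h)
  exact ⟨c, hc.symm⟩

theorem Om_eig (T : ℤ → End O G) (hg : ∀ n, ∃ c : O, T n g = c • g)
    (hs : ∀ r, (∀ n, ∀ y ∈ Om xm g r, T n y ∈ Om xm g r) → ∀ n m, ∀ y ∈ Om xm g r, T n (xm m y) ∈ Om xm g (r + 1))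
    (r : ℕ) : ∀ n, ∀ y ∈ Om xm g r, T n y ∈ Om xm g r := by
  induction r with
  | zero =>
    intro n y hy
    obtain ⟨c, rfl⟩ := Om_zero y hy
    obtain ⟨e, he⟩ := hg n
    rw [map_smul, he]
    exact smul_mem _ _ (smul_mem _ _ (Om_wd [] _ rfl))
  | succ r ih =>
    intro n
    refine Om_op _ fun ns hn => ?_
    rcases ns with _ | ⟨m, ns⟩
    · simp at hn
    · rw [wd_cons]
      exact hs r ih n m _ (Om_wd _ _ (by simpa using hn))

/-- upward recursion -/
theorem Om_fp (T : ℤ → End O G) (β : O) (h0 : ∀ n < 0, T n = 0)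
    (hT : ∀ n m y, T (n + 1) (xm m y) - β • xm m (T (n + 1) y) = β • T n (xm (m + 1) y) - xm (m + 1) (T n y))
    (hg : ∀ n, ∃ c : O, T n g = c • g) (r : ℕ) : ∀ n, ∀ y ∈ Om xm g r, T n y ∈ Om xm g r := by
  refine Om_eig T hg ?_ r
  intro r ih
  have : ∀ (k : ℕ) (n m : ℤ), n < k → ∀ y ∈ Om xm g r, T n (xm m y) ∈ Om xm g (r + 1) := by
    intro k
    induction k with
    | zero =>
      intro n m hn y _
      rw [h0 n (by simpa using hn)]; exact Submodule.zero_mem _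
    | succ k ihk =>
      intro n m hn y hy
      have e := hT (n - 1) m y
      rw [sub_add_cancel, sub_eq_iff_eq_add] at e
      rw [e]
      exact Submodule.add_mem _ (Submodule.sub_mem _ (smul_mem _ _ (ihk _ _ (by push_cast at hn; omega) _ hy))
        (Om_xm _ _ _ (ih _ _ hy))) (smul_mem _ _ (Om_xm _ _ _ (ih _ _ hy)))
  intro n m
  exact this (n + 1).toNat n m (by omega)

/-- downward recursion -/
theorem Om_fm (T : ℤ → End O G) (β β' : O) (hb : β' * β = 1) (h0 : ∀ n, 0 < n → T n = 0)
    (hT : ∀ n m y, T (n + 1) (xm m y) - β • xm m (T (n + 1) y) = β • T n (xm (m + 1) y) - xm (m + 1) (T n y))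
    (hg : ∀ n, ∃ c : O, T n g = c • g) (r : ℕ) : ∀ n, ∀ y ∈ Om xm g r, T n y ∈ Om xm g r := by
  refine Om_eig T hg ?_ r
  intro r ih
  have : ∀ (k : ℕ) (n m : ℤ), -(k : ℤ) < n → ∀ y ∈ Om xm g r, T n (xm m y) ∈ Om xm g (r + 1) := by
    intro k
    induction k with
    | zero =>
      intro n m hn y _
      rw [h0 n (by simpa using hn)]; exact Submodule.zero_mem _
    | succ k ihk =>
      intro n m hn y hy
      have e := hT n (m - 1) y
      rw [sub_add_cancel, eq_sub_iff_add_eq] at e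
      have e2 : T n (xm m y) = β' • (T (n + 1) (xm (m - 1) y) - β • xm (m - 1) (T (n + 1) y) + xm m (T n y)) := by
        rw [e, smul_smul, hb, one_smul]
      rw [e2]
      exact smul_mem _ _ (Submodule.add_mem _ (Submodule.sub_mem _ (ihk _ _ (by push_cast at hn; omega) _ hy)
        (smul_mem _ _ (Om_xm _ _ _ (ih _ _ hy)))) (Om_xm _ _ _ (ih _ _ hy)))
  intro n m
  exact this (1 - n).toNat n m (by omega)

theorem Om_h (T : End O G) (c e : O) (s : ℤ) (hg : T g = e • g)
    (hT : ∀ m y, T (xm m y) = xm m (T y) + c • xm (m + s) y) (r : ℕ) :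
    ∀ y ∈ Om xm g r, T y ∈ Om xm g r := by
  refine Om_eig (fun _ => T) (fun _ => ⟨e, hg⟩) ?_ r 0
  intro r ih n m y hy
  rw [hT]
  exact Submodule.add_mem _ (Om_xm _ _ _ (ih 0 _ hy)) (smul_mem _ _ (Om_xm _ _ _ hy))

theorem Om_xp (xp fp fm : ℤ → End O G) (τ : O)
    (hx : ∀ m n y, xp m (xm n y) = xm n (xp m y) + τ • (fp (m + n) y - fm (m + n) y))
    (hp : ∀ r n, ∀ y ∈ Om xm g r, fp n y ∈ Om xm g r) (hm : ∀ r n, ∀ y ∈ Om xm g r, fm n y ∈ Om xm g r)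
    (hg : ∀ m, xp m g = 0) (r : ℕ) : ∀ m, ∀ y ∈ Om xm g (r + 1), xp m y ∈ Om xm g r := by
  induction r with
  | zero =>
    intro m
    refine Om_op _ fun ns hn => ?_
    obtain ⟨n, rfl⟩ := List.length_eq_one_iff.1 (by simpa using hn)
    have h0 : g ∈ Om xm g 0 := Om_wd [] _ rfl
    rw [wd_cons, wd_nil, hx, hg, map_zero, zero_add]
    exact smul_mem _ _ (Submodule.sub_mem _ (hp _ _ _ h0) (hm _ _ _ h0))
  | succ r ih =>
    intro m
    refine Om_op _ fun ns hn => ?_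
    rcases ns with _ | ⟨n, ns⟩
    · simp at hn
    · have h0 : wd xm g ns ∈ Om xm g (r + 1) := Om_wd _ _ (by simpa using hn)
      rw [wd_cons, hx]
      exact Submodule.add_mem _ (Om_xm _ _ _ (ih _ _ h0))
        (smul_mem _ _ (Submodule.sub_mem _ (hp _ _ _ h0) (hm _ _ _ h0)))
end
end

section
open Polynomial Finset

/-! ### subset module -/
section
variable {ι F : Type} [Fintype ι] [DecidableEq ι] [Field F] (p : F) (a : ι → F)

def sbU (I : Finset ι) (l : ι) : F := if l ∈ I then p⁻¹ else p
def sbCp (i : ι) (I : Finset ι) : F :=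
  ∏ l ∈ univ.erase i, if l ∈ I then 1 else (p * a i - p⁻¹ * a l) / (a i - a l)
def sbCm (i : ι) (I : Finset ι) : F :=
  ∏ l ∈ univ.erase i, if l ∈ I then (p⁻¹ * a i - p * a l) / (a i - a l) else 1
def sbR (j : ι) (I : Finset ι) : F := (if j ∈ I then -1 else 1) * (sbCp p a j I * sbCm p a j I)
def sbS (n : ℤ) (I : Finset ι) : F := ∑ j, sbR p a j I * a j ^ n
def sbEp (n : ℤ) (I : Finset ι) : F :=
  if n < 0 then 0 else if n = 0 then ∏ l, sbU p I l else (p - p⁻¹) * sbS p a n I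
def sbEm (n : ℤ) (I : Finset ι) : F := sbEp p a n I - (p - p⁻¹) * sbS p a n I

theorem sbCp_ins {i j : ι} (h : i ≠ j) {I : Finset ι} (hi : j ∉ I) :
    sbCp p a i I = (p * a i - p⁻¹ * a j) / (a i - a j) * sbCp p a i (insert j I) := by
  have hj : j ∈ univ.erase i := by simp [h.symm]
  rw [sbCp, sbCp, ← mul_prod_erase _ _ hj, ← mul_prod_erase _ _ hj, if_neg hi,
    if_pos (mem_insert_self _ _), one_mul]
  congr 1
  refine prod_congr rfl fun l hl => ?_
  have : l ≠ j := (mem_erase.1 hl).1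
  simp [this]

theorem sbCm_ins {i j : ι} (h : i ≠ j) {I : Finset ι} (hi : j ∉ I) :
    sbCm p a i (insert j I) = (p⁻¹ * a i - p * a j) / (a i - a j) * sbCm p a i I := by
  have hj : j ∈ univ.erase i := by simp [h.symm]
  rw [sbCm, sbCm, ← mul_prod_erase _ _ hj, ← mul_prod_erase _ _ hj, if_neg hi,
    if_pos (mem_insert_self _ _), one_mul]
  congr 1
  refine prod_congr rfl fun l hl => ?_
  have : l ≠ j := (mem_erase.1 hl).1
  simp [this]

theorem sbCp_self (i : ι) (I : Finset ι) : sbCp p a i (insert i I) = sbCp p a i I := by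
  refine prod_congr rfl fun l hl => ?_
  have : l ≠ i := (mem_erase.1 hl).1
  simp [this]
theorem sbCm_self (i : ι) (I : Finset ι) : sbCm p a i (insert i I) = sbCm p a i I := by
  refine prod_congr rfl fun l hl => ?_
  have : l ≠ i := (mem_erase.1 hl).1
  simp [this]

variable {p a}
theorem sbR_rec (hp : p ≠ 0) {i : ι} {I : Finset ι} (hi : i ∉ I) (j : ι) :
    sbR p a j (insert i I) * (a j - (p ^ 2)⁻¹ * a i) = sbR p a j I * ((p ^ 2)⁻¹ * a j - a i) := by
  by_cases h : j = i
  · subst h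
    rw [sbR, sbR, sbCp_self, sbCm_self, if_pos (mem_insert_self _ _), if_neg hi]
    ring
  · rw [sbR, sbR, sbCm_ins p a h hi, sbCp_ins p a h hi]
    have : (if j ∈ insert i I then (-1 : F) else 1) = if j ∈ I then -1 else 1 := by simp [h]
    rw [this]
    field_simp

theorem sbS_rec (hp : p ≠ 0) (ha : ∀ l, a l ≠ 0) {i : ι} {I : Finset ι} (hi : i ∉ I) (n : ℤ) :
    sbS p a (n + 1) (insert i I) - (p ^ 2)⁻¹ * sbS p a (n + 1) I =
      a i * ((p ^ 2)⁻¹ * sbS p a n (insert i I) - sbS p a n I) := by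
  simp only [sbS, Finset.mul_sum, ← sum_sub_distrib]
  refine sum_congr rfl fun j _ => ?_
  rw [zpow_add_one₀ (ha j)]
  linear_combination a j ^ n * sbR_rec (a := a) hp hi j

/-- polynomial identity -/
theorem sb_poly (u : ι → F) (hu : ∀ l, u l ≠ 0) (ha : ∀ l, a l ≠ 0) (hinj : Function.Injective a) :
    ∏ l, (C (u l) - C ((u l)⁻¹ * a l) * X) =
      C (∏ l, (u l)⁻¹) * ∏ l, (1 - C (a l) * X) +
      ∑ j, C ((u j - (u j)⁻¹) * ∏ l ∈ univ.erase j, (u l * a j - (u l)⁻¹ * a l) / (a j - a l)) *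
        ∏ l ∈ univ.erase j, (1 - C (a l) * X) := by
  classical
  have d1 : ∀ x y : F, (C x - C y * X).natDegree ≤ 1 := fun x y => by
    compute_degree
  have d2 : ∀ y : F, (1 - C y * X).natDegree ≤ 1 := fun y => by
    compute_degree
  have dp : ∀ (s : Finset ι) (f : ι → Polynomial F), (∀ l, (f l).natDegree ≤ 1) → (∏ l ∈ s, f l).natDegree ≤ s.card := by
    intro s f hf
    refine (natDegree_prod_le _ _).trans ?_
    refine (sum_le_card_nsmul _ _ 1 fun l _ => hf l).trans (by simp)
  have cp : ∀ (s : Finset ι) (f : ι → Polynomial F), (∀ l, (f l).natDegree ≤ 1) →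
      (∏ l ∈ s, f l).coeff s.card = ∏ l ∈ s, (f l).coeff 1 := by
    intro s f hf
    have := coeff_prod_of_natDegree_le s f 1 (fun l _ => hf l)
    simpa using this
  apply eq_of_degree_sub_lt_of_eval_finset_eq (univ.image fun l => (a l)⁻¹)
  · rw [card_image_of_injective _ (fun x y h => hinj (inv_injective h)), degree_lt_iff_coeff_zero]
    intro m hm
    have z1 : (∑ j, C ((u j - (u j)⁻¹) * ∏ l ∈ univ.erase j, (u l * a j - (u l)⁻¹ * a l) / (a j - a l)) *
        ∏ l ∈ univ.erase j, (1 - C (a l) * X)).coeff m = 0 := by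
      rw [finset_sum_coeff]
      refine sum_eq_zero fun j _ => ?_
      rw [coeff_C_mul, coeff_eq_zero_of_natDegree_lt, mul_zero]
      refine (dp _ _ fun l => d2 _).trans_lt ?_
      rw [card_erase_of_mem (mem_univ _)]
      have : 0 < (univ : Finset ι).card := card_pos.2 ⟨j, mem_univ _⟩
      omega
    rw [coeff_sub, coeff_add, z1, add_zero, coeff_C_mul]
    rcases hm.eq_or_lt with rfl | hm
    · rw [cp _ _ fun l => d1 _ _, cp _ _ fun l => d2 _, ← prod_mul_distrib, sub_eq_zero]
      refine prod_congr rfl fun l _ => ?_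
      simp [coeff_one]
    · rw [coeff_eq_zero_of_natDegree_lt ((dp _ _ fun l => d1 _ _).trans_lt hm),
        coeff_eq_zero_of_natDegree_lt ((dp _ _ fun l => d2 _).trans_lt hm)]
      simp
  · intro x hx
    obtain ⟨j, -, rfl⟩ := mem_image.1 hx
    rw [eval_add, eval_mul, eval_prod, eval_prod,
      prod_eq_zero (f := fun l => eval (a j)⁻¹ (1 - C (a l) * X)) (mem_univ j)
      (by simp [ha j]), mul_zero, zero_add, eval_finset_sum, sum_eq_single j]
    · rw [← mul_prod_erase _ _ (mem_univ j), eval_mul, eval_prod, eval_C,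
        mul_assoc, ← prod_mul_distrib]
      congr 1
      · simp [ha j]
      · refine prod_congr rfl fun l hl => ?_
        have h1 : a j - a l ≠ 0 := sub_ne_zero.2 fun h => (mem_erase.1 hl).1 (hinj h).symm
        have := ha j
        have := hu l
        simp
        field_simp
    · intro k _ hk
      rw [eval_mul, eval_prod, prod_eq_zero (s := univ.erase k)
        (f := fun l => eval (a j)⁻¹ (1 - C (a l) * X)) (i := j) (by simp [hk.symm]) (by simp [ha j]), mul_zero]
    · simp

theorem sbR_eq (j : ι) (I : Finset ι) : (p - p⁻¹) * sbR p a j I =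
    (sbU p I j - (sbU p I j)⁻¹) * ∏ l ∈ univ.erase j, (sbU p I l * a j - (sbU p I l)⁻¹ * a l) / (a j - a l) := by
  rw [sbR, sbCp, sbCm, ← prod_mul_distrib, ← mul_assoc]
  congr 1
  · by_cases h : j ∈ I <;> simp [sbU, h]
  · refine prod_congr rfl fun l _ => ?_
    by_cases h : l ∈ I <;> simp [sbU, h]

theorem sbU_ne (hp : p ≠ 0) (I : Finset ι) (l : ι) : sbU p I l ≠ 0 := by
  unfold sbU; split_ifs <;> simp [hp]

theorem sbS_zero (hp : p ≠ 0) (ha : ∀ l, a l ≠ 0) (hinj : Function.Injective a) (I : Finset ι) :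
    (p - p⁻¹) * sbS p a 0 I = ∏ l, sbU p I l - (∏ l, sbU p I l)⁻¹ := by
  have := congrArg (eval 0) (sb_poly (a := a) (sbU p I) (sbU_ne hp I) ha hinj)
  simp only [eval_prod, eval_add, eval_mul, eval_finset_sum,
    eval_sub, eval_C, eval_X, eval_one, mul_zero, sub_zero,
    prod_const_one, mul_one] at this
  rw [prod_inv_distrib] at this
  refine Eq.trans ?_ (eq_sub_iff_add_eq'.2 this.symm)
  rw [sbS, Finset.mul_sum]
  exact sum_congr rfl fun j _ => by rw [← sbR_eq, zpow_zero, mul_one]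

theorem sbU_ins (hp : p ≠ 0) {i : ι} {I : Finset ι} (hi : i ∉ I) :
    ∏ l, sbU p (insert i I) l = (p ^ 2)⁻¹ * ∏ l, sbU p I l := by
  rw [← mul_prod_erase _ _ (mem_univ i), ← mul_prod_erase _ _ (mem_univ i), ← mul_assoc]
  congr 1
  · simp only [sbU, mem_insert_self, if_true, hi, if_false]
    field_simp
  · refine prod_congr rfl fun l hl => ?_
    have : l ≠ i := (mem_erase.1 hl).1
    simp [sbU, this]

theorem sbEp_rec (hp : p ≠ 0) (ha : ∀ l, a l ≠ 0) (hinj : Function.Injective a) {i : ι} {I : Finset ι} (hi : i ∉ I) (n : ℤ) :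
    sbEp p a (n + 1) (insert i I) - (p ^ 2)⁻¹ * sbEp p a (n + 1) I =
      a i * ((p ^ 2)⁻¹ * sbEp p a n (insert i I) - sbEp p a n I) := by
  rcases lt_trichotomy n (-1) with h | rfl | h
  · rw [sbEp, sbEp, sbEp, sbEp, if_pos (by omega), if_pos (by omega), if_pos (by omega), if_pos (by omega)]; simp
  · simp [sbEp, sbU_ins hp hi]
  · rcases eq_or_ne n 0 with rfl | h0
    · have e1 := sbS_rec (a := a) hp ha hi 0
      have e2 := sbS_zero (a := a) hp ha hinj I
      have e3 := sbS_zero (a := a) hp ha hinj (insert i I)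
      have hU : ∏ l, sbU p I l ≠ 0 := prod_ne_zero_iff.2 fun l _ => sbU_ne hp I l
      rw [sbU_ins hp hi] at e3
      simp only [sbEp, zero_add, one_ne_zero, if_false, lt_irrefl, if_true, Int.not_ofNat_neg] at *
      norm_num at e1 ⊢
      rw [sbU_ins hp hi]
      have e4 : (p ^ 2)⁻¹ * ((p ^ 2)⁻¹ * ∏ l, sbU p I l)⁻¹ = (∏ l, sbU p I l)⁻¹ := by field_simp
      linear_combination (p - p⁻¹) * e1 + a i * (p ^ 2)⁻¹ * e3 - a i * e2 - a i * e4
    · rw [sbEp, sbEp, sbEp, sbEp, if_neg (by omega), if_neg (by omega), if_neg (by omega), if_neg (by omega),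
        if_neg (by omega), if_neg (by omega), if_neg (by omega), if_neg (by omega)]
      linear_combination (p - p⁻¹) * sbS_rec (a := a) hp ha hi n

theorem sbEm_rec (hp : p ≠ 0) (ha : ∀ l, a l ≠ 0) (hinj : Function.Injective a) {i : ι} {I : Finset ι} (hi : i ∉ I) (n : ℤ) :
    sbEm p a (n + 1) (insert i I) - (p ^ 2)⁻¹ * sbEm p a (n + 1) I =
      a i * ((p ^ 2)⁻¹ * sbEm p a n (insert i I) - sbEm p a n I) := by
  simp only [sbEm]
  linear_combination sbEp_rec hp ha hinj hi n - (p - p⁻¹) * sbS_rec (a := a) hp ha hi n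

variable (p a)
def sbXm (n : ℤ) : Module.End F (Finset ι → F) where
  toFun f J := ∑ j, if j ∈ J then a j ^ n * sbCm p a j J * f (J.erase j) else 0
  map_add' f g := by
    funext J
    simp only [Pi.add_apply, ← sum_add_distrib]
    refine sum_congr rfl fun j _ => ?_
    split_ifs <;> ring
  map_smul' c f := by
    funext J
    simp only [Pi.smul_apply, smul_eq_mul, RingHom.id_apply, Finset.mul_sum]
    refine sum_congr rfl fun j _ => ?_
    split_ifs <;> ring
def sbXp (n : ℤ) : Module.End F (Finset ι → F) where
  toFun f J := ∑ j, if j ∈ J then 0 else a j ^ n * sbCp p a j J * f (insert j J)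
  map_add' f g := by
    funext J
    simp only [Pi.add_apply, ← sum_add_distrib]
    refine sum_congr rfl fun j _ => ?_
    split_ifs <;> ring
  map_smul' c f := by
    funext J
    simp only [Pi.smul_apply, smul_eq_mul, RingHom.id_apply, Finset.mul_sum]
    refine sum_congr rfl fun j _ => ?_
    split_ifs <;> ring
def sbD (e : Finset ι → F) : Module.End F (Finset ι → F) where
  toFun f J := e J * f J
  map_add' f g := by funext J; simp [mul_add]
  map_smul' c f := by funext J; simp [mul_left_comm]

theorem sbXm_ap (n : ℤ) (f : Finset ι → F) (J : Finset ι) :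
    sbXm p a n f J = ∑ j, if j ∈ J then a j ^ n * sbCm p a j J * f (J.erase j) else 0 := rfl
theorem sbXp_ap (n : ℤ) (f : Finset ι → F) (J : Finset ι) :
    sbXp p a n f J = ∑ j, if j ∈ J then 0 else a j ^ n * sbCp p a j J * f (insert j J) := rfl
theorem sbD_ap (e f : Finset ι → F) (J : Finset ι) : sbD e f J = e J * f J := rfl

variable {p a}
theorem sb_comm (ha : ∀ l, a l ≠ 0) (m n : ℤ) (f : Finset ι → F) :
    sbXp p a m (sbXm p a n f) = sbXm p a n (sbXp p a m f) + sbD (sbS p a (m + n)) f := by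
  funext I
  have e1 : sbXp p a m (sbXm p a n f) I = ∑ i, ∑ j, if i ∈ I then 0 else if j ∈ insert i I then
      a i ^ m * sbCp p a i I * (a j ^ n * sbCm p a j (insert i I) * f ((insert i I).erase j)) else 0 := by
    rw [sbXp_ap]
    refine sum_congr rfl fun i _ => ?_
    split_ifs
    · simp
    · rw [sbXm_ap, Finset.mul_sum]
      exact sum_congr rfl fun j _ => by rw [mul_ite, mul_zero]
  have e2 : sbXm p a n (sbXp p a m f) I = ∑ i, ∑ j, if j ∈ I then if i ∈ I.erase j then 0 else
      a j ^ n * sbCm p a j I * (a i ^ m * sbCp p a i (I.erase j) * f (insert i (I.erase j))) else 0 := by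
    rw [sbXm_ap, sum_comm]
    refine sum_congr rfl fun j _ => ?_
    split_ifs
    · rw [sbXp_ap, Finset.mul_sum]
      exact sum_congr rfl fun i _ => by rw [mul_ite, mul_zero]
    · simp
  have e3 : sbD (sbS p a (m + n)) f I = ∑ i, ∑ j, if i = j then sbR p a i I * a i ^ (m + n) * f I else 0 := by
    rw [sbD_ap, sbS, Finset.sum_mul]
    exact sum_congr rfl fun i _ => by simp
  rw [Pi.add_apply, e1, e2, e3]
  simp only [← sum_add_distrib]
  refine sum_congr rfl fun i _ => sum_congr rfl fun j _ => ?_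
  by_cases hij : i = j
  · subst hij
    by_cases hi : i ∈ I
    · have : sbCp p a i (I.erase i) = sbCp p a i I := by
        conv_rhs => rw [← insert_erase hi, sbCp_self]
      simp only [hi, if_true, mem_erase, ne_eq, not_true_eq_false, false_and, if_false, insert_erase hi, this]
      rw [sbR, if_pos hi, zpow_add₀ (ha i)]
      ring
    · simp only [hi, if_false, mem_insert_self, if_true, sbCm_self, erase_insert hi, zero_add]
      rw [sbR, if_neg hi, zpow_add₀ (ha i)]
      ring
  · rw [if_neg hij, add_zero]
    by_cases hi : i ∈ I
    · simp [hi, hij]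
    · by_cases hj : j ∈ I
      · have hj2 : j ∉ I.erase j := by simp
        have h1 : (insert i I).erase j = insert i (I.erase j) := erase_insert_of_ne hij
        have h2 : sbCp p a i (I.erase j) = (p * a i - p⁻¹ * a j) / (a i - a j) * sbCp p a i I := by
          conv_rhs => rw [← insert_erase hj]
          exact sbCp_ins p a hij hj2
        have h3 := sbCm_ins p a (i := j) (j := i) (Ne.symm hij) hi
        have h4 : (p⁻¹ * a j - p * a i) / (a j - a i) = (p * a i - p⁻¹ * a j) / (a i - a j) := by
          rw [← neg_sub (p * a i), ← neg_sub (a i), neg_div_neg_eq]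
        simp only [hi, hj, if_false, if_true, mem_insert, or_true, mem_erase, and_false, h1, h2, h3, h4]
        ring
      · have : ¬ j = i := fun h => hij h.symm
        simp [hj, this]

theorem sb_e {E : ℤ → Finset ι → F} {β : F} (ha : ∀ l, a l ≠ 0)
    (hE : ∀ i I n, i ∉ I → E (n + 1) (insert i I) - β * E (n + 1) I = a i * (β * E n (insert i I) - E n I))
    (n m : ℤ) (f : Finset ι → F) : sbD (E (n + 1)) (sbXm p a m f) - β • sbXm p a m (sbD (E (n + 1)) f) =
      β • sbD (E n) (sbXm p a (m + 1) f) - sbXm p a (m + 1) (sbD (E n) f) := by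
  funext J
  simp only [Pi.sub_apply, Pi.smul_apply, sbD_ap, sbXm_ap, smul_eq_mul, Finset.mul_sum, ← sum_sub_distrib]
  refine sum_congr rfl fun j _ => ?_
  split_ifs with h
  · have := hE j (J.erase j) n (by simp)
    rw [insert_erase h] at this
    rw [zpow_add_one₀ (ha j)]
    linear_combination a j ^ m * sbCm p a j J * f (J.erase j) * this
  · ring

def sbH (a : ι → F) (s : ℤ) (I : Finset ι) : F := ∑ l ∈ I, a l ^ s

theorem sb_h (ha : ∀ l, a l ≠ 0) (s m : ℤ) (f : Finset ι → F) :
    sbD (sbH a s) (sbXm p a m f) = sbXm p a m (sbD (sbH a s) f) + sbXm p a (m + s) f := by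
  funext J
  simp only [Pi.add_apply, sbD_ap, sbXm_ap, Finset.mul_sum, ← sum_add_distrib]
  refine sum_congr rfl fun j _ => ?_
  split_ifs with h
  · have : sbH a s J = a j ^ s + sbH a s (J.erase j) := (add_sum_erase _ _ h).symm
    rw [this, zpow_add₀ (ha j)]
    ring
  · ring

def sbV : Finset ι → F := fun I => if I = ∅ then 1 else 0

theorem sbD_sbV (e : Finset ι → F) : sbD e (sbV (ι := ι)) = e ∅ • sbV := by
  funext I
  simp only [sbD_ap, sbV, Pi.smul_apply, smul_eq_mul]
  split_ifs with h
  · rw [h]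
  · simp

theorem sbXp_sbV (n : ℤ) : sbXp p a n (sbV (ι := ι)) = 0 := by
  funext I
  rw [sbXp_ap]
  refine sum_eq_zero fun j _ => ?_
  simp [sbV]

theorem sb_wd (ns : List ℤ) (J : Finset ι) (h : J.card ≠ ns.length) : wd (sbXm p a) sbV ns J = 0 := by
  induction ns generalizing J with
  | nil =>
    rw [wd_nil, sbV, if_neg]
    rintro rfl
    exact h rfl
  | cons n ns ih =>
    rw [wd_cons, sbXm_ap]
    refine sum_eq_zero fun j _ => ?_
    split_ifs with hj
    · rw [ih, mul_zero]
      rw [card_erase_of_mem hj]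
      have : 0 < J.card := card_pos.2 ⟨j, hj⟩
      rw [List.length_cons] at h
      omega
    · rfl

theorem sb_wd0 (ns : List ℤ) (h : Fintype.card ι < ns.length) : wd (sbXm p a) (sbV (ι := ι)) ns = 0 := by
  funext J
  exact sb_wd ns J ((card_le_univ J).trans_lt h).ne
end
end

section
open PowerSeries Finset

/-! ### highest weights as power series -/
section
variable {ι : Type} [Fintype ι]

def gps {R : Type} [CommRing R] (p p' : R) (a : ι → R) : PowerSeries R :=
  ∏ l, ((C p - C (p' * a l) * X) * PowerSeries.mk fun n => a l ^ n)

theorem geo_mul {R : Type} [CommRing R] (c : R) :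
    (PowerSeries.mk fun n => c ^ n) * (1 - C c * X) = 1 := by
  ext n
  rw [mul_sub, mul_one, map_sub, ← mul_assoc]
  rcases n with _ | n
  · simp
  · rw [coeff_succ_mul_X, mul_comm, coeff_C_mul]
    simp [coeff_one, pow_succ, mul_comm]

theorem gps_mul {R : Type} [CommRing R] (p p' : R) (a : ι → R) :
    gps p p' a * ∏ l, (1 - C (a l) * X) =
      ∏ l, (C p - C (p' * a l) * X) := by
  rw [gps, ← prod_mul_distrib]
  refine prod_congr rfl fun l _ => ?_
  rw [mul_assoc, geo_mul, mul_one]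

theorem gps_map {R S : Type} [CommRing R] [CommRing S] (φ : R →+* S) (p p' : R) (a : ι → R) :
    map φ (gps p p' a) = gps (φ p) (φ p') (fun l => φ (a l)) := by
  rw [gps, gps, map_prod]
  refine prod_congr rfl fun l _ => ?_
  rw [map_mul, map_sub, map_mul, map_C, map_C, map_X, map_mul]
  congr 1
  ext n
  simp

theorem gps_sb [DecidableEq ι] {F : Type} [Field F] {p : F} {a : ι → F} (hp : p ≠ 0) (ha : ∀ l, a l ≠ 0)
    (hinj : Function.Injective a) : gps p p⁻¹ a = PowerSeries.mk fun n : ℕ => sbEp p a n ∅ := by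
  have e0 : ∀ l, sbU p (∅ : Finset ι) l = p := fun l => by simp [sbU]
  have e1 : (PowerSeries.mk fun n : ℕ => sbEp p a n ∅) = C (∏ _l : ι, p⁻¹) +
      ∑ j, C ((p - p⁻¹) * sbR p a j ∅) * PowerSeries.mk fun n => a j ^ n := by
    ext n
    rw [coeff_mk, map_add, map_sum]
    simp only [coeff_C_mul, coeff_mk, coeff_C]
    have e2 : ∑ j, (p - p⁻¹) * sbR p a j ∅ * a j ^ n = (p - p⁻¹) * sbS p a n ∅ := by
      rw [sbS, Finset.mul_sum]
      exact sum_congr rfl fun j _ => by rw [mul_assoc, zpow_natCast]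
    rw [e2]
    rcases n with _ | n
    · have := sbS_zero (a := a) hp ha hinj ∅
      rw [Nat.cast_zero, this, if_pos rfl, prod_inv_distrib]
      simp [sbEp, e0]
    · rw [sbEp, if_neg (by omega), if_neg (by omega), if_neg (by omega), zero_add]
  have hne : ∏ l, (1 - C (a l) * X) ≠ 0 := by
    refine prod_ne_zero_iff.2 fun l _ h => ?_
    have := congrArg (constantCoeff (R := F)) h
    simp at this
  apply mul_right_cancel₀ hne
  rw [gps_mul, e1, add_mul, Finset.sum_mul]
  have := congrArg (Polynomial.coeToPowerSeries.ringHom (R := F)) (sb_poly (a := a) (sbU p ∅) (sbU_ne hp ∅) ha hinj)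
  simp only [map_add, map_mul, map_prod, map_sum, map_sub, map_one, Polynomial.coeToPowerSeries.ringHom_apply,
    Polynomial.coe_C, Polynomial.coe_X, ← sbR_eq] at this
  simp only [e0] at this
  simp only [map_mul, map_prod, map_sub] at this ⊢
  rw [this]
  congr 1
  refine sum_congr rfl fun j _ => ?_
  rw [← mul_prod_erase _ _ (mem_univ j), mul_assoc, mul_assoc, mul_assoc,
    ← mul_assoc (PowerSeries.mk _), geo_mul, one_mul]

theorem sbEm_inv [DecidableEq ι] {F : Type} [Field F] {p : F} {a : ι → F} (hp : p ≠ 0) (ha : ∀ l, a l ≠ 0)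
    (hinj : Function.Injective a) (n : ℕ) : sbEm p a (-(n : ℤ)) ∅ = sbEp p⁻¹ (fun l => (a l)⁻¹) n ∅ := by
  have e0 : ∀ l, sbU p (∅ : Finset ι) l = p := fun l => by simp [sbU]
  have e1 : ∀ j, sbR p⁻¹ (fun l => (a l)⁻¹) j ∅ = sbR p a j ∅ := by
    intro j
    simp only [sbR, sbCp, sbCm, notMem_empty, if_false]
    congr 2
    refine prod_congr rfl fun l hl => ?_
    have h1 : a j - a l ≠ 0 := sub_ne_zero.2 fun h => (mem_erase.1 hl).1 (hinj h).symm
    have h2 : (a j)⁻¹ - (a l)⁻¹ ≠ 0 := sub_ne_zero.2 fun h => (mem_erase.1 hl).1 (hinj (inv_injective h)).symm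
    have := ha j
    have := ha l
    rw [div_eq_div_iff h2 h1, inv_inv]
    field_simp
    ring
  have e2 : sbS p⁻¹ (fun l => (a l)⁻¹) n ∅ = sbS p a (-(n : ℤ)) ∅ := by
    rw [sbS, sbS]
    exact sum_congr rfl fun j _ => by rw [e1, inv_zpow, zpow_neg]
  rcases n with _ | n
  · have := sbS_zero (a := a) hp ha hinj ∅
    simp only [e0] at this
    simp [sbEm, this, sbEp, sbU]
  · rw [sbEm, sbEp, if_pos (by omega), sbEp, if_neg (by omega), if_neg (by omega), e2, inv_inv]
    ring

theorem toPS_coe (p : Polynomial ℂ) : toPS p = Polynomial.coeToPowerSeries.ringHom p := by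
  ext n
  simp [toPS]

theorem gam_p {q : ℂ} {M i : ℕ} (hp : qpar q M i ≠ 0) {P : Polynomial ℂ} {b : ι → ℂ}
    (hP : P = ∏ l, (1 - Polynomial.C (b l) * Polynomial.X)) (hd : P.natDegree = Fintype.card ι) (n : ℕ) :
    gammaP q M i P n = coeff n (gps (qpar q M i) (qpar q M i)⁻¹ fun l => qpar q M i * b l) := by
  set p := qpar q M i with hpd
  have e1 : ∀ u, toPS (pscale u P) = ∏ l, (1 - C (u * b l) * X) := by
    intro u
    rw [toPS_coe, pscale, hP, Polynomial.prod_comp, map_prod]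
    refine prod_congr rfl fun l _ => ?_
    simp only [Polynomial.sub_comp, Polynomial.mul_comp, Polynomial.one_comp, Polynomial.C_comp, Polynomial.X_comp,
      map_sub, map_mul, map_one, Polynomial.coeToPowerSeries.ringHom_apply, Polynomial.coe_C, Polynomial.coe_X]
    ring
  have e2 : gps p p⁻¹ (fun l => p * b l) = C (p ^ Fintype.card ι) * toPS (pscale p⁻¹ P) * (toPS (pscale p P))⁻¹ := by
    rw [PowerSeries.eq_mul_inv_iff_mul_eq]
    · rw [e1, e1, gps_mul, map_pow, ← card_univ, ← prod_const, ← prod_mul_distrib]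
      refine prod_congr rfl fun l _ => ?_
      have h1 : C (p⁻¹ * (p * b l)) = C p * C (p⁻¹ * b l) := by
        rw [← map_mul]
        congr 1
        field_simp
      rw [h1]
      ring
    · rw [e1, map_prod]
      simp
  rw [e2, mul_assoc, coeff_C_mul, gammaP, if_pos (by omega), hd]
  rfl

theorem gam_m {q : ℂ} {M i : ℕ} (hp : qpar q M i ≠ 0) {P : Polynomial ℂ} {b : ι → ℂ} (hb : ∀ l, b l ≠ 0)
    (hP : P = ∏ l, (1 - Polynomial.C (b l) * Polynomial.X)) (hd : P.natDegree = Fintype.card ι) (n : ℕ) :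
    gammaM q M i P (-(n : ℤ)) = coeff n (gps (qpar q M i)⁻¹ (qpar q M i) fun l => (qpar q M i * b l)⁻¹) := by
  classical
  set p := qpar q M i with hpd
  have e0 : ∀ (s : Finset ι) (c : ι → ℂ), (∏ l ∈ s, (1 - Polynomial.C (c l) * Polynomial.X)).natDegree ≤ s.card ∧
      (∏ l ∈ s, (1 - Polynomial.C (c l) * Polynomial.X)).reflect s.card = ∏ l ∈ s, (Polynomial.X - Polynomial.C (c l)) := by
    intro s c
    induction s using Finset.induction_on with
    | empty => simp
    | insert j s hj ih =>
      have d1 : (1 - Polynomial.C (c j) * Polynomial.X).natDegree ≤ 1 := by compute_degree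
      rw [prod_insert hj, prod_insert hj, card_insert_of_notMem hj, add_comm s.card 1]
      refine ⟨(Polynomial.natDegree_mul_le).trans (add_le_add d1 ih.1), ?_⟩
      rw [Polynomial.reflect_mul _ _ d1 ih.1, ih.2]
      congr 1
      rw [sub_eq_add_neg, ← neg_mul, ← map_neg, Polynomial.reflect_add, Polynomial.reflect_C_mul, Polynomial.reflect_one_X,
        ← Polynomial.C_1, Polynomial.reflect_C]
      simp [sub_eq_add_neg]
  have e1 : ∀ u, toPS ((pscale u P).reflect P.natDegree) = ∏ l, (X - C (u * b l)) := by
    intro u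
    have : pscale u P = ∏ l, (1 - Polynomial.C (u * b l) * Polynomial.X) := by
      rw [pscale, hP, Polynomial.prod_comp]
      refine prod_congr rfl fun l _ => ?_
      simp only [Polynomial.sub_comp, Polynomial.mul_comp, Polynomial.one_comp, Polynomial.C_comp, Polynomial.X_comp, map_mul]
      ring
    rw [toPS_coe, this, hd, ← card_univ, (e0 univ _).2, map_prod]
    refine prod_congr rfl fun l _ => ?_
    simp
  have e2 : gps p⁻¹ p (fun l => (p * b l)⁻¹) = C (p ^ Fintype.card ι) * toPS ((pscale p⁻¹ P).reflect P.natDegree) *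
      (toPS ((pscale p P).reflect P.natDegree))⁻¹ := by
    rw [PowerSeries.eq_mul_inv_iff_mul_eq]
    · have e3 : ∏ l, (X - C (p * b l)) =
          (∏ l, (1 - C ((p * b l)⁻¹) * X)) * ∏ l, C (-(p * b l)) := by
        rw [← prod_mul_distrib]
        refine prod_congr rfl fun l _ => ?_
        have : C ((p * b l)⁻¹) * C (p * b l) = 1 := by
          rw [← map_mul, inv_mul_cancel₀ (mul_ne_zero hp (hb l)), map_one]
        rw [map_neg]
        linear_combination -X * this
      rw [e1, e1, e3, ← mul_assoc, gps_mul, map_pow, ← card_univ, ← prod_const, ← prod_mul_distrib,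
        ← prod_mul_distrib]
      refine prod_congr rfl fun l _ => ?_
      have h1 : C (p * (p * b l)⁻¹) * C (p * b l) = C p := by
        rw [← map_mul]
        congr 1
        have := hb l
        field_simp
      have h2 : C p⁻¹ * C (p * b l) = C p * C (p⁻¹ * b l) := by
        rw [← map_mul, ← map_mul]
        congr 1
        field_simp
      rw [map_neg]
      linear_combination X * h1 - h2
    · rw [e1, map_prod]
      refine prod_ne_zero_iff.2 fun l _ => ?_
      simp [hp, hb l]
  rw [e2, mul_assoc, coeff_C_mul, gammaM, if_pos (by omega), hd, neg_neg]
  rfl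

theorem exists_factor (P : Polynomial ℂ) (h : P.coeff 0 = 1) : ∃ b : Fin P.natDegree → ℂ, (∀ l, b l ≠ 0) ∧
    P = ∏ l, (1 - Polynomial.C (b l) * Polynomial.X) := by
  have hs := IsAlgClosed.splits P
  have h1 := hs.eq_prod_roots
  have hc := hs.natDegree_eq_card_roots
  have hP0 : P ≠ 0 := fun e => by simp [e] at h
  set L := P.roots.toList with hL
  have hlen : L.length = P.natDegree := by rw [hc, hL, Multiset.length_toList]
  have hr : ∀ x ∈ L, x ≠ 0 := by
    intro x hx h0
    rw [hL, Multiset.mem_toList, Polynomial.mem_roots hP0, Polynomial.IsRoot, h0, ← Polynomial.coeff_zero_eq_eval_zero, h] at hx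
    exact one_ne_zero hx
  have h2 : P = Polynomial.C P.leadingCoeff * (L.map fun x => Polynomial.X - Polynomial.C x).prod := by
    conv_lhs => rw [h1]
    rw [hL, ← Multiset.prod_coe, ← Multiset.map_coe, Multiset.coe_toList]
  have h3 : ∀ L : List ℂ, (∀ x ∈ L, x ≠ 0) → (L.map fun x => Polynomial.X - Polynomial.C x).prod =
      Polynomial.C (L.map fun x => -x).prod * (L.map fun x => 1 - Polynomial.C x⁻¹ * Polynomial.X).prod := by
    intro L hL
    induction L with
    | nil => simp
    | cons x L ih =>
      rw [List.map_cons, List.prod_cons, ih fun y hy => hL y (by simp [hy]), List.map_cons, List.prod_cons, List.map_cons,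
        List.prod_cons, map_mul, map_neg]
      have : Polynomial.C x * Polynomial.C x⁻¹ = 1 := by
        rw [← map_mul, mul_inv_cancel₀ (hL x (by simp)), map_one]
      linear_combination (-Polynomial.X * Polynomial.C (List.map (fun x => -x) L).prod *
        (List.map (fun x => 1 - Polynomial.C x⁻¹ * Polynomial.X) L).prod) * this
  rw [h3 L hr, ← mul_assoc, ← map_mul] at h2
  have h4 : ∀ L : List ℂ, ((L.map fun x => 1 - Polynomial.C x⁻¹ * Polynomial.X).prod).eval 0 = 1 := by
    intro L
    induction L with
    | nil => simp
    | cons x L ih => simp [ih]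
  have h5 : P.leadingCoeff * (L.map fun x => -x).prod = 1 := by
    have := congrArg (Polynomial.eval 0) h2
    rw [← Polynomial.coeff_zero_eq_eval_zero, h, Polynomial.eval_mul, h4, Polynomial.eval_C, mul_one] at this
    exact this.symm
  rw [h5, map_one, one_mul] at h2
  refine ⟨fun l => (L[(l : ℕ)]'(by rw [hlen]; exact l.2))⁻¹, fun l => inv_ne_zero (hr _ (List.getElem_mem _)), ?_⟩
  conv_lhs => rw [h2]
  rw [← Fin.prod_univ_getElem]
  refine Fintype.prod_equiv (finCongr (by rw [List.length_map, hlen])) _ _ fun l => ?_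
  simp
end
end

section
open Submodule Module
variable {q : ℂ} {M N : ℕ} {V Y : Type} [AddCommGroup V] [Module ℂ V] [AddCommGroup Y] [Module ℂ Y]

theorem even_core {R : RD q M N (End ℂ V)} {pr : V →ₗ[ℂ] Y} (ndg : NDG R pr) (hq : QOK q)
    {O : Type} [CommRing O] [Algebra ℂ O] [Module O V] (ev : O →+* ℂ) (hev : ∀ c : ℂ, ev (algebraMap ℂ O c) = c)
    (hsm : ∀ (c : O) (v : V), c • v = ev c • v)
    {F : Type} [Field F] [Algebra O F] (hinj : Function.Injective (algebraMap O F))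
    {ι : Type} [Fintype ι] [DecidableEq ι] {a : ι → F} (ha : ∀ l, a l ≠ 0) (hai : Function.Injective a)
    {i : ℕ} (hi : i ≠ M) {p : F} (hp : p = algebraMap O F (algebraMap ℂ O (qpar q M i)))
    {ep em : ℤ → O} (hep : ∀ n, algebraMap O F (ep n) = sbEp p a n ∅) (hem : ∀ n, algebraMap O F (em n) = sbEm p a n ∅)
    {v : V} (xpv : ∀ j n, R.xp j n v = 0) (fpv : ∀ n, R.fp i n v = ev (ep n) • v) (fmv : ∀ n, R.fm i n v = ev (em n) • v)
    (kv : ∀ j, ∃ c : ℂ, R.k j v = c • v) (kiv : ∀ j, ∃ c : ℂ, R.ki j v = c • v) (hv : ∀ j s, ∃ c : ℂ, R.h j s v = c • v)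
    (p1 : ∀ n, pr (R.xm i n v) = 0) (ns : List ℤ) (hns : Fintype.card ι < ns.length) : wd (R.xm i) v ns = 0 := by
  have hpn : p ≠ 0 := by
    rw [hp]
    intro h
    have h1 : algebraMap ℂ O (qpar q M i) = 0 := hinj (by rw [h, map_zero])
    have h2 := hev (qpar q M i)
    rw [h1, map_zero] at h2
    exact (hq.qpar M i).ne0 h2.symm
  let θ : ℂ →+* F := (algebraMap O F).comp (algebraMap ℂ O)
  have hθ : p = θ (qpar q M i) := hp
  have hβF : θ (q ^ (-cc M i i)) = (p ^ 2)⁻¹ := by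
    rw [hθ, ← map_pow, ← map_inv₀, cc_self_even _ _ hi, ← qpar_zpow_lof M i (-(2 * lof M i))]
    congr 1
    have : lof M i * -(2 * lof M i) = -2 := by
      have := lof_sq M i
      linear_combination -2 * this
    rw [this, zpow_neg]
    norm_cast
  have hsF : ∀ (c : O) (f : Finset ι → F), c • f = algebraMap O F c • f := fun c f => (algebraMap_smul F c f).symm
  let L : End ℂ V → End O V := fun T =>
    { toFun := T, map_add' := T.map_add, map_smul' := fun c x => by rw [hsm, map_smul, hsm]; rfl }
  let L' : End F (Finset ι → F) → End O (Finset ι → F) := fun T =>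
    { toFun := T, map_add' := T.map_add, map_smul' := fun c x => by rw [hsF, map_smul, hsF]; rfl }
  let Pa : End ℂ V → End F (Finset ι → F) → End O (V × (Finset ι → F)) := fun T T' =>
    LinearMap.prodMap (L T) (L' T')
  have hPa : ∀ T T' y, Pa T T' y = (T y.1, T' y.2) := fun _ _ _ => rfl
  have hsP : ∀ (c : O) (y : V × (Finset ι → F)), c • y = (ev c • y.1, algebraMap O F c • y.2) := fun c y => by
    rw [← hsm, ← hsF]; rfl
  have hsC : ∀ (c : ℂ) (y : V × (Finset ι → F)), algebraMap ℂ O c • y = (c • y.1, θ c • y.2) := fun c y => by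
    rw [hsP, hev]; rfl
  let X : ℤ → End O (V × (Finset ι → F)) := fun n => Pa (R.xm i n) (sbXm p a n)
  let g : V × (Finset ι → F) := (v, sbV)
  have hwd : ∀ ns, wd X g ns = (wd (R.xm i) v ns, wd (sbXm p a) sbV ns) := by
    intro ns
    induction ns with
    | nil => rfl
    | cons n ns ih => rw [wd_cons, wd_cons, wd_cons, ih]; rfl
  have hker : ∀ {Y' : Type} [AddCommGroup Y'] [Module ℂ Y'] (φ : V →ₗ[ℂ] Y') (r : ℕ),
      (∀ ns : List ℤ, ns.length = r → φ (wd (R.xm i) v ns) = 0) → ∀ y ∈ Om X g r, φ y.1 = 0 := by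
    intro Y' _ _ φ r h y hy
    refine span_induction ?_ ?_ ?_ ?_ hy
    · rintro _ ⟨ns, hn, rfl⟩
      rw [hwd]; exact h ns hn
    · exact map_zero _
    · intro x y _ _ hx hy
      rw [Prod.fst_add, map_add, hx, hy, add_zero]
    · intro c x _ hx
      rw [hsP]
      change φ (ev c • x.1) = 0
      rw [map_smul, hx, smul_zero]
  have apx : ∀ (A B : End ℂ V) (y : V), (A * B) y = A (B y) := fun _ _ _ => rfl
  -- fp, fm
  have hfp : ∀ r n, ∀ y ∈ Om X g r, Pa (R.fp i n) (sbD (sbEp p a n)) y ∈ Om X g r := by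
    intro r
    refine Om_fp (fun n => Pa (R.fp i n) (sbD (sbEp p a n))) (algebraMap ℂ O (q ^ (-cc M i i))) ?_ ?_ ?_ r
    · intro n hn
      refine LinearMap.ext fun y => ?_
      rw [hPa, R.fp_neg i n hn]
      refine Prod.ext rfl ?_
      funext J
      simp [sbD_ap, sbEp, hn]
    · intro n m y
      simp only [hsC, hβF]
      refine Prod.ext ?_ ?_
      · exact LinearMap.congr_fun (R.fp_xm hq i i n m) y.1
      · exact sb_e ha (fun j I n hj => sbEp_rec hpn ha hai hj n) n m y.2
    · intro n
      refine ⟨ep n, ?_⟩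
      rw [hPa, hsP, hep]
      exact Prod.ext (fpv n) (sbD_sbV _)
  have hfm : ∀ r n, ∀ y ∈ Om X g r, Pa (R.fm i n) (sbD (sbEm p a n)) y ∈ Om X g r := by
    intro r
    refine Om_fm (fun n => Pa (R.fm i n) (sbD (sbEm p a n))) (algebraMap ℂ O (q ^ (-cc M i i)))
      (algebraMap ℂ O (q ^ (cc M i i))) ?_ ?_ ?_ ?_ r
    · rw [← map_mul, ← zpow_add₀ hq.ne0]; simp
    · intro n hn
      refine LinearMap.ext fun y => ?_
      rw [hPa, R.fm_pos i n hn]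
      refine Prod.ext rfl ?_
      funext J
      have h1 : ¬ n < 0 := by omega
      have h2 : ¬ n = 0 := by omega
      simp [sbD_ap, sbEm, sbEp, h1, h2]
    · intro n m y
      simp only [hsC, hβF]
      refine Prod.ext ?_ ?_
      · exact LinearMap.congr_fun (R.fm_xm hq i i n m) y.1
      · exact sb_e ha (fun j I n hj => sbEm_rec hpn ha hai hj n) n m y.2
    · intro n
      refine ⟨em n, ?_⟩
      rw [hPa, hsP, hem]
      exact Prod.ext (fmv n) (sbD_sbV _)
  have hxp : ∀ r m, ∀ y ∈ Om X g (r + 1), Pa (R.xp i m) (sbXp p a m) y ∈ Om X g r := by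
    intro r
    refine Om_xp (fun m => Pa (R.xp i m) (sbXp p a m)) _ _ (algebraMap ℂ O (tq q M i)⁻¹) ?_ hfp hfm ?_ r
    · intro m n y
      rw [hsC]
      refine Prod.ext ?_ ?_
      · have := LinearMap.congr_fun (R.comm i i m n) y.1
        rw [if_pos rfl, sgn_ne _ _ _ (Or.inl hi), one_smul] at this
        exact this
      · refine (sb_comm ha m n y.2).trans ?_
        change _ = sbXm p a n (sbXp p a m y.2) + θ (tq q M i)⁻¹ • (sbD (sbEp p a (m + n)) y.2 - sbD (sbEm p a (m + n)) y.2)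
        congr 1
        have ht : θ (tq q M i)⁻¹ * (p - p⁻¹) = 1 := by
          rw [hθ, ← map_inv₀, ← map_sub, ← map_mul]
          change θ ((tq q M i)⁻¹ * tq q M i) = 1
          rw [inv_mul_cancel₀ (hq.tq_ne M i), map_one]
        funext J
        simp only [Pi.smul_apply, Pi.sub_apply, sbD_ap, smul_eq_mul, sbEm]
        linear_combination -sbS p a (m + n) J * y.2 J * ht
    · intro m
      exact Prod.ext (xpv i m) (sbXp_sbV m)
  -- the kernel
  have hz : ∀ e : V, (e, (0 : Finset ι → F)) ∈ Om X g 0 → e = 0 := by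
    intro e he
    obtain ⟨c, hc⟩ := Om_zero _ he
    rw [hsP] at hc
    have h2 := congrFun (congrArg Prod.snd hc) ∅
    have h3 : algebraMap O F c = 0 := by
      simpa [g, sbV] using h2.symm
    have h4 : c = 0 := hinj (by rw [h3, map_zero])
    have h1 := congrArg Prod.fst hc
    simpa [h4] using h1
  let S : Submodule ℂ V := span ℂ {e | ∃ r, (e, (0 : Finset ι → F)) ∈ Om X g r}
  have st : ∀ T : End ℂ V, (∀ r e, (e, (0 : Finset ι → F)) ∈ Om X g r → T e ∈ S) → ∀ e ∈ S, T e ∈ S := by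
    intro T h
    change S ≤ S.comap T
    apply span_le.2
    rintro e ⟨r, hr⟩
    exact h r e hr
  have st0 : ∀ T : V →ₗ[ℂ] Y, (∀ r e, (e, (0 : Finset ι → F)) ∈ Om X g r → T e = 0) → ∀ e ∈ S, T e = 0 := by
    intro T h
    change S ≤ LinearMap.ker T
    apply span_le.2
    rintro e ⟨r, hr⟩
    exact h r e hr
  have sub : ∀ r e, (e, (0 : Finset ι → F)) ∈ Om X g r → e ∈ S := fun r e h => subset_span ⟨r, h⟩
  have hscal : ∀ (T : End ℂ V) (c : ℂ), (∀ n, T * R.xm i n = c • (R.xm i n * T)) → (∃ e : ℂ, T v = e • v) →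
      ∀ e ∈ S, T e ∈ S := by
    rintro T c hT ⟨t, ht⟩
    have hw : ∀ ns : List ℤ, T (wd (R.xm i) v ns) = (c ^ ns.length * t) • wd (R.xm i) v ns := by
      intro ns
      induction ns with
      | nil => simp [wd_nil, ht]
      | cons n ns ih =>
        rw [wd_cons, ← apx, hT, LinearMap.smul_apply, apx, ih, map_smul, smul_smul, List.length_cons, pow_succ]
        congr 1
        ring
    refine st T fun r e he => ?_
    have := hker (T - (c ^ r * t) • (1 : End ℂ V)) r (fun ns hn => by
      rw [LinearMap.sub_apply, hw, hn]; exact sub_self _) _ he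
    rw [LinearMap.sub_apply, sub_eq_zero] at this
    change T e ∈ S
    rw [this]
    exact smul_mem _ _ (sub r e he)
  have hS : ∀ e ∈ S, e = 0 := by
    refine ndg.kill hq S ?_ ?_ ?_ ?_ ?_ ?_
    · intro j n
      by_cases hj : j = i
      · subst hj
        refine st _ fun r e he => ?_
        rcases r with _ | r
        · rw [hz e he, map_zero]; exact Submodule.zero_mem _
        · refine sub r _ ?_
          have := hxp r n _ he
          rw [hPa, map_zero] at this
          exact this
      · refine st _ fun r e he => ?_
        have hw : ∀ ns : List ℤ, R.xp j n (wd (R.xm i) v ns) = 0 := by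
          intro ns
          induction ns with
          | nil => exact xpv j n
          | cons m ns ih =>
            rw [wd_cons, ← apx, R.comm, if_neg hj, add_zero, LinearMap.smul_apply, apx, ih, map_zero, smul_zero]
        have := hker (R.xp j n) r (fun ns _ => hw ns) _ he
        rw [show R.xp j n e = 0 from this]
        exact Submodule.zero_mem _
    · intro j
      exact hscal _ _ (fun n => R.kxm j i n) (kv j)
    · intro j
      exact hscal _ _ (fun n => R.kixm hq j i n) (kiv j)
    · intro j s
      by_cases hj : vld M N j
      · refine st _ fun r e he => ?_
        refine sub r _ ?_
        obtain ⟨η, hη⟩ := hv j s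
        have := Om_h (xm := X) (g := g) (Pa (R.h j s) (θ η • (1 : End F (Finset ι → F)) + θ (-hco q M j i s) • sbD (sbH a s)))
          (algebraMap ℂ O (-hco q M j i s)) (algebraMap ℂ O η) s ?_ ?_ r _ he
        · rw [hPa, map_zero] at this
          exact this
        · rw [hPa, hsC]
          refine Prod.ext hη ?_
          change θ η • sbV + θ (-hco q M j i s) • sbD (sbH a s) sbV = θ η • sbV
          rw [sbD_sbV]
          simp [sbH]
        · intro m y
          rw [hsC]
          refine Prod.ext ?_ ?_
          · exact LinearMap.congr_fun (R.hxm2 j i s m hj) y.1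
          · change θ η • sbXm p a m y.2 + θ (-hco q M j i s) • sbD (sbH a s) (sbXm p a m y.2) =
              sbXm p a m (θ η • y.2 + θ (-hco q M j i s) • sbD (sbH a s) y.2) + θ (-hco q M j i s) • sbXm p a (m + s) y.2
            rw [sb_h ha, map_add, map_smul, map_smul, smul_add, add_assoc]
      · intro e _
        rw [R.h0 j s hj]
        exact Submodule.zero_mem _
    · refine st0 _ fun r e he => ?_
      rcases r with _ | r
      · rw [hz e he, map_zero]
      · refine hker pr (r + 1) (fun ns hn => ?_) _ he
        rcases ns with _ | ⟨n, _ | ⟨m, ns⟩⟩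
        · simp at hn
        · exact p1 n
        · exact ndg.p2 _ _ _ _ _
    · intro j n
      refine st0 (pr ∘ₗ R.xm j n) fun r e he => ?_
      rcases r with _ | r
      · rw [hz e he, map_zero]
      · refine hker (pr ∘ₗ R.xm j n) (r + 1) (fun ns hn => ?_) _ he
        rcases ns with _ | ⟨m, ns⟩
        · simp at hn
        · exact ndg.p2 _ _ _ _ _
  apply hS
  refine sub ns.length _ ?_
  have : (wd (R.xm i) v ns, (0 : Finset ι → F)) = wd X g ns := by
    rw [hwd, sb_wd0 ns hns]
  rw [this]
  exact Om_wd ns _ rfl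
end

section
open PowerSeries

theorem even_rel {q : ℂ} {M N : ℕ} (hq : QOK q) {κ : ℕ → ℂ} {gp gm : ℕ → ℕ → ℂ} {Y : Type} [AddCommGroup Y]
    [Module ℂ Y] {u : ℤ → Y} (W : HWR q M N κ gp gm u) {i : ℕ} (hv : vld M N i) (hi : i ≠ M) (P : Polynomial ℂ)
    (hP : P.coeff 0 = 1) (hgp : ∀ n : ℕ, gp i n = gammaP q M i P n) (hgm : ∀ n : ℕ, gm i n = gammaM q M i P (-(n : ℤ))) :
    (W.R.xm i 0 ^ (1 + P.natDegree)) W.v = 0 := by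
  obtain ⟨b, hb, hPb⟩ := exists_factor P hP
  have hd : P.natDegree = Fintype.card (Fin P.natDegree) := by simp
  have hp := (hq.qpar M i).ne0
  have key : ∀ x y : ℂ, constantCoeff (C x * (1 + C y * X)) = x :=
    fun x y => by simp
  let O := PowerSeries ℂ
  let F := FractionRing O
  let ev : O →+* ℂ := constantCoeff
  let φ : O →+* F := algebraMap O F
  have hφ : Function.Injective φ := IsFractionRing.injective O F
  have hev : ∀ c : ℂ, ev (algebraMap ℂ O c) = c := fun c => by simp [ev, O]
  let pO : O := algebraMap ℂ O (qpar q M i)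
  let pO' : O := algebraMap ℂ O (qpar q M i)⁻¹
  have hpp : pO * pO' = 1 := by
    rw [← map_mul, mul_inv_cancel₀ hp, map_one]
  let a : Fin P.natDegree → O := fun l => C (qpar q M i * b l) * (1 + C ((l : ℕ) : ℂ) * X)
  let a' : Fin P.natDegree → O := fun l => (a l)⁻¹
  have ha : ∀ l, ev (a l) = qpar q M i * b l := fun l => key _ _
  have ha' : ∀ l, ev (a' l) = (qpar q M i * b l)⁻¹ := fun l => by
    rw [← ha l]
    exact constantCoeff_inv _
  have haa : ∀ l, a l * a' l = 1 := fun l => PowerSeries.mul_inv_cancel _ (by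
    change ev (a l) ≠ 0
    rw [ha]; exact mul_ne_zero hp (hb l))
  have hainj : Function.Injective a := by
    intro l m h
    have h0 : qpar q M i * b l = qpar q M i * b m := by rw [← ha, ← ha, h]
    have h1 := congrArg (coeff (R := ℂ) 1) h
    simp only [a] at h1
    rw [coeff_C_mul, coeff_C_mul, h0] at h1
    have h2 := mul_left_cancel₀ (mul_ne_zero hp (hb m)) h1
    simp [coeff_one] at h2
    exact Fin.ext h2
  have hne : ∀ x y : O, x * y = 1 → φ x ≠ 0 := fun x y e h => by
    have := congrArg φ e
    rw [map_mul, h, zero_mul, map_one] at this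
    exact zero_ne_one this
  have hpF : φ pO ≠ 0 := hne _ _ hpp
  have hpF' : φ pO' = (φ pO)⁻¹ := eq_inv_of_mul_eq_one_right (by rw [← map_mul, hpp, map_one])
  have haF' : ∀ l, φ (a' l) = (φ (a l))⁻¹ := fun l => eq_inv_of_mul_eq_one_right (by rw [← map_mul, haa, map_one])
  have haF : ∀ l, φ (a l) ≠ 0 := fun l => hne _ _ (haa l)
  have haFi : Function.Injective fun l => φ (a l) := hφ.comp hainj
  let ep : ℤ → O := fun n => if n < 0 then 0 else coeff n.toNat (gps pO pO' a)
  let em : ℤ → O := fun n => if 0 < n then 0 else coeff (-n).toNat (gps pO' pO a')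
  have ep_nat : ∀ k : ℕ, ep (k : ℤ) = coeff k (gps pO pO' a) := fun k => by
    simp only [ep]; rw [if_neg (by omega)]; rfl
  have em_nat : ∀ k : ℕ, em (-(k : ℤ)) = coeff k (gps pO' pO a') := fun k => by
    simp only [em]; rw [if_neg (by omega), neg_neg]; rfl
  have hep : ∀ n, φ (ep n) = sbEp (φ pO) (fun l => φ (a l)) n ∅ := by
    intro n
    rcases lt_or_ge n 0 with h | h
    · simp [ep, sbEp, h]
    · obtain ⟨k, rfl⟩ := Int.eq_ofNat_of_zero_le h
      rw [ep_nat, ← coeff_map, gps_map, hpF', gps_sb hpF haF haFi, coeff_mk]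
  have hem : ∀ n, φ (em n) = sbEm (φ pO) (fun l => φ (a l)) n ∅ := by
    intro n
    rcases lt_or_ge 0 n with h | h
    · have h1 : ¬ n < 0 := by omega
      have h2 : ¬ n = 0 := by omega
      simp [em, sbEm, sbEp, h, h1, h2]
    · obtain ⟨k, hk⟩ := Int.eq_ofNat_of_zero_le (show 0 ≤ -n by omega)
      obtain rfl : n = -(k : ℤ) := by omega
      rw [em_nat, ← coeff_map, gps_map, sbEm_inv hpF haF haFi, hpF']
      have e1 : (fun l => φ (a' l)) = fun l => (φ (a l))⁻¹ := funext haF'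
      have e2 := gps_sb (p := (φ pO)⁻¹) (a := fun l => (φ (a l))⁻¹) (inv_ne_zero hpF) (fun l => inv_ne_zero (haF l))
        (fun x y h => haFi (inv_injective h))
      rw [inv_inv] at e2
      rw [e1, e2, coeff_mk]
  have fpv : ∀ n, W.R.fp i n W.v = ev (ep n) • W.v := by
    intro n
    rcases lt_or_ge n 0 with h | h
    · rw [W.R.fp_neg i n h]; simp [ep, h]
    · obtain ⟨k, rfl⟩ := Int.eq_ofNat_of_zero_le h
      rw [W.fpv i hv, ep_nat, hgp, gam_p hp hPb hd, ← coeff_map, gps_map, hev, hev]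
      simp only [ha]
  have fmv : ∀ n, W.R.fm i n W.v = ev (em n) • W.v := by
    intro n
    rcases lt_or_ge 0 n with h | h
    · rw [W.R.fm_pos i n h]; simp [em, h]
    · obtain ⟨k, hk⟩ := Int.eq_ofNat_of_zero_le (show 0 ≤ -n by omega)
      obtain rfl : n = -(k : ℤ) := by omega
      rw [W.fmv i hv, em_nat, hgm, gam_m hp hb hPb hd, ← coeff_map, gps_map, hev, hev]
      simp only [ha']
  letI : Module O W.V := Module.compHom W.V ev
  have main := even_core W.ndg hq ev hev (fun _ _ => rfl) (F := F) hφ haF haFi hi rfl hep hem W.xpv fpv fmv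
    (fun j => by
      by_cases hj : vld M N j
      · exact ⟨_, W.kv j hj⟩
      · exact ⟨0, by rw [W.R.k0 j hj, zero_smul]; rfl⟩)
    (fun j => by
      by_cases hj : vld M N j
      · exact ⟨_, W.kiv j hj⟩
      · exact ⟨0, by rw [W.R.ki0 j hj, zero_smul]; rfl⟩)
    W.hv (fun n => by rw [W.pxv i n hv, if_neg hi]) (List.replicate (1 + P.natDegree) 0) (by simp)
  have hw : ∀ k : ℕ, wd (W.R.xm i) W.v (List.replicate k 0) = (W.R.xm i 0 ^ k) W.v := by
    intro k
    induction k with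
    | zero => rfl
    | succ k ih => rw [List.replicate_succ, wd_cons, ih, pow_succ']; rfl
  rw [← hw]
  exact main

theorem gammaM_zero {q : ℂ} (hq : QOK q) (M i : ℕ) (P : Polynomial ℂ) (hP : P.coeff 0 = 1) :
    gammaM q M i P 0 = (qpar q M i ^ P.natDegree)⁻¹ := by
  obtain ⟨b, hb, hPb⟩ := exists_factor P hP
  have := gam_m (hq.qpar M i).ne0 hb hPb (by simp) 0
  rw [Nat.cast_zero, neg_zero] at this
  rw [this, gps, coeff_zero_eq_constantCoeff, map_prod]
  simp

theorem weyl_lower {q : ℂ} {M N : ℕ} (hq : QOK q) (hM : 1 ≤ M) (hN : 1 ≤ N) (Λ : HW q M N) (Q : Polynomial ℂ)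
    (hQ1 : Q.coeff 0 = 1) (hQf : annih Q Λ.f) : Q.natDegree < Module.finrank ℂ (WeylMod q M N false Λ Q) := by
  have hQ0 : Q ≠ 0 := fun e => by simp [e] at hQ1
  obtain ⟨D⟩ := exists_YD Q hQ1
  have hp := fun i => (hq.qpar M i).ne0
  let κ : ℕ → ℂ := fun i => if i = M then Λ.c else qpar q M i ^ (Λ.P i).natDegree
  let gp : ℕ → ℕ → ℂ := fun i n => if i = M then if n = 0 then Λ.c else (q - q⁻¹) * Λ.f n else gammaP q M i (Λ.P i) n
  let gm : ℕ → ℕ → ℂ := fun i n => if i = M then if n = 0 then Λ.c⁻¹ else -((q - q⁻¹) * Λ.f (-(n : ℤ)))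
    else gammaM q M i (Λ.P i) (-(n : ℤ))
  have hκ : ∀ i, κ i ≠ 0 := by
    intro i
    simp only [κ]
    split_ifs
    · exact Λ.c_ne
    · exact pow_ne_zero _ (hp i)
  obtain ⟨W⟩ := exists_HWR hq M N κ hκ gp gm (fun i => by
    simp only [κ, gp]
    split_ifs
    · rfl
    · exact gammaP_zero i _ (Λ.P_const i)) (fun i => by
    simp only [κ, gm]
    split_ifs
    · rfl
    · rw [Nat.cast_zero, neg_zero]
      exact gammaM_zero hq M i _ (Λ.P_const i)) D.u
  have hMv : vld M N M := ⟨hM, by omega⟩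
  refine lower_of D W hq hM hN Λ hQ1 hQf ?_ ?_ ?_ ?_ ?_
  · intro i hv hi n
    rcases lt_or_ge n 0 with h | h
    · rw [W.R.fp_neg i n h, gammaP, if_neg (by omega), zero_smul]; rfl
    · obtain ⟨k, rfl⟩ := Int.eq_ofNat_of_zero_le h
      rw [W.fpv i hv]
      simp only [gp, if_neg hi]
  · intro i hv hi n
    rcases lt_or_ge 0 n with h | h
    · rw [W.R.fm_pos i n h, gammaM, if_neg (by omega), zero_smul]; rfl
    · obtain ⟨k, hk⟩ := Int.eq_ofNat_of_zero_le (show 0 ≤ -n by omega)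
      obtain rfl : n = -(k : ℤ) := by omega
      rw [W.fmv i hv]
      simp only [gm, if_neg hi]
  · rw [W.kv M hMv]
    simp [κ]
  · intro n
    rcases lt_trichotomy n 0 with h | rfl | h
    · obtain ⟨k, hk⟩ := Int.eq_ofNat_of_zero_le (show 0 ≤ -n by omega)
      obtain rfl : n = -(k : ℤ) := by omega
      have hk0 : k ≠ 0 := by omega
      rw [W.R.fp_neg M _ h, W.fmv M hMv]
      simp [gm, hk0]
    · have h1 := W.fpv M hMv 0
      have h2 := W.fmv M hMv 0
      rw [Nat.cast_zero] at h1 h2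
      rw [neg_zero] at h2
      rw [h1, h2, Λ.f_zero, mul_div_cancel₀ _ hq.sub_inv_ne, ← sub_smul]
      simp [gp, gm]
    · obtain ⟨k, rfl⟩ := Int.eq_ofNat_of_zero_le h.le
      have hk0 : k ≠ 0 := by omega
      rw [W.R.fm_pos M _ h, W.fpv M hMv]
      simp [gp, hk0]
  · intro i hv hi
    exact even_rel hq W hv hi (Λ.P i) (Λ.P_const i) (fun n => by simp [gp, hi]) (fun n => by simp [gm, hi])
end

end QASP
end

open QAS in
/-- Theorem 4.5: for every `(P̲, f, c; Q) ∈ R̃_{M,N}`, the Weyl module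
satisfies `deg Q < dim_ℂ W(P̲,f,c;Q) < ∞`. -/
theorem weyl_dim (q : ℂ) (hq0 : q ≠ 0)
    (hq1 : ∀ k : ℕ, k ≠ 0 → q ^ k ≠ 1) (M N : ℕ) (hM : 1 ≤ M) (hN : 1 ≤ N)
    (Λ : HW q M N) (Q : Polynomial ℂ) (hQ1 : Q.coeff 0 = 1) (hQf : annih Q Λ.f) :
    Q.natDegree < Module.finrank ℂ (WeylMod q M N false Λ Q) ∧
      FiniteDimensional ℂ (WeylMod q M N false Λ Q) := by
  exact ⟨QASP.weyl_lower ⟨hq0, hq1⟩ hM hN Λ Q hQ1 hQf, QASP.weyl_finite ⟨hq0, hq1⟩ hM hN Λ Q hQ1⟩
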